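/- (Linear extension estimate for the paraboloid from bilinear restriction.) For every n ≥ 2 and every p > 2(n+2)/n there exists a constant C = C(n, p) such that ‖E_{[−1,1]^{n−1}} f‖_{L^p(ℝ^n)} ≤ C ‖f‖_{L^∞([−1,1]^{n−1})} for all bounded measurable f : [−1,1]^{n−1} → ℂ. In particular, for n = 2 this holds for every p > 4. -/

import Mathlib

open MeasureTheory Real Complex RealInnerProductSpace ENNReal

/-- The paraboloid extension operator
`E_Ω f(x) = ∫_Ω f(ξ) e^{2πi(x′·ξ + x_n |ξ|²)} dξ`, on `ℝ^n = ℝ^{n−1} × ℝ`. -/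
noncomputable def parabExt {m : ℕ} (Ω : Set (EuclideanSpace ℝ (Fin m)))
    (f : EuclideanSpace ℝ (Fin m) → ℂ) (x : EuclideanSpace ℝ (Fin m) × ℝ) : ℂ :=
  ∫ ξ in Ω, f ξ * Complex.exp (2 * Real.pi * Complex.I * ((⟪x.1, ξ⟫ + x.2 * ∑ i, ξ i ^ 2 : ℝ)))

set_option linter.all false

section
namespace PExt

abbrev VV (d : ℕ) := EuclideanSpace ℝ (Fin d)

noncomputable def ee (θ : ℝ) : ℂ := Complex.exp (2 * Real.pi * Complex.I * (θ : ℝ))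

lemma ee_eq (θ : ℝ) : ee θ = Complex.exp ((2 * π * θ : ℝ) * Complex.I) := by
  unfold ee; congr 1; push_cast; ring

@[simp] lemma norm_ee (θ : ℝ) : ‖ee θ‖ = 1 := by
  rw [ee_eq]; exact Complex.norm_exp_ofReal_mul_I _

@[simp] lemma enorm_ee (θ : ℝ) : ‖ee θ‖ₑ = 1 := by
  rw [← ofReal_norm, norm_ee]; simp

lemma ee_add (a b : ℝ) : ee (a + b) = ee a * ee b := by
  unfold ee; rw [← Complex.exp_add]; congr 1; push_cast; ring

@[simp] lemma ee_zero : ee 0 = 1 := by simp [ee]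

lemma ee_neg (a : ℝ) : ee (-a) = (starRingEnd ℂ) (ee a) := by
  rw [ee_eq, ee_eq, ← Complex.exp_conj]; congr 1
  rw [map_mul, Complex.conj_ofReal, Complex.conj_I]; push_cast; ring

lemma ee_sub (a b : ℝ) : ee (a - b) = ee a * (starRingEnd ℂ) (ee b) := by
  rw [sub_eq_add_neg, ee_add, ee_neg]

@[fun_prop] lemma continuous_ee : Continuous ee := by unfold ee; fun_prop

@[fun_prop] lemma measurable_ee : Measurable ee := continuous_ee.measurable

lemma hasDerivAt_ee (a b s : ℝ) :
    HasDerivAt (fun s : ℝ => ee (a + s * b)) (2 * π * Complex.I * b * ee (a + s * b)) s := by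
  have h1 : HasDerivAt (fun s : ℝ => ((a + s * b : ℝ) : ℂ)) (b : ℂ) s := by
    have : HasDerivAt (fun s : ℝ => (a + s * b : ℝ)) b s := by
      simpa using ((hasDerivAt_id s).mul_const b).const_add a
    exact this.ofReal_comp
  have h2 := (h1.const_mul (2 * π * Complex.I)).cexp
  unfold ee
  convert h2 using 1
  ring

lemma fourierChar_eq_ee (a : ℝ) : ((Real.fourierChar a : Circle) : ℂ) = ee a := by
  rw [Real.fourierChar_apply, ee_eq]

/-- Fourier extension operator, with the density defined on all of `V`. -/
noncomputable def Ex {d : ℕ} (f : VV d → ℂ) (x : VV d) (t : ℝ) : ℂ :=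
  ∫ ξ, f ξ * ee (⟪x, ξ⟫ + t * ‖ξ‖ ^ 2)

attribute [irreducible] Ex
attribute [irreducible] ee

structure Nice {d : ℕ} (f : VV d → ℂ) (ξ₀ : VV d) (ρ : ℝ) : Prop where
  meas : Measurable f
  bdd : ∃ M : ℝ, ∀ ξ, ‖f ξ‖ ≤ M
  supp : ∀ ξ, ρ < ‖ξ - ξ₀‖ → f ξ = 0

namespace Nice
variable {d : ℕ} {f g : VV d → ℂ} {ξ₀ : VV d} {ρ : ℝ}

lemma integrable (h : Nice f ξ₀ ρ) : Integrable f := by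
  obtain ⟨M, hM⟩ := h.bdd
  have h1 : IntegrableOn f (Metric.closedBall ξ₀ ρ) := by
    refine Measure.integrableOn_of_bounded (M := M) ?_ h.meas.aestronglyMeasurable ?_
    · exact (measure_closedBall_lt_top).ne
    · exact Filter.Eventually.of_forall (fun x => hM x)
  refine (integrableOn_iff_integrable_of_support_subset ?_).1 h1
  intro ξ hξ
  by_contra hc
  apply hξ
  apply h.supp
  simpa [dist_eq_norm] using hc

lemma mul_cont (h : Nice f ξ₀ ρ) {m : VV d → ℂ} (hm : Continuous m) :
    Nice (fun ξ => m ξ * f ξ) ξ₀ ρ := by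
  refine ⟨hm.measurable.mul h.meas, ?_, ?_⟩
  · obtain ⟨M, hM⟩ := h.bdd
    obtain ⟨C, hC⟩ := (isCompact_closedBall ξ₀ ρ).exists_bound_of_continuousOn hm.continuousOn
    refine ⟨|C| * M, fun ξ => ?_⟩
    have hM0 : 0 ≤ M := (norm_nonneg _).trans (hM ξ)
    by_cases hξ : ρ < ‖ξ - ξ₀‖
    · simp only [h.supp ξ hξ, mul_zero, norm_zero]; positivity
    · rw [norm_mul]
      have := hC ξ (by simpa [dist_eq_norm] using hξ)
      have h2 := hM ξ
      have := this.trans (le_abs_self C)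
      gcongr
  · intro ξ hξ; simp [h.supp ξ hξ]

lemma coord (h : Nice f ξ₀ ρ) (i : Fin d) : Nice (fun ξ => ((ξ i : ℝ) : ℂ) * f ξ) ξ₀ ρ :=
  h.mul_cont (m := fun ξ => ((ξ i : ℝ) : ℂ)) (by fun_prop)

lemma normsq (h : Nice f ξ₀ ρ) : Nice (fun ξ => ((‖ξ‖ ^ 2 : ℝ) : ℂ) * f ξ) ξ₀ ρ :=
  h.mul_cont (m := fun ξ => ((‖ξ‖ ^ 2 : ℝ) : ℂ)) (by fun_prop)

lemma mono {ρ' : ℝ} (h : Nice f ξ₀ ρ) (hρ : ρ ≤ ρ') : Nice f ξ₀ ρ' :=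
  ⟨h.meas, h.bdd, fun ξ hξ => h.supp ξ (hρ.trans_lt hξ)⟩

lemma translate (h : Nice f ξ₀ ρ) : Nice (fun η => f (ξ₀ + η)) 0 ρ := by
  refine ⟨h.meas.comp (by fun_prop), ?_, ?_⟩
  · obtain ⟨M, hM⟩ := h.bdd; exact ⟨M, fun ξ => hM _⟩
  · intro ξ hξ; apply h.supp; simpa using hξ

lemma osc_integrable (h : Nice f ξ₀ ρ) {a : VV d → ℝ} (ha : Measurable a) :
    Integrable (fun ξ => f ξ * ee (a ξ)) := by
  refine h.integrable.mul_bdd (c := 1) ?_ ?_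
  · exact (measurable_ee.comp ha).aestronglyMeasurable
  · exact Filter.Eventually.of_forall (fun x => by simp)

end Nice

variable {d : ℕ} {f g : VV d → ℂ} {ξ₀ : VV d} {ρ : ℝ}

lemma norm_Ex_le (f : VV d → ℂ) (x : VV d) (t : ℝ) : ‖Ex f x t‖ ≤ ∫ ξ, ‖f ξ‖ := by
  unfold Ex
  refine (norm_integral_le_integral_norm _).trans (le_of_eq ?_)
  simp

lemma Ex_continuous (h : Integrable f) : Continuous (fun p : VV d × ℝ => Ex f p.1 p.2) := by
  unfold Ex
  refine continuous_of_dominated (bound := fun ξ => ‖f ξ‖) ?_ ?_ h.norm ?_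
  · intro p
    refine h.aestronglyMeasurable.mul ?_
    apply Continuous.aestronglyMeasurable; fun_prop
  · intro p; exact Filter.Eventually.of_forall (fun ξ => by simp)
  · refine Filter.Eventually.of_forall (fun ξ => by fun_prop)

lemma Ex_continuous_x (h : Integrable f) (t : ℝ) : Continuous (fun x => Ex f x t) := by
  have h2 : Continuous (fun x : VV d => (x, t)) := Continuous.prodMk continuous_id continuous_const
  exact (Ex_continuous h).comp h2

/-- differentiation of an oscillatory integral in a parameter -/
lemma hasDerivAt_osc (h : Nice f ξ₀ ρ) {a b : VV d → ℝ} (ha : Continuous a) (hb : Continuous b)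
    (s : ℝ) :
    HasDerivAt (fun s : ℝ => ∫ ξ, f ξ * ee (a ξ + s * b ξ))
      (2 * π * Complex.I * ∫ ξ, ((b ξ : ℂ) * f ξ) * ee (a ξ + s * b ξ)) s := by
  have hn : Nice (fun ξ => (b ξ : ℂ) * f ξ) ξ₀ ρ :=
    h.mul_cont (m := fun ξ => (b ξ : ℂ)) (by fun_prop)
  have hm : ∀ s : ℝ, Measurable (fun ξ => a ξ + s * b ξ) := fun s =>
    (ha.add (continuous_const.mul hb)).measurable
  have h1 : ∀ᶠ s in nhds s, AEStronglyMeasurable (fun ξ => f ξ * ee (a ξ + s * b ξ)) volume :=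
    Filter.Eventually.of_forall (fun s => (h.osc_integrable (hm s)).aestronglyMeasurable)
  have h2 : AEStronglyMeasurable
      (fun ξ => f ξ * (2 * π * Complex.I * b ξ * ee (a ξ + s * b ξ))) volume := by
    have e : (fun ξ => f ξ * (2 * π * Complex.I * b ξ * ee (a ξ + s * b ξ))) =
        fun ξ => (2 * π * Complex.I) * (((b ξ : ℂ) * f ξ) * ee (a ξ + s * b ξ)) := by
      ext ξ; ring
    rw [e]
    exact ((hn.osc_integrable (hm s)).const_mul _).aestronglyMeasurable
  have h3 : ∀ᵐ ξ ∂(volume : Measure (VV d)), ∀ s ∈ (Set.univ : Set ℝ),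
      ‖f ξ * (2 * π * Complex.I * b ξ * ee (a ξ + s * b ξ))‖ ≤ 2 * π * ‖(b ξ : ℂ) * f ξ‖ := by
    refine Filter.Eventually.of_forall (fun ξ s _ => ?_)
    simp only [norm_mul, norm_ee, Complex.norm_I, Complex.norm_real, Real.norm_eq_abs,
      abs_of_pos pi_pos, Complex.norm_ofNat]
    apply le_of_eq; ring
  have h4 : ∀ᵐ ξ ∂(volume : Measure (VV d)), ∀ s ∈ (Set.univ : Set ℝ),
      HasDerivAt (fun s : ℝ => f ξ * ee (a ξ + s * b ξ))
        (f ξ * (2 * π * Complex.I * b ξ * ee (a ξ + s * b ξ))) s :=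
    Filter.Eventually.of_forall (fun ξ s _ => (hasDerivAt_ee (a ξ) (b ξ) s).const_mul (f ξ))
  have h5 : Integrable (fun ξ => 2 * π * ‖(b ξ : ℂ) * f ξ‖) := hn.integrable.norm.const_mul _
  have key := (hasDerivAt_integral_of_dominated_loc_of_deriv_le (μ := (volume : Measure (VV d)))
    Filter.univ_mem h1 (h.osc_integrable (hm s)) h2 h3 h5 h4).2
  refine key.congr_deriv ?_
  rw [← integral_const_mul]
  congr 1; ext ξ; ring

lemma hasDerivAt_Ex_t (h : Nice f ξ₀ ρ) (x : VV d) (t : ℝ) :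
    HasDerivAt (fun t => Ex f x t)
      (2 * π * Complex.I * Ex (fun ξ => ((‖ξ‖ ^ 2 : ℝ) : ℂ) * f ξ) x t) t :=
  by
  have := hasDerivAt_osc h (a := fun ξ => ⟪x, ξ⟫) (b := fun ξ => ‖ξ‖ ^ 2) (by fun_prop) (by fun_prop) t
  unfold Ex; exact this

lemma hasLineDerivAt_Ex (h : Nice f ξ₀ ρ) (x : VV d) (t : ℝ) (i : Fin d) :
    HasLineDerivAt ℝ (fun x => Ex f x t)
      (2 * π * Complex.I * Ex (fun ξ => ((ξ i : ℝ) : ℂ) * f ξ) x t) x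
        (EuclideanSpace.single i 1) := by
  unfold HasLineDerivAt Ex
  have := hasDerivAt_osc h (a := fun ξ => ⟪x, ξ⟫ + t * ‖ξ‖ ^ 2) (b := fun ξ => ξ i)
    (by fun_prop) (by fun_prop) 0
  simp only [zero_mul, add_zero] at this
  refine this.congr_of_eventuallyEq (Filter.Eventually.of_forall fun s => ?_)
  simp only []
  congr 1; ext ξ; congr 2
  rw [inner_add_left, inner_smul_left]
  simp [EuclideanSpace.inner_single_left]
  ring

/-- Galilean invariance -/
lemma Ex_galilean (f : VV d → ℂ) (ξ₀ x : VV d) (t : ℝ) :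
    Ex f x t = ee (⟪x, ξ₀⟫ + t * ‖ξ₀‖ ^ 2) *
      Ex (fun η => f (ξ₀ + η)) (x + (2 * t) • ξ₀) t := by
  unfold Ex
  rw [← integral_add_left_eq_self _ ξ₀, ← integral_const_mul]
  congr 1; ext η
  rw [mul_left_comm, ← ee_add]
  congr 2
  rw [inner_add_right, inner_add_left, real_inner_smul_left, @norm_add_sq_real]
  ring

/-- existence of a rapidly decreasing kernel with prescribed smooth Fourier transform -/
lemma exists_kernel {V : Type*} [NormedAddCommGroup V] [InnerProductSpace ℝ V]
    [FiniteDimensional ℝ V] [MeasurableSpace V] [BorelSpace V]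
    (m : V → ℂ) (hm : ContDiff ℝ (⊤ : ℕ∞) m) (hc : HasCompactSupport m) :
    ∃ κ : V → ℂ, Continuous κ ∧ Integrable κ ∧
      (∀ N : ℕ, ∃ C : ℝ, 0 < C ∧ ∀ y, ‖κ y‖ * (1 + ‖y‖ ^ 2) ^ N ≤ C) ∧
      (∀ η, ∫ y, κ y * ee (-⟪y, η⟫) = m η) ∧ (∀ y, κ y = ∫ η, m η * ee ⟪y, η⟫) := by
  let M : SchwartzMap V ℂ := hc.toSchwartzMap hm
  have hM : ∀ x, M x = m x := fun x => rfl
  let κ : SchwartzMap V ℂ := FourierTransformInv.fourierInv M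
  have h1 : FourierTransform.fourier κ = M := by simp [κ]
  refine ⟨κ, κ.continuous, κ.integrable, ?_, ?_, ?_⟩
  · intro N
    obtain ⟨C0, hC0⟩ := κ.decay 0 0
    obtain ⟨C1, hC1⟩ := κ.decay (2 * N) 0
    refine ⟨2 ^ N * (C0 + C1), ?_, ?_⟩
    · have := hC0.1; have := hC1.1; positivity
    · intro y
      have a0 := hC0.2 y
      have a1 := hC1.2 y
      simp only [pow_zero, one_mul, norm_iteratedFDeriv_zero] at a0 a1
      have : (1 + ‖y‖ ^ 2) ^ N ≤ 2 ^ N * (1 + ‖y‖ ^ (2 * N)) := by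
        have h := add_pow_le (a := (1:ℝ)) (b := ‖y‖ ^ 2) (by positivity) (by positivity) N
        refine h.trans ?_
        rw [one_pow, ← pow_mul]
        gcongr
        · norm_num
        · omega
      calc ‖κ y‖ * (1 + ‖y‖ ^ 2) ^ N ≤ ‖κ y‖ * (2 ^ N * (1 + ‖y‖ ^ (2 * N))) := by gcongr
        _ = 2 ^ N * (‖κ y‖ + ‖y‖ ^ (2 * N) * ‖κ y‖) := by ring
        _ ≤ _ := by gcongr
  · intro η
    rw [← hM, ← h1, SchwartzMap.fourier_coe, Real.fourier_eq]
    congr 1; ext y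
    rw [← fourierChar_eq_ee, Circle.smul_def, smul_eq_mul, mul_comm]
  · intro y
    change (FourierTransformInv.fourierInv M) y = _
    rw [SchwartzMap.fourierInv_coe, Real.fourierInv_eq]
    congr 1; ext η
    rw [← fourierChar_eq_ee, Circle.smul_def, smul_eq_mul, mul_comm, real_inner_comm]
    rfl

end PExt

end

section
namespace PExt

section weights
variable {E : Type*} [NormedAddCommGroup E]

/-- polynomial weight at scale `r` -/
noncomputable def jw (N : ℕ) (r : ℝ) (y : E) : ℝ := ((1 + ‖y‖ ^ 2 / r ^ 2) ^ N)⁻¹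

lemma jw_pos (N : ℕ) (r : ℝ) (y : E) : 0 < jw N r y := by unfold jw; positivity

lemma jw_le_one (N : ℕ) (r : ℝ) (y : E) : jw N r y ≤ 1 := by
  unfold jw
  apply inv_le_one_of_one_le₀
  apply one_le_pow₀
  have : 0 ≤ ‖y‖ ^ 2 / r ^ 2 := by positivity
  linarith

lemma jw_neg (N : ℕ) (r : ℝ) (y : E) : jw N r (-y) = jw N r y := by unfold jw; simp

lemma jw_sub_comm (N : ℕ) (r : ℝ) (x y : E) : jw N r (x - y) = jw N r (y - x) := by
  rw [← jw_neg, neg_sub]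

@[fun_prop] lemma jw_continuous (N : ℕ) (r : ℝ) : Continuous (jw N r : E → ℝ) := by
  unfold jw
  apply Continuous.inv₀
  · fun_prop
  · intro y; positivity

lemma peetre_aux (r : ℝ) (x y : E) :
    1 + ‖y‖ ^ 2 / r ^ 2 ≤ 2 * (1 + ‖x‖ ^ 2 / r ^ 2) * (1 + ‖x + y‖ ^ 2 / r ^ 2) := by
  have h1 : ‖y‖ ≤ ‖x‖ + ‖x + y‖ := by
    calc ‖y‖ = ‖(x + y) - x‖ := by congr 1; abel
      _ ≤ ‖x + y‖ + ‖x‖ := norm_sub_le _ _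
      _ = _ := add_comm _ _
  have h2 : ‖y‖ ^ 2 ≤ 2 * ‖x‖ ^ 2 + 2 * ‖x + y‖ ^ 2 := by
    have := norm_nonneg y
    nlinarith [sq_nonneg (‖x‖ - ‖x + y‖)]
  have h3 : ‖y‖ ^ 2 / r ^ 2 ≤ 2 * (‖x‖ ^ 2 / r ^ 2) + 2 * (‖x + y‖ ^ 2 / r ^ 2) := by
    calc _ ≤ (2 * ‖x‖ ^ 2 + 2 * ‖x + y‖ ^ 2) / r ^ 2 := by gcongr
      _ = _ := by ring
  have a : 0 ≤ ‖x‖ ^ 2 / r ^ 2 := by positivity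
  have b : 0 ≤ ‖x + y‖ ^ 2 / r ^ 2 := by positivity
  nlinarith [mul_nonneg a b]

lemma peetre (N : ℕ) (r : ℝ) (x y : E) :
    jw N r (x + y) ≤ 2 ^ N * (1 + ‖x‖ ^ 2 / r ^ 2) ^ N * jw N r y := by
  unfold jw
  rw [← mul_pow, ← inv_pow, ← inv_pow, ← mul_pow]
  apply pow_le_pow_left₀ (by positivity)
  rw [← div_eq_mul_inv]
  rw [inv_le_iff_one_le_mul₀ (by positivity), div_mul_eq_mul_div, one_le_div (by positivity)]
  exact peetre_aux r x y

/-- Peetre with `‖x‖ ≤ A r`. -/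
lemma jw_shift (N : ℕ) {r A : ℝ} (hr : 0 < r) (hA : 0 ≤ A) {x y z : E} (h : ‖x - y‖ ≤ A * r) :
    jw N r (z - x) ≤ (2 * (1 + A ^ 2)) ^ N * jw N r (z - y) := by
  have h1 := peetre N r (y - x) (z - y)
  have e : y - x + (z - y) = z - x := by abel
  rw [e] at h1
  refine h1.trans ?_
  rw [← mul_pow]
  gcongr
  · exact (jw_pos _ _ _).le
  · rw [div_le_iff₀ (by positivity), ← mul_pow]
    rw [norm_sub_rev]
    gcongr

lemma jw_mono_r (N : ℕ) {r R : ℝ} (hr : 0 < r) (hR : r ≤ R) (y : E) : jw N r y ≤ jw N R y := by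
  unfold jw; gcongr

lemma jw_anti_N {N M : ℕ} (h : N ≤ M) (r : ℝ) (y : E) : jw M r y ≤ jw N r y := by
  unfold jw
  gcongr
  have : 0 ≤ ‖y‖ ^ 2 / r ^ 2 := by positivity
  linarith

lemma jw_ball (N : ℕ) {r A : ℝ} (hr : 0 < r) {y : E} (h : ‖y‖ ≤ A * r) :
    1 ≤ (1 + A ^ 2) ^ N * jw N r y := by
  unfold jw
  rw [← div_eq_mul_inv, le_div_iff₀ (by positivity), one_mul]
  gcongr
  rw [div_le_iff₀ (by positivity), ← mul_pow]
  gcongr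

variable [NormedSpace ℝ E] [FiniteDimensional ℝ E] [MeasurableSpace E] [BorelSpace E]
  (μ : Measure E) [μ.IsAddHaarMeasure]

lemma lintegral_smul_comp (f : E → ℝ≥0∞) {r : ℝ} (hr : 0 < r) :
    ∫⁻ y, f (r⁻¹ • y) ∂μ = ENNReal.ofReal (r ^ Module.finrank ℝ E) * ∫⁻ y, f y ∂μ := by
  have hr' : r⁻¹ ≠ 0 := by positivity
  have h := Measure.map_addHaar_smul μ hr'
  have h2 : ∫⁻ y, f (r⁻¹ • y) ∂μ = ∫⁻ y, f y ∂(Measure.map (r⁻¹ • ·) μ) := by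
    exact ((Homeomorph.smulOfNeZero r⁻¹ hr').measurableEmbedding.lintegral_map f).symm
  rw [h2, h, lintegral_smul_measure]
  congr 2
  rw [inv_pow, inv_inv, abs_of_pos (by positivity)]

lemma jw_scale (N : ℕ) (r : ℝ) (hr : 0 < r) (y : E) : jw N r y = jw N 1 (r⁻¹ • y) := by
  unfold jw
  rw [norm_smul, mul_pow, norm_inv, Real.norm_eq_abs, abs_of_pos hr]
  congr 3
  field_simp

lemma lintegral_jw (N : ℕ) {r : ℝ} (hr : 0 < r) (x : E) :
    ∫⁻ y, ENNReal.ofReal (jw N r (y - x)) ∂μ =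
      ENNReal.ofReal (r ^ Module.finrank ℝ E) * ∫⁻ y, ENNReal.ofReal (jw N 1 y) ∂μ := by
  rw [lintegral_sub_right_eq_self (fun y => ENNReal.ofReal (jw N r y)) x,
    ← lintegral_smul_comp μ (fun y => ENNReal.ofReal (jw N 1 y)) hr]
  congr 1; ext y; rw [jw_scale N r hr]

lemma lintegral_jw_lt_top {N : ℕ} (hN : Module.finrank ℝ E < 2 * N) :
    ∫⁻ y : E, ENNReal.ofReal (jw N 1 y) ∂μ < ∞ := by
  have h := integrable_rpow_neg_one_add_norm_sq (E := E) (μ := μ) (r := 2 * N)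
    (by exact_mod_cast hN)
  have := h.lintegral_lt_top
  refine lt_of_le_of_lt (lintegral_mono fun y => ?_) this
  apply ENNReal.ofReal_le_ofReal
  unfold jw
  rw [show (-(2 * (N:ℝ)) / 2) = -(N : ℝ) by ring, Real.rpow_neg (by positivity), Real.rpow_natCast]
  simp

lemma integrable_jw {N : ℕ} (hN : Module.finrank ℝ E < 2 * N) {r : ℝ} (hr : 0 < r) (x : E) :
    Integrable (fun y : E => jw N r (y - x)) μ := by
  refine ⟨(by fun_prop : Continuous fun y : E => jw N r (y - x)).aestronglyMeasurable, ?_⟩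
  rw [hasFiniteIntegral_iff_ofReal (Filter.Eventually.of_forall fun y => (jw_pos _ _ _).le),
    lintegral_jw μ N hr]
  exact ENNReal.mul_lt_top ENNReal.ofReal_lt_top (lintegral_jw_lt_top μ hN)

/-- averaging a small scale weight over a large ball -/
lemma lintegral_ball_jw {N : ℕ} (hN : Module.finrank ℝ E < 2 * N) (A : ℝ) (hA : 0 ≤ A) :
    ∃ C : ℝ, 0 < C ∧ ∀ (r R : ℝ) (x z : E), 0 < r → r ≤ R →
      ∫⁻ y in Metric.closedBall x (A * R), ENNReal.ofReal (jw N r (z - y)) ∂μ ≤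
        ENNReal.ofReal (C * r ^ Module.finrank ℝ E * jw N R (z - x)) := by
  set n := Module.finrank ℝ E
  set I := ∫⁻ y : E, ENNReal.ofReal (jw N 1 y) ∂μ with hI
  have hIt : I < ∞ := lintegral_jw_lt_top μ hN
  set V1 := μ (Metric.closedBall (0:E) 1) with hV1
  have hVt : V1 < ∞ := measure_closedBall_lt_top
  refine ⟨(2 * (1 + A ^ 2)) ^ N * (2 ^ N * (I.toReal + A ^ n * V1.toReal)) + 1, by positivity, ?_⟩
  intro r R x z hr hrR
  have hR : 0 < R := hr.trans_le hrR
  have key : ∀ u : E, jw N r u ≤ 2 ^ N * (jw N r u + (r / R) ^ (2 * N)) * jw N R u := by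
    intro u
    unfold jw
    have a : 0 ≤ ‖u‖ ^ 2 := by positivity
    have h1 : (1 + ‖u‖ ^ 2 / R ^ 2) / (1 + ‖u‖ ^ 2 / r ^ 2) ≤
        (1 + ‖u‖ ^ 2 / r ^ 2)⁻¹ + (r / R) ^ 2 := by
      rw [div_le_iff₀ (by positivity), add_mul, inv_mul_cancel₀ (by positivity), div_pow]
      have : ‖u‖ ^ 2 / R ^ 2 = r ^ 2 / R ^ 2 * (‖u‖ ^ 2 / r ^ 2) := by field_simp
      rw [this]
      have : 0 ≤ r ^ 2 / R ^ 2 := by positivity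
      nlinarith
    have h2 : ((1 + ‖u‖ ^ 2 / R ^ 2) / (1 + ‖u‖ ^ 2 / r ^ 2)) ^ N ≤
        2 ^ N * (((1 + ‖u‖ ^ 2 / r ^ 2) ^ N)⁻¹ + (r / R) ^ (2 * N)) := by
      refine (pow_le_pow_left₀ (by positivity) h1 N).trans ?_
      refine (add_pow_le (by positivity) (by positivity) N).trans ?_
      rw [inv_pow, ← pow_mul]
      gcongr
      · norm_num
      · omega
    rw [div_pow] at h2
    rw [← div_eq_mul_inv, le_div_iff₀ (by positivity)]
    rwa [inv_mul_eq_div]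
  have key2 : ∀ y ∈ Metric.closedBall x (A * R), ENNReal.ofReal (jw N r (z - y)) ≤
      ENNReal.ofReal ((2 * (1 + A ^ 2)) ^ N * 2 ^ N * jw N R (z - x)) *
        (ENNReal.ofReal (jw N r (y - z)) + ENNReal.ofReal ((r / R) ^ (2 * N))) := by
    intro y hy
    rw [← ENNReal.ofReal_add (jw_pos _ _ _).le (by positivity), ← ENNReal.ofReal_mul
      (mul_nonneg (by positivity) (jw_pos _ _ _).le)]
    apply ENNReal.ofReal_le_ofReal
    refine (key _).trans ?_
    have h3 := jw_shift N (z := z) hR hA (x := y) (y := x) (by simpa [dist_eq_norm] using hy)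
    rw [jw_sub_comm N r y z]
    have : 0 < jw N r (z - y) + (r / R) ^ (2 * N) := add_pos_of_pos_of_nonneg (jw_pos _ _ _) (by positivity)
    calc _ ≤ 2 ^ N * (jw N r (z - y) + (r / R) ^ (2 * N)) * ((2 * (1 + A ^ 2)) ^ N * jw N R (z - x)) := by
          gcongr
      _ = _ := by ring
  have hvol : μ (Metric.closedBall x (A * R)) = ENNReal.ofReal ((A * R) ^ n) * V1 := by
    rw [Measure.addHaar_closedBall' μ x (by positivity)]
  calc _ ≤ ∫⁻ y in Metric.closedBall x (A * R), ENNReal.ofReal ((2 * (1 + A ^ 2)) ^ N * 2 ^ N * jw N R (z - x)) *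
        (ENNReal.ofReal (jw N r (y - z)) + ENNReal.ofReal ((r / R) ^ (2 * N))) ∂μ :=
        setLIntegral_mono' Metric.isClosed_closedBall.measurableSet key2
    _ = ENNReal.ofReal ((2 * (1 + A ^ 2)) ^ N * 2 ^ N * jw N R (z - x)) *
        ∫⁻ y in Metric.closedBall x (A * R), (ENNReal.ofReal (jw N r (y - z)) + ENNReal.ofReal ((r / R) ^ (2 * N))) ∂μ := by
        rw [lintegral_const_mul' _ _ ENNReal.ofReal_ne_top]
    _ ≤ ENNReal.ofReal ((2 * (1 + A ^ 2)) ^ N * 2 ^ N * jw N R (z - x)) *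
        (ENNReal.ofReal (r ^ n) * I + ENNReal.ofReal ((r / R) ^ (2 * N)) * (ENNReal.ofReal ((A * R) ^ n) * V1)) := by
        gcongr
        rw [lintegral_add_right _ measurable_const, setLIntegral_const, hvol]
        gcongr
        rw [← lintegral_jw μ N hr z]
        exact setLIntegral_le_lintegral _ _
    _ = ENNReal.ofReal (((2 * (1 + A ^ 2)) ^ N * 2 ^ N * jw N R (z - x)) *
        (r ^ n * I.toReal + (r / R) ^ (2 * N) * ((A * R) ^ n * V1.toReal))) := by
        have := (jw_pos N R (z - x)).le
        rw [ENNReal.ofReal_mul (p := (2 * (1 + A ^ 2)) ^ N * 2 ^ N * jw N R (z - x)) (by positivity),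
          ENNReal.ofReal_add (by positivity) (by positivity),
          ENNReal.ofReal_mul (p := r ^ n) (by positivity),
          ENNReal.ofReal_mul (p := (r / R) ^ (2 * N)) (by positivity),
          ENNReal.ofReal_mul (p := (A * R) ^ n) (by positivity), ENNReal.ofReal_toReal hIt.ne, ENNReal.ofReal_toReal hVt.ne]
    _ ≤ _ := by
        apply ENNReal.ofReal_le_ofReal
        have hj := (jw_pos N R (z - x)).le
        have h5 : (r / R) ^ (2 * N) * (A * R) ^ n ≤ A ^ n * r ^ n := by
          have : (r / R) ^ (2 * N) ≤ (r / R) ^ n :=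
            pow_le_pow_of_le_one (by positivity) (by rw [div_le_one hR]; exact hrR) hN.le
          calc _ ≤ (r / R) ^ n * (A * R) ^ n := by gcongr
            _ = A ^ n * r ^ n := by rw [← mul_pow, ← mul_pow]; congr 1; field_simp
        calc _ = ((2 * (1 + A ^ 2)) ^ N * 2 ^ N * jw N R (z - x)) *
            (r ^ n * I.toReal + ((r / R) ^ (2 * N) * (A * R) ^ n) * V1.toReal) := by ring
          _ ≤ ((2 * (1 + A ^ 2)) ^ N * 2 ^ N * jw N R (z - x)) *
            (r ^ n * I.toReal + (A ^ n * r ^ n) * V1.toReal) := by gcongr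
          _ = ((2 * (1 + A ^ 2)) ^ N * (2 ^ N * (I.toReal + A ^ n * V1.toReal))) * r ^ n * jw N R (z - x) := by ring
          _ ≤ _ := by
            have : 0 < r ^ n := by positivity
            gcongr
            linarith

end weights

end PExt

end

section
namespace PExt

variable {d : ℕ} {f g : VV d → ℂ} {ξ₀ : VV d} {ρ : ℝ}

/-- localized energy -/
noncomputable def En (f : VV d → ℂ) (x : VV d) (t r : ℝ) : ℝ≥0∞ :=
  ∫⁻ y, ‖Ex f y t‖ₑ ^ 2 * ENNReal.ofReal (jw (d + 1) r (y - x))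

lemma finrank_VV (d : ℕ) : Module.finrank ℝ (VV d) = d := by simp

lemma measurable_Ex (h : Integrable f) (t : ℝ) : Measurable (fun x => Ex f x t) :=
  (Ex_continuous_x h t).measurable

lemma En_shift {r A : ℝ} (hr : 0 < r) (hA : 0 ≤ A) {x x' : VV d} (t : ℝ) (hx : ‖x - x'‖ ≤ A * r) :
    En f x t r ≤ ENNReal.ofReal ((2 * (1 + A ^ 2)) ^ (d + 1)) * En f x' t r := by
  unfold En
  rw [← lintegral_const_mul' _ _ ENNReal.ofReal_ne_top]
  apply lintegral_mono
  intro y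
  dsimp only
  rw [mul_left_comm, ← ENNReal.ofReal_mul (by positivity)]
  gcongr
  exact jw_shift _ hr hA hx

lemma En_mono_r {r R : ℝ} (hr : 0 < r) (hR : r ≤ R) (x : VV d) (t : ℝ) :
    En f x t r ≤ En f x t R := by
  unfold En
  apply lintegral_mono; intro y; dsimp only
  gcongr
  exact jw_mono_r _ hr hR _

lemma En_measurable (h : Integrable f) (r : ℝ) :
    Measurable (fun c : VV d × ℝ => En f c.1 c.2 r) := by
  unfold En
  refine Measurable.lintegral_prod_right' (f := fun q : (VV d × ℝ) × VV d =>
    ‖Ex f q.2 q.1.2‖ₑ ^ 2 * ENNReal.ofReal (jw (d + 1) r (q.2 - q.1.1))) ?_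
  have h1 : Continuous (fun q : (VV d × ℝ) × VV d => Ex f q.2 q.1.2) :=
    (Ex_continuous h).comp (by fun_prop : Continuous (fun q : (VV d × ℝ) × VV d => (q.2, q.1.2)))
  have h2 : Continuous (fun q : (VV d × ℝ) × VV d => jw (d + 1) r (q.2 - q.1.1)) := by fun_prop
  exact (h1.measurable.enorm.pow_const 2).mul h2.measurable.ennreal_ofReal

lemma enorm_Ex_le (f : VV d → ℂ) (x : VV d) (t : ℝ) : ‖Ex f x t‖ₑ ≤ ∫⁻ ξ, ‖f ξ‖ₑ := by
  unfold Ex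
  refine (enorm_integral_le_lintegral_enorm _).trans (le_of_eq ?_)
  simp [enorm_mul]

lemma En_le_top (h : Integrable f) {r : ℝ} (hr : 0 < r) (x : VV d) (t : ℝ) : En f x t r < ∞ := by
  unfold En
  calc _ ≤ ∫⁻ y, (∫⁻ ξ, ‖f ξ‖ₑ) ^ 2 * ENNReal.ofReal (jw (d + 1) r (y - x)) := by
        apply lintegral_mono; intro y; dsimp only; gcongr; exact enorm_Ex_le _ _ _
    _ = (∫⁻ ξ, ‖f ξ‖ₑ) ^ 2 * ∫⁻ y, ENNReal.ofReal (jw (d + 1) r (y - x)) := by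
        rw [lintegral_const_mul' _ _ (ENNReal.pow_ne_top h.2.ne)]
    _ < ∞ := by
        refine ENNReal.mul_lt_top (ENNReal.pow_lt_top h.2) ?_
        rw [lintegral_jw volume _ hr]
        refine ENNReal.mul_lt_top ENNReal.ofReal_lt_top (lintegral_jw_lt_top volume ?_)
        rw [finrank_VV]; omega

/-- averaging of energies -/
lemma En_average (A : ℝ) (hA : 0 ≤ A) : ∃ C : ℝ, 0 < C ∧ ∀ (f : VV d → ℂ) (x : VV d) (t r R : ℝ),
    Integrable f → 0 < r → r ≤ R →
    ∫⁻ y in Metric.closedBall x (A * R), En f y t r ≤ ENNReal.ofReal (C * r ^ d) * En f x t R := by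
  obtain ⟨C, hC, h⟩ := lintegral_ball_jw (E := VV d) volume (N := d + 1)
    (by rw [finrank_VV]; omega) A hA
  refine ⟨C, hC, ?_⟩
  intro f x t r R hf hr hrR
  unfold En
  rw [lintegral_lintegral_swap]
  · rw [← lintegral_const_mul' _ _ ENNReal.ofReal_ne_top]
    apply lintegral_mono; intro z; dsimp only
    rw [lintegral_const_mul' _ _ (by finiteness), mul_left_comm]
    gcongr
    refine (h r R x z hr hrR).trans ?_
    rw [finrank_VV, ENNReal.ofReal_mul (by positivity)]
  · apply Measurable.aemeasurable
    have h1 : Continuous (fun q : VV d × VV d => Ex f q.2 t) :=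
      (Ex_continuous_x hf t).comp continuous_snd
    have h2 : Continuous (fun q : VV d × VV d => jw (d + 1) r (q.2 - q.1)) := by fun_prop
    exact (h1.measurable.enorm.pow_const 2).mul h2.measurable.ennreal_ofReal

/-- multipliers as convolutions -/
lemma Ex_multiplier {κ m : VV d → ℂ} (hκ : Integrable κ)
    (hm : ∀ η, ∫ y, κ y * ee (-⟪y, η⟫) = m η) (hf : Integrable f) (s : ℝ) (x : VV d) (t : ℝ) :
    Ex (fun ξ => m (s • ξ) * f ξ) x t = ∫ z, κ z * Ex f (x - s • z) t := by
  unfold Ex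
  have h1 : ∀ z : VV d, κ z * ∫ ξ, f ξ * ee (⟪x - s • z, ξ⟫ + t * ‖ξ‖ ^ 2) =
      ∫ ξ, κ z * (f ξ * ee (⟪x - s • z, ξ⟫ + t * ‖ξ‖ ^ 2)) := fun z => (integral_const_mul _ _).symm
  simp_rw [h1]
  rw [integral_integral_swap]
  · congr 1; ext ξ
    rw [← hm, mul_assoc, ← integral_mul_const]
    congr 1; ext z
    have e2 : ⟪x - s • z, ξ⟫ + t * ‖ξ‖ ^ 2 = -⟪z, s • ξ⟫ + (⟪x, ξ⟫ + t * ‖ξ‖ ^ 2) := by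
      rw [inner_sub_left, real_inner_smul_left, real_inner_smul_right]; ring
    rw [e2, ee_add (-⟪z, s • ξ⟫)]
    ring
  · have h2 : Integrable (fun q : VV d × VV d => κ q.1 * f q.2) (volume.prod volume) :=
      hκ.mul_prod hf
    have h3 := h2.mul_bdd (c := 1)
      (g := fun q : VV d × VV d => ee (⟪x - s • q.1, q.2⟫ + t * ‖q.2‖ ^ 2))
      (Continuous.aestronglyMeasurable (by fun_prop))
      (Filter.Eventually.of_forall (fun q => by simp))
    refine h3.congr (Filter.Eventually.of_forall fun q => ?_)
    simp [Function.uncurry, mul_assoc]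

/-- Cauchy–Schwarz against a kernel -/
lemma conv_sq_le {α : Type*} [MeasurableSpace α] {μ : Measure α} {κ u : α → ℂ}
    (hκ : AEMeasurable κ μ) (hu : AEMeasurable u μ) :
    ‖∫ z, κ z * u z ∂μ‖ₑ ^ 2 ≤ (∫⁻ z, ‖κ z‖ₑ ∂μ) * ∫⁻ z, ‖κ z‖ₑ * ‖u z‖ₑ ^ 2 ∂μ := by
  have h1 : ‖∫ z, κ z * u z ∂μ‖ₑ ≤ ∫⁻ z, ‖κ z‖ₑ * ‖u z‖ₑ ∂μ := by
    refine (enorm_integral_le_lintegral_enorm _).trans (le_of_eq ?_)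
    simp [enorm_mul]
  have h2 : ∫⁻ z, ‖κ z‖ₑ * ‖u z‖ₑ ∂μ ≤
      (∫⁻ z, ‖κ z‖ₑ ∂μ) ^ (1 / 2 : ℝ) * (∫⁻ z, ‖κ z‖ₑ * ‖u z‖ₑ ^ 2 ∂μ) ^ (1 / 2 : ℝ) := by
    have h := ENNReal.lintegral_mul_le_Lp_mul_Lq μ (Real.HolderConjugate.two_two)
      (f := fun z => ‖κ z‖ₑ ^ (1 / 2 : ℝ)) (g := fun z => ‖κ z‖ₑ ^ (1 / 2 : ℝ) * ‖u z‖ₑ)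
      (hκ.enorm.pow_const _) ((hκ.enorm.pow_const _).mul hu.enorm)
    convert h using 2
    · ext z
      simp only [Pi.mul_apply]
      rw [← mul_assoc, ← ENNReal.rpow_add_of_nonneg _ _ (by norm_num) (by norm_num)]
      norm_num
    · congr 1
      congr 1; ext z
      rw [← ENNReal.rpow_mul]; norm_num
    · congr 1
      congr 1; ext z
      rw [ENNReal.mul_rpow_of_nonneg _ _ (by norm_num), ← ENNReal.rpow_mul]; norm_num
  calc _ ≤ ((∫⁻ z, ‖κ z‖ₑ ∂μ) ^ (1 / 2 : ℝ) * (∫⁻ z, ‖κ z‖ₑ * ‖u z‖ₑ ^ 2 ∂μ) ^ (1 / 2 : ℝ)) ^ 2 := by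
        gcongr; exact h1.trans h2
    _ = _ := by
        rw [mul_pow, ← ENNReal.rpow_natCast, ← ENNReal.rpow_mul, ← ENNReal.rpow_natCast,
          ← ENNReal.rpow_mul]
        norm_num

/-- weighted Bernstein inequality -/
lemma En_multiplier (m : VV d → ℂ) (hm : ContDiff ℝ (⊤ : ℕ∞) m) (hc : HasCompactSupport m) :
    ∃ C : ℝ, 0 < C ∧ ∀ (f : VV d → ℂ) (x : VV d) (t r δ : ℝ), Integrable f → 0 < δ → 1 ≤ r * δ →
      En (fun ξ => m (δ⁻¹ • ξ) * f ξ) x t r ≤ ENNReal.ofReal C * En f x t r := by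
  obtain ⟨κ, hκc, hκi, hκd, hκm, -⟩ := exists_kernel m hm hc
  obtain ⟨C0, hC0, hκ0⟩ := hκd (2 * (d + 1))
  set I := ∫⁻ y : VV d, ENNReal.ofReal (jw (d + 1) 1 y) with hI
  have hIt : I < ∞ := lintegral_jw_lt_top volume (by rw [finrank_VV]; omega)
  set I0 := ∫⁻ z, ‖κ z‖ₑ with hI0
  have hI0t : I0 < ∞ := hκi.2
  refine ⟨I0.toReal * (2 ^ (d + 1) * C0 * I.toReal) + 1, by positivity, ?_⟩
  intro f x t r δ hf hδ hrδ
  have hr : 0 < r := by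
    by_contra hneg
    have : r * δ ≤ 0 := mul_nonpos_of_nonpos_of_nonneg (not_lt.1 hneg) hδ.le
    linarith
  have hu : ∀ y, Measurable fun z => Ex f (y - δ⁻¹ • z) t := fun y =>
    ((Ex_continuous_x hf t).comp
      (by fun_prop : Continuous fun z : VV d => y - δ⁻¹ • z)).measurable
  have hpt : ∀ z : VV d, ∫⁻ y, ‖Ex f (y - δ⁻¹ • z) t‖ₑ ^ 2 * ENNReal.ofReal (jw (d + 1) r (y - x)) ≤
      ENNReal.ofReal (2 ^ (d + 1) * (1 + ‖z‖ ^ 2) ^ (d + 1)) * En f x t r := by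
    intro z
    rw [← lintegral_add_right_eq_self _ (δ⁻¹ • z)]
    unfold En
    rw [← lintegral_const_mul' _ _ ENNReal.ofReal_ne_top]
    apply lintegral_mono; intro y; dsimp only
    rw [add_sub_cancel_right, mul_left_comm, ← ENNReal.ofReal_mul (by positivity)]
    gcongr
    have h1 := peetre (d + 1) r (δ⁻¹ • z) (y - x)
    rw [show y + δ⁻¹ • z - x = δ⁻¹ • z + (y - x) by abel]
    refine h1.trans ?_
    have := (jw_pos (d + 1) r (y - x)).le
    gcongr
    rw [norm_smul, mul_pow, div_le_iff₀ (by positivity), norm_inv, Real.norm_eq_abs, abs_of_pos hδ,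
      mul_comm]
    gcongr
    rw [inv_le_iff_one_le_mul₀ hδ]; exact hrδ
  calc En (fun ξ => m (δ⁻¹ • ξ) * f ξ) x t r
      ≤ ∫⁻ y, (I0 * ∫⁻ z, ‖κ z‖ₑ * ‖Ex f (y - δ⁻¹ • z) t‖ₑ ^ 2) * ENNReal.ofReal (jw (d + 1) r (y - x)) := by
        unfold En
        apply lintegral_mono; intro y; dsimp only
        gcongr
        rw [Ex_multiplier hκi hκm hf]
        exact conv_sq_le hκc.measurable.aemeasurable (hu y).aemeasurable
    _ = I0 * ∫⁻ y, ∫⁻ z, ‖κ z‖ₑ * (‖Ex f (y - δ⁻¹ • z) t‖ₑ ^ 2 * ENNReal.ofReal (jw (d + 1) r (y - x))) := by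
        rw [← lintegral_const_mul' _ _ hI0t.ne]
        congr 1; ext y
        rw [mul_assoc, ← lintegral_mul_const' _ _ ENNReal.ofReal_ne_top]
        simp_rw [mul_assoc]
    _ = I0 * ∫⁻ z, ∫⁻ y, ‖κ z‖ₑ * (‖Ex f (y - δ⁻¹ • z) t‖ₑ ^ 2 * ENNReal.ofReal (jw (d + 1) r (y - x))) := by
        congr 1
        rw [lintegral_lintegral_swap]
        apply Measurable.aemeasurable
        have h1 : Continuous (fun q : VV d × VV d => Ex f (q.1 - δ⁻¹ • q.2) t) :=
          (Ex_continuous_x hf t).comp (by fun_prop)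
        have h2 : Continuous (fun q : VV d × VV d => jw (d + 1) r (q.1 - x)) := by fun_prop
        have h3 : Continuous (fun q : VV d × VV d => κ q.2) := hκc.comp continuous_snd
        exact h3.measurable.enorm.mul ((h1.measurable.enorm.pow_const 2).mul h2.measurable.ennreal_ofReal)
    _ ≤ I0 * ∫⁻ z, ENNReal.ofReal (2 ^ (d + 1) * C0) * ENNReal.ofReal (jw (d + 1) 1 z) * En f x t r := by
        gcongr with z
        rw [lintegral_const_mul' _ _ (by finiteness)]
        calc _ ≤ ‖κ z‖ₑ * (ENNReal.ofReal (2 ^ (d + 1) * (1 + ‖z‖ ^ 2) ^ (d + 1)) * En f x t r) := by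
              gcongr; exact hpt z
          _ = ENNReal.ofReal (‖κ z‖ * (2 ^ (d + 1) * (1 + ‖z‖ ^ 2) ^ (d + 1))) * En f x t r := by
              rw [ENNReal.ofReal_mul (norm_nonneg _), ofReal_norm, mul_assoc]
          _ ≤ _ := by
              rw [← ENNReal.ofReal_mul (by positivity)]
              refine mul_le_mul_left (ENNReal.ofReal_le_ofReal ?_) _
              unfold jw
              rw [← div_eq_mul_inv, le_div_iff₀ (by positivity)]
              calc _ = 2 ^ (d + 1) * (‖κ z‖ * (1 + ‖z‖ ^ 2) ^ (2 * (d + 1))) := by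
                    rw [one_pow, div_one, two_mul (d + 1), pow_add _ (d + 1) (d + 1)]; ring
                _ ≤ _ := by gcongr; exact hκ0 z
    _ = I0 * (ENNReal.ofReal (2 ^ (d + 1) * C0) * I * En f x t r) := by
        rw [lintegral_mul_const' _ _ (En_le_top hf hr x t).ne,
          lintegral_const_mul' _ _ ENNReal.ofReal_ne_top, ← hI]
    _ = ENNReal.ofReal (I0.toReal * (2 ^ (d + 1) * C0 * I.toReal)) * En f x t r := by
        rw [ENNReal.ofReal_mul (p := I0.toReal) (by positivity),
          ENNReal.ofReal_mul (q := I.toReal) (by positivity),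
          ENNReal.ofReal_toReal hI0t.ne, ENNReal.ofReal_toReal hIt.ne]; ring
    _ ≤ _ := by gcongr; linarith

/-- a smooth bump equal to one on the unit ball -/
lemma exists_bump (d : ℕ) : ∃ χ : VV d → ℝ, ContDiff ℝ (⊤ : ℕ∞) χ ∧ HasCompactSupport χ ∧
    ∀ ξ, ‖ξ‖ ≤ 1 → χ ξ = 1 := by
  let b : ContDiffBump (0 : VV d) := ⟨1, 2, by norm_num, by norm_num⟩
  exact ⟨b, b.contDiff, b.hasCompactSupport, fun ξ hξ => b.one_of_mem_closedBall (by simpa using hξ)⟩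

lemma En_bernstein (d : ℕ) : ∃ C : ℝ, 0 < C ∧ ∀ (f : VV d → ℂ) (i : Fin d) (x : VV d) (t r δ : ℝ),
    Nice f 0 δ → 0 < δ → 1 ≤ r * δ →
      En (fun ξ => ((ξ i : ℝ) : ℂ) * f ξ) x t r ≤ ENNReal.ofReal (C * δ ^ 2) * En f x t r := by
  obtain ⟨χ, hχ, hχc, hχ1⟩ := exists_bump d
  have h : ∀ i : Fin d, ∃ C : ℝ, 0 < C ∧ ∀ (f : VV d → ℂ) (x : VV d) (t r δ : ℝ), Integrable f →
      0 < δ → 1 ≤ r * δ →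
      En (fun ξ => (((δ⁻¹ • ξ) i * χ (δ⁻¹ • ξ) : ℝ) : ℂ) * f ξ) x t r ≤ ENNReal.ofReal C * En f x t r := by
    intro i
    refine En_multiplier (fun ξ : VV d => ((ξ i * χ ξ : ℝ) : ℂ)) ?_ ?_
    · have : ContDiff ℝ (⊤ : ℕ∞) (fun ξ : VV d => ξ i) :=
        (EuclideanSpace.proj (𝕜 := ℝ) i : VV d →L[ℝ] ℝ).contDiff
      exact Complex.ofRealCLM.contDiff.comp (this.mul hχ)
    · have : HasCompactSupport (fun ξ : VV d => ξ i * χ ξ) := hχc.mul_left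
      exact this.comp_left (g := fun a : ℝ => (a : ℂ)) (by simp)
  choose C hC hC2 using h
  refine ⟨∑ i, C i + 1, by have := Finset.sum_nonneg (s := Finset.univ) (f := C) (fun i _ => (hC i).le); positivity, ?_⟩
  intro f i x t r δ hf hδ hrδ
  have e : Ex (fun ξ => ((ξ i : ℝ) : ℂ) * f ξ) =
      fun x t => (δ : ℂ) * Ex (fun ξ => (((δ⁻¹ • ξ) i * χ (δ⁻¹ • ξ) : ℝ) : ℂ) * f ξ) x t := by
    ext x t
    unfold Ex
    rw [← integral_const_mul]
    congr 1; ext ξ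
    dsimp only
    by_cases hξ : δ < ‖ξ - 0‖
    · rw [hf.supp ξ hξ]; simp
    · rw [hχ1 (δ⁻¹ • ξ)]
      · have : (δ : ℂ) ≠ 0 := by exact_mod_cast hδ.ne'
        simp only [PiLp.smul_apply, smul_eq_mul, mul_one]
        push_cast
        field_simp
      · rw [norm_smul, norm_inv, Real.norm_eq_abs, abs_of_pos hδ, inv_mul_le_iff₀ hδ]
        simpa using hξ
  have h1 := hC2 i f x t r δ hf.integrable hδ hrδ
  have h2 : En (fun ξ => ((ξ i : ℝ) : ℂ) * f ξ) x t r = ENNReal.ofReal (δ ^ 2) *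
      En (fun ξ => (((δ⁻¹ • ξ) i * χ (δ⁻¹ • ξ) : ℝ) : ℂ) * f ξ) x t r := by
    unfold En
    rw [← lintegral_const_mul' _ _ ENNReal.ofReal_ne_top]
    congr 1; ext y
    rw [e]
    rw [enorm_mul, mul_pow, mul_assoc]
    congr 1
    rw [← ofReal_norm, ← ENNReal.ofReal_pow (by positivity)]
    simp
  rw [h2]
  calc _ ≤ ENNReal.ofReal (δ ^ 2) * (ENNReal.ofReal (C i) * En f x t r) := by gcongr
    _ = ENNReal.ofReal (C i * δ ^ 2) * En f x t r := by
      rw [ENNReal.ofReal_mul (hC i).le]; ring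
    _ ≤ _ := by
      gcongr
      have := Finset.single_le_sum (f := C) (fun j _ => (hC j).le) (Finset.mem_univ i)
      linarith

end PExt

end

section
namespace PExt

variable {d : ℕ} {f g : VV d → ℂ} {ξ₀ : VV d} {ρ : ℝ}

lemma gronwall_two_sided {Φ Φ' : ℝ → ℝ} {a : ℝ} (h : ∀ t, HasDerivAt Φ (Φ' t) t)
    (hb : ∀ t, |Φ' t| ≤ a * Φ t) (s t : ℝ) : Φ t ≤ Real.exp (a * |t - s|) * Φ s := by
  have e1 : ∀ b t : ℝ, HasDerivAt (fun t => Φ t * Real.exp (b * t))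
      (Φ' t * Real.exp (b * t) + Φ t * (Real.exp (b * t) * b)) t := by
    intro b t
    have h2 : HasDerivAt (fun t : ℝ => b * t) b t := by
      simpa using (hasDerivAt_id t).const_mul b
    exact (h t).mul h2.exp
  rcases le_total s t with hst | hst
  · have hanti : Antitone (fun t => Φ t * Real.exp (-a * t)) := by
      apply antitone_of_deriv_nonpos (fun t => (e1 (-a) t).differentiableAt)
      intro t
      rw [(e1 (-a) t).deriv]
      have := (abs_le.1 (hb t)).2
      have h3 := Real.exp_pos (-a * t)
      nlinarith
    have h4 := hanti hst
    simp only at h4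
    rw [abs_of_nonneg (by linarith)]
    have h5 : Real.exp (a * (t - s)) = Real.exp (-a * s) * Real.exp (a * t) := by
      rw [← Real.exp_add]; congr 1; ring
    have h6 : Real.exp (-a * t) * Real.exp (a * t) = 1 := by
      rw [← Real.exp_add]; simp
    calc Φ t = (Φ t * Real.exp (-a * t)) * Real.exp (a * t) := by rw [mul_assoc, h6, mul_one]
      _ ≤ (Φ s * Real.exp (-a * s)) * Real.exp (a * t) := by gcongr
      _ = _ := by rw [h5]; ring
  · have hmono : Monotone (fun t => Φ t * Real.exp (a * t)) := by
      apply monotone_of_deriv_nonneg (fun t => (e1 a t).differentiableAt)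
      intro t
      rw [(e1 a t).deriv]
      have := (abs_le.1 (hb t)).1
      have h3 := Real.exp_pos (a * t)
      nlinarith
    have h4 := hmono hst
    simp only at h4
    rw [abs_of_nonpos (by linarith)]
    have h5 : Real.exp (a * -(t - s)) = Real.exp (a * s) * Real.exp (-a * t) := by
      rw [← Real.exp_add]; congr 1; ring
    have h6 : Real.exp (a * t) * Real.exp (-a * t) = 1 := by
      rw [← Real.exp_add]; simp
    calc Φ t = (Φ t * Real.exp (a * t)) * Real.exp (-a * t) := by rw [mul_assoc, h6, mul_one]
      _ ≤ (Φ s * Real.exp (a * s)) * Real.exp (-a * t) := by gcongr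
      _ = _ := by rw [h5]; ring

/-- derivative of the weight -/
noncomputable def djw (N : ℕ) (r : ℝ) (i : Fin d) (y : VV d) : ℝ :=
  -(N * (2 * y i / r ^ 2) / (1 + ‖y‖ ^ 2 / r ^ 2)) * jw N r y

lemma hasLineDerivAt_jw (N : ℕ) (r : ℝ) (i : Fin d) (y : VV d) :
    HasLineDerivAt ℝ (jw N r : VV d → ℝ) (djw N r i y) y (EuclideanSpace.single i 1) := by
  unfold HasLineDerivAt djw jw
  have h0 : HasDerivAt (fun s : ℝ => y + s • (EuclideanSpace.single i (1:ℝ) : VV d))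
      (EuclideanSpace.single i (1:ℝ)) 0 := by
    simpa using ((hasDerivAt_id (0:ℝ)).smul_const (EuclideanSpace.single i (1:ℝ) : VV d)).const_add y
  have h1 := h0.norm_sq
  simp only [zero_smul, add_zero] at h1
  have h2 := (((h1.div_const (r ^ 2)).const_add 1).pow N).inv (by simp only [Pi.pow_apply, zero_smul, add_zero]; positivity)
  refine h2.congr_deriv ?_
  simp only [Pi.pow_apply, zero_smul, add_zero, EuclideanSpace.inner_single_right]
  rcases Nat.eq_zero_or_pos N with hN | hN
  · subst hN; simp
  · obtain ⟨k, rfl⟩ : ∃ k, N = k + 1 := ⟨N - 1, by omega⟩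
    have : 1 + ‖y‖ ^ 2 / r ^ 2 ≠ 0 := by positivity
    simp only [Nat.add_sub_cancel, conj_trivial, one_mul]
    generalize 1 + ‖y‖ ^ 2 / r ^ 2 = A at *
    have e : (A ^ (k + 1)) ^ 2 = A ^ k * (A * A ^ (k + 1)) := by ring
    rw [e]
    field_simp

lemma abs_djw_le (N : ℕ) {r : ℝ} (hr : 0 < r) (i : Fin d) (y : VV d) :
    |djw N r i y| ≤ N / r * jw N r y := by
  unfold djw
  rw [abs_mul, abs_of_pos (jw_pos _ _ _), abs_neg]
  gcongr
  · exact (jw_pos _ _ _).le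
  · have hA : 0 < 1 + ‖y‖ ^ 2 / r ^ 2 := by positivity
    rw [abs_div, abs_of_pos hA, div_le_iff₀ hA, abs_mul, abs_div, abs_mul]
    have h1 : |y i| ≤ ‖y‖ := by
      have := PiLp.norm_apply_le y i
      simpa using this
    have h2 : |(2:ℝ)| * |y i| / |r ^ 2| ≤ 1 / r * (1 + ‖y‖ ^ 2 / r ^ 2) := by
      rw [abs_of_pos (by positivity : 0 < r ^ 2), abs_two]
      have : 2 * |y i| * r ≤ r ^ 2 + ‖y‖ ^ 2 := by nlinarith [sq_nonneg (r - ‖y‖)]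
      have e : 1 / r * (1 + ‖y‖ ^ 2 / r ^ 2) = ((r ^ 2 + ‖y‖ ^ 2) / r) / r ^ 2 := by field_simp
      rw [e]
      gcongr
      rw [le_div_iff₀ hr]; exact this
    calc |(N:ℝ)| * (|2| * |y i| / |r ^ 2|) ≤ N * (1 / r * (1 + ‖y‖ ^ 2 / r ^ 2)) := by
          rw [Nat.abs_cast]; gcongr
      _ = _ := by ring

@[fun_prop] lemma djw_continuous (N : ℕ) (r : ℝ) (i : Fin d) : Continuous (djw N r i : VV d → ℝ) := by
  unfold djw
  refine Continuous.mul (Continuous.neg (Continuous.div (by fun_prop) (by fun_prop) ?_)) (by fun_prop)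
  intro y; positivity

lemma integrable_bdd_mul {E : Type*} [NormedAddCommGroup E] [NormedSpace ℝ E] {w : VV d → ℝ}
    {F : VV d → E} {M : ℝ} (hw : Integrable w) (hF : Continuous F) (hM : ∀ y, ‖F y‖ ≤ M) [SecondCountableTopology E] :
    Integrable (fun y => w y • F y) :=
  (hw.norm.mul_const M).mono' (hw.aestronglyMeasurable.smul hF.aestronglyMeasurable)
    (Filter.Eventually.of_forall fun y => by rw [norm_smul]; gcongr; exact hM y)

lemma hasLineDerivAt_jw_sub (N : ℕ) (r : ℝ) (i : Fin d) (y x : VV d) :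
    HasLineDerivAt ℝ (fun y : VV d => jw N r (y - x)) (djw N r i (y - x)) y
      (EuclideanSpace.single i 1) := by
  have := hasLineDerivAt_jw N r i (y - x)
  unfold HasLineDerivAt at *
  convert this using 3
  abel

lemma Ex_bound (h : Nice f ξ₀ ρ) : ∃ M : ℝ, 0 ≤ M ∧ ∀ x t, ‖Ex f x t‖ ≤ M :=
  ⟨∫ ξ, ‖f ξ‖, integral_nonneg fun _ => norm_nonneg _, fun x t => norm_Ex_le f x t⟩

lemma inner_I_mul_self (v : ℂ) (a : ℝ) : inner ℝ ((a : ℂ) * Complex.I * v) v = 0 := by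
  rw [Complex.inner]
  simp
  ring

/-- integration by parts step -/
lemma energy_ibp (h : Nice f ξ₀ ρ) {r : ℝ} (hr : 0 < r) (x : VV d) (t : ℝ) (i : Fin d) :
    ∫ y, jw (d + 1) r (y - x) * inner ℝ (Ex f y t)
      (2 * π * Complex.I * Ex (fun ξ => ((ξ i : ℝ) : ℂ) * (((ξ i : ℝ) : ℂ) * f ξ)) y t) =
    - ∫ y, djw (d + 1) r i (y - x) * inner ℝ (Ex f y t) (Ex (fun ξ => ((ξ i : ℝ) : ℂ) * f ξ) y t) := by
  set v : VV d → ℂ := fun y => Ex (fun ξ => ((ξ i : ℝ) : ℂ) * f ξ) y t with hv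
  set v' : VV d → ℂ := fun y => 2 * π * Complex.I *
    Ex (fun ξ => ((ξ i : ℝ) : ℂ) * (((ξ i : ℝ) : ℂ) * f ξ)) y t with hv'
  set u : VV d → ℂ := fun y => Ex f y t with hu
  set w : VV d → ℝ := fun y => jw (d + 1) r (y - x) with hw
  set w' : VV d → ℝ := fun y => djw (d + 1) r i (y - x) with hw'
  have cu : Continuous u := Ex_continuous_x h.integrable t
  have cv : Continuous v := Ex_continuous_x (h.coord i).integrable t
  have cv' : Continuous v' := continuous_const.mul (Ex_continuous_x ((h.coord i).coord i).integrable t)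
  have cw : Continuous w := by fun_prop
  have cw' : Continuous w' := by fun_prop
  obtain ⟨Mu, hMu0, hMu⟩ := Ex_bound h
  obtain ⟨Mv, hMv0, hMv⟩ := Ex_bound (h.coord i)
  obtain ⟨Mv', hMv'0, hMv'⟩ := Ex_bound ((h.coord i).coord i)
  have iw : Integrable w := integrable_jw volume (by rw [finrank_VV]; omega) hr x
  have iw' : Integrable w' := by
    refine (iw.const_mul ((d + 1 : ℕ) / r : ℝ)).mono' cw'.aestronglyMeasurable
      (Filter.Eventually.of_forall fun y => ?_)
    exact abs_djw_le _ hr i _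
  have bv' : ∀ y, ‖v' y‖ ≤ 2 * π * Mv' := by
    intro y
    simp only [hv', norm_mul, Complex.norm_I, Complex.norm_real, Real.norm_eq_abs,
      abs_of_pos pi_pos, Complex.norm_ofNat, mul_one]
    gcongr
    exact hMv' _ _
  have du : ∀ y, HasLineDerivAt ℝ u (2 * π * Complex.I * v y) y (EuclideanSpace.single i 1) :=
    fun y => hasLineDerivAt_Ex h y t i
  have dv : ∀ y, HasLineDerivAt ℝ v (v' y) y (EuclideanSpace.single i 1) :=
    fun y => hasLineDerivAt_Ex (h.coord i) y t i
  have dw : ∀ y, HasLineDerivAt ℝ w (w' y) y (EuclideanSpace.single i 1) :=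
    fun y => hasLineDerivAt_jw_sub _ _ _ _ _
  have dwu : ∀ y, HasLineDerivAt ℝ (fun y => w y • u y)
      (w y • (2 * π * Complex.I * v y) + w' y • u y) y (EuclideanSpace.single i 1) := by
    intro y
    have a := dw y
    have b := du y
    unfold HasLineDerivAt at *
    have c := a.smul b
    simp only [zero_smul, add_zero] at c
    exact c
  have z0 : ∀ y, inner ℝ (2 * π * Complex.I * v y) (v y) = 0 := by
    intro y
    have := inner_I_mul_self (v y) (2 * π)
    push_cast at this; exact this
  have einner : ∀ y, inner ℝ (w y • (2 * π * Complex.I * v y) + w' y • u y) (v y) =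
      w' y * inner ℝ (u y) (v y) := by
    intro y
    rw [inner_add_left, real_inner_smul_left, real_inner_smul_left, z0, mul_zero, zero_add]
  have B0 : ∀ a b : ℂ, innerSL ℝ (E := ℂ) a b = inner ℝ a b := fun a b => rfl
  have key := integral_bilinear_hasLineDerivAt_right_eq_neg_left_of_integrable
    (μ := (volume : Measure (VV d))) (B := innerSL ℝ (E := ℂ))
    (f := fun y => w y • u y) (f' := fun y => w y • (2 * π * Complex.I * v y) + w' y • u y)
    (g := v) (g' := v') (v := EuclideanSpace.single i 1) ?_ ?_ ?_ (fun y _ => dwu y) (fun y _ => dv y)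
  · simp only [B0, einner, real_inner_smul_left] at key
    exact key
  · simp only [B0, einner]
    refine integrable_bdd_mul (M := Mu * Mv) iw' (cu.inner cv) (fun y => ?_)
    refine (norm_inner_le_norm _ _).trans ?_
    gcongr
    · exact hMu _ _
    · exact hMv _ _
  · simp only [B0, real_inner_smul_left]
    refine integrable_bdd_mul (M := Mu * (2 * π * Mv')) iw (cu.inner cv') (fun y => ?_)
    refine (norm_inner_le_norm _ _).trans ?_
    gcongr
    · exact hMu _ _
    · exact bv' _
  · simp only [B0, real_inner_smul_left]
    refine integrable_bdd_mul (M := Mu * Mv) iw (cu.inner cv) (fun y => ?_)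
    refine (norm_inner_le_norm _ _).trans ?_
    gcongr
    · exact hMu _ _
    · exact hMv _ _

end PExt

end

section
namespace PExt

variable {d : ℕ} {f g : VV d → ℂ} {ξ₀ : VV d} {ρ : ℝ}

noncomputable def Ph (f : VV d → ℂ) (x : VV d) (r t : ℝ) : ℝ :=
  ∫ y, jw (d + 1) r (y - x) * ‖Ex f y t‖ ^ 2

lemma Ph_integrable (h : Nice f ξ₀ ρ) {r : ℝ} (hr : 0 < r) (x : VV d) (t : ℝ) :
    Integrable (fun y => jw (d + 1) r (y - x) * ‖Ex f y t‖ ^ 2) := by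
  obtain ⟨M, hM0, hM⟩ := Ex_bound h
  have iw : Integrable (fun y : VV d => jw (d + 1) r (y - x)) :=
    integrable_jw volume (by rw [finrank_VV]; omega) hr x
  refine integrable_bdd_mul (M := M ^ 2) iw ((Ex_continuous_x h.integrable t).norm.pow 2) (fun y => ?_)
  rw [Real.norm_eq_abs, abs_of_nonneg (by positivity)]
  gcongr; exact hM _ _

lemma En_eq_Ph (h : Nice f ξ₀ ρ) {r : ℝ} (hr : 0 < r) (x : VV d) (t : ℝ) :
    En f x t r = ENNReal.ofReal (Ph f x r t) := by
  unfold En Ph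
  rw [ofReal_integral_eq_lintegral_ofReal (Ph_integrable h hr x t)]
  · apply lintegral_congr; intro y
    rw [ENNReal.ofReal_mul (jw_pos _ _ _).le, mul_comm, ENNReal.ofReal_pow (norm_nonneg _),
      ofReal_norm_eq_enorm]
  · exact Filter.Eventually.of_forall fun y => mul_nonneg (jw_pos _ _ _).le (by positivity)

lemma Ph_nonneg (f : VV d → ℂ) (x : VV d) (r t : ℝ) : 0 ≤ Ph f x r t :=
  integral_nonneg fun y => mul_nonneg (jw_pos _ _ _).le (by positivity)

lemma Ex_normsq (h : Nice f ξ₀ ρ) (x : VV d) (t : ℝ) :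
    Ex (fun ξ => ((‖ξ‖ ^ 2 : ℝ) : ℂ) * f ξ) x t =
      ∑ i, Ex (fun ξ => ((ξ i : ℝ) : ℂ) * (((ξ i : ℝ) : ℂ) * f ξ)) x t := by
  unfold Ex
  rw [← integral_finset_sum]
  · congr 1; ext ξ
    rw [← Finset.sum_mul]
    dsimp only
    rw [EuclideanSpace.norm_sq_eq]
    push_cast
    rw [Finset.sum_mul]
    congr 1
    apply Finset.sum_congr rfl; intro i _
    rw [← Complex.ofReal_pow]
    simp only [Real.norm_eq_abs, sq_abs]
    push_cast; ring
  · intro i _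
    exact ((h.coord i).coord i).osc_integrable (by fun_prop)

lemma hasDerivAt_Ph (h : Nice f ξ₀ ρ) {r : ℝ} (hr : 0 < r) (x : VV d) (t : ℝ) :
    HasDerivAt (Ph f x r) (- ∑ i, 2 * ∫ y, djw (d + 1) r i (y - x) *
      inner ℝ (Ex f y t) (Ex (fun ξ => ((ξ i : ℝ) : ℂ) * f ξ) y t)) t := by
  obtain ⟨M, hM0, hM⟩ := Ex_bound h
  obtain ⟨M2, hM20, hM2⟩ := Ex_bound h.normsq
  have iw : Integrable (fun y : VV d => jw (d + 1) r (y - x)) :=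
    integrable_jw volume (by rw [finrank_VV]; omega) hr x
  set F' : ℝ → VV d → ℝ := fun t y => jw (d + 1) r (y - x) * (2 * inner ℝ (Ex f y t)
    (2 * π * Complex.I * Ex (fun ξ => ((‖ξ‖ ^ 2 : ℝ) : ℂ) * f ξ) y t)) with hF'
  have key := hasDerivAt_integral_of_dominated_loc_of_deriv_le
    (μ := (volume : Measure (VV d))) (F := fun t y => jw (d + 1) r (y - x) * ‖Ex f y t‖ ^ 2)
    (F' := F') (x₀ := t) (s := Set.univ) (bound := fun y => jw (d + 1) r (y - x) * (2 * (M * (2 * π * M2))))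
    Filter.univ_mem
    (Filter.Eventually.of_forall fun s => (Ph_integrable h hr x s).aestronglyMeasurable)
    (Ph_integrable h hr x t) ?_ ?_ (iw.mul_const _) ?_
  · refine key.2.congr_deriv ?_
    have e : ∀ y, F' t y = ∑ i, 2 * (jw (d + 1) r (y - x) * inner ℝ (Ex f y t)
      (2 * π * Complex.I * Ex (fun ξ => ((ξ i : ℝ) : ℂ) * (((ξ i : ℝ) : ℂ) * f ξ)) y t)) := by
      intro y
      simp only [hF']
      rw [Ex_normsq h, Finset.mul_sum, inner_sum, Finset.mul_sum, Finset.mul_sum]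
      apply Finset.sum_congr rfl; intro i _; ring
    simp_rw [e]
    rw [integral_finset_sum]
    · rw [← Finset.sum_neg_distrib]
      apply Finset.sum_congr rfl; intro i _
      rw [integral_const_mul, energy_ibp h hr]; ring
    · intro i _
      apply Integrable.const_mul
      obtain ⟨M3, hM30, hM3⟩ := Ex_bound ((h.coord i).coord i)
      refine integrable_bdd_mul (M := M * (2 * π * M3)) iw ((Ex_continuous_x h.integrable t).inner
        (continuous_const.mul (Ex_continuous_x ((h.coord i).coord i).integrable t))) (fun y => ?_)
      refine (norm_inner_le_norm _ _).trans ?_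
      simp only [norm_mul, Complex.norm_I, Complex.norm_real, Real.norm_eq_abs,
        abs_of_pos pi_pos, Complex.norm_ofNat, mul_one]
      gcongr
      · exact hM _ _
      · exact hM3 _ _
  · apply Continuous.aestronglyMeasurable
    have := Ex_continuous_x h.integrable t
    have := Ex_continuous_x h.normsq.integrable t
    simp only [hF']
    refine Continuous.mul (by fun_prop) (continuous_const.mul (Continuous.inner ‹_› ?_))
    exact continuous_const.mul this
  · refine Filter.Eventually.of_forall fun y s _ => ?_
    simp only [hF']
    rw [norm_mul, Real.norm_eq_abs, abs_of_pos (jw_pos _ _ _)]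
    gcongr
    · exact (jw_pos _ _ _).le
    rw [norm_mul, Real.norm_eq_abs, abs_two]
    gcongr
    refine (norm_inner_le_norm _ _).trans ?_
    simp only [norm_mul, Complex.norm_I, Complex.norm_real, Real.norm_eq_abs,
        abs_of_pos pi_pos, Complex.norm_ofNat, mul_one]
    gcongr
    · exact hM _ _
    · exact hM2 _ _
  · refine Filter.Eventually.of_forall fun y s _ => ?_
    exact ((hasDerivAt_Ex_t h y s).norm_sq).const_mul _

lemma En_transport0 (d : ℕ) : ∃ C : ℝ, 0 < C ∧ ∀ (f : VV d → ℂ) (x : VV d) (t s r δ : ℝ),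
    Nice f 0 δ → 0 < δ → 1 ≤ r * δ →
      En f x t r ≤ ENNReal.ofReal (Real.exp (C * (δ * |t - s| / r))) * En f x s r := by
  obtain ⟨C, hC, hB⟩ := En_bernstein d
  refine ⟨(d + 1) * (d + 1) * (1 + C), by positivity, ?_⟩
  intro f x t s r δ h hδ hrδ
  have hr : 0 < r := by
    by_contra hr; push Not at hr; nlinarith
  rw [En_eq_Ph h hr, En_eq_Ph h hr, ← ENNReal.ofReal_mul (by positivity)]
  apply ENNReal.ofReal_le_ofReal
  have := gronwall_two_sided (a := (d + 1) * (d + 1) * (1 + C) * δ / r)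
    (fun t => hasDerivAt_Ph h hr x t) ?_ s t
  · refine this.trans (le_of_eq ?_)
    congr 2; ring
  intro t
  have iw : Integrable (fun y : VV d => jw (d + 1) r (y - x)) :=
    integrable_jw volume (by rw [finrank_VV]; omega) hr x
  have hi : ∀ i, |∫ y, djw (d + 1) r i (y - x) *
      inner ℝ (Ex f y t) (Ex (fun ξ => ((ξ i : ℝ) : ℂ) * f ξ) y t)| ≤
        (d + 1) / r * (δ / 2 * (1 + C)) * Ph f x r t := by
    intro i
    have hc := h.coord i
    have hb : Ph (fun ξ => ((ξ i : ℝ) : ℂ) * f ξ) x r t ≤ C * δ ^ 2 * Ph f x r t := by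
      have := hB f i x t r δ h hδ hrδ
      rw [En_eq_Ph h hr, En_eq_Ph hc hr, ← ENNReal.ofReal_mul (by positivity)] at this
      exact (ENNReal.ofReal_le_ofReal_iff (mul_nonneg (by positivity) (Ph_nonneg _ _ _ _))).1 this
    have i1 := Ph_integrable h hr x t
    have i2 := Ph_integrable hc hr x t
    calc _ = ‖∫ y, djw (d + 1) r i (y - x) *
      inner ℝ (Ex f y t) (Ex (fun ξ => ((ξ i : ℝ) : ℂ) * f ξ) y t)‖ := rfl
      _ ≤ ∫ y, (d + 1) / r * (δ / 2 * (jw (d + 1) r (y - x) * ‖Ex f y t‖ ^ 2) +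
          1 / (2 * δ) * (jw (d + 1) r (y - x) * ‖Ex (fun ξ => ((ξ i : ℝ) : ℂ) * f ξ) y t‖ ^ 2)) := by
          apply norm_integral_le_of_norm_le
          · exact (((i1.const_mul _).add (i2.const_mul _)).const_mul _)
          · refine Filter.Eventually.of_forall fun y => ?_
            rw [norm_mul]
            have a1 := abs_djw_le (d + 1) hr i (y - x)
            have a2 := norm_inner_le_norm (𝕜 := ℝ) (Ex f y t) (Ex (fun ξ => ((ξ i : ℝ) : ℂ) * f ξ) y t)
            set A := ‖Ex f y t‖
            set B := ‖Ex (fun ξ => ((ξ i : ℝ) : ℂ) * f ξ) y t‖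
            have a3 : A * B ≤ δ / 2 * A ^ 2 + 1 / (2 * δ) * B ^ 2 := by
              have : 0 ≤ (δ * A - B) ^ 2 / (2 * δ) := by positivity
              have e : (δ * A - B) ^ 2 / (2 * δ) = δ / 2 * A ^ 2 + 1 / (2 * δ) * B ^ 2 - A * B := by
                field_simp; ring
              linarith
            have hw := jw_pos (d + 1) r (y - x)
            calc _ ≤ ((d + 1 : ℕ) / r * jw (d + 1) r (y - x)) * (δ / 2 * A ^ 2 + 1 / (2 * δ) * B ^ 2) := by
                  gcongr
                  · exact a1
                  · exact a2.trans a3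
              _ = _ := by push_cast; ring
      _ = (d + 1) / r * (δ / 2 * Ph f x r t + 1 / (2 * δ) * Ph (fun ξ => ((ξ i : ℝ) : ℂ) * f ξ) x r t) := by
          rw [integral_const_mul, integral_add (i1.const_mul _) (i2.const_mul _), integral_const_mul,
            integral_const_mul]; rfl
      _ ≤ (d + 1) / r * (δ / 2 * Ph f x r t + 1 / (2 * δ) * (C * δ ^ 2 * Ph f x r t)) := by gcongr
      _ = _ := by field_simp
  rw [abs_neg]
  calc _ ≤ ∑ i : Fin d, 2 * ((d + 1) / r * (δ / 2 * (1 + C)) * Ph f x r t) := by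
        refine (Finset.abs_sum_le_sum_abs _ _).trans (Finset.sum_le_sum fun i _ => ?_)
        rw [abs_mul, abs_two]; gcongr; exact hi i
    _ = d * ((d + 1) * (1 + C) * δ / r * Ph f x r t) := by
          rw [Finset.sum_const, Finset.card_univ, Fintype.card_fin, nsmul_eq_mul]; ring
    _ ≤ (d + 1) * ((d + 1) * (1 + C) * δ / r * Ph f x r t) := by
        have := Ph_nonneg f x r t
        gcongr; linarith
    _ = _ := by ring

lemma En_galilean (f : VV d → ℂ) (ξ₀ x : VV d) (t r : ℝ) :
    En f x t r = En (fun η => f (ξ₀ + η)) (x + (2 * t) • ξ₀) t r := by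
  unfold En
  conv_rhs => rw [← lintegral_add_right_eq_self _ ((2 * t) • ξ₀)]
  apply lintegral_congr; intro y
  rw [add_sub_add_right_eq_sub, Ex_galilean f ξ₀ y t, enorm_mul, enorm_ee, one_mul]

lemma En_transport (d : ℕ) : ∃ C : ℝ, 0 < C ∧ ∀ (f : VV d → ℂ) (ξ₀ x : VV d) (t s r δ : ℝ),
    Nice f ξ₀ δ → 0 < δ → 1 ≤ r * δ →
      En f x t r ≤ ENNReal.ofReal (Real.exp (C * (δ * |t - s| / r))) *
        En f (x + (2 * (t - s)) • ξ₀) s r := by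
  obtain ⟨C, hC, h⟩ := En_transport0 d
  refine ⟨C, hC, fun f ξ₀ x t s r δ hf hδ hr => ?_⟩
  rw [En_galilean f ξ₀ x t r, En_galilean f ξ₀ _ s r]
  have e : x + (2 * (t - s)) • ξ₀ + (2 * s) • ξ₀ = x + (2 * t) • ξ₀ := by module
  rw [e]
  exact h _ _ t s r δ hf.translate hδ hr

end PExt

end

section
namespace PExt

section LW
variable {E : Type*} [NormedAddCommGroup E] [NormedSpace ℝ E] [FiniteDimensional ℝ E]
  [MeasurableSpace E] [BorelSpace E] (μ : Measure E) [μ.IsAddHaarMeasure] {k : ℕ}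

/-- linear map associated with vectors -/
noncomputable def LL (v : Fin k → E) (z : Fin k → ℝ) : E := ∑ j, z j • v j

lemma LL_continuous (v : Fin k → E) : Continuous (LL v) := by
  unfold LL; fun_prop

lemma LL_norm_le {v : Fin k → E} {A R : ℝ} (hv : ∀ j, ‖v j‖ ≤ A) (hA : 0 ≤ A) (hR : 0 ≤ R) {z : Fin k → ℝ}
    (hz : z ∈ Metric.closedBall (0 : Fin k → ℝ) R) : ‖LL v z‖ ≤ k * A * R := by
  unfold LL
  refine (norm_sum_le _ _).trans ?_
  calc _ ≤ ∑ j : Fin k, R * A := by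
        apply Finset.sum_le_sum; intro j _
        rw [norm_smul]
        have : ‖z j‖ ≤ R := (norm_le_pi_norm z j).trans (by simpa using hz)
        gcongr; exact hv j
    _ = _ := by simp; ring

lemma LL_update (v : Fin k → E) (z : Fin k → ℝ) (i : Fin k) (s : ℝ) :
    LL v (Function.update z i s) = LL v z + (s - z i) • v i := by
  unfold LL
  rw [← Finset.add_sum_erase _ _ (Finset.mem_univ i), ← Finset.add_sum_erase (Finset.univ) (fun j => z j • v j) (Finset.mem_univ i)]
  rw [Function.update_self]
  have : ∑ x ∈ Finset.univ.erase i, Function.update z i s x • v x = ∑ x ∈ Finset.univ.erase i, z x • v x := by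
    apply Finset.sum_congr rfl; intro j hj
    rw [Function.update_of_ne (Finset.ne_of_mem_erase hj)]
  rw [this]; module

lemma LL_sub (v : Fin k → E) (z z' : Fin k → ℝ) : LL v z - LL v z' = LL v (z - z') := by
  unfold LL; rw [← Finset.sum_sub_distrib]; apply Finset.sum_congr rfl; intro j _; simp [sub_smul]

/-- the auxiliary function to which the grid-lines lemma is applied -/
noncomputable def lwf (v : Fin k → E) (G : Fin k → E → ℝ≥0∞) (R : ℝ) (X : E) (z : Fin k → ℝ) : ℝ≥0∞ :=
  (Metric.closedBall (0 : Fin k → ℝ) R).indicator (fun z => ∑ j, G j (X + LL v z)) z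

lemma lwf_measurable (v : Fin k → E) {G : Fin k → E → ℝ≥0∞} (hG : ∀ j, Measurable (G j)) (R : ℝ) :
    Measurable (fun q : E × (Fin k → ℝ) => lwf v G R q.1 q.2) := by
  have h1 : (fun q : E × (Fin k → ℝ) => lwf v G R q.1 q.2) =
    (Prod.snd ⁻¹' (Metric.closedBall (0 : Fin k → ℝ) R)).indicator
      (fun q : E × (Fin k → ℝ) => ∑ j, G j (q.1 + LL v q.2)) := by
    ext q; unfold lwf Set.indicator; rfl
  rw [h1]
  apply Measurable.indicator
  · apply Finset.measurable_sum; intro j _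
    have := (LL_continuous v).measurable
    exact (hG j).comp (measurable_fst.add (this.comp measurable_snd))
  · exact measurable_snd Metric.isClosed_closedBall.measurableSet

lemma lw_line {v : Fin k → E} {G : Fin k → E → ℝ≥0∞} {R D : ℝ} (hR : 0 < R) (hD : 0 < D)
    (h1 : ∀ j X s, |s| ≤ 2 * R → G j X ≤ ENNReal.ofReal D * G j (X + s • v j)) (X : E) {z : Fin k → ℝ}
    (hz : z ∈ Metric.closedBall (0 : Fin k → ℝ) R) (i : Fin k) :
    ENNReal.ofReal (2 * R / D) * G i (X + LL v z) ≤ ∫⁻ s, lwf v G R X (Function.update z i s) := by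
  have hzi : |z i| ≤ R := (norm_le_pi_norm z i).trans (by simpa using hz)
  calc _ = ∫⁻ s in Set.Icc (-R) R, ENNReal.ofReal (1 / D) * G i (X + LL v z) := by
        rw [setLIntegral_const, Real.volume_Icc, mul_right_comm, ← ENNReal.ofReal_mul (by positivity)]
        congr 2; ring
    _ ≤ ∫⁻ s in Set.Icc (-R) R, lwf v G R X (Function.update z i s) := by
        apply setLIntegral_mono' measurableSet_Icc
        intro s hs
        unfold lwf
        rw [Set.indicator_of_mem]
        · refine le_trans ?_ (Finset.single_le_sum (f := fun j => G j (X + LL v (Function.update z i s)))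
            (fun _ _ => zero_le) (Finset.mem_univ i))
          have := h1 i (X + LL v z) (s - z i) (by
            rw [abs_le] at hzi ⊢; constructor <;> linarith [hs.1, hs.2])
          rw [LL_update, ← add_assoc]
          calc _ ≤ ENNReal.ofReal (1 / D) * (ENNReal.ofReal D * G i (X + LL v z + (s - z i) • v i)) := by
                gcongr
            _ = _ := by
                rw [← mul_assoc, ← ENNReal.ofReal_mul (by positivity), one_div_mul_cancel hD.ne']; simp
        · rw [mem_closedBall_zero_iff, pi_norm_le_iff_of_nonneg hR.le]
          intro j
          by_cases hj : j = i
          · subst hj; rw [Function.update_self]; exact abs_le.2 hs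
          · rw [Function.update_of_ne hj]; exact (norm_le_pi_norm z j).trans (by simpa using hz)
    _ ≤ _ := setLIntegral_le_lintegral _ _

lemma lw_sup {v : Fin k → E} {G : Fin k → E → ℝ≥0∞} {r R D c A : ℝ} {c0 : E} (hr : 0 < r) (hrR : r ≤ R) (hD : 0 < D)
    (hc : 0 < c) (hA : 0 ≤ A) (hG : ∀ j, Measurable (G j)) (hv : ∀ j, ‖v j‖ ≤ A)
    (hL : ∀ z, c * ‖z‖ ≤ ‖LL v z‖)
    (h2 : ∀ j X Y, ‖Y‖ ≤ r → G j X ≤ ENNReal.ofReal D * G j (X + Y))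
    (hB : ∀ j, ∫⁻ X in Metric.closedBall c0 ((3 + 2 * k * A) * R), G j X ∂μ ≤ 1)
    (X : E) (hX : X ∈ Metric.closedBall c0 ((2 + k * A) * R)) :
    μ (Metric.closedBall 0 r) * ∫⁻ z, lwf v G R X z ≤ k * ENNReal.ofReal (D * (4 * r / c) ^ k) := by
  have hR : 0 < R := hr.trans_le hrR
  have hQ : MeasurableSet (Metric.closedBall (0 : Fin k → ℝ) R) := Metric.isClosed_closedBall.measurableSet
  have mLL := (LL_continuous v).measurable
  unfold lwf
  rw [lintegral_indicator hQ, lintegral_finset_sum' (f := fun j z => G j (X + LL v z)) _ (fun j _ => ((hG j).comp (measurable_const.add mLL)).aemeasurable), Finset.mul_sum]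
  have hj : ∀ j, μ (Metric.closedBall 0 r) * ∫⁻ z in Metric.closedBall (0 : Fin k → ℝ) R, G j (X + LL v z) ≤
      ENNReal.ofReal (D * (4 * r / c) ^ k) := by
    intro j
    calc _ = ∫⁻ z in Metric.closedBall (0 : Fin k → ℝ) R, ∫⁻ Y in Metric.closedBall (0:E) r, G j (X + LL v z) ∂μ := by
          rw [← lintegral_const_mul' _ _ measure_closedBall_lt_top.ne]
          apply lintegral_congr; intro z; rw [setLIntegral_const, mul_comm]
      _ ≤ ∫⁻ z in Metric.closedBall (0 : Fin k → ℝ) R, ∫⁻ X' in Metric.closedBall c0 ((3 + 2 * k * A) * R),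
            (ENNReal.ofReal D * G j X') * (Metric.closedBall (X + LL v z) r).indicator 1 X' ∂μ := by
          apply setLIntegral_mono' hQ
          intro z hz
          have hz' := LL_norm_le hv hA hR.le hz
          calc _ ≤ ∫⁻ Y in Metric.closedBall (0:E) r, ENNReal.ofReal D * G j (X + LL v z + Y) ∂μ := by
                apply setLIntegral_mono' Metric.isClosed_closedBall.measurableSet
                intro Y hY; exact h2 j _ Y (by simpa using hY)
            _ = ∫⁻ Y, (fun X' => (Metric.closedBall (X + LL v z) r).indicator (fun X' => ENNReal.ofReal D * G j X') X') (X + LL v z + Y) ∂μ := by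
                rw [← lintegral_indicator Metric.isClosed_closedBall.measurableSet]
                apply lintegral_congr; intro Y
                unfold Set.indicator
                simp
            _ = ∫⁻ X', (Metric.closedBall (X + LL v z) r).indicator (fun X' => ENNReal.ofReal D * G j X') X' ∂μ := by
                rw [lintegral_add_left_eq_self]
            _ = ∫⁻ X' in Metric.closedBall (X + LL v z) r, (ENNReal.ofReal D * G j X') * (Metric.closedBall (X + LL v z) r).indicator 1 X' ∂μ := by
                rw [lintegral_indicator Metric.isClosed_closedBall.measurableSet]
                apply setLIntegral_congr_fun Metric.isClosed_closedBall.measurableSet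
                intro X' hX'
                simp only [Set.indicator_of_mem hX', Pi.one_apply, mul_one]
            _ ≤ _ := by
                apply lintegral_mono_set
                apply Metric.closedBall_subset_closedBall'
                rw [mem_closedBall_iff_norm] at hX
                rw [dist_eq_norm]
                have : ‖X + LL v z - c0‖ ≤ (2 + k * A) * R + k * A * R := by
                  calc _ = ‖(X - c0) + LL v z‖ := by congr 1; abel
                    _ ≤ _ := (norm_add_le _ _).trans (by gcongr)
                nlinarith
      _ = ∫⁻ X' in Metric.closedBall c0 ((3 + 2 * k * A) * R), (∫⁻ z in Metric.closedBall (0 : Fin k → ℝ) R,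
            (ENNReal.ofReal D * G j X') * (Metric.closedBall (X + LL v z) r).indicator 1 X') ∂μ := by
          rw [lintegral_lintegral_swap]
          apply Measurable.aemeasurable
          apply Measurable.mul
          · exact ((hG j).comp measurable_snd).const_mul _
          · have : (Function.uncurry fun (z : Fin k → ℝ) X' => (Metric.closedBall (X + LL v z) r).indicator (1 : E → ℝ≥0∞) X') =
              ({q : (Fin k → ℝ) × E | dist q.2 (X + LL v q.1) ≤ r}).indicator 1 := by
              ext q; simp [Function.uncurry, Set.indicator]
            have h3 : Measurable (({q : (Fin k → ℝ) × E | dist q.2 (X + LL v q.1) ≤ r}).indicator (1 : (Fin k → ℝ) × E → ℝ≥0∞)) := by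
              apply measurable_one.indicator
              have := LL_continuous v
              exact (isClosed_le (by fun_prop) continuous_const).measurableSet
            rw [← this] at h3; exact h3
      _ ≤ ∫⁻ X' in Metric.closedBall c0 ((3 + 2 * k * A) * R), (ENNReal.ofReal D * G j X') * ENNReal.ofReal ((4 * r / c) ^ k) ∂μ := by
          apply lintegral_mono; intro X'; dsimp only
          have mS : MeasurableSet {z : Fin k → ℝ | X' ∈ Metric.closedBall (X + LL v z) r} := by
            have := LL_continuous v
            have : IsClosed {z : Fin k → ℝ | dist X' (X + LL v z) ≤ r} := isClosed_le (by fun_prop) continuous_const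
            exact this.measurableSet
          have e : ∀ z : Fin k → ℝ, (Metric.closedBall (X + LL v z) r).indicator (1 : E → ℝ≥0∞) X' =
              {z : Fin k → ℝ | X' ∈ Metric.closedBall (X + LL v z) r}.indicator 1 z := by
            intro z; simp [Set.indicator]
          simp_rw [e]
          rw [lintegral_const_mul _ (measurable_one.indicator mS)]
          gcongr
          refine (setLIntegral_le_lintegral _ _).trans ?_
          rw [lintegral_indicator_one mS]
          rcases Set.eq_empty_or_nonempty {z : Fin k → ℝ | X' ∈ Metric.closedBall (X + LL v z) r} with hS | ⟨z0, hz0⟩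
          · rw [hS]; simp
          · have hsub : {z : Fin k → ℝ | X' ∈ Metric.closedBall (X + LL v z) r} ⊆ Metric.closedBall z0 (2 * r / c) := by
              intro z hz
              simp only [Set.mem_setOf_eq, mem_closedBall_iff_norm] at hz hz0 ⊢
              rw [le_div_iff₀' hc]
              refine (hL _).trans ?_
              rw [← LL_sub]
              calc _ = ‖(X' - (X + LL v z0)) - (X' - (X + LL v z))‖ := by congr 1; abel
                _ ≤ r + r := (norm_sub_le _ _).trans (by gcongr)
                _ = _ := by ring
            refine (measure_mono hsub).trans ?_
            rw [Real.volume_pi_closedBall _ (by positivity)]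
            simp only [Fintype.card_fin]
            apply ENNReal.ofReal_le_ofReal
            apply le_of_eq; congr 1; ring
      _ = ENNReal.ofReal D * ENNReal.ofReal ((4 * r / c) ^ k) * ∫⁻ X' in Metric.closedBall c0 ((3 + 2 * k * A) * R), G j X' ∂μ := by
          rw [← lintegral_const_mul' _ _ (ENNReal.mul_ne_top ENNReal.ofReal_ne_top ENNReal.ofReal_ne_top)]
          apply lintegral_congr; intro X'; ring
      _ ≤ ENNReal.ofReal D * ENNReal.ofReal ((4 * r / c) ^ k) * 1 := by gcongr; exact hB j
      _ = _ := by rw [mul_one, ENNReal.ofReal_mul hD.le]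
  calc _ ≤ ∑ j : Fin k, ENNReal.ofReal (D * (4 * r / c) ^ k) := Finset.sum_le_sum fun j _ => hj j
    _ = _ := by simp

lemma lw_int {v : Fin k → E} {G : Fin k → E → ℝ≥0∞} {R A : ℝ} {c0 : E} (hR : 0 < R)
    (hA : 0 ≤ A) (hG : ∀ j, Measurable (G j)) (hv : ∀ j, ‖v j‖ ≤ A)
    (hB : ∀ j, ∫⁻ X in Metric.closedBall c0 ((3 + 2 * k * A) * R), G j X ∂μ ≤ 1) :
    ∫⁻ X in Metric.closedBall c0 ((2 + k * A) * R), (∫⁻ z, lwf v G R X z) ∂μ ≤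
      k * ENNReal.ofReal ((2 * R) ^ k) := by
  have hQ : MeasurableSet (Metric.closedBall (0 : Fin k → ℝ) R) := Metric.isClosed_closedBall.measurableSet
  have mLL := (LL_continuous v).measurable
  rw [lintegral_lintegral_swap (lwf_measurable v hG R).aemeasurable]
  calc _ ≤ ∫⁻ z, (Metric.closedBall (0 : Fin k → ℝ) R).indicator (fun z => (k : ℝ≥0∞)) z := by
        apply lintegral_mono; intro z; dsimp only
        unfold lwf
        by_cases hz : z ∈ Metric.closedBall (0 : Fin k → ℝ) R
        · simp only [Set.indicator_of_mem hz]
          rw [lintegral_finset_sum' (f := fun j X => G j (X + LL v z)) _ (fun j _ => ((hG j).comp (measurable_id.add_const _)).aemeasurable)]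
          have hz' := LL_norm_le hv hA hR.le hz
          calc _ ≤ ∑ j : Fin k, (1 : ℝ≥0∞) := by
                apply Finset.sum_le_sum; intro j _
                refine le_trans ?_ (hB j)
                rw [← lintegral_indicator Metric.isClosed_closedBall.measurableSet,
                  ← lintegral_indicator Metric.isClosed_closedBall.measurableSet,
                  ← lintegral_add_right_eq_self (μ := μ) ((Metric.closedBall c0 ((3 + 2 * k * A) * R)).indicator (G j)) (LL v z)]
                apply lintegral_mono; intro X; dsimp only
                by_cases hX : X ∈ Metric.closedBall c0 ((2 + k * A) * R)
                swap
                · rw [Set.indicator_of_notMem hX]; exact zero_le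
                rw [Set.indicator_of_mem hX, Set.indicator_of_mem]
                rw [mem_closedBall_iff_norm] at hX ⊢
                have : ‖X + LL v z - c0‖ ≤ (2 + k * A) * R + k * A * R := by
                  calc _ = ‖(X - c0) + LL v z‖ := by congr 1; abel
                    _ ≤ _ := (norm_add_le _ _).trans (by gcongr)
                nlinarith
            _ = _ := by simp
        · simp [Set.indicator_of_notMem hz]
    _ = _ := by
        rw [lintegral_indicator hQ, setLIntegral_const, Real.volume_pi_closedBall _ hR.le]; simp

lemma lw_avg {v : Fin k → E} {g : E → ℝ≥0∞} {R A : ℝ} {c0 : E} (hR : 0 < R)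
    (hA : 0 ≤ A) (hg : Measurable g) (hv : ∀ j, ‖v j‖ ≤ A) :
    ENNReal.ofReal ((2 * R) ^ k) * ∫⁻ X in Metric.closedBall c0 (2 * R), g X ∂μ ≤
    ∫⁻ X in Metric.closedBall c0 ((2 + k * A) * R), (∫⁻ z in Metric.closedBall (0 : Fin k → ℝ) R, g (X + LL v z)) ∂μ := by
  have hQ : MeasurableSet (Metric.closedBall (0 : Fin k → ℝ) R) := Metric.isClosed_closedBall.measurableSet
  have mLL := (LL_continuous v).measurable
  rw [lintegral_lintegral_swap]
  · calc _ = ∫⁻ z in Metric.closedBall (0 : Fin k → ℝ) R, ∫⁻ X in Metric.closedBall c0 (2 * R), g X ∂μ := by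
          rw [setLIntegral_const, Real.volume_pi_closedBall _ hR.le, mul_comm]; simp
      _ ≤ _ := by
          apply setLIntegral_mono' hQ
          intro z hz
          have hz' := LL_norm_le hv hA hR.le hz
          rw [← lintegral_indicator Metric.isClosed_closedBall.measurableSet,
            ← lintegral_indicator Metric.isClosed_closedBall.measurableSet,
            ← lintegral_add_right_eq_self (μ := μ) ((Metric.closedBall c0 (2 * R)).indicator g) (LL v z)]
          apply lintegral_mono; intro X; dsimp only
          by_cases hX : X + LL v z ∈ Metric.closedBall c0 (2 * R)
          swap
          · rw [Set.indicator_of_notMem hX]; exact zero_le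
          rw [Set.indicator_of_mem hX, Set.indicator_of_mem]
          rw [mem_closedBall_iff_norm] at hX ⊢
          calc ‖X - c0‖ = ‖(X + LL v z - c0) - LL v z‖ := by congr 1; abel
            _ ≤ 2 * R + k * A * R := (norm_sub_le _ _).trans (by gcongr)
            _ = _ := by ring
  · apply Measurable.aemeasurable
    exact hg.comp (measurable_fst.add (mLL.comp measurable_snd))

lemma lw_norm {v : Fin k → E} {G : Fin k → E → ℝ≥0∞} {r R D c A : ℝ} {c0 : E} (hk : 2 ≤ k) (hr : 0 < r) (hrR : r ≤ R) (hD : 0 < D)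
    (hc : 0 < c) (hA : 0 ≤ A) (hG : ∀ j, Measurable (G j)) (hv : ∀ j, ‖v j‖ ≤ A)
    (hL : ∀ z, c * ‖z‖ ≤ ‖LL v z‖)
    (h1 : ∀ j X s, |s| ≤ 2 * R → G j X ≤ ENNReal.ofReal D * G j (X + s • v j))
    (h2 : ∀ j X Y, ‖Y‖ ≤ r → G j X ≤ ENNReal.ofReal D * G j (X + Y))
    (hB : ∀ j, ∫⁻ X in Metric.closedBall c0 ((3 + 2 * k * A) * R), G j X ∂μ ≤ 1) :
    ENNReal.ofReal (2 * R / D) ^ ((1 : ℝ) / (k - 1) * k) * ∫⁻ X in Metric.closedBall c0 (2 * R), ∏ j, G j X ^ ((1 : ℝ) / (k - 1)) ∂μ ≤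
      k * (k * ENNReal.ofReal (D * (4 * r / c) ^ k) / μ (Metric.closedBall 0 r)) ^ ((1 : ℝ) / (k - 1)) := by
  have hR : 0 < R := hr.trans_le hrR
  have hk1 : (0:ℝ) < k - 1 := by
    have : (2:ℝ) ≤ k := by exact_mod_cast hk
    linarith
  have hQ : MeasurableSet (Metric.closedBall (0 : Fin k → ℝ) R) := Metric.isClosed_closedBall.measurableSet
  have mLL := (LL_continuous v).measurable
  set q : ℝ := (1 : ℝ) / (k - 1) with hq
  have hq0 : 0 < q := by positivity
  set a := ENNReal.ofReal (2 * R / D)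
  set S := k * ENNReal.ofReal (D * (4 * r / c) ^ k) / μ (Metric.closedBall 0 r) with hS
  have hμ0 : μ (Metric.closedBall (0:E) r) ≠ 0 := (Metric.measure_closedBall_pos μ _ hr).ne'
  have hμt : μ (Metric.closedBall (0:E) r) ≠ ∞ := measure_closedBall_lt_top.ne
  have mg : Measurable (fun X => ∏ j, G j X ^ q) :=
    Finset.measurable_prod _ fun j _ => (hG j).pow_const _
  have hconj : Real.HolderConjugate (Fintype.card (Fin k)) (1 + q) := by
    rw [Fintype.card_fin, Real.holderConjugate_iff]
    have : (2:ℝ) ≤ k := by exact_mod_cast hk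
    refine ⟨by linarith, ?_⟩
    have : (k:ℝ) ≠ 0 := by positivity
    rw [hq]
    have e : 1 + 1 / ((k:ℝ) - 1) = k / (k - 1) := by field_simp; ring
    rw [e]; field_simp; ring
  have hpt : ∀ X ∈ Metric.closedBall c0 ((2 + k * A) * R),
      a ^ (q * k) * ∫⁻ z in Metric.closedBall (0 : Fin k → ℝ) R, ∏ j, G j (X + LL v z) ^ q ≤
        S ^ q * ∫⁻ z, lwf v G R X z := by
    intro X hX
    have hI : ∫⁻ z, lwf v G R X z ≤ S := by
      rw [hS, ENNReal.le_div_iff_mul_le (Or.inl hμ0) (Or.inl hμt), mul_comm]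
      exact lw_sup μ hr hrR hD hc hA hG hv hL h2 hB X hX
    have ml : Measurable (lwf v G R X) := (lwf_measurable v hG R).comp measurable_prodMk_left
    calc _ = ∫⁻ z in Metric.closedBall (0 : Fin k → ℝ) R, ∏ j, (a * G j (X + LL v z)) ^ q := by
          rw [← lintegral_const_mul]
          · apply lintegral_congr; intro z
            simp_rw [ENNReal.mul_rpow_of_nonneg _ _ hq0.le]
            rw [Finset.prod_mul_distrib, Finset.prod_const, Finset.card_univ, Fintype.card_fin,
              ENNReal.rpow_mul, ENNReal.rpow_natCast]
          · exact mg.comp (measurable_const.add mLL)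
      _ ≤ ∫⁻ z in Metric.closedBall (0 : Fin k → ℝ) R, ∏ j, (∫⁻ s, lwf v G R X (Function.update z j s)) ^ q := by
          apply setLIntegral_mono' hQ
          intro z hz
          apply Finset.prod_le_prod'
          intro j _
          gcongr
          exact lw_line hR hD h1 X hz j
      _ ≤ ∫⁻ z, ∏ j, (∫⁻ s, lwf v G R X (Function.update z j s)) ^ q := setLIntegral_le_lintegral _ _
      _ ≤ (∫⁻ z, lwf v G R X z) ^ (1 + q) := by
          have := lintegral_prod_lintegral_pow_le (fun _ : Fin k => (volume : Measure ℝ)) hconj ml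
          rw [Fintype.card_fin] at this
          exact this
      _ = (∫⁻ z, lwf v G R X z) ^ q * ∫⁻ z, lwf v G R X z := by
          rw [ENNReal.rpow_add_of_nonneg _ _ (by norm_num) hq0.le, ENNReal.rpow_one, mul_comm]
      _ ≤ _ := by gcongr
  have hfin : ENNReal.ofReal ((2 * R) ^ k) ≠ ∞ := ENNReal.ofReal_ne_top
  have hpos : ENNReal.ofReal ((2 * R) ^ k) ≠ 0 := by
    rw [Ne, ENNReal.ofReal_eq_zero, not_le]; positivity
  have key : ENNReal.ofReal ((2 * R) ^ k) * (a ^ (q * k) * ∫⁻ X in Metric.closedBall c0 (2 * R), ∏ j, G j X ^ q ∂μ) ≤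
      ENNReal.ofReal ((2 * R) ^ k) * (k * S ^ q) := by
    calc _ = a ^ (q * k) * (ENNReal.ofReal ((2 * R) ^ k) * ∫⁻ X in Metric.closedBall c0 (2 * R), ∏ j, G j X ^ q ∂μ) := by ring
      _ ≤ a ^ (q * k) * ∫⁻ X in Metric.closedBall c0 ((2 + k * A) * R), (∫⁻ z in Metric.closedBall (0 : Fin k → ℝ) R, ∏ j, G j (X + LL v z) ^ q) ∂μ := by
          gcongr
          exact lw_avg μ hR hA mg hv
      _ = ∫⁻ X in Metric.closedBall c0 ((2 + k * A) * R), a ^ (q * k) * (∫⁻ z in Metric.closedBall (0 : Fin k → ℝ) R, ∏ j, G j (X + LL v z) ^ q) ∂μ := by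
          rw [lintegral_const_mul' _ _ (ENNReal.rpow_ne_top_of_nonneg (by positivity) ENNReal.ofReal_ne_top)]
      _ ≤ ∫⁻ X in Metric.closedBall c0 ((2 + k * A) * R), S ^ q * (∫⁻ z, lwf v G R X z) ∂μ := by
          apply setLIntegral_mono' Metric.isClosed_closedBall.measurableSet
          exact hpt
      _ = S ^ q * ∫⁻ X in Metric.closedBall c0 ((2 + k * A) * R), (∫⁻ z, lwf v G R X z) ∂μ := by
          rw [lintegral_const_mul']
          apply ENNReal.rpow_ne_top_of_nonneg hq0.le
          rw [hS]
          exact (ENNReal.div_lt_top (ENNReal.mul_ne_top (by simp) ENNReal.ofReal_ne_top) hμ0).ne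
      _ ≤ S ^ q * (k * ENNReal.ofReal ((2 * R) ^ k)) := by
          gcongr
          exact lw_int μ hR hA hG hv hB
      _ = _ := by ring
  exact (ENNReal.mul_le_mul_iff_right hpos hfin).1 key

/-- Loomis-Whitney type inequality -/
lemma loomis_whitney (hk : 2 ≤ k) {D c A : ℝ} (hD : 0 < D) (hc : 0 < c) (hA : 0 ≤ A) :
    ∃ C : ℝ, 0 < C ∧ ∀ (v : Fin k → E) (F : Fin k → E → ℝ≥0∞) (r R : ℝ) (c0 : E) (b : Fin k → ℝ≥0∞),
    0 < r → r ≤ R → (∀ j, Measurable (F j)) → (∀ j, ‖v j‖ ≤ A) →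
    (∀ z, c * ‖z‖ ≤ ‖LL v z‖) →
    (∀ j X s, |s| ≤ 2 * R → F j X ≤ ENNReal.ofReal D * F j (X + s • v j)) →
    (∀ j X Y, ‖Y‖ ≤ r → F j X ≤ ENNReal.ofReal D * F j (X + Y)) →
    (∀ j, ∫⁻ X in Metric.closedBall c0 ((3 + 2 * k * A) * R), F j X ∂μ ≤ b j) → (∀ j, b j ≠ ∞) →
    ∫⁻ X in Metric.closedBall c0 (2 * R), ∏ j, F j X ^ ((1 : ℝ) / (k - 1)) ∂μ ≤
      ENNReal.ofReal C * (ENNReal.ofReal (r ^ k / (r ^ Module.finrank ℝ E * R ^ k)) * ∏ j, b j) ^ ((1 : ℝ) / (k - 1)) := by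
  have hk1 : (0:ℝ) < k - 1 := by
    have : (2:ℝ) ≤ k := by exact_mod_cast hk
    linarith
  set q : ℝ := (1 : ℝ) / (k - 1) with hq
  have hq0 : 0 < q := by positivity
  set V1 : ℝ := (μ (Metric.ball (0:E) 1)).toReal with hV1
  have hV1t : μ (Metric.ball (0:E) 1) ≠ ∞ := measure_ball_lt_top.ne
  have hV1p : 0 < V1 := ENNReal.toReal_pos (Metric.measure_ball_pos μ _ one_pos).ne' hV1t
  refine ⟨k * (k * (D * (4 / c) ^ k) * (D / 2) ^ k / V1) ^ q, by positivity, ?_⟩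
  intro v F r R c0 b hr hrR hF hv hL h1 h2 hB hb
  have hR : 0 < R := hr.trans_le hrR
  by_cases hb0 : ∃ j, b j = 0
  · obtain ⟨j, hj⟩ := hb0
    have h3 : ∫⁻ X in Metric.closedBall c0 (2 * R), F j X ∂μ = 0 := by
      refine le_antisymm ?_ zero_le
      refine le_trans (lintegral_mono_set ?_) ((hB j).trans hj.le)
      apply Metric.closedBall_subset_closedBall
      gcongr; nlinarith [mul_nonneg (Nat.cast_nonneg (α := ℝ) k) hA]
    rw [lintegral_eq_zero_iff (hF j)] at h3
    have h4 : ∫⁻ X in Metric.closedBall c0 (2 * R), ∏ j, F j X ^ q ∂μ = 0 := by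
      rw [lintegral_eq_zero_iff (Finset.measurable_prod _ fun j _ => (hF j).pow_const _)]
      filter_upwards [h3] with X hX
      apply Finset.prod_eq_zero (Finset.mem_univ j)
      rw [hX]; simp [hq0]
    rw [h4]; exact zero_le
  push Not at hb0
  set G : Fin k → E → ℝ≥0∞ := fun j X => (b j)⁻¹ * F j X with hG
  have key := lw_norm μ (v := v) (G := G) (c0 := c0) hk hr hrR hD hc hA (fun j => (hF j).const_mul _) hv hL
    (fun j X s hs => by
      simp only [hG]; rw [mul_left_comm]; gcongr; exact h1 j X s hs)
    (fun j X Y hY => by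
      simp only [hG]; rw [mul_left_comm]; gcongr; exact h2 j X Y hY)
    (fun j => by
      simp only [hG]
      rw [lintegral_const_mul _ (hF j)]
      calc _ ≤ (b j)⁻¹ * b j := by gcongr; exact hB j
        _ = 1 := ENNReal.inv_mul_cancel (hb0 j) (hb j))
  rw [← hq] at key
  have e1 : ∀ X, ∏ j, F j X ^ q = (∏ j, b j) ^ q * ∏ j, G j X ^ q := by
    intro X
    rw [← ENNReal.prod_rpow_of_nonneg hq0.le, ← Finset.prod_mul_distrib]
    apply Finset.prod_congr rfl; intro j _
    rw [← ENNReal.mul_rpow_of_nonneg _ _ hq0.le]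
    simp only [hG]
    rw [← mul_assoc, ENNReal.mul_inv_cancel (hb0 j) (hb j), one_mul]
  have hbq : (∏ j, b j) ^ q ≠ ∞ := ENNReal.rpow_ne_top_of_nonneg hq0.le (ENNReal.prod_ne_top fun j _ => hb j)
  simp_rw [e1]
  rw [lintegral_const_mul' _ _ hbq]
  have e2 : (k * ENNReal.ofReal (D * (4 * r / c) ^ k) / μ (Metric.closedBall 0 r)) =
      ENNReal.ofReal (k * (D * (4 * r / c) ^ k) / (r ^ Module.finrank ℝ E * V1)) := by
    rw [Measure.addHaar_closedBall μ _ hr.le, ← ENNReal.ofReal_toReal hV1t, ← hV1,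
      ENNReal.ofReal_div_of_pos (by positivity), ENNReal.ofReal_mul (by positivity : (0:ℝ) ≤ k), ENNReal.ofReal_mul (by positivity : 0 ≤ r ^ Module.finrank ℝ E), ENNReal.ofReal_natCast]
  have e3 : ENNReal.ofReal (2 * R / D) ^ (q * k) = ENNReal.ofReal ((2 * R / D) ^ k) ^ q := by
    rw [mul_comm q, ENNReal.rpow_mul, ENNReal.rpow_natCast, ENNReal.ofReal_pow (by positivity)]
  rw [e2, e3] at key
  set I := ∫⁻ X in Metric.closedBall c0 (2 * R), ∏ j, G j X ^ q ∂μ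
  have hA1 : 0 < (2 * R / D) ^ k := by positivity
  have h5 : I ≤ k * ENNReal.ofReal (k * (D * (4 / c) ^ k) * (D / 2) ^ k / V1 * (r ^ k / (r ^ Module.finrank ℝ E * R ^ k))) ^ q := by
    calc I = ENNReal.ofReal ((2 * R / D) ^ k)⁻¹ ^ q * (ENNReal.ofReal ((2 * R / D) ^ k) ^ q * I) := by
          rw [← mul_assoc, ← ENNReal.mul_rpow_of_nonneg _ _ hq0.le, ← ENNReal.ofReal_mul (by positivity),
            inv_mul_cancel₀ hA1.ne']; simp
      _ ≤ ENNReal.ofReal ((2 * R / D) ^ k)⁻¹ ^ q * (k * ENNReal.ofReal (k * (D * (4 * r / c) ^ k) / (r ^ Module.finrank ℝ E * V1)) ^ q) := by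
          gcongr
      _ = _ := by
          rw [mul_left_comm, ← ENNReal.mul_rpow_of_nonneg _ _ hq0.le, ← ENNReal.ofReal_mul (by positivity)]
          congr 3
          simp only [div_pow, mul_pow]
          field_simp
  calc _ ≤ (∏ j, b j) ^ q * (k * ENNReal.ofReal (k * (D * (4 / c) ^ k) * (D / 2) ^ k / V1 * (r ^ k / (r ^ Module.finrank ℝ E * R ^ k))) ^ q) := by
        gcongr
    _ = _ := by
        rw [ENNReal.ofReal_mul (by positivity : (0:ℝ) ≤ k * (D * (4 / c) ^ k) * (D / 2) ^ k / V1), ENNReal.mul_rpow_of_nonneg _ _ hq0.le,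
          ENNReal.mul_rpow_of_nonneg _ _ hq0.le, ENNReal.ofReal_mul (by positivity : (0:ℝ) ≤ k), ENNReal.ofReal_natCast,
          ENNReal.ofReal_rpow_of_nonneg (by positivity) hq0.le]
        ring

end LW
end PExt

end

section
namespace PExt

variable {d k : ℕ}

noncomputable def vv (ξ : VV d) : VV d × ℝ := (-(2:ℝ) • ξ, 1)

/-- quantitative transversality -/
def Trans (c : ℝ) (ξ : Fin k → VV d) : Prop :=
  ∀ z : Fin k → ℝ, c * ‖z‖ ≤ ‖LL (fun j => vv (ξ j)) z‖

/-- product of energies -/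
noncomputable def aa (f : Fin k → VV d → ℂ) (r : ℝ) (X : VV d × ℝ) : ℝ≥0∞ :=
  ∏ j, En (f j) X.1 X.2 r ^ ((1 : ℝ) / (k - 1))

lemma aa_measurable {f : Fin k → VV d → ℂ} (hf : ∀ j, Integrable (f j)) (r : ℝ) : Measurable (aa f r) := by
  unfold aa
  exact Finset.measurable_prod _ fun j _ => (En_measurable (hf j) r).pow_const _

lemma finrank_X (d : ℕ) : Module.finrank ℝ (VV d × ℝ) = d + 1 := by simp

lemma vv_norm_le {B : ℝ} (hB : 0 ≤ B) {ξ : VV d} (h : ‖ξ‖ ≤ B) : ‖vv ξ‖ ≤ 2 * B + 1 := by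
  unfold vv
  rw [Prod.norm_def]
  apply max_le
  · rw [norm_smul]; simp; linarith
  · simp; linarith

/-- energies are essentially constant along tubes and at scale `r` -/
lemma En_line (d : ℕ) : ∃ D : ℝ, 0 < D ∧ ∀ (f : VV d → ℂ) (ξ : VV d) (r δ s : ℝ) (X : VV d × ℝ),
    Nice f ξ δ → 0 < δ → 1 ≤ r * δ → |s| ≤ 2 * (r / δ) →
      En f X.1 X.2 r ≤ ENNReal.ofReal D * En f (X + s • vv ξ).1 (X + s • vv ξ).2 r := by
  obtain ⟨C, hC, h⟩ := En_transport d
  refine ⟨Real.exp (C * 2), by positivity, fun f ξ r δ s X hf hδ hr hs => ?_⟩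
  have hr0 : 0 < r := by
    by_contra hr'; push Not at hr'; nlinarith
  refine (h f ξ X.1 X.2 (X.2 + s) r δ hf hδ hr).trans ?_
  have e : X.1 + (2 * (X.2 - (X.2 + s))) • ξ = (X + s • vv ξ).1 := by
    simp only [vv, Prod.fst_add, Prod.smul_fst]; module
  have e2 : (X + s • vv ξ).2 = X.2 + s := by simp [vv]
  rw [e, e2]
  gcongr
  rw [div_le_iff₀ hr0]
  have : X.2 - (X.2 + s) = -s := by ring
  rw [this, abs_neg]
  calc δ * |s| ≤ δ * (2 * (r / δ)) := by gcongr
    _ = 2 * r := by field_simp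

lemma En_near (d : ℕ) {A B : ℝ} (hA : 0 ≤ A) (hB : 0 ≤ B) : ∃ D : ℝ, 0 < D ∧ ∀ (f : VV d → ℂ) (ξ : VV d) (r δ : ℝ) (X Y : VV d × ℝ),
    Nice f ξ δ → 0 < δ → δ ≤ 1 → ‖ξ‖ ≤ B → 1 ≤ r * δ → ‖Y‖ ≤ A * r →
      En f X.1 X.2 r ≤ ENNReal.ofReal D * En f (X + Y).1 (X + Y).2 r := by
  obtain ⟨C, hC, h⟩ := En_transport d
  refine ⟨Real.exp (C * A) * (2 * (1 + (A * (1 + 2 * B)) ^ 2)) ^ (d + 1), by positivity, fun f ξ r δ X Y hf hδ hδ1 hξ hr hY => ?_⟩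
  have hr0 : 0 < r := by
    by_contra hr'; push Not at hr'; nlinarith
  have hY1 : ‖Y.1‖ ≤ A * r := (norm_fst_le Y).trans hY
  have hY2 : |Y.2| ≤ A * r := (norm_snd_le Y).trans hY
  refine (h f ξ X.1 X.2 (X.2 + Y.2) r δ hf hδ hr).trans ?_
  have e : X.1 + (2 * (X.2 - (X.2 + Y.2))) • ξ - (X + Y).1 = -(Y.1 + (2 * Y.2) • ξ) := by
    simp only [Prod.fst_add]; module
  have h2 := En_shift (f := f) hr0 (A := A * (1 + 2 * B)) (by positivity) (X.2 + Y.2)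
    (x := X.1 + (2 * (X.2 - (X.2 + Y.2))) • ξ) (x' := (X + Y).1) (by
      rw [e, norm_neg]
      calc _ ≤ ‖Y.1‖ + ‖(2 * Y.2) • ξ‖ := norm_add_le _ _
        _ = ‖Y.1‖ + 2 * |Y.2| * ‖ξ‖ := by rw [norm_smul]; simp
        _ ≤ A * r + 2 * (A * r) * B := by gcongr
        _ = _ := by ring)
  rw [ENNReal.ofReal_mul (by positivity), mul_assoc]
  gcongr
  · rw [div_le_iff₀ hr0]
    have : X.2 - (X.2 + Y.2) = -Y.2 := by ring
    rw [this, abs_neg]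
    calc δ * |Y.2| ≤ 1 * (A * r) := by gcongr
      _ = _ := by ring
  · exact h2

lemma En_box (d : ℕ) {A B : ℝ} (hA : 0 ≤ A) (hB : 0 ≤ B) : ∃ D : ℝ, 0 < D ∧ ∀ (f : VV d → ℂ) (ξ : VV d) (r R δ : ℝ) (X : VV d × ℝ),
    Nice f ξ δ → 0 < δ → δ ≤ 1 → ‖ξ‖ ≤ B → 1 ≤ r * δ → r ≤ R →
      ∫⁻ Y in Metric.closedBall X (A * R), En f Y.1 Y.2 r ≤ ENNReal.ofReal (D * r ^ d * R) * En f X.1 X.2 R := by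
  obtain ⟨C, hC, h⟩ := En_average (d := d) A hA
  obtain ⟨D, hD, h2⟩ := En_near d hA hB
  refine ⟨C * D * (2 * A + 1), by positivity, fun f ξ r R δ X hf hδ hδ1 hξ hr hrR => ?_⟩
  have hr0 : 0 < r := by
    by_contra hr'; push Not at hr'; nlinarith
  have hR0 : 0 < R := by linarith
  have e : Metric.closedBall X (A * R) = Metric.closedBall X.1 (A * R) ×ˢ Metric.closedBall X.2 (A * R) := by
    rw [closedBall_prod_same]
  rw [e, Measure.volume_eq_prod, setLIntegral_prod_symm _ (En_measurable hf.integrable r).aemeasurable]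
  calc _ ≤ ∫⁻ t in Metric.closedBall X.2 (A * R), ENNReal.ofReal (C * r ^ d) * (ENNReal.ofReal D * En f X.1 X.2 R) := by
        apply setLIntegral_mono' Metric.isClosed_closedBall.measurableSet
        intro t ht
        refine (h f X.1 t r R hf.integrable hr0 hrR).trans ?_
        gcongr
        have := h2 f ξ R δ (X.1, t) (0, X.2 - t) hf hδ hδ1 hξ (by nlinarith) (by
          rw [Prod.norm_def]; apply max_le
          · simp; positivity
          · rw [mem_closedBall_iff_norm] at ht; rw [← norm_neg, neg_sub]; exact ht)
        simpa using this
    _ = ENNReal.ofReal (C * r ^ d) * (ENNReal.ofReal D * En f X.1 X.2 R) * ENNReal.ofReal (2 * (A * R)) := by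
        rw [setLIntegral_const, Real.volume_closedBall]
    _ = ENNReal.ofReal (C * r ^ d * D * (2 * (A * R))) * En f X.1 X.2 R := by
        rw [ENNReal.ofReal_mul (by positivity : 0 ≤ C * r ^ d * D), ENNReal.ofReal_mul (by positivity : 0 ≤ C * r ^ d)]; ring
    _ ≤ _ := by
        refine mul_le_mul_left (ENNReal.ofReal_le_ofReal ?_) _
        have : 0 ≤ C * r ^ d * D * R := by positivity
        calc C * r ^ d * D * (2 * (A * R)) = (C * r ^ d * D * R) * (2 * A) := by ring
          _ ≤ (C * r ^ d * D * R) * (2 * A + 1) := by gcongr; linarith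
          _ = _ := by ring

instance : (volume : Measure (VV d × ℝ)).IsAddHaarMeasure :=
  inferInstanceAs ((volume : Measure (VV d)).prod (volume : Measure ℝ)).IsAddHaarMeasure

lemma one_step (hk : 2 ≤ k) {c B : ℝ} (hc : 0 < c) (hB : 0 ≤ B) : ∃ C : ℝ, 0 < C ∧
    ∀ (f : Fin k → VV d → ℂ) (ξ : Fin k → VV d) (r R δ : ℝ) (X : VV d × ℝ),
    (∀ j, Nice (f j) (ξ j) δ) → 0 < δ → δ ≤ 1 → (∀ j, ‖ξ j‖ ≤ B) → Trans c ξ → 1 ≤ r * δ → r ≤ R →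
    R ≤ r / δ → ∫⁻ Y in Metric.closedBall X (2 * R), aa f r Y ≤ ENNReal.ofReal (C * r ^ (d + 1)) * aa f R X := by
  obtain ⟨D1, hD1, h1⟩ := En_line d
  obtain ⟨D2, hD2, h2⟩ := En_near d (zero_le_one) hB
  obtain ⟨D3, hD3, h3⟩ := En_box d (A := 3 + 2 * k * (2 * B + 1)) (by positivity) hB
  obtain ⟨C, hC, hLW⟩ := loomis_whitney (E := VV d × ℝ) volume hk (D := max D1 D2) (c := c) (A := 2 * B + 1)
    (lt_max_of_lt_left hD1) hc (by positivity)
  have hk1 : (0:ℝ) < k - 1 := by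
    have : (2:ℝ) ≤ k := by exact_mod_cast hk
    linarith
  set q : ℝ := (1 : ℝ) / (k - 1) with hq
  have hq0 : 0 < q := by positivity
  refine ⟨C * (D3 ^ k) ^ q, by positivity, fun f ξ r R δ X hf hδ hδ1 hξ hT hr hrR hR => ?_⟩
  have hr0 : 0 < r := by
    by_contra hr'; push Not at hr'; nlinarith
  have hR0 : 0 < R := by linarith
  have key := hLW (fun j => vv (ξ j)) (fun j Y => En (f j) Y.1 Y.2 r) r R X
    (fun j => ENNReal.ofReal (D3 * r ^ d * R) * En (f j) X.1 X.2 R) hr0 hrR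
    (fun j => En_measurable (hf j).integrable r) (fun j => vv_norm_le hB (hξ j)) hT
    (fun j Y s hs => (h1 (f j) (ξ j) r δ s Y (hf j) hδ hr (by linarith)).trans (by
      gcongr; exact le_max_left _ _))
    (fun j Y Z hZ => (h2 (f j) (ξ j) r δ Y Z (hf j) hδ hδ1 (hξ j) hr (by linarith)).trans (by
      gcongr; exact le_max_right _ _))
    (fun j => h3 (f j) (ξ j) r R δ X (hf j) hδ hδ1 (hξ j) hr hrR)
    (fun j => ENNReal.mul_ne_top ENNReal.ofReal_ne_top (En_le_top (hf j).integrable hR0 _ _).ne)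
  unfold aa
  refine key.trans (le_of_eq ?_)
  rw [Finset.prod_mul_distrib, Finset.prod_const, Finset.card_univ, Fintype.card_fin, ← mul_assoc,
    ENNReal.mul_rpow_of_nonneg _ _ hq0.le, ENNReal.prod_rpow_of_nonneg hq0.le, ← mul_assoc,
    ← ENNReal.ofReal_pow (by positivity), ← ENNReal.ofReal_mul (by positivity),
    ENNReal.ofReal_rpow_of_nonneg (by positivity) hq0.le, ← ENNReal.ofReal_mul (by positivity), finrank_X]
  congr 2
  have e : r ^ k / (r ^ (d + 1) * R ^ k) * (D3 * r ^ d * R) ^ k = D3 ^ k * (r ^ (d + 1)) ^ (k - 1 : ℕ) := by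
    obtain ⟨m, rfl⟩ : ∃ m, k = m + 1 := ⟨k - 1, by omega⟩
    simp only [Nat.add_sub_cancel, mul_pow]
    field_simp
    ring
  rw [e, Real.mul_rpow (by positivity) (by positivity), ← mul_assoc]
  congr 1
  rw [← Real.rpow_natCast (r ^ (d + 1)), ← Real.rpow_mul (by positivity)]
  have : ((k - 1 : ℕ) : ℝ) * q = 1 := by
    rw [Nat.cast_sub (by omega), hq]; push_cast; field_simp
  rw [this, Real.rpow_one]

end PExt

end

section
namespace PExt

variable {d k : ℕ}

lemma ball_average {E : Type*} [NormedAddCommGroup E] [NormedSpace ℝ E] [FiniteDimensional ℝ E]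
    [MeasurableSpace E] [BorelSpace E] (μ : Measure E) [μ.IsAddHaarMeasure] {g : E → ℝ≥0∞}
    (hg : Measurable g) {r R : ℝ} (hrR : r ≤ R) (x : E) :
    μ (Metric.closedBall 0 r) * ∫⁻ y in Metric.closedBall x R, g y ∂μ ≤
      ∫⁻ z in Metric.closedBall x (2 * R), (∫⁻ y in Metric.closedBall z r, g y ∂μ) ∂μ := by
  have mS : MeasurableSet {q : E × E | dist q.2 q.1 ≤ r} :=
    (isClosed_le (by fun_prop) continuous_const).measurableSet
  have e1 : ∀ z, ∫⁻ y in Metric.closedBall z r, g y ∂μ = ∫⁻ y, {q : E × E | dist q.2 q.1 ≤ r}.indicator (fun q => g q.2) (z, y) ∂μ := by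
    intro z
    rw [← lintegral_indicator Metric.isClosed_closedBall.measurableSet]
    apply lintegral_congr; intro y
    simp [Set.indicator]
  simp_rw [e1]
  rw [lintegral_lintegral_swap (f := fun z y => {q : E × E | dist q.2 q.1 ≤ r}.indicator (fun q => g q.2) (z, y)) (((hg.comp measurable_snd).indicator mS).aemeasurable)]
  rw [← lintegral_const_mul' _ _ measure_closedBall_lt_top.ne,
    ← lintegral_indicator Metric.isClosed_closedBall.measurableSet]
  apply lintegral_mono; intro y; dsimp only
  by_cases hy : y ∈ Metric.closedBall x R
  swap
  · rw [Set.indicator_of_notMem hy]; exact zero_le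
  rw [Set.indicator_of_mem hy]
  calc _ = ∫⁻ z in Metric.closedBall y r, g y ∂μ := by
        rw [setLIntegral_const, mul_comm, ← Measure.addHaar_closedBall_center μ y]
    _ = ∫⁻ z in Metric.closedBall y r, {q : E × E | dist q.2 q.1 ≤ r}.indicator (fun q => g q.2) (z, y) ∂μ := by
        apply setLIntegral_congr_fun Metric.isClosed_closedBall.measurableSet
        intro z hz
        dsimp only
        rw [Set.indicator_of_mem]
        rw [Set.mem_setOf_eq, dist_comm]; exact hz
    _ ≤ _ := by
        apply lintegral_mono_set
        apply Metric.closedBall_subset_closedBall'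
        have := Metric.mem_closedBall.1 hy
        linarith

lemma iterate_step (hk : 2 ≤ k) {c B : ℝ} (hc : 0 < c) (hB : 0 ≤ B) : ∃ K : ℝ, 1 ≤ K ∧
    ∀ (f : Fin k → VV d → ℂ) (ξ : Fin k → VV d) (δ : ℝ),
    (∀ j, Nice (f j) (ξ j) δ) → 0 < δ → δ ≤ 1 → (∀ j, ‖ξ j‖ ≤ B) → Trans c ξ → ∀ (l : ℕ) (X : VV d × ℝ),
    ∫⁻ Y in Metric.closedBall X (δ⁻¹ ^ (l + 1)), aa f δ⁻¹ Y ≤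
      ENNReal.ofReal (K ^ (l + 1) * δ⁻¹ ^ (d + 1)) * aa f (δ⁻¹ ^ (l + 1)) X := by
  obtain ⟨C, hC, h⟩ := one_step (d := d) hk hc hB
  set V1 : ℝ := ((volume : Measure (VV d × ℝ)) (Metric.ball (0:VV d × ℝ) 1)).toReal with hV1
  have hV1t : (volume : Measure (VV d × ℝ)) (Metric.ball (0:VV d × ℝ) 1) ≠ ∞ := measure_ball_lt_top.ne
  have hV1p : 0 < V1 := ENNReal.toReal_pos (Metric.measure_ball_pos volume _ one_pos).ne' hV1t
  set K := max 1 (max C (C / V1)) with hK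
  have hK1 : 1 ≤ K := le_max_left _ _
  have hKC : C ≤ K := (le_max_left _ _).trans (le_max_right _ _)
  have hKC' : C / V1 ≤ K := (le_max_right _ _).trans (le_max_right _ _)
  refine ⟨K, hK1, fun f ξ δ hf hδ hδ1 hξ hT l => ?_⟩
  have hδi : 1 ≤ δ⁻¹ := (one_le_inv₀ hδ).2 hδ1
  induction l with
  | zero =>
    intro X
    have := h f ξ δ⁻¹ δ⁻¹ δ X hf hδ hδ1 hξ hT (by rw [inv_mul_cancel₀ hδ.ne']) le_rfl
      (by rw [le_div_iff₀ hδ]; nlinarith)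
    simp only [zero_add, pow_one]
    refine (lintegral_mono_set (Metric.closedBall_subset_closedBall (by linarith))).trans (this.trans ?_)
    gcongr
  | succ l ih =>
    intro X
    set r := δ⁻¹ ^ (l + 1) with hr
    have hr0 : 0 < r := by positivity
    have hr1 : 1 ≤ r := one_le_pow₀ hδi
    have eR : δ⁻¹ ^ (l + 1 + 1) = r / δ := by rw [pow_succ, ← hr, div_eq_mul_inv]
    rw [eR]
    have hrR : r ≤ r / δ := by rw [le_div_iff₀ hδ]; nlinarith
    have mm := aa_measurable (f := f) (fun j => (hf j).integrable) δ⁻¹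
    have av := ball_average volume mm hrR X
    have hVr : (volume : Measure (VV d × ℝ)) (Metric.closedBall 0 r) = ENNReal.ofReal (r ^ (d + 1) * V1) := by
      rw [Measure.addHaar_closedBall _ _ hr0.le, finrank_X, ← ENNReal.ofReal_toReal hV1t, ← hV1,
        ← ENNReal.ofReal_mul (by positivity)]
    rw [hVr] at av
    have h1 := h f ξ r (r / δ) δ X hf hδ hδ1 hξ hT (by
      calc (1:ℝ) = δ⁻¹ * δ := (inv_mul_cancel₀ hδ.ne').symm
        _ ≤ r * δ := by gcongr; rw [hr]; exact le_self_pow₀ hδi (by omega)) hrR le_rfl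
    set P := r ^ (d + 1) * V1 with hP
    have hP0 : 0 < P := by positivity
    have h2 : ENNReal.ofReal P * ∫⁻ Y in Metric.closedBall X (r / δ), aa f δ⁻¹ Y ≤
        ENNReal.ofReal P * (ENNReal.ofReal (K ^ (l + 1 + 1) * δ⁻¹ ^ (d + 1)) * aa f (r / δ) X) := by
      calc _ ≤ _ := av
        _ ≤ ∫⁻ z in Metric.closedBall X (2 * (r / δ)), ENNReal.ofReal (K ^ (l + 1) * δ⁻¹ ^ (d + 1)) * aa f r z := by
            apply lintegral_mono; intro z; exact ih z
        _ = ENNReal.ofReal (K ^ (l + 1) * δ⁻¹ ^ (d + 1)) * ∫⁻ z in Metric.closedBall X (2 * (r / δ)), aa f r z := by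
            rw [lintegral_const_mul' _ _ ENNReal.ofReal_ne_top]
        _ ≤ ENNReal.ofReal (K ^ (l + 1) * δ⁻¹ ^ (d + 1)) * (ENNReal.ofReal (C * r ^ (d + 1)) * aa f (r / δ) X) := by gcongr
        _ = ENNReal.ofReal (K ^ (l + 1) * δ⁻¹ ^ (d + 1) * (C * r ^ (d + 1))) * aa f (r / δ) X := by
            rw [← mul_assoc, ← ENNReal.ofReal_mul (by positivity)]
        _ ≤ ENNReal.ofReal (P * (K ^ (l + 1 + 1) * δ⁻¹ ^ (d + 1))) * aa f (r / δ) X := by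
            refine mul_le_mul_left (ENNReal.ofReal_le_ofReal ?_) _
            calc _ = K ^ (l + 1) * δ⁻¹ ^ (d + 1) * P * (C / V1) := by rw [hP]; field_simp
              _ ≤ K ^ (l + 1) * δ⁻¹ ^ (d + 1) * P * K := by gcongr
              _ = _ := by ring
        _ = _ := by rw [ENNReal.ofReal_mul hP0.le, mul_assoc]
    exact (ENNReal.mul_le_mul_iff_right (by rw [Ne, ENNReal.ofReal_eq_zero, not_le]; exact hP0) ENNReal.ofReal_ne_top).1 h2

/-- local multilinear estimate with epsilon loss -/
lemma broad_local (d : ℕ) (hk : 2 ≤ k) {c B ε : ℝ} (hc : 0 < c) (hB : 0 ≤ B) (hε : 0 < ε) : ∃ δ C : ℝ, 0 < δ ∧ δ < 1 ∧ 1 ≤ C ∧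
    ∀ (f : Fin k → VV d → ℂ) (ξ : Fin k → VV d),
    (∀ j, Nice (f j) (ξ j) δ) → (∀ j, ‖ξ j‖ ≤ B) → Trans c ξ → ∀ (ρ : ℝ), δ⁻¹ ≤ ρ → ∃ R : ℝ, ρ ≤ R ∧ R ≤ C * ρ ∧ ∀ (X : VV d × ℝ),
    ∫⁻ Y in Metric.closedBall X ρ, aa f δ⁻¹ Y ≤
      ENNReal.ofReal (C * ρ ^ ε) * aa f R X := by
  obtain ⟨K, hK1, h⟩ := iterate_step (d := d) hk hc hB
  set M := max 2 (K ^ (1 / ε)) with hM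
  have hM2 : 2 ≤ M := le_max_left _ _
  have hM0 : 0 < M := by linarith
  have hKM : K ≤ M ^ ε := by
    calc K = (K ^ (1 / ε)) ^ ε := by rw [← Real.rpow_mul (by linarith)]; field_simp; simp
      _ ≤ _ := by gcongr; exact le_max_right _ _
  refine ⟨M⁻¹, max M (K ^ 2 * M ^ (d + 1)), by positivity, inv_lt_one_of_one_lt₀ (by linarith), le_max_of_le_left (by linarith), ?_⟩
  intro f ξ hf hξ hT ρ hρ
  have hfi := h f ξ M⁻¹ hf (by positivity) (inv_le_one_of_one_le₀ (by linarith)) hξ hT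
  rw [inv_inv] at hρ hfi
  simp only [inv_inv]
  have hρ0 : 0 < ρ := by linarith
  obtain ⟨l, hl1, hl2⟩ := exists_nat_pow_near (x := ρ / M) (y := M) (by rw [le_div_iff₀ hM0]; linarith) (by linarith)
  refine ⟨M ^ (l + 1 + 1), ?_, ?_, fun X => ?_⟩
  · rw [div_lt_iff₀ hM0] at hl2; rw [pow_succ]; exact hl2.le
  · rw [le_div_iff₀ hM0] at hl1
    calc M ^ (l + 1 + 1) = M * (M ^ l * M) := by ring
      _ ≤ M * ρ := by gcongr
      _ ≤ _ := by gcongr; exact le_max_left _ _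
  · refine (lintegral_mono_set (Metric.closedBall_subset_closedBall ?_)).trans ((hfi (l + 1) X).trans ?_)
    · rw [div_lt_iff₀ hM0] at hl2; rw [pow_succ]; exact hl2.le
    · refine mul_le_mul_left (ENNReal.ofReal_le_ofReal ?_) _
      have h1 : K ^ l ≤ ρ ^ ε := by
        calc K ^ l ≤ (M ^ ε) ^ l := by gcongr
          _ = (M ^ l) ^ ε := by rw [← Real.rpow_natCast, ← Real.rpow_natCast, ← Real.rpow_mul hM0.le, ← Real.rpow_mul hM0.le, mul_comm]
          _ ≤ ρ ^ ε := by
            gcongr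
            refine hl1.trans (div_le_self hρ0.le (by linarith))
      calc K ^ (l + 1 + 1) * M ^ (d + 1) = K ^ 2 * M ^ (d + 1) * K ^ l := by ring
        _ ≤ K ^ 2 * M ^ (d + 1) * ρ ^ ε := by gcongr
        _ ≤ _ := by gcongr; exact le_max_right _ _

end PExt

end

section
namespace PExt

section TT
variable {Y Ξ : Type*} [MeasurableSpace Y] [MeasurableSpace Ξ] {ν : Measure Y} [IsFiniteMeasure ν]
  {μ : Measure Ξ} [SFinite μ] {φ : Y → Ξ → ℝ} {f : Ξ → ℂ} {G : Ξ → ℝ} {M : ℝ}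

lemma enorm_integral_self {Z : Type*} [MeasurableSpace Z] {m : Measure Z} {F : Z → ℂ} {B : ℝ} {w : Z → ℝ}
    (hw : Integrable w m) (hw0 : ∀ z, 0 ≤ w z) (hF : Measurable F) (hB : ∀ z, ‖F z‖ ≤ B) :
    ‖∫ z, (w z : ℂ) * (F z * (starRingEnd ℂ) (F z)) ∂m‖ₑ = ∫⁻ z, ENNReal.ofReal (w z) * ‖F z‖ₑ ^ 2 ∂m := by
  have e : ∀ z, (w z : ℂ) * (F z * (starRingEnd ℂ) (F z)) = ((w z * ‖F z‖ ^ 2 : ℝ) : ℂ) := by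
    intro z; rw [Complex.mul_conj, Complex.normSq_eq_norm_sq]; push_cast; rfl
  simp_rw [e]
  rw [integral_complex_ofReal, ← ofReal_norm_eq_enorm, Complex.norm_real, Real.norm_eq_abs, abs_of_nonneg (integral_nonneg fun z => mul_nonneg (hw0 z) (by positivity)),
    ofReal_integral_eq_lintegral_ofReal]
  · apply lintegral_congr; intro z
    rw [ENNReal.ofReal_mul (hw0 z), ENNReal.ofReal_pow (norm_nonneg _), ofReal_norm_eq_enorm]
  · refine (hw.mul_const (B ^ 2)).mono' (hw.aestronglyMeasurable.mul (hF.norm.pow_const 2).aestronglyMeasurable) (Filter.Eventually.of_forall fun z => ?_)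
    rw [norm_mul, Real.norm_eq_abs, abs_of_nonneg (hw0 z)]
    have := hw0 z
    gcongr
    simp only [norm_pow, norm_norm]
    gcongr; exact hB z
  · exact Filter.Eventually.of_forall fun z => mul_nonneg (hw0 z) (by positivity)

/-- the TT* inequality -/
lemma TTstar (hφ : Measurable (fun q : Y × Ξ => φ q.1 q.2)) (hf : Measurable f) (hG : Integrable G μ)
    (hGm : Measurable G) (hG0 : ∀ ξ, 0 ≤ G ξ) (hM : 0 ≤ M) (hfG : ∀ ξ, ‖f ξ‖ ≤ M * G ξ) :
    (∫⁻ y, ‖∫ ξ, f ξ * ee (φ y ξ) ∂μ‖ₑ ^ 2 ∂ν) ^ 2 ≤ ENNReal.ofReal (M ^ 2 * ∫ ξ, G ξ ∂μ) *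
      ∫⁻ q : Y × Y, ‖∫ ξ, f ξ * ee (φ q.1 ξ) ∂μ‖ₑ * ‖∫ ξ, f ξ * ee (φ q.2 ξ) ∂μ‖ₑ *
        ‖∫ ξ, (G ξ : ℂ) * ee (φ q.2 ξ - φ q.1 ξ) ∂μ‖ₑ ∂(ν.prod ν) := by
  have hfi : Integrable f μ := (hG.const_mul M).mono' hf.aestronglyMeasurable (Filter.Eventually.of_forall hfG)
  set F : Y → ℂ := fun y => ∫ ξ, f ξ * ee (φ y ξ) ∂μ with hF
  set B := ∫ ξ, ‖f ξ‖ ∂μ with hB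
  have hB0 : 0 ≤ B := integral_nonneg fun _ => norm_nonneg _
  have mF : Measurable F := by
    refine (StronglyMeasurable.integral_prod_right' (f := fun q : Y × Ξ => f q.2 * ee (φ q.1 q.2)) ?_).measurable
    exact ((hf.comp measurable_snd).mul (measurable_ee.comp hφ)).stronglyMeasurable
  have bF : ∀ y, ‖F y‖ ≤ B := fun y => by
    refine (norm_integral_le_integral_norm _).trans (le_of_eq ?_); simp [hB]
  set H : Ξ → ℂ := fun ξ => ∫ y, F y * (starRingEnd ℂ) (ee (φ y ξ)) ∂ν with hH
  have mH : Measurable H := by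
    refine (StronglyMeasurable.integral_prod_left' (f := fun q : Y × Ξ => F q.1 * (starRingEnd ℂ) (ee (φ q.1 q.2))) ?_).measurable
    exact ((mF.comp measurable_fst).mul (Complex.continuous_conj.measurable.comp (measurable_ee.comp hφ))).stronglyMeasurable
  have bH : ∀ ξ, ‖H ξ‖ ≤ B * ν.real Set.univ := fun ξ => by
    refine norm_integral_le_of_norm_le_const (Filter.Eventually.of_forall fun y => ?_)
    simp [bF y]
  have s1 : ∫⁻ y, ‖F y‖ₑ ^ 2 ∂ν = ‖∫ ξ, (starRingEnd ℂ) (f ξ) * H ξ ∂μ‖ₑ := by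
    have := enorm_integral_self (m := ν) (w := fun _ => 1) (integrable_const _) (fun _ => zero_le_one) mF bF
    simp only [Complex.ofReal_one, one_mul, ENNReal.ofReal_one] at this
    rw [← this]
    congr 1
    have e1 : ∀ y, F y * (starRingEnd ℂ) (F y) = ∫ ξ, F y * ((starRingEnd ℂ) (f ξ) * (starRingEnd ℂ) (ee (φ y ξ))) ∂μ := by
      intro y
      rw [integral_const_mul]
      congr 1
      rw [hF]; dsimp only
      rw [← integral_conj]; simp
    simp_rw [e1]
    rw [integral_integral_swap]
    · congr 1; ext ξ
      rw [hH]; dsimp only; rw [← integral_const_mul]; congr 1; ext y; ring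
    · have i1 : Integrable (fun q : Y × Ξ => (B : ℝ) * ‖f q.2‖) (ν.prod μ) :=
        (integrable_const B).mul_prod hfi.norm
      refine i1.mono' ?_ (Filter.Eventually.of_forall fun q => ?_)
      · apply Measurable.aestronglyMeasurable
        exact (mF.comp measurable_fst).mul ((Complex.continuous_conj.measurable.comp (hf.comp measurable_snd)).mul
          (Complex.continuous_conj.measurable.comp (measurable_ee.comp hφ)))
      · simp only [Function.uncurry, norm_mul, RCLike.norm_conj, norm_ee, mul_one]
        gcongr; exact bF _
  have s2 : ‖∫ ξ, (starRingEnd ℂ) (f ξ) * H ξ ∂μ‖ₑ ^ 2 ≤ ENNReal.ofReal (M ^ 2 * ∫ ξ, G ξ ∂μ) * ∫⁻ ξ, ENNReal.ofReal (G ξ) * ‖H ξ‖ₑ ^ 2 ∂μ := by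
    refine (conv_sq_le (Complex.continuous_conj.measurable.comp hf).aemeasurable mH.aemeasurable).trans ?_
    have en : ∀ ξ, ‖(starRingEnd ℂ) (f ξ)‖ₑ ≤ ENNReal.ofReal M * ENNReal.ofReal (G ξ) := by
      intro ξ
      rw [← ENNReal.ofReal_mul hM, ← ofReal_norm_eq_enorm, RCLike.norm_conj]
      exact ENNReal.ofReal_le_ofReal (hfG ξ)
    calc _ ≤ (∫⁻ ξ, ENNReal.ofReal M * ENNReal.ofReal (G ξ) ∂μ) * ∫⁻ ξ, ENNReal.ofReal M * (ENNReal.ofReal (G ξ) * ‖H ξ‖ₑ ^ 2) ∂μ := by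
          refine mul_le_mul' (lintegral_mono fun ξ => en ξ) (lintegral_mono fun ξ => ?_)
          rw [← mul_assoc]; exact mul_le_mul_left (en ξ) _
      _ = _ := by
          rw [lintegral_const_mul' _ _ ENNReal.ofReal_ne_top, lintegral_const_mul' _ _ ENNReal.ofReal_ne_top,
            ENNReal.ofReal_mul (by positivity), ofReal_integral_eq_lintegral_ofReal hG (Filter.Eventually.of_forall hG0),
            ENNReal.ofReal_pow hM]
          ring
  have s3 : ∫⁻ ξ, ENNReal.ofReal (G ξ) * ‖H ξ‖ₑ ^ 2 ∂μ ≤ ∫⁻ q : Y × Y, ‖F q.1‖ₑ * ‖F q.2‖ₑ *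
        ‖∫ ξ, (G ξ : ℂ) * ee (φ q.2 ξ - φ q.1 ξ) ∂μ‖ₑ ∂(ν.prod ν) := by
    rw [← enorm_integral_self hG hG0 mH bH]
    have e2 : ∀ ξ, (G ξ : ℂ) * (H ξ * (starRingEnd ℂ) (H ξ)) = ∫ q : Y × Y, (F q.1 * (starRingEnd ℂ) (F q.2)) * ((G ξ : ℂ) * ee (φ q.2 ξ - φ q.1 ξ)) ∂(ν.prod ν) := by
      intro ξ
      have : (starRingEnd ℂ) (H ξ) = ∫ y, (starRingEnd ℂ) (F y) * ee (φ y ξ) ∂ν := by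
        rw [hH]; dsimp only; rw [← integral_conj]; simp
      rw [this, hH]; dsimp only
      rw [← integral_prod_mul, ← integral_const_mul]
      congr 1; ext q; rw [ee_sub]; ring
    simp_rw [e2]
    rw [integral_integral_swap]
    · refine (enorm_integral_le_lintegral_enorm _).trans (le_of_eq ?_)
      apply lintegral_congr; intro q
      rw [integral_const_mul, enorm_mul, enorm_mul]
      congr 2
      rw [← ofReal_norm_eq_enorm, RCLike.norm_conj, ofReal_norm_eq_enorm]
    · have i1 : Integrable (fun q : Ξ × (Y × Y) => G q.1 * (B * B)) (μ.prod (ν.prod ν)) :=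
        hG.mul_prod (integrable_const _)
      refine i1.mono' ?_ (Filter.Eventually.of_forall fun q => ?_)
      · apply Measurable.aestronglyMeasurable
        apply Measurable.mul
        · exact (mF.comp (measurable_fst.comp measurable_snd)).mul (Complex.continuous_conj.measurable.comp (mF.comp (measurable_snd.comp measurable_snd)))
        · apply Measurable.mul
          · exact Complex.measurable_ofReal.comp (hGm.comp measurable_fst)
          · apply measurable_ee.comp
            apply Measurable.sub
            · exact hφ.comp (Measurable.prodMk (measurable_snd.comp measurable_snd) measurable_fst)
            · exact hφ.comp (Measurable.prodMk (measurable_fst.comp measurable_snd) measurable_fst)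
      · simp only [Function.uncurry, norm_mul, RCLike.norm_conj, norm_ee, mul_one, Complex.norm_real, Real.norm_eq_abs, abs_of_nonneg (hG0 _)]
        rw [mul_comm]
        have := hG0 q.1
        gcongr <;> exact bF _
  rw [s1]
  exact s2.trans (by gcongr)
end TT

section K
variable {d : ℕ}

/-- the Gaussian kernel -/
lemma gauss_kernel (z : VV d) (t : ℝ) :
    ‖∫ ξ : VV d, ((Real.exp (-π * ‖ξ‖ ^ 2) : ℝ) : ℂ) * ee (⟪z, ξ⟫ + t * ‖ξ‖ ^ 2)‖ =
      (1 + 4 * t ^ 2) ^ (-(d:ℝ) / 4) * Real.exp (-π * ‖z‖ ^ 2 / (1 + 4 * t ^ 2)) := by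
  have e : ∀ ξ : VV d, ((Real.exp (-π * ‖ξ‖ ^ 2) : ℝ) : ℂ) * ee (⟪z, ξ⟫ + t * ‖ξ‖ ^ 2) =
     cexp (-(π * (1 - 2 * t * Complex.I)) * ‖ξ‖ ^ 2 + (2 * π * Complex.I) * ⟪z, ξ⟫) := by
    intro ξ
    rw [ee_eq, Complex.ofReal_exp, ← Complex.exp_add]
    congr 1; push_cast; ring
  simp_rw [e]
  have hb : 0 < ((π : ℂ) * (1 - 2 * t * Complex.I)).re := by simp [pi_pos]
  rw [GaussianFourier.integral_cexp_neg_mul_sq_norm_add hb]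
  have hw : (1 - 2 * t * Complex.I : ℂ) ≠ 0 := by
    intro h; have := congrArg Complex.re h; simp at this
  have hns : ‖(1 - 2 * t * Complex.I : ℂ)‖ ^ 2 = 1 + 4 * t ^ 2 := by
    rw [← Complex.normSq_eq_norm_sq, Complex.normSq_apply]; simp; ring
  have hs : 0 < 1 + 4 * t ^ 2 := by positivity
  have e1 : (π : ℂ) / (π * (1 - 2 * t * Complex.I)) = (1 - 2 * t * Complex.I)⁻¹ := by
    have : (π : ℂ) ≠ 0 := by exact_mod_cast pi_ne_zero
    field_simp
  have hpos : 0 < (1 - 2 * t * Complex.I : ℂ).re := by simp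
  rw [norm_mul, e1]
  congr 1
  · rw [finrank_VV]
    have : ((d : ℂ) / 2) = ((d / 2 : ℝ) : ℂ) := by push_cast; rfl
    rw [this, Complex.norm_cpow_real]
    rw [norm_inv]
    have : ‖(1 - 2 * t * Complex.I : ℂ)‖ = (1 + 4 * t ^ 2) ^ ((1:ℝ) / 2) := by
      rw [← hns, ← Real.sqrt_eq_rpow, Real.sqrt_sq (norm_nonneg _)]
    rw [this, ← Real.rpow_neg hs.le, ← Real.rpow_mul hs.le]
    congr 1; ring
  · rw [Complex.norm_exp]
    congr 1
    have : (2 * π * Complex.I) ^ 2 * (‖z‖:ℂ) ^ 2 / (4 * (π * (1 - 2 * t * Complex.I))) =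
        ((-π * ‖z‖ ^ 2 : ℝ) : ℂ) * (1 - 2 * t * Complex.I)⁻¹ := by
      have : (π : ℂ) ≠ 0 := by exact_mod_cast pi_ne_zero
      have hI : Complex.I ^ 2 = -1 := Complex.I_sq
      field_simp
      push_cast
      rw [hI]
      ring
    rw [this, Complex.re_ofReal_mul, Complex.inv_re, Complex.normSq_eq_norm_sq, hns]
    simp
    ring

lemma gauss_kernel_zero (z : VV d) :
    ‖∫ ξ : VV d, ((Real.exp (-π * ‖ξ‖ ^ 2) : ℝ) : ℂ) * ee (⟪z, ξ⟫ + 0 * ‖ξ‖ ^ 2)‖ = Real.exp (-π * ‖z‖ ^ 2) := by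
  rw [gauss_kernel]; simp

lemma gauss_kernel_decay (hd : 1 ≤ d) (z : VV d) (t : ℝ) :
    ‖∫ ξ : VV d, ((Real.exp (-π * ‖ξ‖ ^ 2) : ℝ) : ℂ) * ee (⟪z, ξ⟫ + t * ‖ξ‖ ^ 2)‖ ≤ (1 + ‖(z, t)‖ ^ 2) ^ (-(1:ℝ) / 4) := by
  rw [gauss_kernel]
  set s := 1 + 4 * t ^ 2 with hs
  have hs1 : 1 ≤ s := by rw [hs]; nlinarith [sq_nonneg t]
  have hs0 : 0 < s := by linarith
  have h1 : s ^ (-(d:ℝ) / 4) ≤ s ^ (-(1:ℝ) / 4) := by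
    apply Real.rpow_le_rpow_of_exponent_le hs1
    have : (1:ℝ) ≤ d := by exact_mod_cast hd
    linarith
  have h2 : Real.exp (-π * ‖z‖ ^ 2 / s) ≤ (1 + 4 * π * ‖z‖ ^ 2 / s) ^ (-(1:ℝ) / 4) := by
    have h3 : 1 + 4 * π * ‖z‖ ^ 2 / s ≤ Real.exp (4 * π * ‖z‖ ^ 2 / s) := by
      have := Real.add_one_le_exp (4 * π * ‖z‖ ^ 2 / s); linarith
    calc Real.exp (-π * ‖z‖ ^ 2 / s) = (Real.exp (4 * π * ‖z‖ ^ 2 / s)) ^ (-(1:ℝ) / 4) := by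
          rw [← Real.exp_mul]; congr 1; ring
      _ ≤ _ := by
          apply Real.rpow_le_rpow_of_nonpos (by positivity) h3 (by norm_num)
  calc _ ≤ s ^ (-(1:ℝ) / 4) * (1 + 4 * π * ‖z‖ ^ 2 / s) ^ (-(1:ℝ) / 4) := by gcongr
    _ = (s + 4 * π * ‖z‖ ^ 2) ^ (-(1:ℝ) / 4) := by
        rw [← Real.mul_rpow hs0.le (by positivity)]; congr 1; field_simp
    _ ≤ _ := by
        apply Real.rpow_le_rpow_of_nonpos (by positivity) _ (by norm_num)
        rw [Prod.norm_def]
        have hpi := Real.pi_gt_three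
        rcases max_cases ‖z‖ ‖t‖ with ⟨h, -⟩ | ⟨h, -⟩ <;> simp only [h]
        · have := sq_nonneg t; have := sq_nonneg ‖z‖; nlinarith
        · rw [Real.norm_eq_abs, sq_abs]
          have := sq_nonneg t; have := sq_nonneg ‖z‖; nlinarith
end K

end PExt

end

section
namespace PExt

lemma cs_lint {α : Type*} [MeasurableSpace α] {μ : Measure α} {f g : α → ℝ≥0∞} (hf : AEMeasurable f μ) (hg : AEMeasurable g μ) :
    (∫⁻ a, f a * g a ∂μ) ^ 2 ≤ (∫⁻ a, f a ^ 2 ∂μ) * ∫⁻ a, g a ^ 2 ∂μ := by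
  have h := ENNReal.lintegral_mul_le_Lp_mul_Lq μ Real.HolderConjugate.two_two hf hg
  have e : ∀ x : ℝ≥0∞, (x ^ ((1:ℝ) / 2)) ^ 2 = x := fun x => by
    rw [← ENNReal.rpow_natCast, ← ENNReal.rpow_mul]; norm_num
  calc _ ≤ _ := pow_le_pow_left' h 2
    _ = _ := by
      rw [mul_pow, e, e]
      simp only [ENNReal.rpow_ofNat]

lemma mul_le_sq_add (a b : ℝ≥0∞) : a * b ≤ a ^ 2 + b ^ 2 := by
  rcases le_total a b with h | h
  · calc a * b ≤ b * b := by gcongr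
      _ ≤ _ := by rw [← sq]; exact le_add_self
  · calc a * b ≤ a * a := by gcongr
      _ ≤ _ := by rw [← sq]; exact le_self_add

/-- off-diagonal kernel bound -/
lemma kernel_off {d : ℕ} (hd : 1 ≤ d) {R ρ : ℝ} (hR : 1 ≤ R) (hρ : 0 < ρ) (x x' y y' : VV d) (t t' : ℝ)
    (h : ρ ≤ ‖(x - x', t - t')‖) :
    ‖∫ ξ : VV d, ((Real.exp (-π * ‖ξ‖ ^ 2) : ℝ) : ℂ) * ee (⟪y - y', ξ⟫ + (t - t') * ‖ξ‖ ^ 2)‖ ≤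
      2 * √(R / ρ) * (√(1 + ‖y - x‖ ^ 2 / R ^ 2) * √(1 + ‖y' - x'‖ ^ 2 / R ^ 2)) := by
  refine (gauss_kernel_decay hd _ _).trans ?_
  have hR0 : 0 < R := by linarith
  set a := ‖y - x‖ / R with ha
  set b := ‖y' - x'‖ / R with hb
  set Q := ‖(y - y', t - t')‖ with hQ
  have ha0 : 0 ≤ a := by positivity
  have hb0 : 0 ≤ b := by positivity
  have hQ0 : 0 ≤ Q := norm_nonneg _
  rw [← div_pow, ← div_pow, ← ha, ← hb]
  have h1 : ρ ≤ Q + R * a + R * b := by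
    have e : (x - x', t - t') = (y - y', t - t') - (y - x, (0:ℝ)) + (y' - x', (0:ℝ)) := by
      ext <;> simp
    rw [e] at h
    have h2 := (norm_add_le ((y - y', t - t') - (y - x, (0:ℝ))) (y' - x', (0:ℝ)))
    have h3 := norm_sub_le (y - y', t - t') (y - x, (0:ℝ))
    have h4 : ‖(y - x, (0:ℝ))‖ = R * a := by rw [Prod.norm_def, ha]; simp; field_simp
    have h5 : ‖(y' - x', (0:ℝ))‖ = R * b := by rw [Prod.norm_def, hb]; simp; field_simp
    linarith
  have h6 : ρ / R ≤ (1 + a ^ 2) * (1 + b ^ 2) * (Q + 2) := by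
    rw [div_le_iff₀ hR0]
    have g1 : a ≤ (1 + a ^ 2) * (1 + b ^ 2) := by nlinarith [sq_nonneg (a - 1), sq_nonneg a, sq_nonneg b, mul_nonneg (sq_nonneg a) (sq_nonneg b)]
    have g2 : b ≤ (1 + a ^ 2) * (1 + b ^ 2) := by nlinarith [sq_nonneg (b - 1), sq_nonneg a, sq_nonneg b, mul_nonneg (sq_nonneg a) (sq_nonneg b)]
    have g3 : 1 ≤ (1 + a ^ 2) * (1 + b ^ 2) := by nlinarith [sq_nonneg a, sq_nonneg b, mul_nonneg (sq_nonneg a) (sq_nonneg b)]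
    set P := (1 + a ^ 2) * (1 + b ^ 2)
    have g4 : Q ≤ R * (P * Q) := by
      have : 1 * Q ≤ (R * P) * Q := by
        apply mul_le_mul_of_nonneg_right _ hQ0
        nlinarith
      linarith
    have g5 := mul_le_mul_of_nonneg_left g1 hR0.le
    have g6 := mul_le_mul_of_nonneg_left g2 hR0.le
    nlinarith
  rw [← Real.sqrt_mul (by positivity)]
  set P := (1 + a ^ 2) * (1 + b ^ 2) with hP
  have hP0 : 0 < P := by positivity
  have h7 : (1 + Q ^ 2) ^ (-(1:ℝ) / 4) = √(√((1 + Q ^ 2)⁻¹)) := by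
    rw [Real.sqrt_eq_rpow, Real.sqrt_eq_rpow, ← Real.rpow_mul (by positivity), Real.inv_rpow (by positivity), ← Real.rpow_neg (by positivity)]
    norm_num
  have h8 : 2 * √(R / ρ) * √P = √(4 * (R / ρ) * P) := by
    have q : 0 ≤ R / ρ := by positivity
    rw [show 4 * (R / ρ) * P = 2 ^ 2 * ((R / ρ) * P) by ring, Real.sqrt_mul (show (0:ℝ) ≤ 2 ^ 2 by norm_num), Real.sqrt_sq (by norm_num : (0:ℝ) ≤ 2), Real.sqrt_mul q]; ring
  rw [h7, h8]
  apply Real.sqrt_le_sqrt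
  apply Real.sqrt_le_iff.mpr
  refine ⟨by positivity, ?_⟩
  have h9 : 1 ≤ (R / ρ) * P * (Q + 2) := by
    have := mul_le_mul_of_nonneg_left h6 (show 0 ≤ R / ρ by positivity)
    have e : R / ρ * (ρ / R) = 1 := by field_simp
    linarith
  have h10 : (Q + 2) ^ 2 ≤ 16 * (1 + Q ^ 2) := by nlinarith [sq_nonneg (Q - 1)]
  rw [inv_le_iff_one_le_mul₀ (by positivity)]
  calc (1:ℝ) = 1 ^ 2 := by norm_num
    _ ≤ ((R / ρ) * P * (Q + 2)) ^ 2 := by gcongr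
    _ = ((R / ρ) * P) ^ 2 * (Q + 2) ^ 2 := by ring
    _ ≤ ((R / ρ) * P) ^ 2 * (16 * (1 + Q ^ 2)) := by gcongr
    _ = _ := by ring

section sparse
variable {d : ℕ} {ι : Type*} [Fintype ι]

/-- the measure carried by weighted slices -/
noncomputable def slm (x : ι → VV d) (t : ι → ℝ) (R : ℝ) : Measure (VV d × ℝ) :=
  ∑ i, ((volume : Measure (VV d)).withDensity (fun y => ENNReal.ofReal (jw (d + 1) R (y - x i)))).map (fun y => (y, t i))

lemma measurable_jw_sub (N : ℕ) (R : ℝ) (x : VV d) : Measurable (fun y => ENNReal.ofReal (jw N R (y - x))) := by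
  have : Continuous (fun y : VV d => jw N R (y - x)) := by fun_prop
  exact this.measurable.ennreal_ofReal

lemma lintegral_slm (x : ι → VV d) (t : ι → ℝ) (R : ℝ) {F : VV d × ℝ → ℝ≥0∞} (hF : Measurable F) :
    ∫⁻ q, F q ∂(slm x t R) = ∑ i, ∫⁻ y, ENNReal.ofReal (jw (d + 1) R (y - x i)) * F (y, t i) := by
  unfold slm
  rw [lintegral_finset_sum_measure]
  congr 1; ext i
  have m : Measurable (fun y : VV d => (y, t i)) := measurable_id.prodMk measurable_const
  rw [lintegral_map hF m, lintegral_withDensity_eq_lintegral_mul _ (measurable_jw_sub _ _ _) (g := fun a => F (a, t i)) (hF.comp m)]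
  rfl

lemma slm_finite (x : ι → VV d) (t : ι → ℝ) {R : ℝ} (hR : 0 < R) : IsFiniteMeasure (slm x t R) := by
  constructor
  have := lintegral_slm x t R (F := fun _ => 1) measurable_const
  rw [lintegral_one] at this
  rw [this]
  refine ENNReal.sum_lt_top.mpr fun i _ => ?_
  simp only [mul_one]
  rw [lintegral_jw volume _ hR]
  exact ENNReal.mul_lt_top ENNReal.ofReal_lt_top (lintegral_jw_lt_top _ (by rw [finrank_VV]; omega))

lemma gauss_lint (z : VV d) : ∫⁻ y : VV d, ENNReal.ofReal (Real.exp (-π * ‖z - y‖ ^ 2)) = 1 := by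
  rw [lintegral_sub_left_eq_self (fun y : VV d => ENNReal.ofReal (Real.exp (-π * ‖y‖ ^ 2))) z]
  have h := GaussianFourier.integrable_cexp_neg_mul_sq_norm_add (V := VV d) (b := π) (by simp [pi_pos]) 0 0
  have h2 := GaussianFourier.integral_rexp_neg_mul_sq_norm (V := VV d) pi_pos
  have hi : Integrable (fun y : VV d => Real.exp (-π * ‖y‖ ^ 2)) := by
    refine h.norm.congr (Filter.Eventually.of_forall fun y => ?_)
    simp only [Complex.norm_exp]
    congr 1
    simp [← Complex.ofReal_pow]
  rw [← ofReal_integral_eq_lintegral_ofReal hi (Filter.Eventually.of_forall fun y => (Real.exp_pos _).le), h2]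
  simp [pi_ne_zero]

set_option maxHeartbeats 1000000 in
/-- sparse energy lemma -/
lemma sparse (hd : 1 ≤ d) (B : ℝ) : ∃ C : ℝ, 0 < C ∧ ∀ {ι : Type} [Fintype ι] (x : ι → VV d) (t : ι → ℝ) (R ρ : ℝ) (f : VV d → ℂ),
    1 ≤ R → 0 < ρ → (∀ i j, i ≠ j → ρ ≤ ‖(x i - x j, t i - t j)‖) → (Fintype.card ι : ℝ) ^ 2 * R ^ (2 * d + 1) ≤ ρ →
    Measurable f → (∀ ξ, ‖f ξ‖ ≤ 1) → (∀ ξ, B < ‖ξ‖ → f ξ = 0) →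
    ∑ i, En f (x i) (t i) R ≤ ENNReal.ofReal C := by
  set c0 := ∫⁻ y : VV d, ENNReal.ofReal (jw d 1 y) with hc0
  have c0t : c0 ≠ ∞ := (lintegral_jw_lt_top _ (by rw [finrank_VV]; omega)).ne
  set G : VV d → ℝ := fun ξ => Real.exp (-π * ‖ξ‖ ^ 2) with hG
  set M := Real.exp (π * B ^ 2) with hM
  have hGi : Integrable G := by
    have h := GaussianFourier.integrable_cexp_neg_mul_sq_norm_add (V := VV d) (b := π) (by simp [pi_pos]) 0 0
    refine h.norm.congr (Filter.Eventually.of_forall fun y => ?_)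
    simp only [Complex.norm_exp, hG]
    congr 1
    simp [← Complex.ofReal_pow]
  have hG1 : ENNReal.ofReal (M ^ 2 * ∫ ξ, G ξ) ≠ ∞ := ENNReal.ofReal_ne_top
  set C1 := ENNReal.ofReal (M ^ 2 * ∫ ξ, G ξ) * (2 + 4 * c0) with hC1
  have C1t : C1 ≠ ∞ := ENNReal.mul_ne_top hG1 (ENNReal.add_ne_top.2 ⟨by norm_num, ENNReal.mul_ne_top (by norm_num) c0t⟩)
  refine ⟨C1.toReal + 1, by positivity, ?_⟩
  intro ι _ x t R ρ f hR hρ hsep hcard hfm hf1 hfB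
  have hR0 : 0 < R := by linarith
  have hfM : ∀ ξ, ‖f ξ‖ ≤ M * G ξ := by
    intro ξ
    by_cases h : B < ‖ξ‖
    · rw [hfB ξ h, norm_zero]; positivity
    · push Not at h
      refine (hf1 ξ).trans ?_
      rw [hM, hG]; dsimp only; rw [← Real.exp_add, Real.one_le_exp_iff]
      have : ‖ξ‖ ^ 2 ≤ B ^ 2 := by gcongr
      have := mul_le_mul_of_nonneg_left this pi_pos.le
      linarith
  have hM0 : 0 ≤ M := (Real.exp_pos _).le
  have hfi : Integrable f := (hGi.const_mul M).mono' hfm.aestronglyMeasurable (Filter.Eventually.of_forall hfM)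
  haveI := slm_finite x t hR0
  set ν := slm x t R with hν
  set Λ := ∑ i, En f (x i) (t i) R with hΛ
  have Λt : Λ ≠ ∞ := (ENNReal.sum_lt_top.mpr fun i _ => En_le_top hfi hR0 _ _).ne
  have hφ : Measurable (fun q : (VV d × ℝ) × VV d => ⟪q.1.1, q.2⟫ + q.1.2 * ‖q.2‖ ^ 2) := by
    have : Continuous (fun q : (VV d × ℝ) × VV d => ⟪q.1.1, q.2⟫ + q.1.2 * ‖q.2‖ ^ 2) := by fun_prop
    exact this.measurable
  have key := TTstar (ν := ν) (μ := (volume : Measure (VV d))) (φ := fun (y : VV d × ℝ) ξ => ⟪y.1, ξ⟫ + y.2 * ‖ξ‖ ^ 2) hφ hfm hGi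
    (by have : Continuous G := by { rw [hG]; fun_prop }
        exact this.measurable) (fun ξ => (Real.exp_pos _).le) hM0 hfM
  have eE : ∀ y : VV d × ℝ, (∫ ξ, f ξ * ee (⟪y.1, ξ⟫ + y.2 * ‖ξ‖ ^ 2)) = Ex f y.1 y.2 := by intro y; unfold Ex; rfl
  simp only [eE] at key
  have mE : Measurable (fun q : VV d × ℝ => Ex f q.1 q.2) := (Ex_continuous hfi).measurable
  have l1 : ∫⁻ y, ‖Ex f y.1 y.2‖ₑ ^ 2 ∂ν = Λ := by
    rw [hν, lintegral_slm x t R (mE.enorm.pow_const 2), hΛ]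
    congr 1; ext i; unfold En; congr 1; ext y; rw [mul_comm]
  rw [l1] at key
  set KK : (VV d × ℝ) → (VV d × ℝ) → ℝ≥0∞ := fun q q' =>
    ‖∫ ξ : VV d, (G ξ : ℂ) * ee (⟪q'.1, ξ⟫ + q'.2 * ‖ξ‖ ^ 2 - (⟪q.1, ξ⟫ + q.2 * ‖ξ‖ ^ 2))‖ₑ with hKK
  have mKK : Measurable (fun q : (VV d × ℝ) × (VV d × ℝ) => KK q.1 q.2) := by
    refine Measurable.enorm ?_
    refine (StronglyMeasurable.integral_prod_right' (f := fun q : ((VV d × ℝ) × (VV d × ℝ)) × VV d =>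
      (G q.2 : ℂ) * ee (⟪q.1.2.1, q.2⟫ + q.1.2.2 * ‖q.2‖ ^ 2 - (⟪q.1.1.1, q.2⟫ + q.1.1.2 * ‖q.2‖ ^ 2))) ?_).measurable
    apply Continuous.stronglyMeasurable
    apply Continuous.mul
    · rw [hG]; fun_prop
    · apply continuous_ee.comp; fun_prop
  have eK : ∀ q q', KK q q' = ‖∫ ξ : VV d, ((Real.exp (-π * ‖ξ‖ ^ 2) : ℝ) : ℂ) * ee (⟪q'.1 - q.1, ξ⟫ + (q'.2 - q.2) * ‖ξ‖ ^ 2)‖ₑ := by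
    intro q q'
    rw [hKK]; dsimp only; congr 2; ext ξ; congr 2; rw [inner_sub_left]; ring
  set w : ι → VV d → ℝ≥0∞ := fun i y => ENNReal.ofReal (jw (d + 1) R (y - x i)) with hw
  have mw : ∀ i, Measurable (w i) := fun i => measurable_jw_sub _ _ _
  set u : ι → VV d → ℝ≥0∞ := fun i y => ‖Ex f y (t i)‖ₑ with hu
  have mu : ∀ i, Measurable (u i) := fun i => (measurable_Ex hfi (t i)).enorm
  have l2 : ∫⁻ q : (VV d × ℝ) × (VV d × ℝ), ‖Ex f q.1.1 q.1.2‖ₑ * ‖Ex f q.2.1 q.2.2‖ₑ * KK q.1 q.2 ∂(ν.prod ν)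
      = ∑ i, ∑ j, ∫⁻ y, ∫⁻ z, w i y * u i y * (w j z * u j z) * KK (y, t i) (z, t j) := by
    have m0 : Measurable (fun q : (VV d × ℝ) × (VV d × ℝ) => ‖Ex f q.1.1 q.1.2‖ₑ * ‖Ex f q.2.1 q.2.2‖ₑ * KK q.1 q.2) :=
      ((mE.comp measurable_fst).enorm.mul (mE.comp measurable_snd).enorm).mul mKK
    rw [lintegral_prod _ m0.aemeasurable, hν, lintegral_slm x t R m0.lintegral_prod_right']
    congr 1; ext i
    rw [← lintegral_finset_sum']
    · congr 1; ext y
      rw [lintegral_slm x t R (F := fun y_1 => ‖Ex f y (t i)‖ₑ * ‖Ex f y_1.1 y_1.2‖ₑ * KK (y, t i) y_1) (m0.comp (measurable_prodMk_left (x := (y, t i)))), Finset.mul_sum]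
      congr 1; ext j
      rw [← lintegral_const_mul' _ _ ENNReal.ofReal_ne_top]
      congr 1; ext z
      simp only [hw, hu, Function.comp]; ring
    · intro j _
      apply Measurable.aemeasurable
      refine Measurable.lintegral_prod_right' (f := fun q : VV d × VV d => w i q.1 * u i q.1 * (w j q.2 * u j q.2) * KK (q.1, t i) (q.2, t j)) ?_
      refine Measurable.mul ?_ (mKK.comp ((measurable_fst.prodMk measurable_const).prodMk (measurable_snd.prodMk measurable_const)))
      exact (((mw i).comp measurable_fst).mul ((mu i).comp measurable_fst)).mul (((mw j).comp measurable_snd).mul ((mu j).comp measurable_snd))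
  have hEn : ∀ i, En f (x i) (t i) R = ∫⁻ y, w i y * u i y ^ 2 := by
    intro i; unfold En; congr 1; ext y; rw [mul_comm]
  have hw1 : ∀ i y, w i y ≤ 1 := fun i y => by
    simp only [hw]; rw [← ENNReal.ofReal_one]; exact ENNReal.ofReal_le_ofReal (jw_le_one _ _ _)
  -- diagonal
  have ldiag : ∀ i, ∫⁻ y, ∫⁻ z, w i y * u i y * (w i z * u i z) * KK (y, t i) (z, t i) ≤ 2 * En f (x i) (t i) R := by
    intro i
    have eKd : ∀ y z, KK (y, t i) (z, t i) = ENNReal.ofReal (Real.exp (-π * ‖z - y‖ ^ 2)) := by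
      intro y z; rw [eK, ← ofReal_norm_eq_enorm]; dsimp only; rw [sub_self, gauss_kernel_zero]
    set g : VV d → ℝ≥0∞ := fun y => (w i y * u i y) ^ 2 with hg
    have mg : Measurable g := ((mw i).mul (mu i)).pow_const 2
    have mG : Measurable (fun q : VV d × VV d => ENNReal.ofReal (Real.exp (-π * ‖q.2 - q.1‖ ^ 2))) := by
      have : Continuous (fun q : VV d × VV d => Real.exp (-π * ‖q.2 - q.1‖ ^ 2)) := by fun_prop
      exact this.measurable.ennreal_ofReal
    have mGl : ∀ y : VV d, Measurable (fun z : VV d => ENNReal.ofReal (Real.exp (-π * ‖z - y‖ ^ 2))) := by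
      intro y
      have : Continuous (fun z : VV d => Real.exp (-π * ‖z - y‖ ^ 2)) := by fun_prop
      exact this.measurable.ennreal_ofReal
    have mGr : ∀ y : VV d, Measurable (fun z : VV d => ENNReal.ofReal (Real.exp (-π * ‖y - z‖ ^ 2))) := by
      intro y
      have : Continuous (fun z : VV d => Real.exp (-π * ‖y - z‖ ^ 2)) := by fun_prop
      exact this.measurable.ennreal_ofReal
    have hgE : ∫⁻ y, g y ≤ En f (x i) (t i) R := by
      rw [hEn]; apply lintegral_mono; intro y
      simp only [hg, mul_pow, sq (w i y)]
      calc _ ≤ w i y * 1 * u i y ^ 2 := by gcongr; exact hw1 i y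
        _ = _ := by ring
    calc _ ≤ ∫⁻ y, ∫⁻ z, (g y * ENNReal.ofReal (Real.exp (-π * ‖z - y‖ ^ 2)) + g z * ENNReal.ofReal (Real.exp (-π * ‖z - y‖ ^ 2))) := by
          apply lintegral_mono; intro y; apply lintegral_mono; intro z
          dsimp only
          rw [eKd, ← add_mul]
          gcongr
          exact mul_le_sq_add _ _
      _ = (∫⁻ y, ∫⁻ z, g y * ENNReal.ofReal (Real.exp (-π * ‖z - y‖ ^ 2))) + ∫⁻ y, ∫⁻ z, g z * ENNReal.ofReal (Real.exp (-π * ‖z - y‖ ^ 2)) := by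
          rw [← lintegral_add_left]
          · congr 1; ext y; rw [lintegral_add_left]
            exact measurable_const.mul (mGl y)
          · exact ((mg.comp measurable_fst).mul mG).lintegral_prod_right'
      _ ≤ En f (x i) (t i) R + En f (x i) (t i) R := by
          gcongr
          · refine le_trans (le_of_eq ?_) hgE
            congr 1; ext y
            have := gauss_lint y
            simp_rw [norm_sub_rev y] at this
            rw [lintegral_const_mul (g y) (f := fun z => ENNReal.ofReal (Real.exp (-π * ‖z - y‖ ^ 2))) (mGl y), this, mul_one]
          · refine le_trans (le_of_eq ?_) hgE
            rw [lintegral_lintegral_swap ((mg.comp measurable_snd).mul mG).aemeasurable]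
            congr 1; ext z
            rw [lintegral_const_mul (g z) (f := fun y => ENNReal.ofReal (Real.exp (-π * ‖z - y‖ ^ 2))) (mGr z), gauss_lint z, mul_one]
      _ = _ := by rw [two_mul]
  -- off diagonal
  set A : ι → VV d → ℝ≥0∞ := fun i y => ENNReal.ofReal √(1 + ‖y - x i‖ ^ 2 / R ^ 2) with hA
  have mA : ∀ i, Measurable (A i) := by
    intro i
    have : Continuous (fun y : VV d => √(1 + ‖y - x i‖ ^ 2 / R ^ 2)) := by fun_prop
    exact this.measurable.ennreal_ofReal
  set s : ι → ℝ≥0∞ := fun i => ∫⁻ y, w i y * u i y * A i y with hs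
  have hs2 : ∀ i, s i ^ 2 ≤ En f (x i) (t i) R * (ENNReal.ofReal (R ^ d) * c0) := by
    intro i
    set v : VV d → ℝ≥0∞ := fun y => ENNReal.ofReal √(jw (d + 1) R (y - x i)) with hv
    have hvv : ∀ y, v y ^ 2 = w i y := by
      intro y; simp only [hv, hw]; rw [← ENNReal.ofReal_pow (Real.sqrt_nonneg _), Real.sq_sqrt (jw_pos _ _ _).le]
    have mv : Measurable v := by
      have : Continuous (fun y : VV d => √(jw (d + 1) R (y - x i))) := by fun_prop
      exact this.measurable.ennreal_ofReal
    have h := cs_lint (μ := (volume : Measure (VV d))) (f := fun y => v y * u i y) (g := fun y => v y * A i y) (mv.mul (mu i)).aemeasurable (mv.mul (mA i)).aemeasurable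
    calc s i ^ 2 = (∫⁻ y, v y * u i y * (v y * A i y)) ^ 2 := by
          rw [hs]; dsimp only; congr 2; ext y; rw [← hvv]; ring
      _ ≤ _ := h
      _ = _ := by
          rw [hEn]
          congr 1
          · congr 1; ext y; rw [mul_pow, hvv]
          · have e := lintegral_jw (volume : Measure (VV d)) d hR0 (x i)
            rw [finrank_VV] at e
            rw [hc0, ← e]
            congr 1; ext y
            rw [mul_pow, hvv]
            simp only [hw, hA]
            rw [← ENNReal.ofReal_pow (Real.sqrt_nonneg _), Real.sq_sqrt (by positivity), ← ENNReal.ofReal_mul (jw_pos _ _ _).le]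
            congr 1
            unfold jw
            rw [pow_succ]; field_simp
  have loff : ∀ i j, i ≠ j → ∫⁻ y, ∫⁻ z, w i y * u i y * (w j z * u j z) * KK (y, t i) (z, t j) ≤
      ENNReal.ofReal (2 * √(R / ρ)) * (s i * s j) := by
    intro i j hij
    calc _ ≤ ∫⁻ y, ∫⁻ z, ENNReal.ofReal (2 * √(R / ρ)) * ((w i y * u i y * A i y) * (w j z * u j z * A j z)) := by
          apply lintegral_mono; intro y; apply lintegral_mono; intro z
          dsimp only
          have hk := kernel_off hd hR hρ (x j) (x i) z y (t j) (t i) (hsep j i hij.symm)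
          have hk2 : KK (y, t i) (z, t j) ≤ ENNReal.ofReal (2 * √(R / ρ)) * (A j z * A i y) := by
            rw [eK, ← ofReal_norm_eq_enorm]; simp only [hA]
            rw [← ENNReal.ofReal_mul (Real.sqrt_nonneg _), ← ENNReal.ofReal_mul (by positivity)]
            exact ENNReal.ofReal_le_ofReal hk
          calc _ ≤ w i y * u i y * (w j z * u j z) * (ENNReal.ofReal (2 * √(R / ρ)) * (A j z * A i y)) := by gcongr
            _ = _ := by ring
      _ = _ := by
          have m1 : ∀ i, Measurable (fun y => w i y * u i y * A i y) := fun i => ((mw i).mul (mu i)).mul (mA i)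
          have : ∀ y, ∫⁻ z, ENNReal.ofReal (2 * √(R / ρ)) * ((w i y * u i y * A i y) * (w j z * u j z * A j z)) =
              ENNReal.ofReal (2 * √(R / ρ)) * ((w i y * u i y * A i y) * s j) := by
            intro y
            rw [lintegral_const_mul _ ((m1 j).const_mul _), lintegral_const_mul _ (m1 j)]
          simp_rw [this]
          rw [lintegral_const_mul _ ((m1 i).mul_const _), lintegral_mul_const _ (m1 i)]
  set N : ℝ := (Fintype.card ι : ℝ) with hN
  have hsum : ∑ i, ∑ j, s i * s j ≤ ENNReal.ofReal (2 * N) * (Λ * (ENNReal.ofReal (R ^ d) * c0)) := by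
    calc ∑ i, ∑ j, s i * s j ≤ ∑ i, ∑ j, (s i ^ 2 + s j ^ 2) := by gcongr; exact mul_le_sq_add _ _
      _ = ENNReal.ofReal (2 * N) * ∑ i, s i ^ 2 := by
          simp_rw [Finset.sum_add_distrib]
          simp only [Finset.sum_const, Finset.card_univ, nsmul_eq_mul]
          rw [← Finset.mul_sum, ENNReal.ofReal_mul (by norm_num), hN, ENNReal.ofReal_natCast]
          simp; ring
      _ ≤ _ := by
          gcongr
          rw [hΛ, Finset.sum_mul]
          gcongr with i; exact hs2 i
  have hconst : ENNReal.ofReal (2 * √(R / ρ)) * (ENNReal.ofReal (2 * N) * (Λ * (ENNReal.ofReal (R ^ d) * c0))) ≤ 4 * c0 * Λ := by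
    have h1 : √(R / ρ) * N * R ^ d ≤ 1 := by
      have : √(R / ρ) * N * R ^ d = √((R / ρ) * (N * R ^ d) ^ 2) := by
        rw [Real.sqrt_mul (by positivity), Real.sqrt_sq (by positivity)]; ring
      rw [this]
      apply Real.sqrt_le_iff.mpr ⟨zero_le_one, ?_⟩
      rw [one_pow, div_mul_eq_mul_div, div_le_one hρ]
      calc _ = N ^ 2 * R ^ (2 * d + 1) := by ring
        _ ≤ _ := hcard
    calc _ = ENNReal.ofReal (2 * √(R / ρ)) * ENNReal.ofReal (2 * N) * ENNReal.ofReal (R ^ d) * (c0 * Λ) := by ring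
      _ = ENNReal.ofReal (4 * (√(R / ρ) * N * R ^ d)) * (c0 * Λ) := by
          rw [← ENNReal.ofReal_mul (by positivity), ← ENNReal.ofReal_mul (by positivity)]; congr 2; ring
      _ ≤ ENNReal.ofReal (4 * 1) * (c0 * Λ) := by gcongr
      _ = _ := by norm_num; ring
  classical
  have ltot : ∑ i, ∑ j, ∫⁻ y, ∫⁻ z, w i y * u i y * (w j z * u j z) * KK (y, t i) (z, t j) ≤ (2 + 4 * c0) * Λ := by
    calc _ ≤ ∑ i, ∑ j, ((if i = j then 2 * En f (x i) (t i) R else 0) + ENNReal.ofReal (2 * √(R / ρ)) * (s i * s j)) := by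
          gcongr with i _ j _
          split_ifs with h
          · subst h; exact (ldiag i).trans le_self_add
          · rw [zero_add]; exact loff i j h
      _ = 2 * Λ + ENNReal.ofReal (2 * √(R / ρ)) * ∑ i, ∑ j, s i * s j := by
          simp_rw [Finset.sum_add_distrib]
          congr 1
          · simp [Finset.mul_sum, hΛ]
          · simp_rw [Finset.mul_sum]
      _ ≤ 2 * Λ + 4 * c0 * Λ := by
          refine add_le_add le_rfl (le_trans (mul_le_mul_right hsum _) hconst)
      _ = _ := by ring
  have fin : Λ ^ 2 ≤ C1 * Λ := by
    refine key.trans ?_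
    change _ * (∫⁻ q : (VV d × ℝ) × (VV d × ℝ), ‖Ex f q.1.1 q.1.2‖ₑ * ‖Ex f q.2.1 q.2.2‖ₑ * KK q.1 q.2 ∂(ν.prod ν)) ≤ _
    rw [l2, hC1, mul_assoc]
    gcongr
  have : Λ ≤ C1 := by
    by_cases h0 : Λ = 0
    · rw [h0]; exact zero_le
    · rw [sq] at fin
      exact (ENNReal.mul_le_mul_iff_left h0 Λt).1 fin
  refine this.trans ?_
  rw [← ENNReal.ofReal_toReal C1t]
  exact ENNReal.ofReal_le_ofReal (by simp)
end sparse

end PExt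

end

section
namespace PExt

lemma exists_net {α : Type*} [PseudoMetricSpace α] (E : Set α) (ρ : ℝ) (hρ : 0 < ρ) (M : ℕ)
    (h : ∀ G : Finset α, (∀ x ∈ G, x ∈ E) → (∀ x ∈ G, ∀ y ∈ G, x ≠ y → ρ ≤ dist x y) → G.card ≤ M) :
    ∃ G : Finset α, (∀ x ∈ G, x ∈ E) ∧ (∀ x ∈ G, ∀ y ∈ G, x ≠ y → ρ ≤ dist x y) ∧ ∀ y ∈ E, ∃ x ∈ G, dist y x < ρ := by
  classical
  by_contra hc
  push Not at hc
  have : ∀ n : ℕ, ∃ G : Finset α, (∀ x ∈ G, x ∈ E) ∧ (∀ x ∈ G, ∀ y ∈ G, x ≠ y → ρ ≤ dist x y) ∧ G.card = n := by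
    intro n
    induction n with
    | zero => exact ⟨∅, by simp, by simp, by simp⟩
    | succ n ih =>
      obtain ⟨G, h1, h2, h3⟩ := ih
      obtain ⟨y, hy, hy2⟩ := hc G h1 h2
      have hyG : y ∉ G := fun hm => by have := hy2 y hm; rw [dist_self] at this; linarith
      refine ⟨insert y G, ?_, ?_, by rw [Finset.card_insert_of_notMem hyG, h3]⟩
      · intro x hx; rcases Finset.mem_insert.1 hx with rfl | hx
        · exact hy
        · exact h1 x hx
      · intro a ha b hb hab
        rcases Finset.mem_insert.1 ha with rfl | ha' <;> rcases Finset.mem_insert.1 hb with rfl | hb'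
        · exact absurd rfl hab
        · exact hy2 b hb'
        · rw [dist_comm]; exact hy2 a ha'
        · exact h2 a ha' b hb' hab
  obtain ⟨G, h1, h2, h3⟩ := this (M + 1)
  have := h G h1 h2
  omega

def ex_seq (D : ℕ) : ℕ → ℕ
  | 0 => 1
  | i + 1 => 2 + D + D * ex_seq D i

lemma ex_seq_le (D : ℕ) (hD : 1 ≤ D) : Monotone (ex_seq D) := by
  apply monotone_nat_of_le_succ
  intro n
  simp only [ex_seq]
  nlinarith

open Classical in
lemma abstract_count (I D : ℕ) (hI : 1 ≤ I) (hD : 1 ≤ D) {α : Type*} [PseudoMetricSpace α] (G : Finset α) (hG : G.Nonempty) (Q H ε : ℝ) (hQ : 1 ≤ Q)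
    (hε : 0 ≤ ε) (hH : 0 ≤ H)
    (h : ∀ X ⊆ G, ∀ ρ ρ' : ℝ, Q ≤ ρ → 0 < ρ' → (∀ x ∈ X, ∀ y ∈ X, x ≠ y → ρ' ≤ dist x y) → (X.card : ℝ) ^ 2 * (Q * ρ) ^ D ≤ ρ' →
      ∑ x ∈ X, ((G.filter (fun y => dist y x ≤ ρ)).card : ℝ) ≤ H * ρ ^ ε) :
    (G.card : ℝ) ^ (1 - 1 / (I:ℝ)) ≤ I * H * (Q * G.card) ^ ((ex_seq D I : ℝ) * ε) := by
  set N : ℝ := (G.card : ℝ) with hN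
  have hN1 : 1 ≤ N := by rw [hN]; exact_mod_cast hG.card_pos
  have hQN : 1 ≤ Q * N := by nlinarith
  set ρ : ℕ → ℝ := fun i => (Q * N) ^ (ex_seq D i) with hρ
  have ρpos : ∀ i, 0 < ρ i := fun i => by positivity
  have ρQ : ∀ i, Q ≤ ρ i := by
    intro i
    calc Q ≤ (Q * N) ^ 1 := by rw [pow_one]; nlinarith
      _ ≤ ρ i := pow_le_pow_right₀ hQN (ex_seq_le D hD (Nat.zero_le i))
  have ρstep : ∀ i, N ^ 2 * (Q * ρ i) ^ D ≤ ρ (i + 1) := by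
    intro i
    have e : ρ (i + 1) = (Q * N) ^ 2 * ((Q * N) * ρ i) ^ D := by
      simp only [hρ, ex_seq]; ring
    rw [e]
    have := ρpos i
    gcongr
    · nlinarith
    · nlinarith
  set n : ℕ → α → ℝ := fun i x => ((G.filter (fun y => dist y x ≤ ρ i)).card : ℝ) with hn
  have n1 : ∀ i, ∀ x ∈ G, 1 ≤ n i x := by
    intro i x hx
    have : (G.filter (fun y => dist y x ≤ ρ i)).Nonempty := ⟨x, by simp [hx, (ρpos i).le]⟩
    simp only [hn]; exact_mod_cast this.card_pos
  have nN : ∀ i x, n i x ≤ N := by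
    intro i x; simp only [hn, hN]; exact_mod_cast Finset.card_filter_le _ _
  set q : ℝ := N ^ (1 / (I:ℝ)) with hq
  have hI0 : (0:ℝ) < I := by exact_mod_cast hI
  have q0 : 0 < q := by positivity
  have qI : q ^ I = N := by rw [hq, ← Real.rpow_natCast, ← Real.rpow_mul (by linarith)]; field_simp; simp
  have pig : ∀ x ∈ G, ∃ i ∈ Finset.range I, n (i + 1) x ≤ q * n i x := by
    intro x hx
    by_contra hc
    push Not at hc
    have : ∀ i, i ≤ I → q ^ i * n 0 x ≤ n i x ∧ (0 < i → q ^ i * n 0 x < n i x) := by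
      intro i
      induction i with
      | zero => intro _; simp
      | succ i ih =>
        intro hi
        have h1 := (ih (by omega)).1
        have h2 := hc i (Finset.mem_range.2 (by omega))
        have h3 : q ^ (i + 1) * n 0 x < n (i + 1) x := by
          calc _ = q * (q ^ i * n 0 x) := by ring
            _ ≤ q * n i x := by gcongr
            _ < _ := h2
        exact ⟨h3.le, fun _ => h3⟩
    have h4 := (this I le_rfl).2 hI
    rw [qI] at h4
    have := n1 0 x hx
    have := nN I x
    nlinarith
  -- choose the index
  have hsum : G.card ≤ ∑ i ∈ Finset.range I, (G.filter (fun x => n (i + 1) x ≤ q * n i x)).card := by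
    refine le_trans (Finset.card_le_card ?_) Finset.card_biUnion_le
    intro x hx
    obtain ⟨i, hi, h2⟩ := pig x hx
    exact Finset.mem_biUnion.2 ⟨i, hi, Finset.mem_filter.2 ⟨hx, h2⟩⟩
  obtain ⟨i, hi, hcard⟩ : ∃ i ∈ Finset.range I, N / I ≤ ((G.filter (fun x => n (i + 1) x ≤ q * n i x)).card : ℝ) := by
    by_contra hc
    push Not at hc
    have h1 : ∑ i ∈ Finset.range I, ((G.filter (fun x => n (i + 1) x ≤ q * n i x)).card : ℝ) < ∑ i ∈ Finset.range I, N / I :=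
      Finset.sum_lt_sum_of_nonempty ⟨0, Finset.mem_range.2 hI⟩ hc
    rw [Finset.sum_const, Finset.card_range, nsmul_eq_mul, mul_div_cancel₀ _ hI0.ne'] at h1
    have h2 : N ≤ ∑ i ∈ Finset.range I, ((G.filter (fun x => n (i + 1) x ≤ q * n i x)).card : ℝ) := by
      rw [hN]; exact_mod_cast hsum
    linarith
  set Gi := G.filter (fun x => n (i + 1) x ≤ q * n i x) with hGi
  obtain ⟨X, X1, X2, X3⟩ := exists_net (Gi : Set α) (ρ (i + 1)) (ρpos _) Gi.card
    (fun F hF _ => Finset.card_le_card fun x hx => Finset.mem_coe.1 (hF x hx))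
  have XG : X ⊆ G := fun x hx => Finset.mem_of_mem_filter x (Finset.mem_coe.1 (X1 x hx))
  have XN : (X.card : ℝ) ≤ N := by rw [hN]; exact_mod_cast Finset.card_le_card XG
  have h5 := h X XG (ρ i) (ρ (i + 1)) (ρQ i) (ρpos _) X2 (by
    refine le_trans ?_ (ρstep i)
    have := ρpos i
    gcongr)
  have h6 : (Gi.card : ℝ) ≤ ∑ x ∈ X, n (i + 1) x := by
    have : Gi.card ≤ ∑ x ∈ X, (G.filter (fun y => dist y x ≤ ρ (i + 1))).card := by
      refine le_trans (Finset.card_le_card ?_) Finset.card_biUnion_le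
      intro y hy
      obtain ⟨x, hx, hxy⟩ := X3 y (Finset.mem_coe.2 hy)
      exact Finset.mem_biUnion.2 ⟨x, hx, Finset.mem_filter.2 ⟨Finset.mem_of_mem_filter y hy, hxy.le⟩⟩
    simp only [hn]; exact_mod_cast this
  have h7 : ∑ x ∈ X, n (i + 1) x ≤ q * ∑ x ∈ X, n i x := by
    rw [Finset.mul_sum]
    exact Finset.sum_le_sum fun x hx => (Finset.mem_filter.1 (Finset.mem_coe.1 (X1 x hx))).2
  have h8 : N / I ≤ q * (H * ρ i ^ ε) := hcard.trans (h6.trans (h7.trans (mul_le_mul_of_nonneg_left h5 q0.le)))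
  have h9 : ρ i ^ ε ≤ (Q * N) ^ ((ex_seq D I : ℝ) * ε) := by
    rw [Real.rpow_mul (by linarith), Real.rpow_natCast]
    apply Real.rpow_le_rpow (ρpos i).le _ hε
    exact pow_le_pow_right₀ hQN (ex_seq_le D hD (Finset.mem_range.1 hi).le)
  rw [Real.rpow_sub (by linarith), Real.rpow_one, div_le_iff₀ q0]
  have h10 : N ≤ I * (q * (H * ρ i ^ ε)) := by rw [div_le_iff₀ hI0] at h8; linarith
  calc N ≤ I * (q * (H * ρ i ^ ε)) := h10
    _ ≤ I * (q * (H * (Q * N) ^ ((ex_seq D I : ℝ) * ε))) := by gcongr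
    _ = _ := by ring

variable {d k : ℕ}

lemma aa_near (hk : 2 ≤ k) {A B : ℝ} (hA : 0 ≤ A) (hB : 0 ≤ B) : ∃ D : ℝ, 1 ≤ D ∧ ∀ (f : Fin k → VV d → ℂ) (ξ : Fin k → VV d) (r δ : ℝ) (X Y : VV d × ℝ),
    (∀ j, Nice (f j) (ξ j) δ) → 0 < δ → δ ≤ 1 → (∀ j, ‖ξ j‖ ≤ B) → 1 ≤ r * δ → ‖Y‖ ≤ A * r →
      aa f r X ≤ ENNReal.ofReal D * aa f r (X + Y) := by
  obtain ⟨D, hD, h⟩ := En_near d hA hB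
  have hk1 : (0:ℝ) ≤ 1 / ((k:ℝ) - 1) := by
    have : (2:ℝ) ≤ k := by exact_mod_cast hk
    apply div_nonneg zero_le_one; linarith
  refine ⟨max 1 ((D ^ ((1:ℝ) / (k - 1))) ^ k), le_max_left _ _, ?_⟩
  intro f ξ r δ X Y hf hδ hδ1 hξ hr hY
  unfold aa
  calc _ ≤ ∏ j, (ENNReal.ofReal D * En (f j) (X + Y).1 (X + Y).2 r) ^ ((1:ℝ) / (k - 1)) := by
        gcongr with j
        exact h _ _ _ _ _ _ (hf j) hδ hδ1 (hξ j) hr hY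
    _ = ENNReal.ofReal ((D ^ ((1:ℝ) / (k - 1))) ^ k) * ∏ j, En (f j) (X + Y).1 (X + Y).2 r ^ ((1:ℝ) / (k - 1)) := by
        simp_rw [ENNReal.mul_rpow_of_nonneg _ _ hk1]
        rw [Finset.prod_mul_distrib, Finset.prod_const, Finset.card_univ, Fintype.card_fin, ENNReal.ofReal_rpow_of_pos hD, ENNReal.ofReal_pow (by positivity)]
    _ ≤ _ := by gcongr; exact le_max_right _ _

/-- products of bounded energies are dominated by the sum -/
lemma prod_le_sum_bdd (hk : 2 ≤ k) {C : ℝ≥0∞} (e : Fin k → ℝ≥0∞) (he : ∀ j, e j ≤ C) (hC : 1 ≤ C) :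
    ∏ j, e j ^ ((1:ℝ) / (k - 1)) ≤ C * ∑ j, e j := by
  have hk2 : (2:ℝ) ≤ k := by exact_mod_cast hk
  have hk1 : (0:ℝ) ≤ 1 / ((k:ℝ) - 1) := by
    apply div_nonneg zero_le_one; linarith
  haveI : NeZero k := ⟨by omega⟩
  obtain ⟨i, -, hi⟩ := Finset.exists_max_image (Finset.univ : Finset (Fin k)) e ⟨0, Finset.mem_univ _⟩
  calc ∏ j, e j ^ ((1:ℝ) / (k - 1)) ≤ ∏ j : Fin k, e i ^ ((1:ℝ) / (k - 1)) := by
        gcongr with j; exact hi j (Finset.mem_univ _)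
    _ = e i ^ (1 + (1:ℝ) / (k - 1)) := by
        rw [Finset.prod_const, Finset.card_univ, Fintype.card_fin, ← ENNReal.rpow_natCast, ← ENNReal.rpow_mul]
        congr 1
        have : (k:ℝ) - 1 ≠ 0 := by intro h; linarith
        field_simp; ring
    _ = e i ^ ((1:ℝ) / (k - 1)) * e i := by
        rw [add_comm, ENNReal.rpow_add_of_nonneg _ _ hk1 zero_le_one, ENNReal.rpow_one]
    _ ≤ C ^ ((1:ℝ) / (k - 1)) * e i := by gcongr; exact he i
    _ ≤ C ^ (1:ℝ) * e i := by
        gcongr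
        rw [div_le_one (by linarith)]; linarith
    _ ≤ _ := by
        rw [ENNReal.rpow_one]; gcongr
        exact Finset.single_le_sum (f := e) (fun _ _ => zero_le) (Finset.mem_univ i)

/-- sparse sums of product energies -/
lemma sparse_aa (hd : 1 ≤ d) (hk : 2 ≤ k) (B : ℝ) : ∃ C : ℝ, 1 ≤ C ∧ ∀ (X : Finset (VV d × ℝ)) (R ρ : ℝ) (f : Fin k → VV d → ℂ),
    1 ≤ R → 0 < ρ → (∀ x ∈ X, ∀ y ∈ X, x ≠ y → ρ ≤ dist x y) → (X.card : ℝ) ^ 2 * R ^ (2 * d + 1) ≤ ρ →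
    (∀ j, Measurable (f j)) → (∀ j ξ, ‖f j ξ‖ ≤ 1) → (∀ j ξ, B < ‖ξ‖ → f j ξ = 0) →
    ∑ x ∈ X, aa f R x ≤ ENNReal.ofReal C := by
  obtain ⟨C, hC, h⟩ := sparse hd B
  set C1 := max C 1 with hC1
  refine ⟨max 1 (C1 * (k * C1)), le_max_left _ _, ?_⟩
  intro X R ρ f hR hρ hsep hcard hfm hf1 hfB
  obtain ⟨m, ⟨e⟩⟩ : ∃ m : ℕ, Nonempty (X ≃ Fin m) := ⟨_, ⟨X.equivFin⟩⟩
  have hc : m = X.card := by simpa using (Fintype.card_congr e).symm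
  have hs : ∀ j, ∑ x ∈ X, En (f j) x.1 x.2 R ≤ ENNReal.ofReal C1 := by
    intro j
    have := h (fun i : Fin m => (e.symm i).1.1) (fun i => (e.symm i).1.2) R ρ (f j) hR hρ ?_ ?_ (hfm j) (hf1 j) (hfB j)
    · rw [← Finset.sum_coe_sort, ← e.symm.sum_comp]
      exact this.trans (ENNReal.ofReal_le_ofReal (le_max_left _ _))
    · intro i i' hii
      have := hsep _ (e.symm i).2 _ (e.symm i').2 (fun hh => hii (e.symm.injective (Subtype.ext hh)))
      rw [dist_eq_norm] at this
      exact this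
    · rw [Fintype.card_fin, hc]; exact hcard
  have hle : ∀ x ∈ X, aa f R x ≤ ENNReal.ofReal C1 * ∑ j, En (f j) x.1 x.2 R := by
    intro x hx
    unfold aa
    refine prod_le_sum_bdd hk _ (fun j => ?_) ?_
    · exact (Finset.single_le_sum (f := fun x : VV d × ℝ => En (f j) x.1 x.2 R) (fun _ _ => zero_le) hx).trans (hs j)
    · rw [← ENNReal.ofReal_one]; exact ENNReal.ofReal_le_ofReal (le_max_right _ _)
  calc _ ≤ ∑ x ∈ X, ENNReal.ofReal C1 * ∑ j, En (f j) x.1 x.2 R := Finset.sum_le_sum hle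
    _ = ENNReal.ofReal C1 * ∑ j, ∑ x ∈ X, En (f j) x.1 x.2 R := by rw [← Finset.mul_sum, Finset.sum_comm]
    _ ≤ ENNReal.ofReal C1 * ∑ j : Fin k, ENNReal.ofReal C1 := by gcongr with j; exact hs j
    _ = ENNReal.ofReal (C1 * (k * C1)) := by
        rw [Finset.sum_const, Finset.card_univ, Fintype.card_fin, nsmul_eq_mul, ENNReal.ofReal_mul (by positivity), ENNReal.ofReal_mul (by positivity), ENNReal.ofReal_natCast]
    _ ≤ _ := by gcongr; exact le_max_right _ _

end PExt

end

section
namespace PExt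
variable {d k : ℕ}

lemma weak_to_strong {α : Type*} [MeasurableSpace α] (μ : Measure α) {s q K A : ℝ} (hq : 0 < q) (hqs : q < s) (hK : 0 ≤ K) (hA : 0 ≤ A) :
    ∃ C : ℝ, ∀ a : α → ℝ≥0∞, Measurable a → (∀ x, a x ≤ ENNReal.ofReal A) →
      (∀ t : ℝ, 0 < t → μ {x | ENNReal.ofReal t ≤ a x} ≤ ENNReal.ofReal (K * t ^ (-q))) →
      ∫⁻ x, a x ^ s ∂μ ≤ ENNReal.ofReal C := by
  have hi : IntegrableOn (fun t : ℝ => K * t ^ (s - 1 - q)) (Set.Ioc 0 A) :=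
    ((intervalIntegral.intervalIntegrable_rpow' (a := 0) (b := A) (r := s - 1 - q) (by linarith)).1).const_mul K
  have hfin : ∫⁻ t in Set.Ioc 0 A, ENNReal.ofReal (K * t ^ (s - 1 - q)) ≠ ∞ := hi.lintegral_lt_top.ne
  refine ⟨(ENNReal.ofReal s * ∫⁻ t in Set.Ioc 0 A, ENNReal.ofReal (K * t ^ (s - 1 - q))).toReal, ?_⟩
  intro a ha haA hw
  rw [ENNReal.ofReal_toReal (ENNReal.mul_ne_top ENNReal.ofReal_ne_top hfin)]
  have at' : ∀ x, a x ≠ ∞ := fun x => ((haA x).trans_lt ENNReal.ofReal_lt_top).ne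
  have e : ∀ x, a x ^ s = ENNReal.ofReal ((a x).toReal ^ s) := by
    intro x
    rw [← ENNReal.ofReal_rpow_of_nonneg ENNReal.toReal_nonneg (by linarith), ENNReal.ofReal_toReal (at' x)]
  simp_rw [e]
  rw [lintegral_rpow_eq_lintegral_meas_le_mul μ (Filter.Eventually.of_forall fun x => ENNReal.toReal_nonneg) ha.ennreal_toReal.aemeasurable (by linarith)]
  refine mul_le_mul_right ?_ _
  rw [← lintegral_indicator measurableSet_Ioc, ← lintegral_indicator measurableSet_Ioi]
  apply lintegral_mono
  intro t
  by_cases ht : 0 < t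
  swap
  · rw [Set.indicator_of_notMem (by simpa using ht)]; exact zero_le
  rw [Set.indicator_of_mem (by simpa using ht)]
  have e2 : {x | t ≤ (a x).toReal} = {x | ENNReal.ofReal t ≤ a x} := by
    ext x; exact (ENNReal.ofReal_le_iff_le_toReal (at' x)).symm
  by_cases htA : t ≤ A
  · rw [Set.indicator_of_mem (show t ∈ Set.Ioc 0 A from ⟨ht, htA⟩), e2]
    calc _ ≤ ENNReal.ofReal (K * t ^ (-q)) * ENNReal.ofReal (t ^ (s - 1)) := by gcongr; exact hw t ht
      _ = _ := by
        rw [← ENNReal.ofReal_mul (by positivity), mul_assoc, ← Real.rpow_add ht]; congr 3; ring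
  · have : {x | t ≤ (a x).toReal} = ∅ := by
      ext x; simp only [Set.mem_setOf_eq, Set.mem_empty_iff_false, iff_false, not_le]
      have := ENNReal.toReal_mono ENNReal.ofReal_ne_top (haA x)
      rw [ENNReal.toReal_ofReal hA] at this
      push Not at htA; linarith
    rw [this]; simp

/-- global multilinear estimate -/
theorem broad_global (hd : 1 ≤ d) (hk : 2 ≤ k) {c B s : ℝ} (hc : 0 < c) (hB : 0 ≤ B) (hs : 1 < s) :
    ∃ δ C : ℝ, 0 < δ ∧ δ < 1 ∧ ∀ (f : Fin k → VV d → ℂ) (ξ : Fin k → VV d),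
    (∀ j, Nice (f j) (ξ j) δ) → (∀ j η, ‖f j η‖ ≤ 1) → (∀ j, ‖ξ j‖ ≤ B) → Trans c ξ →
    ∫⁻ X, aa f δ⁻¹ X ^ s ≤ ENNReal.ofReal C := by
  set q := (1 + s) / 2 with hq
  have hq1 : 1 < q := by rw [hq]; linarith
  have hqs : q < s := by rw [hq]; linarith
  set η := (1 - 1 / q) / 2 with hη
  have hη0 : 0 < η := by
    have : 1 / q < 1 := by rw [div_lt_one (by linarith)]; exact hq1
    rw [hη]; linarith
  set I := ⌈1 / η⌉₊ with hI
  have hI1 : 1 ≤ I := Nat.one_le_ceil_iff.2 (by positivity)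
  have hI0 : (0:ℝ) < I := by exact_mod_cast hI1
  have hIη : 1 / (I:ℝ) ≤ η := by
    rw [div_le_iff₀ hI0]
    have := Nat.le_ceil (1 / η)
    rw [← hI, div_le_iff₀ hη0] at this; linarith
  set D0 := 2 * d + 1 with hD0
  set E := ex_seq D0 I with hE
  have hE1 : 1 ≤ E := ex_seq_le D0 (by omega) (Nat.zero_le I)
  have hE0 : (0:ℝ) < E := by exact_mod_cast hE1
  set ε := η / E with hε
  have hε0 : 0 < ε := by positivity
  obtain ⟨δ, C1, hδ0, hδ1, hC1, hloc⟩ := broad_local d hk hc hB hε0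
  obtain ⟨C2, hC2, hsp⟩ := sparse_aa hd hk (B + 1)
  obtain ⟨D, hD1, hnear⟩ := aa_near (d := d) hk (A := 1) zero_le_one hB
  set r0 := δ⁻¹ with hr0
  have r01 : 1 ≤ r0 := (one_le_inv₀ hδ0).2 hδ1.le
  set v0 := (volume (Metric.closedBall (0 : VV d × ℝ) (r0 / 4))).toReal with hv0
  have v0t : volume (Metric.closedBall (0 : VV d × ℝ) (r0 / 4)) ≠ ∞ := measure_closedBall_lt_top.ne
  have v00 : 0 < v0 := ENNReal.toReal_pos (Metric.measure_closedBall_pos _ _ (by positivity)).ne' v0t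
  set v1 := (volume (Metric.closedBall (0 : VV d × ℝ) r0)).toReal with hv1
  set Q := max (2 * C1) r0 with hQ
  have hQ1 : 1 ≤ Q := le_max_of_le_right r01
  set C3 := I * (D * C1 * 2 ^ ε * C2 / v0) * Q ^ η with hC3
  have hC30 : 0 ≤ C3 := by positivity
  obtain ⟨C, hC⟩ := weak_to_strong (volume : Measure (VV d × ℝ)) (s := s) (q := q) (K := C3 ^ q * v1) (A := C2) (by linarith) hqs (by positivity) (by linarith)
  refine ⟨δ, C, hδ0, hδ1, ?_⟩
  intro f ξ hf hf1 hξ hT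
  have hfB : ∀ j η, B + 1 < ‖η‖ → f j η = 0 := by
    intro j η hη
    apply (hf j).supp
    have := norm_sub_norm_le η (ξ j)
    have := hξ j
    linarith
  have hfm : ∀ j, Measurable (f j) := fun j => (hf j).meas
  apply hC _ (aa_measurable (fun j => (hf j).integrable) _)
  · intro x
    have := hsp {x} r0 (r0 ^ D0) f r01 (by positivity) (by simp) (by simp [hD0]) hfm hf1 hfB
    simpa using this
  intro t ht
  -- counting
  have hcount : ∀ G : Finset (VV d × ℝ), (∀ x ∈ G, x ∈ {x | ENNReal.ofReal t ≤ aa f r0 x}) → (∀ x ∈ G, ∀ y ∈ G, x ≠ y → r0 ≤ dist x y) →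
      (G.card : ℝ) ≤ (C3 / t) ^ q := by
    intro G hG1 hG2
    by_cases hne : G.Nonempty
    swap
    · rw [Finset.not_nonempty_iff_eq_empty.1 hne]; simp; positivity
    set N : ℝ := (G.card : ℝ) with hN
    have hN1 : 1 ≤ N := by rw [hN]; exact_mod_cast hne.card_pos
    have key := abstract_count I D0 hI1 (by omega) G hne Q (D * C1 * 2 ^ ε * C2 / v0 / t) ε hQ1 hε0.le (by positivity) ?_
    · rw [← hN, ← hE] at key
      have e1 : (E:ℝ) * ε = η := by rw [hε]; field_simp
      rw [e1, Real.mul_rpow (by linarith) (by linarith)] at key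
      have k2 : N ^ (1 / q) ≤ C3 / t := by
        have k3 : N ^ (1 / q) * N ^ η ≤ N ^ (1 - 1 / (I:ℝ)) := by
          rw [← Real.rpow_add (by linarith)]
          apply Real.rpow_le_rpow_of_exponent_le hN1
          rw [hη] at hIη ⊢
          linarith
        have k4 : N ^ (1 / q) * N ^ η ≤ (C3 / t) * N ^ η := by
          refine k3.trans (key.trans (le_of_eq ?_))
          rw [hC3]; ring
        exact le_of_mul_le_mul_right k4 (by positivity)
      calc N = (N ^ (1 / q)) ^ q := by rw [← Real.rpow_mul (by linarith)]; field_simp; simp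
        _ ≤ _ := by gcongr
    · intro X hXG ρ ρ' hρ hρ' hsep hcard
      have hρ1 : 1 ≤ ρ := hQ1.trans hρ
      have hρr : r0 ≤ ρ := (le_max_right _ _).trans hρ
      obtain ⟨R, hR1, hR2, hR3⟩ := hloc f ξ hf hξ hT (2 * ρ) (by linarith)
      have hsX := hsp X R ρ' f (by linarith) hρ' hsep (le_trans (by
        have h0 : 0 ≤ R := by linarith
        have : R ≤ Q * ρ := by
          calc R ≤ C1 * (2 * ρ) := hR2
            _ = (2 * C1) * ρ := by ring
            _ ≤ _ := by gcongr; exact le_max_left _ _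
        gcongr) hcard) hfm hf1 hfB
      have hx : ∀ x ∈ X, ENNReal.ofReal (t * v0) * ((G.filter (fun y => dist y x ≤ ρ)).card : ℝ≥0∞) ≤
          ENNReal.ofReal D * (ENNReal.ofReal (C1 * (2 * ρ) ^ ε) * aa f R x) := by
        intro x hx
        calc _ = ∑ y ∈ G.filter (fun y => dist y x ≤ ρ), ENNReal.ofReal (t * v0) := by
              rw [Finset.sum_const, nsmul_eq_mul, mul_comm]
          _ ≤ ∑ y ∈ G.filter (fun y => dist y x ≤ ρ), ∫⁻ Z in Metric.closedBall y (r0 / 4), ENNReal.ofReal D * aa f r0 Z := by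
              apply Finset.sum_le_sum
              intro y hy
              have hyG := Finset.mem_of_mem_filter y hy
              calc _ = ∫⁻ Z in Metric.closedBall y (r0 / 4), ENNReal.ofReal t := by
                    rw [setLIntegral_const, Measure.addHaar_closedBall_center, ENNReal.ofReal_mul ht.le, hv0, ENNReal.ofReal_toReal v0t]
                _ ≤ _ := by
                    apply setLIntegral_mono' Metric.isClosed_closedBall.measurableSet
                    intro Z hZ
                    have h1 : ENNReal.ofReal t ≤ aa f r0 y := hG1 y hyG
                    have h2 := hnear f ξ r0 δ y (Z - y) hf hδ0 hδ1.le hξ (by rw [hr0, inv_mul_cancel₀ hδ0.ne']) (by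
                      rw [Metric.mem_closedBall, dist_eq_norm] at hZ; linarith)
                    rw [add_sub_cancel] at h2
                    exact h1.trans h2
          _ = ∫⁻ Z in ⋃ y ∈ G.filter (fun y => dist y x ≤ ρ), Metric.closedBall y (r0 / 4), ENNReal.ofReal D * aa f r0 Z := by
              rw [lintegral_biUnion_finset]
              · intro y hy y' hy' hyy
                have := hG2 y (Finset.mem_of_mem_filter y hy) y' (Finset.mem_of_mem_filter y' hy') hyy
                apply Metric.closedBall_disjoint_closedBall
                linarith
              · intro y _; exact Metric.isClosed_closedBall.measurableSet
          _ ≤ ∫⁻ Z in Metric.closedBall x (2 * ρ), ENNReal.ofReal D * aa f r0 Z := by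
              apply lintegral_mono_set
              apply Set.iUnion₂_subset
              intro y hy
              apply Metric.closedBall_subset_closedBall'
              have := (Finset.mem_filter.1 hy).2
              linarith
          _ = ENNReal.ofReal D * ∫⁻ Z in Metric.closedBall x (2 * ρ), aa f r0 Z := lintegral_const_mul' _ _ ENNReal.ofReal_ne_top
          _ ≤ _ := by gcongr; exact hR3 x
      have hS : ENNReal.ofReal (t * v0) * ENNReal.ofReal (∑ x ∈ X, ((G.filter (fun y => dist y x ≤ ρ)).card : ℝ)) ≤
          ENNReal.ofReal (D * (C1 * (2 * ρ) ^ ε) * C2) := by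
        rw [ENNReal.ofReal_sum_of_nonneg (fun _ _ => by positivity), Finset.mul_sum]
        simp_rw [ENNReal.ofReal_natCast]
        calc _ ≤ ∑ x ∈ X, ENNReal.ofReal D * (ENNReal.ofReal (C1 * (2 * ρ) ^ ε) * aa f R x) := Finset.sum_le_sum hx
          _ = ENNReal.ofReal D * ENNReal.ofReal (C1 * (2 * ρ) ^ ε) * ∑ x ∈ X, aa f R x := by
              rw [Finset.mul_sum]; congr 1; ext x; ring
          _ ≤ ENNReal.ofReal D * ENNReal.ofReal (C1 * (2 * ρ) ^ ε) * ENNReal.ofReal C2 := by gcongr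
          _ = _ := by rw [← ENNReal.ofReal_mul (by linarith), ← ENNReal.ofReal_mul (by positivity)]
      rw [← ENNReal.ofReal_mul (by positivity), ENNReal.ofReal_le_ofReal_iff (by positivity)] at hS
      rw [Real.mul_rpow (by norm_num) (by linarith)] at hS
      have : D * C1 * 2 ^ ε * C2 / v0 / t * ρ ^ ε = (D * (C1 * (2 ^ ε * ρ ^ ε)) * C2) / (t * v0) := by
        field_simp
      rw [this, le_div_iff₀ (by positivity)]
      calc _ = t * v0 * ∑ x ∈ X, ((G.filter (fun y => dist y x ≤ ρ)).card : ℝ) := by rw [mul_comm]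
        _ ≤ _ := hS
  obtain ⟨G, G1, G2, G3⟩ := exists_net {x | ENNReal.ofReal t ≤ aa f r0 x} r0 (by linarith) ⌊(C3 / t) ^ q⌋₊
    (fun G h1 h2 => Nat.le_floor (hcount G h1 h2))
  calc volume {x | ENNReal.ofReal t ≤ aa f r0 x} ≤ volume (⋃ x ∈ G, Metric.closedBall x r0) := by
        apply measure_mono
        intro y hy
        obtain ⟨x, hx, hxy⟩ := G3 y hy
        exact Set.mem_biUnion hx (Metric.mem_closedBall.2 hxy.le)
    _ ≤ ∑ x ∈ G, volume (Metric.closedBall x r0) := measure_biUnion_finset_le _ _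
    _ = ENNReal.ofReal (G.card * v1) := by
        simp_rw [Measure.addHaar_closedBall_center]
        rw [Finset.sum_const, nsmul_eq_mul, ENNReal.ofReal_mul (by positivity), hv1, ENNReal.ofReal_toReal measure_closedBall_lt_top.ne, ENNReal.ofReal_natCast]
    _ ≤ _ := by
        apply ENNReal.ofReal_le_ofReal
        calc _ ≤ (C3 / t) ^ q * v1 := by gcongr; exact hcount G G1 G2
          _ = _ := by rw [Real.div_rpow hC30 ht.le, Real.rpow_neg ht.le]; ring

end PExt

end

section
namespace PExt

variable {d : ℕ}

/-- pairing on space-time -/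
noncomputable def pr (X ζ : VV d × ℝ) : ℝ := ⟪X.1, ζ.1⟫ + X.2 * ζ.2

@[fun_prop] lemma pr_continuous : Continuous (fun p : (VV d × ℝ) × (VV d × ℝ) => pr p.1 p.2) := by
  unfold pr; fun_prop

lemma pr_measurable {α : Type*} [MeasurableSpace α] {F G : α → VV d × ℝ} (hF : Measurable F) (hG : Measurable G) :
    Measurable (fun a => pr (F a) (G a)) := by
  have : Measurable (fun p : (VV d × ℝ) × (VV d × ℝ) => pr p.1 p.2) := pr_continuous.measurable
  exact this.comp (hF.prodMk hG)

lemma pr_add_left (X Y ζ : VV d × ℝ) : pr (X + Y) ζ = pr X ζ + pr Y ζ := by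
  simp only [pr, Prod.fst_add, Prod.snd_add, inner_add_left]; ring
lemma pr_sub_left (X Y ζ : VV d × ℝ) : pr (X - Y) ζ = pr X ζ - pr Y ζ := by
  simp only [pr, Prod.fst_sub, Prod.snd_sub, inner_sub_left]; ring
lemma pr_add_right (X ζ ω : VV d × ℝ) : pr X (ζ + ω) = pr X ζ + pr X ω := by
  simp only [pr, Prod.fst_add, Prod.snd_add, inner_add_right]; ring
lemma pr_sub_right (X ζ ω : VV d × ℝ) : pr X (ζ - ω) = pr X ζ - pr X ω := by
  simp only [pr, Prod.fst_sub, Prod.snd_sub, inner_sub_right]; ring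
lemma pr_neg_right (X ζ : VV d × ℝ) : pr X (-ζ) = - pr X ζ := by
  simp only [pr, Prod.fst_neg, Prod.snd_neg, inner_neg_right]; ring
lemma pr_smul_left (a : ℝ) (X ζ : VV d × ℝ) : pr (a • X) ζ = a * pr X ζ := by
  simp only [pr, Prod.smul_fst, Prod.smul_snd, inner_smul_left, smul_eq_mul, RCLike.conj_to_real]; ring
lemma pr_smul_right (a : ℝ) (X ζ : VV d × ℝ) : pr X (a • ζ) = a * pr X ζ := by
  simp only [pr, Prod.smul_fst, Prod.smul_snd, inner_smul_right, smul_eq_mul]; ring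

noncomputable def osc {Y : Type*} [MeasurableSpace Y] (μ : Measure Y) (g : Y → ℂ) (φ : Y → VV d × ℝ)
    (X : VV d × ℝ) : ℂ := ∫ y, g y * ee (pr X (φ y)) ∂μ

lemma Ex_eq_osc (f : VV d → ℂ) (X : VV d × ℝ) :
    Ex f X.1 X.2 = osc volume f (fun ξ => (ξ, ‖ξ‖ ^ 2)) X := by
  unfold Ex osc pr; rfl

section osc
variable {Y Z : Type*} [MeasurableSpace Y] [MeasurableSpace Z] {μ : Measure Y} {ν : Measure Z}
  [SFinite μ] [SFinite ν] {g : Y → ℂ} {φ : Y → VV d × ℝ} {h : Z → ℂ} {ψ : Z → VV d × ℝ}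

lemma integrable_mul_ee {α : Type*} [MeasurableSpace α] {m : Measure α} {g : α → ℂ} {a : α → ℝ}
    (hg : Integrable g m) (ha : Measurable a) : Integrable (fun y => g y * ee (a y)) m := by
  refine hg.mul_bdd (c := 1) (measurable_ee.comp ha).aestronglyMeasurable ?_
  filter_upwards with y
  simp

lemma osc_fub (hg : Integrable g μ) (hφ : Measurable φ) {H : VV d × ℝ → ℂ} (hH : Integrable H) :
    ∫ X, H X * osc μ g φ X = ∫ y, g y * (∫ X, H X * ee (pr X (φ y))) ∂μ := by
  have h1 : Integrable (fun p : (VV d × ℝ) × Y => (H p.1 * g p.2) * ee (pr p.1 (φ p.2))) (volume.prod μ) :=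
    integrable_mul_ee (hH.mul_prod hg) (pr_measurable measurable_fst (hφ.comp measurable_snd))
  calc ∫ X, H X * osc μ g φ X = ∫ X, ∫ y, (H X * g y) * ee (pr X (φ y)) ∂μ := by
        unfold osc
        congr 1; ext X
        rw [← integral_const_mul]
        congr 1; ext y; ring
    _ = ∫ y, (∫ X, (H X * g y) * ee (pr X (φ y))) ∂μ := integral_integral_swap h1
    _ = _ := by
        congr 1; ext y
        rw [← integral_const_mul]
        congr 1; ext X; ring

lemma osc_mul (X : VV d × ℝ) :
    osc μ g φ X * osc ν h ψ X = osc (μ.prod ν) (fun p => g p.1 * h p.2) (fun p => φ p.1 + ψ p.2) X := by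
  unfold osc
  rw [← integral_prod_mul]
  congr 1; ext p
  rw [pr_add_right, ee_add]; ring

lemma osc_conj (X : VV d × ℝ) :
    (starRingEnd ℂ) (osc μ g φ X) = osc μ (fun y => (starRingEnd ℂ) (g y)) (fun y => - φ y) X := by
  unfold osc
  rw [← integral_conj]
  congr 1; ext y
  rw [pr_neg_right, ee_neg, map_mul]

lemma osc_orth (hg : Integrable g μ) (hφ : Measurable φ) (hh : Integrable h ν) (hψ : Measurable ψ)
    {H : VV d × ℝ → ℂ} (hH : Integrable H) {R : ℝ}
    (hR : ∀ ζ, R < ‖ζ‖ → ∫ X, H X * ee (pr X ζ) = 0)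
    (hs : ∀ y z, g y ≠ 0 → h z ≠ 0 → R < ‖φ y - ψ z‖) :
    ∫ X, H X * (osc μ g φ X * (starRingEnd ℂ) (osc ν h ψ X)) = 0 := by
  have hh' : Integrable (fun z => (starRingEnd ℂ) (h z)) ν := by
    refine (integrable_norm_iff ?_).1 ?_
    · exact (Complex.continuous_conj.comp_aestronglyMeasurable hh.1)
    · simpa using hh.norm
  simp_rw [osc_conj, osc_mul]
  rw [osc_fub (hg.mul_prod hh') (by exact (hφ.comp measurable_fst).add (hψ.neg.comp measurable_snd)) hH]
  rw [← integral_zero (Y × Z) ℂ (μ := μ.prod ν)]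
  congr 1; ext p
  by_cases h1 : g p.1 = 0
  · simp [h1]
  by_cases h2 : h p.2 = 0
  · simp [h2]
  rw [hR _ (by rw [← sub_eq_add_neg]; exact hs _ _ h1 h2), mul_zero]

end osc

lemma exists_bump' (V : Type*) [NormedAddCommGroup V] [InnerProductSpace ℝ V] [FiniteDimensional ℝ V] :
    ∃ χ : V → ℝ, ContDiff ℝ (⊤ : ℕ∞) χ ∧ HasCompactSupport χ ∧ (∀ ξ, ‖ξ‖ ≤ 1 → χ ξ = 1) ∧ (∀ ξ, 0 ≤ χ ξ) ∧
      ∀ ξ, 2 ≤ ‖ξ‖ → χ ξ = 0 := by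
  let b : ContDiffBump (0 : V) := ⟨1, 2, one_pos, one_lt_two⟩
  refine ⟨b, b.contDiff, b.hasCompactSupport, fun ξ h => b.one_of_mem_closedBall (by simpa using h),
    fun ξ => b.nonneg, fun ξ h => b.zero_of_le_dist (by simpa using h)⟩

/-- nonneg. function with compactly supported Fourier transform -/
lemma exists_phi (V : Type*) [NormedAddCommGroup V] [InnerProductSpace ℝ V]
    [FiniteDimensional ℝ V] [MeasurableSpace V] [BorelSpace V] :
    ∃ φ : V → ℝ, Continuous φ ∧ Integrable φ ∧ (∀ y, 0 ≤ φ y) ∧ (∀ y, ‖y‖ ≤ 1 → 1 ≤ φ y) ∧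
      (∀ N : ℕ, ∃ C : ℝ, 0 < C ∧ ∀ y, φ y ≤ C * jw N 1 y) ∧
      ∃ R : ℝ, 0 < R ∧ ∀ η, R < ‖η‖ → ∫ y, (φ y : ℂ) * ee ⟪y, η⟫ = 0 := by
  obtain ⟨χ, hχ, hχc, hχ1, hχ0, hχ2⟩ := exists_bump' V
  have hmC : ContDiff ℝ (⊤ : ℕ∞) (fun ξ => (χ ξ : ℂ)) := Complex.ofRealCLM.contDiff.comp hχ
  have hmc : HasCompactSupport (fun ξ => (χ ξ : ℂ)) := hχc.comp_left (g := fun x : ℝ => (x : ℂ)) (by simp)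
  obtain ⟨κ, κc, κi, κd, κ1, κ2⟩ := exists_kernel (fun ξ => (χ ξ : ℂ)) hmC hmc
  have χi : Integrable χ := hχ.continuous.integrable_of_hasCompactSupport hχc
  have mi : Integrable (fun ξ => (χ ξ : ℂ)) := hmC.continuous.integrable_of_hasCompactSupport hmc
  -- κ 0 ≠ 0
  have h0 : 0 < ‖κ 0‖ := by
    rw [norm_pos_iff, κ2]
    simp only [inner_zero_left, ee_zero, mul_one]
    rw [integral_complex_ofReal]
    have : 0 < ∫ ξ, χ ξ := by
      apply hχ.continuous.integral_pos_of_hasCompactSupport_nonneg_nonzero hχc hχ0 (x := 0)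
      rw [hχ1 0 (by simp)]; norm_num
    exact_mod_cast this.ne'
  set a := ‖κ 0‖ with ha
  obtain ⟨s, hs, hs2⟩ : ∃ s : ℝ, 0 < s ∧ ∀ y, ‖y‖ < s → a / 2 < ‖κ y‖ := by
    have : ∀ᶠ y in nhds (0:V), a / 2 < ‖κ y‖ := by
      apply (κc.norm.tendsto 0).eventually_const_lt
      linarith
    obtain ⟨s, hs, h⟩ := Metric.eventually_nhds_iff.1 this
    exact ⟨s, hs, fun y hy => h (by simpa using hy)⟩
  obtain ⟨s, hs, hs2⟩ : ∃ s : ℝ, 0 < s ∧ s ≤ 1 ∧ ∀ y, ‖y‖ ≤ s → a / 2 < ‖κ y‖ :=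
    ⟨min (s/2) 1, by positivity, min_le_right _ _, fun y hy => hs2 y (by
      have := min_le_left (s/2) 1; linarith)⟩
  obtain ⟨hs1, hs2⟩ := hs2
  have κb : ∃ C, ∀ y, ‖κ y‖ ≤ C := by
    obtain ⟨C, hC, h⟩ := κd 0
    exact ⟨C, fun y => by simpa using h y⟩
  obtain ⟨Cb, hCb⟩ := κb
  have κκi : Integrable (fun y => ‖κ y‖ ^ 2) := by
    have := κi.norm.mul_bdd (c := Cb) (g := fun y => ‖κ y‖) κc.norm.aestronglyMeasurable (by
      filter_upwards with y; simpa using hCb y)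
    simpa [sq] using this
  set φ : V → ℝ := fun y => (4 / a ^ 2) * ‖κ (s • y)‖ ^ 2 with hφ
  refine ⟨φ, ?_, ?_, ?_, ?_, ?_, ?_⟩
  · rw [hφ]; fun_prop
  · exact (κκi.comp_smul hs.ne').const_mul _
  · intro y; positivity
  · intro y hy
    have := hs2 (s • y) (by rw [norm_smul, Real.norm_eq_abs, abs_of_pos hs]; nlinarith)
    simp only [hφ]
    rw [div_mul_eq_mul_div, one_le_div (by positivity)]
    nlinarith
  · intro N
    obtain ⟨C, hC, h⟩ := κd N
    refine ⟨4 / a ^ 2 * (Cb + 1) * C * (s⁻¹ ^ 2) ^ N, ?_, fun y => ?_⟩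
    · have : 0 ≤ Cb := (norm_nonneg _).trans (hCb 0)
      positivity
    · simp only [hφ]
      have hCb0 : 0 ≤ Cb := (norm_nonneg _).trans (hCb 0)
      have e1 : ‖κ (s • y)‖ * (1 + ‖y‖ ^ 2) ^ N ≤ C * (s⁻¹ ^ 2) ^ N := by
        have := h (s • y)
        have e2 : (1 + ‖y‖ ^ 2) ≤ (1 + ‖s • y‖ ^ 2) * s⁻¹ ^ 2 := by
          rw [norm_smul, Real.norm_eq_abs, abs_of_pos hs, mul_pow, add_mul]
          have : s ^ 2 * ‖y‖ ^ 2 * s⁻¹ ^ 2 = ‖y‖ ^ 2 := by field_simp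
          rw [this]
          have : 1 ≤ s⁻¹ ^ 2 := one_le_pow₀ ((one_le_inv₀ hs).2 hs1)
          linarith
        calc _ ≤ ‖κ (s • y)‖ * ((1 + ‖s • y‖ ^ 2) * s⁻¹ ^ 2) ^ N := by gcongr
          _ = (‖κ (s • y)‖ * (1 + ‖s • y‖ ^ 2) ^ N) * (s⁻¹ ^ 2) ^ N := by rw [mul_pow]; ring
          _ ≤ _ := by gcongr
      unfold jw
      rw [← div_eq_mul_inv, le_div_iff₀ (by positivity)]
      calc 4 / a ^ 2 * ‖κ (s • y)‖ ^ 2 * (1 + ‖y‖ ^ 2 / 1 ^ 2) ^ N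
          = 4 / a ^ 2 * ‖κ (s • y)‖ * (‖κ (s • y)‖ * (1 + ‖y‖ ^ 2) ^ N) := by simp only [one_pow, div_one]; ring
        _ ≤ 4 / a ^ 2 * (Cb + 1) * (C * (s⁻¹ ^ 2) ^ N) := by
            gcongr; linarith [hCb (s • y)]
        _ = _ := by ring
  · -- Fourier support
    have key : ∀ η : V, 4 < ‖η‖ → ∫ y, ((‖κ y‖ ^ 2 : ℝ) : ℂ) * ee ⟪y, η⟫ = 0 := by
      intro η hη
      have h1 : Integrable (fun p : V × V => (κ p.1 * (χ p.2 : ℂ)) * ee (⟪p.1, η - p.2⟫)) (volume.prod volume) :=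
        integrable_mul_ee (κi.mul_prod mi)
          ((by fun_prop : Continuous fun p : V × V => (⟪p.1, η - p.2⟫ : ℝ)).measurable)
      have h2 : ∀ y, ((‖κ y‖ ^ 2 : ℝ) : ℂ) * ee ⟪y, η⟫ = ∫ ω, (κ y * (χ ω : ℂ)) * ee (⟪y, η - ω⟫) := by
        intro y
        have e : (starRingEnd ℂ) (κ y) = ∫ ω, (χ ω : ℂ) * ee (-⟪y, ω⟫) := by
          rw [κ2, ← integral_conj]
          congr 1; ext ω
          rw [map_mul, ee_neg, Complex.conj_ofReal]
        have e2 : ((‖κ y‖ ^ 2 : ℝ) : ℂ) = κ y * (starRingEnd ℂ) (κ y) := by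
          rw [Complex.mul_conj, Complex.normSq_eq_norm_sq]
        rw [e2, e, mul_assoc, ← integral_mul_const, ← integral_const_mul]
        congr 1; ext ω
        rw [inner_sub_right, sub_eq_add_neg, ee_add]; ring
      simp_rw [h2]
      rw [integral_integral_swap h1]
      rw [← integral_zero V ℂ]
      congr 1; ext ω
      have h3 : ∫ y, (κ y * (χ ω : ℂ)) * ee (⟪y, η - ω⟫) = (χ ω : ℂ) * (χ (ω - η) : ℂ) := by
        rw [← κ1 (ω - η), ← integral_const_mul]
        congr 1; ext y
        rw [← inner_neg_right, neg_sub]; ring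
      rw [h3]
      by_cases hω : 2 ≤ ‖ω‖
      · rw [hχ2 ω hω]; simp
      · rw [hχ2 (ω - η)]
        · simp
        · have := norm_sub_norm_le η ω
          rw [norm_sub_rev] at this
          push Not at hω; linarith
    refine ⟨4 * s, by positivity, fun η hη => ?_⟩
    have := key (s⁻¹ • η) (by
      rw [norm_smul, norm_inv, Real.norm_eq_abs, abs_of_pos hs]
      rwa [inv_mul_eq_div, lt_div_iff₀ hs])
    have h4 := Measure.integral_comp_smul (volume : Measure V)
      (fun y => ((‖κ y‖ ^ 2 : ℝ) : ℂ) * ee ⟪y, s⁻¹ • η⟫) s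
    rw [this, smul_zero] at h4
    have h5 : ∀ y : V, ((φ y : ℝ) : ℂ) * ee ⟪y, η⟫ = ((4 / a ^ 2 : ℝ) : ℂ) *
        (((‖κ (s • y)‖ ^ 2 : ℝ) : ℂ) * ee ⟪s • y, s⁻¹ • η⟫) := by
      intro y
      simp only [hφ]
      have : (⟪s • y, s⁻¹ • η⟫ : ℝ) = ⟪y, η⟫ := by
        rw [inner_smul_left, inner_smul_right]; simp; field_simp
      rw [this]; push_cast; ring
    simp_rw [h5]
    rw [integral_const_mul, h4, mul_zero]
end PExt

end

section
namespace PExt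

variable {d : ℕ}

lemma jw_prod (N : ℕ) (r : ℝ) (x : VV d) (t : ℝ) : jw N r x * jw N r t ≤ jw N r ((x, t) : VV d × ℝ) := by
  have hx := jw_le_one N r x
  have ht := jw_le_one N r t
  have hx' := jw_pos N r x
  have ht' := jw_pos N r t
  rcases le_total ‖x‖ ‖t‖ with h | h
  · have : ‖((x, t) : VV d × ℝ)‖ = ‖t‖ := by rw [Prod.norm_def]; exact max_eq_right h
    have e : jw N r ((x, t) : VV d × ℝ) = jw N r t := by unfold jw; rw [this]
    rw [e]; nlinarith
  · have : ‖((x, t) : VV d × ℝ)‖ = ‖x‖ := by rw [Prod.norm_def]; exact max_eq_left h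
    have e : jw N r ((x, t) : VV d × ℝ) = jw N r x := by unfold jw; rw [this]
    rw [e]; nlinarith

lemma real_inner_comm' (t s : ℝ) : (⟪t, s⟫ : ℝ) = t * s := by
  simp [mul_comm]

lemma exists_PHI (d : ℕ) :
    ∃ φ : VV d × ℝ → ℝ, Continuous φ ∧ Integrable φ ∧ (∀ y, 0 ≤ φ y) ∧ (∀ y, ‖y‖ ≤ 1 → 1 ≤ φ y) ∧
      (∀ N : ℕ, ∃ C : ℝ, 0 < C ∧ ∀ y, φ y ≤ C * jw N 1 y) ∧
      ∃ R : ℝ, 0 < R ∧ ∀ η, R < ‖η‖ → ∫ y, (φ y : ℂ) * ee (pr y η) = 0 := by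
  obtain ⟨φ, φc, φi, φ0, φ1, φd, R, hR, φR⟩ := exists_phi (VV d)
  obtain ⟨ψ, ψc, ψi, ψ0, ψ1, ψd, S, hS, ψS⟩ := exists_phi ℝ
  refine ⟨fun p => φ p.1 * ψ p.2, by fun_prop, φi.mul_prod ψi, fun y => mul_nonneg (φ0 _) (ψ0 _), ?_, ?_,
    max R S, by positivity, ?_⟩
  · intro y hy
    have h1 := φ1 y.1 ((norm_fst_le y).trans hy)
    have h2 := ψ1 y.2 ((norm_snd_le y).trans hy)
    nlinarith
  · intro N
    obtain ⟨C, hC, h⟩ := φd N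
    obtain ⟨D, hD, h'⟩ := ψd N
    refine ⟨C * D, by positivity, fun y => ?_⟩
    calc φ y.1 * ψ y.2 ≤ (C * jw N 1 y.1) * (D * jw N 1 y.2) :=
          mul_le_mul (h _) (h' _) (ψ0 _) (mul_nonneg hC.le (jw_pos _ _ _).le)
      _ = C * D * (jw N 1 y.1 * jw N 1 y.2) := by ring
      _ ≤ _ := by gcongr; exact jw_prod N 1 y.1 y.2
  · intro η hη
    have e : ∫ y : VV d × ℝ, ((φ y.1 * ψ y.2 : ℝ) : ℂ) * ee (pr y η) =
        (∫ x, (φ x : ℂ) * ee ⟪x, η.1⟫) * (∫ t, (ψ t : ℂ) * ee ⟪t, η.2⟫) := by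
      rw [← integral_prod_mul]
      apply integral_congr_ae
      filter_upwards with y
      unfold pr
      rw [ee_add, real_inner_comm']; push_cast; ring
    rw [e]
    rw [Prod.norm_def] at hη
    rcases lt_max_iff.1 hη with h | h
    · rw [φR _ (lt_of_le_of_lt (le_max_left _ _) h), zero_mul]
    · rw [ψS _ (lt_of_le_of_lt (le_max_right _ _) h), mul_zero]

/-- rescaled version -/
lemma PHI_scale {φ : VV d × ℝ → ℝ} {R : ℝ} (hR : ∀ η, R < ‖η‖ → ∫ y, (φ y : ℂ) * ee (pr y η) = 0)
    {K : ℝ} (hK : 0 < K) (c : VV d × ℝ) (η : VV d × ℝ) (hη : R / K < ‖η‖) :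
    ∫ y, (φ (K⁻¹ • (y - c)) : ℂ) * ee (pr y η) = 0 := by
  have h1 := integral_sub_right_eq_self (μ := (volume : Measure (VV d × ℝ)))
    (fun y => (φ (K⁻¹ • y) : ℂ) * ee (pr (y + c) η)) c
  simp only [sub_add_cancel] at h1
  rw [h1]
  have h2 := Measure.integral_comp_smul (volume : Measure (VV d × ℝ))
    (fun y => (φ y : ℂ) * ee (pr y (K • η)) * ee (pr c η)) K⁻¹
  rw [integral_mul_const (μ := volume) (ee (pr c η)) (fun y => (φ y : ℂ) * ee (pr y (K • η))), hR (K • η) (by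
    rw [norm_smul, Real.norm_eq_abs, abs_of_pos hK]; rwa [div_lt_iff₀' hK] at hη), zero_mul, smul_zero] at h2
  rw [← h2]
  congr 1; ext y
  rw [pr_add_left, ee_add, pr_smul_left, pr_smul_right, inv_mul_cancel_left₀ hK.ne']; ring

lemma exists_PSI (d : ℕ) (N : ℕ) :
    ∃ Ψ : VV d × ℝ → ℂ, Continuous Ψ ∧ Integrable Ψ ∧ (∃ C : ℝ, 0 < C ∧ ∀ y, ‖Ψ y‖ ≤ C * jw N 1 y) ∧
      ∀ η, ‖η‖ ≤ 1 → ∫ y, Ψ y * ee (- pr y η) = 1 := by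
  have main : ∀ (V : Type) [NormedAddCommGroup V] [InnerProductSpace ℝ V]
    [FiniteDimensional ℝ V] [MeasurableSpace V] [BorelSpace V], ∃ κ : V → ℂ, Continuous κ ∧ Integrable κ ∧
      (∃ C : ℝ, 0 < C ∧ ∀ y, ‖κ y‖ ≤ C * jw N 1 y) ∧ ∀ η, ‖η‖ ≤ 1 → ∫ y, κ y * ee (-⟪y, η⟫) = 1 := by
    intro V _ _ _ _ _
    obtain ⟨χ, hχ, hχc, hχ1, hχ0, hχ2⟩ := exists_bump' V
    have hmC : ContDiff ℝ (⊤ : ℕ∞) (fun ξ => (χ ξ : ℂ)) := Complex.ofRealCLM.contDiff.comp hχ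
    have hmc : HasCompactSupport (fun ξ => (χ ξ : ℂ)) := hχc.comp_left (g := fun x : ℝ => (x : ℂ)) (by simp)
    obtain ⟨κ, κc, κi, κd, κ1, κ2⟩ := exists_kernel (fun ξ => (χ ξ : ℂ)) hmC hmc
    refine ⟨κ, κc, κi, ?_, fun η hη => by rw [κ1, hχ1 η hη]; simp⟩
    obtain ⟨C, hC, h⟩ := κd N
    refine ⟨C, hC, fun y => ?_⟩
    unfold jw
    rw [← div_eq_mul_inv, le_div_iff₀ (by positivity)]
    simpa using h y
  obtain ⟨φ, φc, φi, ⟨C, hC, h⟩, φR⟩ := main (VV d)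
  obtain ⟨ψ, ψc, ψi, ⟨D, hD, h'⟩, ψS⟩ := main ℝ
  refine ⟨fun p => φ p.1 * ψ p.2, by fun_prop, φi.mul_prod ψi, ⟨C * D, by positivity, fun y => ?_⟩, ?_⟩
  · rw [norm_mul]
    calc ‖φ y.1‖ * ‖ψ y.2‖ ≤ (C * jw N 1 y.1) * (D * jw N 1 y.2) :=
          mul_le_mul (h _) (h' _) (norm_nonneg _) (mul_nonneg hC.le (jw_pos _ _ _).le)
      _ = C * D * (jw N 1 y.1 * jw N 1 y.2) := by ring
      _ ≤ _ := by gcongr; exact jw_prod N 1 y.1 y.2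
  · intro η hη
    have e : ∫ y : VV d × ℝ, (φ y.1 * ψ y.2) * ee (-pr y η) =
        (∫ x, φ x * ee (-⟪x, η.1⟫)) * (∫ t, ψ t * ee (-⟪t, η.2⟫)) := by
      rw [← integral_prod_mul]
      apply integral_congr_ae
      filter_upwards with y
      unfold pr
      rw [neg_add, ee_add, real_inner_comm']; ring
    rw [e, φR _ ((norm_fst_le η).trans hη), ψS _ ((norm_snd_le η).trans hη), one_mul]

/-- reproducing formula -/
lemma Ex_repr {Ψ : VV d × ℝ → ℂ} (hΨ : Integrable Ψ)
    (hΨ1 : ∀ η, ‖η‖ ≤ 1 → ∫ y, Ψ y * ee (- pr y η) = 1) {f : VV d → ℂ} (hf : Integrable f)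
    {s : ℝ} (ζ₀ : VV d × ℝ)
    (hs : ∀ ξ, f ξ ≠ 0 → ‖s • (((ξ, ‖ξ‖ ^ 2) : VV d × ℝ) - ζ₀)‖ ≤ 1) (X : VV d × ℝ) :
    Ex f X.1 X.2 = ∫ Z, (Ψ Z * ee (s * pr Z ζ₀)) * Ex f (X - s • Z).1 (X - s • Z).2 := by
  set φ : VV d → VV d × ℝ := fun ξ => (ξ, ‖ξ‖ ^ 2) with hφ
  have φm : Measurable φ := (by fun_prop : Continuous φ).measurable
  have h1 : ∀ Z, Ex f (X - s • Z).1 (X - s • Z).2 =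
      osc volume (fun ξ => f ξ * ee (pr X (φ ξ))) (fun ξ => (-s) • φ ξ) Z := by
    intro Z
    rw [Ex_eq_osc]
    unfold osc
    congr 1; ext ξ
    rw [pr_sub_left, pr_smul_left, pr_smul_right, sub_eq_add_neg, ee_add, neg_mul]; ring
  simp_rw [h1]
  have hA : Integrable (fun ξ => f ξ * ee (pr X (φ ξ))) :=
    integrable_mul_ee hf (pr_measurable measurable_const φm)
  have hB : Measurable (fun ξ => (-s) • φ ξ) := φm.const_smul (-s)
  have hC0 : Measurable (fun Z : VV d × ℝ => s * pr Z ζ₀) :=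
    (pr_measurable measurable_id measurable_const).const_mul _
  have hC : Integrable (fun Z => Ψ Z * ee (s * pr Z ζ₀)) := integrable_mul_ee hΨ hC0
  rw [osc_fub hA hB hC, Ex_eq_osc]
  unfold osc
  congr 1; ext ξ
  by_cases h0 : f ξ = 0
  · simp [h0]
  have h2 := hΨ1 _ (hs ξ h0)
  have h3 : ∫ Z, (Ψ Z * ee (s * pr Z ζ₀)) * ee (pr Z ((-s) • φ ξ)) = 1 := by
    rw [← h2]
    congr 1; ext Z
    rw [mul_assoc, ← ee_add]
    congr 2
    rw [pr_smul_right, pr_smul_right, pr_sub_right]; ring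
  rw [h3, mul_one]
end PExt

end

section
namespace PExt

variable {d : ℕ}

lemma jensen_p {α : Type*} [MeasurableSpace α] {μ : Measure α} {p : ℝ} (hp : 1 < p) {k g : α → ℝ≥0∞}
    (hk : Measurable k) (hg : Measurable g) (hkt : ∀ a, k a ≠ ∞) :
    (∫⁻ a, k a * g a ∂μ) ^ p ≤ (∫⁻ a, k a ∂μ) ^ (p - 1) * ∫⁻ a, k a * g a ^ p ∂μ := by
  have hp0 : 0 < p := by linarith
  have hq := Real.HolderConjugate.conjExponent hp
  set q := p.conjExponent with hqd
  have hq0 : 0 < q := hq.symm.pos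
  have h := ENNReal.lintegral_mul_le_Lp_mul_Lq μ hq.symm (f := fun a => k a ^ (1 / q))
    (g := fun a => k a ^ (1 / p) * g a) (hk.pow_const _).aemeasurable
    ((hk.pow_const _).mul hg).aemeasurable
  have e1 : ∀ a, k a ^ (1 / q) * (k a ^ (1 / p) * g a) = k a * g a := by
    intro a
    rw [← mul_assoc, ← ENNReal.rpow_add_of_nonneg _ _ (by positivity) (by positivity)]
    have : 1 / q + 1 / p = 1 := by
      have := hq.inv_add_inv_eq_one
      rw [one_div, one_div, add_comm]; exact this
    rw [this, ENNReal.rpow_one]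
  have e2 : ∀ a, (k a ^ (1 / q)) ^ q = k a := by
    intro a; rw [← ENNReal.rpow_mul, one_div, inv_mul_cancel₀ hq0.ne', ENNReal.rpow_one]
  have e3 : ∀ a, (k a ^ (1 / p) * g a) ^ p = k a * g a ^ p := by
    intro a
    rw [ENNReal.mul_rpow_of_nonneg _ _ hp0.le, ← ENNReal.rpow_mul, one_div, inv_mul_cancel₀ hp0.ne',
      ENNReal.rpow_one]
  simp only [Pi.mul_apply, e1, e2, e3] at h
  have h2 := ENNReal.rpow_le_rpow h hp0.le
  refine h2.trans (le_of_eq ?_)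
  rw [ENNReal.mul_rpow_of_nonneg _ _ hp0.le, ← ENNReal.rpow_mul, ← ENNReal.rpow_mul]
  have e4 : 1 / q * p = p - 1 := by
    rw [hqd, Real.conjExponent]; field_simp
  rw [e4, one_div, inv_mul_cancel₀ hp0.ne', ENNReal.rpow_one]

/-- averaged `p`-th power -/
noncomputable def bb (p : ℝ) (N : ℕ) (K : ℝ) (f : VV d → ℂ) (c : VV d × ℝ) : ℝ≥0∞ :=
  ENNReal.ofReal ((K ^ (d + 1))⁻¹) * ∫⁻ Y : VV d × ℝ, ‖Ex f Y.1 Y.2‖ₑ ^ p * ENNReal.ofReal (jw N K (Y - c))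

lemma measurable_ExX {f : VV d → ℂ} (hf : Integrable f) : Measurable (fun X : VV d × ℝ => Ex f X.1 X.2) :=
  (Ex_continuous hf).measurable

lemma measurable_jwX (N : ℕ) (K : ℝ) :
    Measurable (fun p : (VV d × ℝ) × (VV d × ℝ) => ENNReal.ofReal (jw N K (p.2 - p.1))) :=
  ((by fun_prop : Continuous fun p : (VV d × ℝ) × (VV d × ℝ) => jw N K (p.2 - p.1)).measurable).ennreal_ofReal

lemma bb_measurable {f : VV d → ℂ} (hf : Integrable f) (p : ℝ) (N : ℕ) (K : ℝ) : Measurable (bb p N K f) := by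
  unfold bb
  refine Measurable.const_mul ?_ _
  apply Measurable.lintegral_prod_right'
    (f := fun p' : (VV d × ℝ) × (VV d × ℝ) => ‖Ex f p'.2.1 p'.2.2‖ₑ ^ p * ENNReal.ofReal (jw N K (p'.2 - p'.1)))
  exact (((measurable_ExX hf).comp measurable_snd).enorm.pow_const _).mul (measurable_jwX N K)

lemma Nice.near {f : VV d → ℂ} {ξ₀ : VV d} {a B K : ℝ} (h : Nice f ξ₀ (a / K)) (ha : 0 ≤ a) (hB : ‖ξ₀‖ ≤ B)
    (hK : 1 ≤ K) {ξ : VV d} (hξ : f ξ ≠ 0) :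
    ‖((ξ, ‖ξ‖ ^ 2) : VV d × ℝ) - (ξ₀, ‖ξ₀‖ ^ 2)‖ ≤ (a + 1) * (2 * B + a + 1) / K := by
  have hB0 : 0 ≤ B := (norm_nonneg _).trans hB
  have h1 : ‖ξ - ξ₀‖ ≤ a / K := by
    by_contra hc
    exact hξ (h.supp ξ (not_le.1 hc))
  have h1' : ‖ξ - ξ₀‖ ≤ a := h1.trans (div_le_self ha hK)
  have h2 := abs_norm_sub_norm_le ξ ξ₀
  have h3 : ‖ξ‖ ≤ B + a := by have := norm_sub_norm_le ξ ξ₀; linarith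
  rw [Prod.mk_sub_mk, Prod.norm_def]
  apply max_le
  · refine h1.trans ?_
    gcongr; nlinarith
  · simp only []
    have : ‖ξ‖ ^ 2 - ‖ξ₀‖ ^ 2 = (‖ξ‖ - ‖ξ₀‖) * (‖ξ‖ + ‖ξ₀‖) := by ring
    rw [this, norm_mul, Real.norm_eq_abs, Real.norm_eq_abs, abs_of_nonneg (by positivity : 0 ≤ ‖ξ‖ + ‖ξ₀‖)]
    calc _ ≤ (a / K) * (2 * B + a) := by
          apply mul_le_mul (h2.trans h1) (by linarith) (by positivity) (by positivity)
      _ = a * (2 * B + a) / K := by ring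
      _ ≤ _ := by
          have : a * (2 * B + a) ≤ (a + 1) * (2 * B + a + 1) := by nlinarith
          gcongr

set_option maxHeartbeats 1000000 in
lemma bb_pointwise (d N : ℕ) (hN : d + 1 < 2 * N) {p a B : ℝ} (hp : 1 < p) (ha : 0 ≤ a) (hB : 0 ≤ B) :
    ∃ C : ℝ, 0 < C ∧ ∀ (f : VV d → ℂ) (ξ₀ : VV d) (K : ℝ) (X c : VV d × ℝ), Nice f ξ₀ (a / K) → ‖ξ₀‖ ≤ B → 1 ≤ K →
      ‖Ex f X.1 X.2‖ₑ ^ p ≤ ENNReal.ofReal (C * (1 + ‖X - c‖ ^ 2 / K ^ 2) ^ N) * bb p N K f c := by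
  obtain ⟨Ψ, Ψc, Ψi, ⟨C0, hC0, hΨd⟩, Ψ1⟩ := exists_PSI d N
  set I := ∫⁻ Z, ‖Ψ Z‖ₑ with hI
  have hIt : I ≠ ∞ := Ψi.2.ne
  set J := (I ^ (p - 1)).toReal with hJ
  have hJt : I ^ (p - 1) ≠ ∞ := ENNReal.rpow_ne_top_of_nonneg (by linarith) hIt
  set L := (a + 1) * (2 * B + a + 1) with hL
  have hL1 : 1 ≤ L := by rw [hL]; nlinarith
  refine ⟨(J + 1) * C0 * L ^ (d + 1) * 2 ^ N, by positivity, fun f ξ₀ K X c hf hξ hK => ?_⟩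
  have hK0 : 0 < K := by linarith
  set s := K / L with hs
  have hs0 : 0 < s := by positivity
  have hsK : s ≤ K := div_le_self hK0.le hL1
  have fi := hf.integrable
  have hrep := Ex_repr Ψi Ψ1 fi (s := s) (ξ₀, ‖ξ₀‖ ^ 2) (fun ξ hξ0 => by
    rw [norm_smul, Real.norm_eq_abs, abs_of_pos hs0]
    have := hf.near ha hξ hK hξ0
    calc _ ≤ s * (L / K) := by gcongr
      _ = 1 := by rw [hs]; field_simp) X
  have um : Measurable (fun Z : VV d × ℝ => ‖Ex f Z.1 Z.2‖ₑ) := (measurable_ExX fi).enorm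
  have um2 : Measurable (fun Z : VV d × ℝ => ‖Ex f (X - s • Z).1 (X - s • Z).2‖ₑ) :=
    um.comp (by fun_prop : Continuous fun Z : VV d × ℝ => X - s • Z).measurable
  have h1 : ‖Ex f X.1 X.2‖ₑ ≤ ∫⁻ Z, ‖Ψ Z‖ₑ * ‖Ex f (X - s • Z).1 (X - s • Z).2‖ₑ := by
    conv_lhs => rw [hrep]
    refine (enorm_integral_le_lintegral_enorm _).trans (le_of_eq ?_)
    congr 1; ext Z
    simp [enorm_mul]
  have h2 := (ENNReal.rpow_le_rpow h1 (by linarith : 0 ≤ p)).trans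
    (jensen_p hp Ψc.measurable.enorm um2 (fun a => enorm_ne_top))
  refine h2.trans ?_
  have h3 : ∫⁻ Z, ‖Ψ Z‖ₑ * ‖Ex f (X - s • Z).1 (X - s • Z).2‖ₑ ^ p ≤
      ENNReal.ofReal (C0 * L ^ (d + 1) * (2 ^ N * (1 + ‖X - c‖ ^ 2 / K ^ 2) ^ N)) * bb p N K f c := by
    have a1 : ∀ Z, ‖Ψ Z‖ₑ * ‖Ex f (X - s • Z).1 (X - s • Z).2‖ₑ ^ p ≤
        (fun W : VV d × ℝ => ENNReal.ofReal (C0 * jw N K W) * ‖Ex f (X - W).1 (X - W).2‖ₑ ^ p) ((s⁻¹)⁻¹ • Z) := by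
      intro Z
      rw [inv_inv]
      dsimp only
      gcongr
      rw [← ofReal_norm]
      apply ENNReal.ofReal_le_ofReal
      refine (hΨd Z).trans ?_
      gcongr
      have := jw_scale N s hs0 (s • Z)
      rw [inv_smul_smul₀ hs0.ne'] at this
      rw [← this]
      exact jw_mono_r N hs0 hsK _
    refine (lintegral_mono a1).trans ?_
    have a5 := lintegral_smul_comp (volume : Measure (VV d × ℝ))
      (fun W : VV d × ℝ => ENNReal.ofReal (C0 * jw N K W) * ‖Ex f (X - W).1 (X - W).2‖ₑ ^ p) (inv_pos.2 hs0)
    rw [finrank_X] at a5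
    refine a5.le.trans ?_
    have a2 := lintegral_sub_left_eq_self (μ := (volume : Measure (VV d × ℝ)))
      (fun W : VV d × ℝ => ENNReal.ofReal (C0 * jw N K W) * ‖Ex f (X - W).1 (X - W).2‖ₑ ^ p) X
    rw [← a2]
    unfold bb
    rw [← mul_assoc, ← ENNReal.ofReal_mul (by positivity), ← lintegral_const_mul' _ _ ENNReal.ofReal_ne_top,
      ← lintegral_const_mul' _ _ ENNReal.ofReal_ne_top]
    apply lintegral_mono
    intro Y
    dsimp only
    have a6 : X - (X - Y) = Y := by abel
    change ENNReal.ofReal (s⁻¹ ^ (d + 1)) * (ENNReal.ofReal (C0 * jw N K (X - Y)) *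
      ‖Ex f (X - (X - Y)).1 (X - (X - Y)).2‖ₑ ^ p) ≤ _
    rw [a6]
    have a3 := peetre N K (c - X) (Y - c)
    have a4 : jw N K (X - Y) ≤ 2 ^ N * (1 + ‖X - c‖ ^ 2 / K ^ 2) ^ N * jw N K (Y - c) := by
      rw [jw_sub_comm, norm_sub_rev X c]
      convert a3 using 2; abel
    have a7 : s⁻¹ ^ (d + 1) * (C0 * jw N K (X - Y)) ≤
        (C0 * L ^ (d + 1) * (2 ^ N * (1 + ‖X - c‖ ^ 2 / K ^ 2) ^ N) * (K ^ (d + 1))⁻¹) * jw N K (Y - c) := by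
      calc s⁻¹ ^ (d + 1) * (C0 * jw N K (X - Y)) ≤ s⁻¹ ^ (d + 1) * (C0 * (2 ^ N * (1 + ‖X - c‖ ^ 2 / K ^ 2) ^ N * jw N K (Y - c))) := by
            gcongr
        _ = _ := by rw [hs, inv_div, div_pow]; ring
    have a8 := ENNReal.ofReal_le_ofReal a7
    rw [ENNReal.ofReal_mul (by positivity : 0 ≤ s⁻¹ ^ (d + 1)), ENNReal.ofReal_mul (by positivity : 0 ≤
      (C0 * L ^ (d + 1) * (2 ^ N * (1 + ‖X - c‖ ^ 2 / K ^ 2) ^ N) * (K ^ (d + 1))⁻¹))] at a8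
    calc _ = (ENNReal.ofReal (s⁻¹ ^ (d + 1)) * ENNReal.ofReal (C0 * jw N K (X - Y))) * ‖Ex f Y.1 Y.2‖ₑ ^ p := by ring
      _ ≤ _ := mul_le_mul_left a8 _
      _ = _ := by ring
  calc _ ≤ ENNReal.ofReal (J + 1) * (ENNReal.ofReal (C0 * L ^ (d + 1) * (2 ^ N * (1 + ‖X - c‖ ^ 2 / K ^ 2) ^ N)) * bb p N K f c) := by
        apply mul_le_mul' _ h3
        rw [← ENNReal.ofReal_toReal hJt]
        apply ENNReal.ofReal_le_ofReal
        linarith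
    _ = _ := by
        rw [← mul_assoc, ← ENNReal.ofReal_mul (by positivity)]
        congr 2; ring

lemma bb_int (d : ℕ) (p : ℝ) : ∃ C : ℝ, 0 < C ∧ ∀ (f : VV d → ℂ) (K S : ℝ), Integrable f → 1 ≤ K → K ≤ S →
    ∫⁻ c, ENNReal.ofReal (jw (d + 1) S c) * bb p (2 * (d + 1)) K f c ≤
      ENNReal.ofReal C * ∫⁻ Y : VV d × ℝ, ‖Ex f Y.1 Y.2‖ₑ ^ p * ENNReal.ofReal (jw (d + 1) S Y) := by
  have hIt : ∫⁻ y : VV d × ℝ, ENNReal.ofReal (jw (d + 1) 1 y) < ∞ :=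
    lintegral_jw_lt_top volume (by rw [finrank_X]; omega)
  set I := ∫⁻ y : VV d × ℝ, ENNReal.ofReal (jw (d + 1) 1 y) with hI
  refine ⟨2 ^ (d + 1) * (I.toReal + 1), by positivity, fun f K S hf hK hKS => ?_⟩
  have hK0 : 0 < K := by linarith
  have um : Measurable (fun Z : VV d × ℝ => ‖Ex f Z.1 Z.2‖ₑ ^ p) := (measurable_ExX hf).enorm.pow_const _
  have jm : Measurable (fun c : VV d × ℝ => ENNReal.ofReal (jw (d + 1) S c)) :=
    ((by fun_prop : Continuous fun c : VV d × ℝ => jw (d + 1) S c).measurable).ennreal_ofReal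
  unfold bb
  calc ∫⁻ c, ENNReal.ofReal (jw (d + 1) S c) * (ENNReal.ofReal ((K ^ (d + 1))⁻¹) * ∫⁻ Y : VV d × ℝ, ‖Ex f Y.1 Y.2‖ₑ ^ p * ENNReal.ofReal (jw (2 * (d + 1)) K (Y - c)))
      = ENNReal.ofReal ((K ^ (d + 1))⁻¹) * ∫⁻ c, ∫⁻ Y : VV d × ℝ, ENNReal.ofReal (jw (d + 1) S c) * (‖Ex f Y.1 Y.2‖ₑ ^ p * ENNReal.ofReal (jw (2 * (d + 1)) K (Y - c))) := by
        rw [← lintegral_const_mul' _ _ ENNReal.ofReal_ne_top]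
        congr 1; ext c
        rw [lintegral_const_mul' _ _ ENNReal.ofReal_ne_top]
        ring
    _ = ENNReal.ofReal ((K ^ (d + 1))⁻¹) * ∫⁻ Y : VV d × ℝ, ∫⁻ c, ENNReal.ofReal (jw (d + 1) S c) * (‖Ex f Y.1 Y.2‖ₑ ^ p * ENNReal.ofReal (jw (2 * (d + 1)) K (Y - c))) := by
        rw [lintegral_lintegral_swap]
        exact ((jm.comp measurable_fst).mul ((um.comp measurable_snd).mul (measurable_jwX _ K))).aemeasurable
    _ ≤ ENNReal.ofReal ((K ^ (d + 1))⁻¹) * ∫⁻ Y : VV d × ℝ, (‖Ex f Y.1 Y.2‖ₑ ^ p * ENNReal.ofReal (jw (d + 1) S Y)) * (ENNReal.ofReal (2 ^ (d + 1)) * (ENNReal.ofReal (K ^ (d + 1)) * I)) := by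
        gcongr with Y
        rw [← finrank_X d, ← lintegral_jw volume (d + 1) hK0 Y, finrank_X, ← lintegral_const_mul' _ _ ENNReal.ofReal_ne_top]
        have em : Measurable (fun c : VV d × ℝ => ENNReal.ofReal (2 ^ (d + 1)) * ENNReal.ofReal (jw (d + 1) K (c - Y))) :=
          ((by fun_prop : Continuous fun c : VV d × ℝ => jw (d + 1) K (c - Y)).measurable).ennreal_ofReal.const_mul _
        rw [← lintegral_const_mul _ em]
        apply lintegral_mono
        intro c
        dsimp only
        have h1 := peetre (d + 1) S (c - Y) Y
        rw [sub_add_cancel] at h1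
        have h2 : jw (d + 1) S c * jw (2 * (d + 1)) K (Y - c) ≤ jw (d + 1) S Y * (2 ^ (d + 1) * jw (d + 1) K (c - Y)) := by
          have h3 : (1 + ‖c - Y‖ ^ 2 / S ^ 2) ^ (d + 1) ≤ (1 + ‖c - Y‖ ^ 2 / K ^ 2) ^ (d + 1) := by gcongr
          have h4 : (1 + ‖c - Y‖ ^ 2 / K ^ 2) ^ (d + 1) * jw (2 * (d + 1)) K (Y - c) = jw (d + 1) K (c - Y) := by
            unfold jw
            rw [norm_sub_rev Y c, two_mul, pow_add _ (d + 1) (d + 1), mul_inv, ← mul_assoc, mul_inv_cancel₀ (by positivity), one_mul]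
          calc _ ≤ (2 ^ (d + 1) * (1 + ‖c - Y‖ ^ 2 / K ^ 2) ^ (d + 1) * jw (d + 1) S Y) * jw (2 * (d + 1)) K (Y - c) := by
                apply mul_le_mul_of_nonneg_right _ (jw_pos _ _ _).le
                refine h1.trans ?_
                have := jw_pos (d + 1) S Y
                gcongr
            _ = jw (d + 1) S Y * (2 ^ (d + 1) * ((1 + ‖c - Y‖ ^ 2 / K ^ 2) ^ (d + 1) * jw (2 * (d + 1)) K (Y - c))) := by ring
            _ = _ := by rw [h4]
        have h5 := ENNReal.ofReal_le_ofReal h2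
        rw [ENNReal.ofReal_mul (jw_pos _ _ _).le, ENNReal.ofReal_mul (jw_pos _ _ _).le, ENNReal.ofReal_mul (by positivity)] at h5
        calc _ = ‖Ex f Y.1 Y.2‖ₑ ^ p * (ENNReal.ofReal (jw (d + 1) S c) * ENNReal.ofReal (jw (2 * (d + 1)) K (Y - c))) := by ring
          _ ≤ ‖Ex f Y.1 Y.2‖ₑ ^ p * (ENNReal.ofReal (jw (d + 1) S Y) * (ENNReal.ofReal (2 ^ (d + 1)) * ENNReal.ofReal (jw (d + 1) K (c - Y)))) := mul_le_mul_right h5 _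
          _ = _ := by ring
    _ ≤ _ := by
        have em : Measurable (fun Y : VV d × ℝ => ‖Ex f Y.1 Y.2‖ₑ ^ p * ENNReal.ofReal (jw (d + 1) S Y)) := um.mul jm
        rw [lintegral_mul_const _ em]
        have : ENNReal.ofReal ((K ^ (d + 1))⁻¹) * ENNReal.ofReal (K ^ (d + 1)) = 1 := by
          rw [← ENNReal.ofReal_mul (by positivity), inv_mul_cancel₀ (by positivity), ENNReal.ofReal_one]
        set Q := ∫⁻ Y : VV d × ℝ, ‖Ex f Y.1 Y.2‖ₑ ^ p * ENNReal.ofReal (jw (d + 1) S Y)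
        calc _ = (ENNReal.ofReal ((K ^ (d + 1))⁻¹) * ENNReal.ofReal (K ^ (d + 1))) * (ENNReal.ofReal (2 ^ (d + 1)) * I) * Q := by ring
          _ = (ENNReal.ofReal (2 ^ (d + 1)) * I) * Q := by rw [this, one_mul]
          _ ≤ _ := by
            rw [ENNReal.ofReal_mul (by positivity)]
            gcongr
            rw [← ENNReal.ofReal_toReal hIt.ne]
            apply ENNReal.ofReal_le_ofReal; simp
end PExt

end

section
namespace PExt

variable {d : ℕ}

lemma lint_sq_eq {u : VV d × ℝ → ℂ} {Φ : VV d × ℝ → ℝ} (hΦ0 : ∀ X, 0 ≤ Φ X)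
    (hi : Integrable (fun X => ‖u X‖ ^ 2 * Φ X)) :
    ∫⁻ X, ‖u X‖ₑ ^ 2 * ENNReal.ofReal (Φ X) = ENNReal.ofReal (∫ X, ‖u X‖ ^ 2 * Φ X) := by
  rw [ofReal_integral_eq_lintegral_ofReal hi (Filter.Eventually.of_forall fun X => mul_nonneg (by positivity) (hΦ0 X))]
  congr 1; ext X
  rw [ENNReal.ofReal_mul (by positivity), ENNReal.ofReal_pow (norm_nonneg _), ofReal_norm]

lemma schur {ι : Type*} [DecidableEq ι] (T : Finset ι) (u : ι → VV d × ℝ → ℂ) (hu : ∀ i, Continuous (u i))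
    (hb : ∀ i, ∃ M : ℝ, ∀ X, ‖u i X‖ ≤ M) {Φ : VV d × ℝ → ℝ} (hΦ0 : ∀ X, 0 ≤ Φ X) (hΦi : Integrable Φ)
    (rel : ι → ι → Prop) [DecidableRel rel] (hsymm : ∀ i j, rel i j → rel j i)
    (horth : ∀ i ∈ T, ∀ j ∈ T, ¬ rel i j → ∫ X, (Φ X : ℂ) * (u i X * (starRingEnd ℂ) (u j X)) = 0)
    (D : ℕ) (hD : ∀ i ∈ T, (T.filter (fun j => rel i j)).card ≤ D) :
    ∫⁻ X, ‖∑ i ∈ T, u i X‖ₑ ^ 2 * ENNReal.ofReal (Φ X) ≤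
      D * ∑ i ∈ T, ∫⁻ X, ‖u i X‖ₑ ^ 2 * ENNReal.ofReal (Φ X) := by
  have hΦC : Integrable (fun X => (Φ X : ℂ)) := hΦi.ofReal
  have hij : ∀ i j, Integrable (fun X => (Φ X : ℂ) * (u i X * (starRingEnd ℂ) (u j X))) := by
    intro i j
    obtain ⟨M, hM⟩ := hb i
    obtain ⟨M', hM'⟩ := hb j
    refine hΦC.mul_bdd (c := M * M') ?_ ?_
    · exact ((hu i).mul (Complex.continuous_conj.comp (hu j))).aestronglyMeasurable
    · filter_upwards with X
      rw [norm_mul, RCLike.norm_conj]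
      exact mul_le_mul (hM X) (hM' X) (norm_nonneg _) ((norm_nonneg _).trans (hM X))
  have hsq : ∀ i, Integrable (fun X => ‖u i X‖ ^ 2 * Φ X) := by
    intro i
    have := (hij i i).norm
    refine this.congr ?_
    filter_upwards with X
    rw [norm_mul, norm_mul, RCLike.norm_conj, Complex.norm_real, Real.norm_eq_abs, abs_of_nonneg (hΦ0 X)]; ring
  have hS : ∀ X, ((‖∑ i ∈ T, u i X‖ ^ 2 * Φ X : ℝ) : ℂ) = ∑ i ∈ T, ∑ j ∈ T, (Φ X : ℂ) * (u i X * (starRingEnd ℂ) (u j X)) := by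
    intro X
    rw [← Complex.normSq_eq_norm_sq, Complex.ofReal_mul, ← Complex.mul_conj, map_sum, Finset.sum_mul_sum, Finset.sum_mul]
    apply Finset.sum_congr rfl; intro i _
    rw [Finset.sum_mul]
    apply Finset.sum_congr rfl; intro j _
    ring
  have hSi : Integrable (fun X => ‖∑ i ∈ T, u i X‖ ^ 2 * Φ X) := by
    have : Integrable (fun X => ((‖∑ i ∈ T, u i X‖ ^ 2 * Φ X : ℝ) : ℂ)) := by
      simp_rw [hS]
      exact integrable_finsetSum _ fun i _ => integrable_finsetSum _ fun j _ => hij i j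
    exact this.re
  rw [lint_sq_eq hΦ0 hSi]
  simp_rw [lint_sq_eq hΦ0 (hsq _)]
  have hA0 : ∀ i, 0 ≤ ∫ X, ‖u i X‖ ^ 2 * Φ X := fun i => integral_nonneg fun X => mul_nonneg (by positivity) (hΦ0 X)
  rw [← ENNReal.ofReal_sum_of_nonneg (fun i _ => hA0 i), ← ENNReal.ofReal_natCast, ← ENNReal.ofReal_mul (by positivity)]
  apply ENNReal.ofReal_le_ofReal
  set A : ι → ℝ := fun i => ∫ X, ‖u i X‖ ^ 2 * Φ X with hA
  have h1 : ((∫ X, ‖∑ i ∈ T, u i X‖ ^ 2 * Φ X : ℝ) : ℂ) = ∑ i ∈ T, ∑ j ∈ T, ∫ X, (Φ X : ℂ) * (u i X * (starRingEnd ℂ) (u j X)) := by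
    rw [← integral_complex_ofReal]
    simp_rw [hS]
    rw [integral_finsetSum _ fun i _ => integrable_finsetSum _ fun j _ => hij i j]
    apply Finset.sum_congr rfl; intro i _
    rw [integral_finsetSum _ fun j _ => hij i j]
  have h2 : ∀ i j, ‖∫ X, (Φ X : ℂ) * (u i X * (starRingEnd ℂ) (u j X))‖ ≤ (A i + A j) / 2 := by
    intro i j
    refine (norm_integral_le_integral_norm _).trans ?_
    rw [hA, ← integral_add (hsq i) (hsq j), ← integral_div]
    apply integral_mono (hij i j).norm (((hsq i).add (hsq j)).div_const 2)
    intro X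
    dsimp only
    rw [norm_mul, norm_mul, RCLike.norm_conj, Complex.norm_real, Real.norm_eq_abs, abs_of_nonneg (hΦ0 X)]
    have hh := mul_nonneg (hΦ0 X) (sq_nonneg (‖u i X‖ - ‖u j X‖))
    simp only [Pi.add_apply]
    linarith [show Φ X * (‖u i X‖ - ‖u j X‖) ^ 2 = ‖u i X‖ ^ 2 * Φ X + ‖u j X‖ ^ 2 * Φ X - 2 * (Φ X * (‖u i X‖ * ‖u j X‖)) by ring]
  have h3 : ∫ X, ‖∑ i ∈ T, u i X‖ ^ 2 * Φ X ≤ ∑ i ∈ T, ∑ j ∈ T, if rel i j then (A i + A j) / 2 else 0 := by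
    have : ∫ X, ‖∑ i ∈ T, u i X‖ ^ 2 * Φ X ≤ ‖((∫ X, ‖∑ i ∈ T, u i X‖ ^ 2 * Φ X : ℝ) : ℂ)‖ := by
      rw [Complex.norm_real]; exact le_abs_self _
    refine this.trans ?_
    rw [h1]
    refine (norm_sum_le _ _).trans (Finset.sum_le_sum fun i hi => ?_)
    refine (norm_sum_le _ _).trans (Finset.sum_le_sum fun j hj => ?_)
    split_ifs with h
    · exact h2 i j
    · rw [horth i hi j hj h]; simp
  refine h3.trans ?_
  have h4 : ∑ i ∈ T, ∑ j ∈ T, (if rel i j then (A i + A j) / 2 else 0) =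
      (∑ i ∈ T, ∑ j ∈ T, (if rel i j then A i / 2 else 0)) + ∑ i ∈ T, ∑ j ∈ T, (if rel i j then A j / 2 else 0) := by
    simp_rw [← Finset.sum_add_distrib]
    apply Finset.sum_congr rfl; intro i _
    apply Finset.sum_congr rfl; intro j _
    split_ifs
    · ring
    · ring
  have h5 : ∑ i ∈ T, ∑ j ∈ T, (if rel i j then A j / 2 else 0) = ∑ i ∈ T, ∑ j ∈ T, (if rel i j then A i / 2 else 0) := by
    rw [Finset.sum_comm]
    apply Finset.sum_congr rfl; intro i _
    apply Finset.sum_congr rfl; intro j _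
    have : rel j i ↔ rel i j := ⟨hsymm _ _, hsymm _ _⟩
    simp only [this]
  have h6 : ∑ i ∈ T, ∑ j ∈ T, (if rel i j then A i / 2 else 0) ≤ ∑ i ∈ T, D * (A i / 2) := by
    apply Finset.sum_le_sum; intro i hi
    rw [← Finset.sum_filter, Finset.sum_const, nsmul_eq_mul]
    have := hA0 i
    have := hD i hi
    gcongr
  rw [h4, h5]
  calc _ ≤ ∑ i ∈ T, D * (A i / 2) + ∑ i ∈ T, D * (A i / 2) := add_le_add h6 h6
    _ = _ := by
      rw [← Finset.sum_add_distrib, Finset.mul_sum]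
      apply Finset.sum_congr rfl; intro i _; ring

lemma wt_int (d M : ℕ) {φ : VV d × ℝ → ℝ} (hφ : ∃ C : ℝ, 0 < C ∧ ∀ y, φ y ≤ C * jw (M + (d + 1)) 1 y) :
    ∃ C : ℝ, 0 < C ∧ ∀ (K : ℝ) (c : VV d × ℝ), 0 < K →
      ∫⁻ X, ENNReal.ofReal ((1 + ‖X - c‖ ^ 2 / K ^ 2) ^ M) * ENNReal.ofReal (φ (K⁻¹ • (X - c))) ≤
        ENNReal.ofReal (C * K ^ (d + 1)) := by
  obtain ⟨C, hC, h⟩ := hφ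
  have hIt : ∫⁻ y : VV d × ℝ, ENNReal.ofReal (jw (d + 1) 1 y) < ∞ :=
    lintegral_jw_lt_top volume (by rw [finrank_X]; omega)
  set I := ∫⁻ y : VV d × ℝ, ENNReal.ofReal (jw (d + 1) 1 y) with hI
  refine ⟨C * (I.toReal + 1), by positivity, fun K c hK => ?_⟩
  calc _ ≤ ∫⁻ X : VV d × ℝ, ENNReal.ofReal C * ENNReal.ofReal (jw (d + 1) K (X - c)) := by
        apply lintegral_mono
        intro X
        dsimp only
        rw [← ENNReal.ofReal_mul (by positivity), ← ENNReal.ofReal_mul hC.le]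
        apply ENNReal.ofReal_le_ofReal
        have h1 := h (K⁻¹ • (X - c))
        rw [← jw_scale _ K hK] at h1
        calc _ ≤ (1 + ‖X - c‖ ^ 2 / K ^ 2) ^ M * (C * jw (M + (d + 1)) K (X - c)) := by gcongr
          _ = C * ((1 + ‖X - c‖ ^ 2 / K ^ 2) ^ M * jw (M + (d + 1)) K (X - c)) := by ring
          _ = _ := by
            unfold jw
            rw [pow_add _ M (d + 1), mul_inv, ← mul_assoc ((1 + ‖X - c‖ ^ 2 / K ^ 2) ^ M), mul_inv_cancel₀ (by positivity), one_mul]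
    _ = ENNReal.ofReal C * (ENNReal.ofReal (K ^ (d + 1)) * I) := by
        rw [lintegral_const_mul' _ _ ENNReal.ofReal_ne_top, lintegral_jw volume _ hK, finrank_X]
    _ ≤ ENNReal.ofReal C * (ENNReal.ofReal (K ^ (d + 1)) * ENNReal.ofReal (I.toReal + 1)) := by
        gcongr
        rw [← ENNReal.ofReal_toReal hIt.ne]
        apply ENNReal.ofReal_le_ofReal; simp
    _ = _ := by
        rw [← ENNReal.ofReal_mul (by positivity), ← ENNReal.ofReal_mul (by positivity)]
        congr 1; ring
end PExt

end

section
namespace PExt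

variable {d : ℕ}

noncomputable def zt (ξ : VV d) : VV d × ℝ := (ξ, ‖ξ‖ ^ 2)

lemma zt_measurable : Measurable (zt : VV d → VV d × ℝ) := by
  have : Continuous (zt : VV d → VV d × ℝ) := by unfold zt; fun_prop
  exact this.measurable

lemma holder_interp {α : Type*} [MeasurableSpace α] {μ : Measure α} {p : ℝ} (hp : 2 ≤ p) (hp4 : p ≤ 4)
    {g Φ : α → ℝ≥0∞} (hg : Measurable g) (hΦ : Measurable Φ) :
    ∫⁻ a, g a ^ (p / 2) * Φ a ∂μ ≤ (∫⁻ a, g a * Φ a ∂μ) ^ (2 - p / 2) * (∫⁻ a, g a ^ 2 * Φ a ∂μ) ^ (p / 2 - 1) := by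
  have h := ENNReal.lintegral_mul_norm_pow_le (μ := μ) (f := fun a => g a * Φ a) (g := fun a => g a ^ 2 * Φ a)
    (hg.mul hΦ).aemeasurable ((hg.pow_const 2).mul hΦ).aemeasurable (p := 2 - p / 2) (q := p / 2 - 1)
    (by linarith) (by linarith) (by ring)
  refine le_trans (le_of_eq ?_) h
  congr 1; ext a
  rw [ENNReal.mul_rpow_of_nonneg _ _ (by linarith), ENNReal.mul_rpow_of_nonneg _ _ (by linarith)]
  have e1 : Φ a ^ (2 - p / 2) * Φ a ^ (p / 2 - 1) = Φ a := by
    rw [← ENNReal.rpow_add_of_nonneg _ _ (by linarith) (by linarith)]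
    ring_nf; exact ENNReal.rpow_one _
  have e2 : g a ^ (2 - p / 2) * (g a ^ 2) ^ (p / 2 - 1) = g a ^ (p / 2) := by
    rw [← ENNReal.rpow_natCast, ← ENNReal.rpow_mul, ← ENNReal.rpow_add_of_nonneg _ _ (by linarith) (by push_cast; linarith)]
    congr 1; push_cast; ring
  calc _ = (g a ^ (2 - p / 2) * (g a ^ 2) ^ (p / 2 - 1)) * (Φ a ^ (2 - p / 2) * Φ a ^ (p / 2 - 1)) := by rw [e1, e2]
    _ = _ := by ring

lemma sigma_bound {ι : Type*} (T : Finset ι) (e : ι → ℝ≥0∞) {p : ℝ} (hp : 2 ≤ p) :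
    (∑ i ∈ T, e i ^ (2 / p)) ^ (p / 2) ≤ (T.card : ℝ≥0∞) ^ (p / 2 - 1) * ∑ i ∈ T, e i := by
  have h := ENNReal.rpow_sum_le_const_mul_sum_rpow T (fun i => e i ^ (2 / p)) (p := p / 2) (by linarith)
  refine h.trans (le_of_eq ?_)
  congr 1
  apply Finset.sum_congr rfl; intro i _
  rw [← ENNReal.rpow_mul, div_mul_div_cancel₀ (by linarith), div_self (by norm_num), ENNReal.rpow_one]

lemma prod_rpow_le (a b : ℝ≥0∞) {p : ℝ} (hp : 0 ≤ p) : (a * b) ^ (p / 4) ≤ a ^ (p / 2) + b ^ (p / 2) := by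
  have main : ∀ a b : ℝ≥0∞, a ≤ b → (a * b) ^ (p / 4) ≤ b ^ (p / 2) := by
    intro a b h
    calc (a * b) ^ (p / 4) ≤ (b * b) ^ (p / 4) := by gcongr
      _ = b ^ (p / 2) := by
        rw [← sq, ← ENNReal.rpow_natCast, ← ENNReal.rpow_mul]; congr 1; push_cast; ring
  rcases le_total a b with h | h
  · exact (main a b h).trans le_add_self
  · rw [mul_comm]; exact (main b a h).trans le_self_add


set_option maxHeartbeats 2000000 in
lemma narrow_core (d : ℕ) {p a B : ℝ} (hp : 2 < p) (hp4 : p ≤ 4) (ha : 0 ≤ a) (hB : 0 ≤ B) :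
    ∃ C R' : ℝ, 0 < C ∧ 0 < R' ∧ ∀ (ι : Type) [DecidableEq ι] (K : ℝ) (c : VV d × ℝ) (T₁ T₂ : Finset ι)
      (f g : ι → VV d → ℂ) (ξ : ι → VV d) (D₀ D₁ : ℕ), 1 ≤ K → (∀ i, Nice (f i) (ξ i) (a / K)) →
      (∀ i, Nice (g i) (ξ i) (a / K)) → (∀ i, ‖ξ i‖ ≤ B) →
      (∀ i ∈ T₁, (T₁.filter (fun j => ‖zt (ξ i) - zt (ξ j)‖ ≤ R' / K)).card ≤ D₀) →
      (∀ i ∈ T₂, (T₂.filter (fun j => ‖zt (ξ i) - zt (ξ j)‖ ≤ R' / K)).card ≤ D₀) →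
      (∀ i ∈ T₁ ×ˢ T₂, ((T₁ ×ˢ T₂).filter (fun j => ‖(zt (ξ i.1) + zt (ξ i.2)) - (zt (ξ j.1) + zt (ξ j.2))‖ ≤ R' / K)).card ≤ D₁) →
      ∫⁻ X in Metric.closedBall c K, (‖∑ i ∈ T₁, Ex (f i) X.1 X.2‖ₑ * ‖∑ i ∈ T₂, Ex (g i) X.1 X.2‖ₑ) ^ (p / 2) ≤
        ENNReal.ofReal (C * K ^ (d + 1)) * (D₀ : ℝ≥0∞) ^ (2 - p / 2) * (D₁ : ℝ≥0∞) ^ (p / 2 - 1) *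
          ((T₁.card : ℝ≥0∞) + T₂.card) ^ (p / 2 - 1) *
          (∑ i ∈ T₁, bb p (2 * (d + 1)) K (f i) c + ∑ i ∈ T₂, bb p (2 * (d + 1)) K (g i) c) := by
  set N := 2 * (d + 1) with hN
  obtain ⟨φ, φc, φi, φ0, φ1, φd, R, hR, φR⟩ := exists_PHI d
  obtain ⟨C₁, hC₁, hpt⟩ := bb_pointwise d N (by omega) (p := p) (by linarith) ha hB
  obtain ⟨C₂, hC₂, hwt⟩ := wt_int d (2 * N) (φd _)
  set L := (a + 1) * (2 * B + a + 1) with hL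
  have hL0 : 0 < L := by positivity
  set C₃ := max C₁ 1 with hC₃
  have hC₃1 : 1 ≤ C₃ := le_max_right _ _
  refine ⟨C₃ ^ 2 * C₂, R + 4 * L, by positivity, by positivity, ?_⟩
  intro ι _ K c T₁ T₂ f g ξ D₀ D₁ hK hf hg hξ hd1 hd2 hd3
  have hK0 : 0 < K := by linarith
  have hp0 : 0 < p := by linarith
  set Φ : VV d × ℝ → ℝ := fun X => φ (K⁻¹ • (X - c)) with hΦ
  have Φc : Continuous Φ := by rw [hΦ]; fun_prop
  have Φ0 : ∀ X, 0 ≤ Φ X := fun X => φ0 _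
  have Φm : Measurable (fun X => ENNReal.ofReal (Φ X)) := Φc.measurable.ennreal_ofReal
  have Φi : Integrable Φ := by
    have h1 : Integrable (fun X => φ (K⁻¹ • X)) := φi.comp_smul (inv_pos.2 hK0).ne'
    exact h1.comp_sub_right c
  have ΦC : Integrable (fun X => (Φ X : ℂ)) := Φi.ofReal
  have ΦR : ∀ ζ, R / K < ‖ζ‖ → ∫ X, (Φ X : ℂ) * ee (pr X ζ) = 0 := fun ζ hζ => PHI_scale φR hK0 c ζ hζ
  set Q := ENNReal.ofReal (C₃ ^ 2 * C₂ * K ^ (d + 1)) with hQ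
  -- pointwise bounds
  have pt : ∀ (h : VV d → ℂ) (η : VV d) (X : VV d × ℝ), Nice h η (a / K) → ‖η‖ ≤ B →
      ‖Ex h X.1 X.2‖ₑ ^ 2 ≤ ENNReal.ofReal (C₃ * (1 + ‖X - c‖ ^ 2 / K ^ 2) ^ N) * bb p N K h c ^ (2 / p) := by
    intro h η X hn hη
    have h1 := hpt h η K X c hn hη hK
    have h2 := ENNReal.rpow_le_rpow h1 (by positivity : 0 ≤ 2 / p)
    rw [← ENNReal.rpow_mul, mul_div_cancel₀ _ hp0.ne', ENNReal.mul_rpow_of_nonneg _ _ (by positivity)] at h2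
    have h3 : ‖Ex h X.1 X.2‖ₑ ^ 2 = ‖Ex h X.1 X.2‖ₑ ^ (2:ℝ) := by rw [← ENNReal.rpow_natCast]; norm_num
    rw [h3]
    refine h2.trans ?_
    gcongr
    have h4 : (1:ℝ) ≤ (1 + ‖X - c‖ ^ 2 / K ^ 2) ^ N := one_le_pow₀ (by
      have : 0 ≤ ‖X - c‖ ^ 2 / K ^ 2 := by positivity
      linarith)
    have h5 : 1 ≤ C₃ * (1 + ‖X - c‖ ^ 2 / K ^ 2) ^ N := by nlinarith
    calc _ ≤ (ENNReal.ofReal (C₃ * (1 + ‖X - c‖ ^ 2 / K ^ 2) ^ N)) ^ (2 / p) := by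
          gcongr; exact le_max_left _ _
      _ ≤ (ENNReal.ofReal (C₃ * (1 + ‖X - c‖ ^ 2 / K ^ 2) ^ N)) ^ (1 : ℝ) := by
          apply ENNReal.rpow_le_rpow_of_exponent_le
          · rw [← ENNReal.ofReal_one]; exact ENNReal.ofReal_le_ofReal h5
          · rw [div_le_one hp0]; linarith
      _ = _ := ENNReal.rpow_one _
  have wtm : Measurable (fun X : VV d × ℝ => ENNReal.ofReal ((1 + ‖X - c‖ ^ 2 / K ^ 2) ^ (2 * N)) * ENNReal.ofReal (Φ X)) :=
    ((by fun_prop : Continuous fun X : VV d × ℝ => (1 + ‖X - c‖ ^ 2 / K ^ 2) ^ (2 * N)).measurable.ennreal_ofReal).mul Φm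
  have A1 : ∀ (h : VV d → ℂ) (η : VV d), Nice h η (a / K) → ‖η‖ ≤ B →
      ∫⁻ X : VV d × ℝ, ‖Ex h X.1 X.2‖ₑ ^ 2 * ENNReal.ofReal (Φ X) ≤ Q * bb p N K h c ^ (2 / p) := by
    intro h η hn hη
    calc _ ≤ ∫⁻ X : VV d × ℝ, (ENNReal.ofReal (C₃ ^ 2) * bb p N K h c ^ (2 / p)) * (ENNReal.ofReal ((1 + ‖X - c‖ ^ 2 / K ^ 2) ^ (2 * N)) * ENNReal.ofReal (Φ X)) := by
          apply lintegral_mono; intro X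
          dsimp only
          have h4 : (1:ℝ) ≤ (1 + ‖X - c‖ ^ 2 / K ^ 2) := by
            have : 0 ≤ ‖X - c‖ ^ 2 / K ^ 2 := by positivity
            linarith
          calc _ ≤ (ENNReal.ofReal (C₃ ^ 2 * (1 + ‖X - c‖ ^ 2 / K ^ 2) ^ (2 * N)) * bb p N K h c ^ (2 / p)) * ENNReal.ofReal (Φ X) := by
                gcongr
                refine (pt h η X hn hη).trans ?_
                gcongr
                · nlinarith
                · omega
            _ = _ := by rw [ENNReal.ofReal_mul (by positivity)]; ring
      _ = (ENNReal.ofReal (C₃ ^ 2) * bb p N K h c ^ (2 / p)) * ∫⁻ X : VV d × ℝ, ENNReal.ofReal ((1 + ‖X - c‖ ^ 2 / K ^ 2) ^ (2 * N)) * ENNReal.ofReal (Φ X) :=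
          lintegral_const_mul _ wtm
      _ ≤ (ENNReal.ofReal (C₃ ^ 2) * bb p N K h c ^ (2 / p)) * ENNReal.ofReal (C₂ * K ^ (d + 1)) := by
          gcongr; exact hwt K c hK0
      _ = _ := by
          rw [hQ, mul_assoc (C₃ ^ 2), ENNReal.ofReal_mul (by positivity : 0 ≤ C₃ ^ 2)]; ring
  have A2 : ∀ (h k : VV d → ℂ) (η θ : VV d), Nice h η (a / K) → ‖η‖ ≤ B → Nice k θ (a / K) → ‖θ‖ ≤ B →
      ∫⁻ X : VV d × ℝ, ‖Ex h X.1 X.2 * Ex k X.1 X.2‖ₑ ^ 2 * ENNReal.ofReal (Φ X) ≤ Q * (bb p N K h c ^ (2 / p) * bb p N K k c ^ (2 / p)) := by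
    intro h k η θ hn hη kn hθ
    calc _ ≤ ∫⁻ X : VV d × ℝ, (ENNReal.ofReal (C₃ ^ 2) * (bb p N K h c ^ (2 / p) * bb p N K k c ^ (2 / p))) * (ENNReal.ofReal ((1 + ‖X - c‖ ^ 2 / K ^ 2) ^ (2 * N)) * ENNReal.ofReal (Φ X)) := by
          apply lintegral_mono; intro X
          dsimp only
          rw [enorm_mul, mul_pow]
          calc _ ≤ ((ENNReal.ofReal (C₃ * (1 + ‖X - c‖ ^ 2 / K ^ 2) ^ N) * bb p N K h c ^ (2 / p)) * (ENNReal.ofReal (C₃ * (1 + ‖X - c‖ ^ 2 / K ^ 2) ^ N) * bb p N K k c ^ (2 / p))) * ENNReal.ofReal (Φ X) := by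
                gcongr
                · exact pt h η X hn hη
                · exact pt k θ X kn hθ
            _ = _ := by
                have e : (1 + ‖X - c‖ ^ 2 / K ^ 2) ^ (2 * N) = (1 + ‖X - c‖ ^ 2 / K ^ 2) ^ N * (1 + ‖X - c‖ ^ 2 / K ^ 2) ^ N := by
                  rw [two_mul, pow_add]
                rw [ENNReal.ofReal_mul (by positivity : 0 ≤ C₃), e, ENNReal.ofReal_mul (by positivity : 0 ≤ (1 + ‖X - c‖ ^ 2 / K ^ 2) ^ N),
                  sq C₃, ENNReal.ofReal_mul (by positivity : 0 ≤ C₃)]; ring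
      _ = (ENNReal.ofReal (C₃ ^ 2) * (bb p N K h c ^ (2 / p) * bb p N K k c ^ (2 / p))) * ∫⁻ X : VV d × ℝ, ENNReal.ofReal ((1 + ‖X - c‖ ^ 2 / K ^ 2) ^ (2 * N)) * ENNReal.ofReal (Φ X) :=
          lintegral_const_mul _ wtm
      _ ≤ (ENNReal.ofReal (C₃ ^ 2) * (bb p N K h c ^ (2 / p) * bb p N K k c ^ (2 / p))) * ENNReal.ofReal (C₂ * K ^ (d + 1)) := by
          gcongr; exact hwt K c hK0
      _ = _ := by
          rw [hQ, mul_assoc (C₃ ^ 2), ENNReal.ofReal_mul (by positivity : 0 ≤ C₃ ^ 2)]; ring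
  -- continuity and boundedness
  have uc : ∀ (h : VV d → ℂ) (η : VV d), Nice h η (a / K) → Continuous (fun X : VV d × ℝ => Ex h X.1 X.2) :=
    fun h η hn => Ex_continuous hn.integrable
  have nr : ∀ (h : VV d → ℂ) (η y : VV d), Nice h η (a / K) → ‖η‖ ≤ B → h y ≠ 0 → ‖zt y - zt η‖ ≤ L / K :=
    fun h η y hn hη hy => hn.near ha hη hK hy
  -- L2
  have S2 : ∀ (T : Finset ι) (h : ι → VV d → ℂ), (∀ i, Nice (h i) (ξ i) (a / K)) →
      (∀ i ∈ T, (T.filter (fun j => ‖zt (ξ i) - zt (ξ j)‖ ≤ (R + 4 * L) / K)).card ≤ D₀) →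
      ∫⁻ X : VV d × ℝ, ‖∑ i ∈ T, Ex (h i) X.1 X.2‖ₑ ^ 2 * ENNReal.ofReal (Φ X) ≤ D₀ * Q * ∑ i ∈ T, bb p N K (h i) c ^ (2 / p) := by
    intro T h hh hD
    have hsch := schur T (fun i X => Ex (h i) X.1 X.2) (fun i => uc _ _ (hh i)) (fun i => ⟨_, fun X => norm_Ex_le _ _ _⟩)
      Φ0 Φi (fun i j => ‖zt (ξ i) - zt (ξ j)‖ ≤ (R + 4 * L) / K) (fun i j hij => by rwa [norm_sub_rev]) ?_ D₀ hD
    · refine hsch.trans ?_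
      rw [mul_assoc]
      refine mul_le_mul_right ?_ _
      rw [Finset.mul_sum]
      exact Finset.sum_le_sum fun i hi => A1 _ _ (hh i) (hξ i)
    · intro i _ j _ hij
      simp only [Ex_eq_osc]
      refine osc_orth (hh i).integrable zt_measurable (hh j).integrable zt_measurable ΦC ΦR ?_
      intro y z hy hz
      change R / K < ‖zt y - zt z‖
      have h1 := nr _ _ y (hh i) (hξ i) hy
      have h2 := nr _ _ z (hh j) (hξ j) hz
      push Not at hij
      have h3 : ‖zt (ξ i) - zt (ξ j)‖ ≤ ‖zt y - zt z‖ + ‖zt y - zt (ξ i)‖ + ‖zt z - zt (ξ j)‖ := by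
        calc _ = ‖(zt y - zt z) - (zt y - zt (ξ i)) + (zt z - zt (ξ j))‖ := by congr 1; abel
          _ ≤ _ := (norm_add_le _ _).trans (by gcongr; exact norm_sub_le _ _)
      have h4 : (R + 4 * L) / K = R / K + 4 * (L / K) := by ring
      have : 0 < L / K := by positivity
      linarith
  -- L4
  have S4 : ∫⁻ X : VV d × ℝ, ‖(∑ i ∈ T₁, Ex (f i) X.1 X.2) * ∑ i ∈ T₂, Ex (g i) X.1 X.2‖ₑ ^ 2 * ENNReal.ofReal (Φ X) ≤
      D₁ * Q * ((∑ i ∈ T₁, bb p N K (f i) c ^ (2 / p)) * ∑ i ∈ T₂, bb p N K (g i) c ^ (2 / p)) := by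
    have hsch := schur (T₁ ×ˢ T₂) (fun i X => Ex (f i.1) X.1 X.2 * Ex (g i.2) X.1 X.2)
      (fun i => (uc _ _ (hf i.1)).mul (uc _ _ (hg i.2)))
      (fun i => ⟨(∫ ξ, ‖f i.1 ξ‖) * ∫ ξ, ‖g i.2 ξ‖, fun X => by
        rw [norm_mul]
        exact mul_le_mul (norm_Ex_le _ _ _) (norm_Ex_le _ _ _) (norm_nonneg _) (integral_nonneg fun _ => norm_nonneg _)⟩)
      Φ0 Φi (fun i j => ‖(zt (ξ i.1) + zt (ξ i.2)) - (zt (ξ j.1) + zt (ξ j.2))‖ ≤ (R + 4 * L) / K)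
      (fun i j hij => by rwa [norm_sub_rev]) ?_ D₁ hd3
    · simp_rw [Finset.sum_mul_sum, ← Finset.sum_product']
      refine hsch.trans ?_
      rw [mul_assoc]
      refine mul_le_mul_right ?_ _
      rw [Finset.mul_sum]
      exact Finset.sum_le_sum fun i hi => A2 _ _ _ _ (hf _) (hξ _) (hg _) (hξ _)
    · intro i _ j _ hij
      simp only [Ex_eq_osc, osc_mul]
      refine osc_orth ((hf i.1).integrable.mul_prod (hg i.2).integrable)
        ((zt_measurable.comp measurable_fst).add (zt_measurable.comp measurable_snd))
        ((hf j.1).integrable.mul_prod (hg j.2).integrable)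
        ((zt_measurable.comp measurable_fst).add (zt_measurable.comp measurable_snd)) ΦC ΦR ?_
      intro y z hy hz
      change R / K < ‖(zt y.1 + zt y.2) - (zt z.1 + zt z.2)‖
      have h1 := nr _ _ y.1 (hf i.1) (hξ _) (left_ne_zero_of_mul hy)
      have h1' := nr _ _ y.2 (hg i.2) (hξ _) (right_ne_zero_of_mul hy)
      have h2 := nr _ _ z.1 (hf j.1) (hξ _) (left_ne_zero_of_mul hz)
      have h2' := nr _ _ z.2 (hg j.2) (hξ _) (right_ne_zero_of_mul hz)
      push Not at hij
      have h3 : ‖(zt (ξ i.1) + zt (ξ i.2)) - (zt (ξ j.1) + zt (ξ j.2))‖ ≤ ‖(zt y.1 + zt y.2) - (zt z.1 + zt z.2)‖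
          + ‖zt y.1 - zt (ξ i.1)‖ + ‖zt y.2 - zt (ξ i.2)‖ + ‖zt z.1 - zt (ξ j.1)‖ + ‖zt z.2 - zt (ξ j.2)‖ := by
        calc _ = ‖((zt y.1 + zt y.2) - (zt z.1 + zt z.2)) - (zt y.1 - zt (ξ i.1)) - (zt y.2 - zt (ξ i.2)) + (zt z.1 - zt (ξ j.1)) + (zt z.2 - zt (ξ j.2))‖ := by congr 1; abel
          _ ≤ _ := by
            refine (norm_add_le _ _).trans ?_
            gcongr
            refine (norm_add_le _ _).trans ?_
            gcongr
            refine (norm_sub_le _ _).trans ?_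
            gcongr
            exact norm_sub_le _ _
      have h4 : (R + 4 * L) / K = R / K + 4 * (L / K) := by ring
      linarith
  set s₁ := ∑ i ∈ T₁, bb p N K (f i) c ^ (2 / p) with hs₁
  set s₂ := ∑ i ∈ T₂, bb p N K (g i) c ^ (2 / p) with hs₂
  have m1 : Measurable (fun X : VV d × ℝ => ‖∑ i ∈ T₁, Ex (f i) X.1 X.2‖ₑ) :=
    (Finset.measurable_sum _ fun i _ => (uc _ _ (hf i)).measurable).enorm
  have m2 : Measurable (fun X : VV d × ℝ => ‖∑ i ∈ T₂, Ex (g i) X.1 X.2‖ₑ) :=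
    (Finset.measurable_sum _ fun i _ => (uc _ _ (hg i)).measurable).enorm
  set G : VV d × ℝ → ℝ≥0∞ := fun X => ‖∑ i ∈ T₁, Ex (f i) X.1 X.2‖ₑ * ‖∑ i ∈ T₂, Ex (g i) X.1 X.2‖ₑ with hG
  have hGm : Measurable G := m1.mul m2
  have I1 : ∫⁻ X, G X * ENNReal.ofReal (Φ X) ≤ (D₀ * Q) * (s₁ * s₂) ^ ((1:ℝ) / 2) := by
    have e : ∀ x : ℝ≥0∞, (x ^ ((1:ℝ) / 2)) ^ 2 = x := fun x => by
      rw [← ENNReal.rpow_natCast, ← ENNReal.rpow_mul]; norm_num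
    have e' : ∀ x : ℝ≥0∞, (x ^ 2) ^ ((1:ℝ) / 2) = x := fun x => by
      rw [← ENNReal.rpow_natCast, ← ENNReal.rpow_mul]; norm_num
    have hcs := cs_lint (μ := (volume : Measure (VV d × ℝ)))
      (f := fun X => ‖∑ i ∈ T₁, Ex (f i) X.1 X.2‖ₑ * ENNReal.ofReal (Φ X) ^ ((1:ℝ)/2))
      (g := fun X => ‖∑ i ∈ T₂, Ex (g i) X.1 X.2‖ₑ * ENNReal.ofReal (Φ X) ^ ((1:ℝ)/2))
      (m1.mul (Φm.pow_const _)).aemeasurable (m2.mul (Φm.pow_const _)).aemeasurable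
    simp only [mul_pow, e] at hcs
    have e3 : ∀ X : VV d × ℝ, ‖∑ i ∈ T₁, Ex (f i) X.1 X.2‖ₑ * ENNReal.ofReal (Φ X) ^ ((1:ℝ)/2) * (‖∑ i ∈ T₂, Ex (g i) X.1 X.2‖ₑ * ENNReal.ofReal (Φ X) ^ ((1:ℝ)/2)) = G X * ENNReal.ofReal (Φ X) := by
      intro X
      calc _ = G X * (ENNReal.ofReal (Φ X) ^ ((1:ℝ)/2)) ^ 2 := by rw [hG]; ring
        _ = _ := by rw [e]
    simp only [e3] at hcs
    have h2 := hcs.trans (mul_le_mul' (S2 T₁ f hf hd1) (S2 T₂ g hg hd2))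
    have h3 := ENNReal.rpow_le_rpow h2 (by norm_num : (0:ℝ) ≤ 1 / 2)
    rw [e'] at h3
    refine h3.trans (le_of_eq ?_)
    rw [show (D₀ : ℝ≥0∞) * Q * s₁ * (D₀ * Q * s₂) = (D₀ * Q) ^ 2 * (s₁ * s₂) by ring,
      ENNReal.mul_rpow_of_nonneg _ _ (by norm_num), e']
  have I2 : ∫⁻ X, G X ^ 2 * ENNReal.ofReal (Φ X) ≤ (D₁ * Q) * (s₁ * s₂) := by
    refine le_trans (le_of_eq ?_) S4
    congr 1; ext X
    rw [hG, enorm_mul]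
  calc ∫⁻ X in Metric.closedBall c K, G X ^ (p / 2)
      ≤ ∫⁻ X in Metric.closedBall c K, G X ^ (p / 2) * ENNReal.ofReal (Φ X) := by
        apply setLIntegral_mono ((hGm.pow_const _).mul Φm)
        intro X hX
        have h1 : 1 ≤ Φ X := by
          apply φ1
          rw [norm_smul, norm_inv, Real.norm_eq_abs, abs_of_pos hK0, inv_mul_le_iff₀ hK0, mul_one]
          simpa [dist_eq_norm] using hX
        calc _ = G X ^ (p / 2) * 1 := (mul_one _).symm
          _ ≤ _ := by
            refine mul_le_mul_right ?_ _
            rw [← ENNReal.ofReal_one]; exact ENNReal.ofReal_le_ofReal h1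
    _ ≤ ∫⁻ X, G X ^ (p / 2) * ENNReal.ofReal (Φ X) := setLIntegral_le_lintegral _ _
    _ ≤ _ := holder_interp hp.le hp4 hGm Φm
    _ ≤ ((D₀ * Q) * (s₁ * s₂) ^ ((1:ℝ) / 2)) ^ (2 - p / 2) * ((D₁ * Q) * (s₁ * s₂)) ^ (p / 2 - 1) :=
        mul_le_mul' (ENNReal.rpow_le_rpow I1 (by linarith)) (ENNReal.rpow_le_rpow I2 (by linarith))
    _ = Q * (D₀ : ℝ≥0∞) ^ (2 - p / 2) * (D₁ : ℝ≥0∞) ^ (p / 2 - 1) * (s₁ * s₂) ^ (p / 4) := by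
        have h1 : (0:ℝ) ≤ 2 - p / 2 := by linarith
        have h2 : (0:ℝ) ≤ p / 2 - 1 := by linarith
        rw [ENNReal.mul_rpow_of_nonneg _ _ h1, ENNReal.mul_rpow_of_nonneg _ _ h1, ENNReal.mul_rpow_of_nonneg (D₁ * Q) _ h2,
          ENNReal.mul_rpow_of_nonneg _ _ h2, ← ENNReal.rpow_mul]
        have e1 : Q ^ (2 - p / 2) * Q ^ (p / 2 - 1) = Q := by
          rw [← ENNReal.rpow_add_of_nonneg _ _ h1 h2]
          ring_nf; exact ENNReal.rpow_one _
        have e2 : (s₁ * s₂) ^ ((1:ℝ) / 2 * (2 - p / 2)) * (s₁ * s₂) ^ (p / 2 - 1) = (s₁ * s₂) ^ (p / 4) := by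
          rw [← ENNReal.rpow_add_of_nonneg _ _ (by linarith) h2]
          congr 1; ring
        calc _ = (Q ^ (2 - p / 2) * Q ^ (p / 2 - 1)) * (D₀ : ℝ≥0∞) ^ (2 - p / 2) * (D₁ : ℝ≥0∞) ^ (p / 2 - 1) * ((s₁ * s₂) ^ ((1:ℝ) / 2 * (2 - p / 2)) * (s₁ * s₂) ^ (p / 2 - 1)) := by ring
          _ = _ := by rw [e1, e2]
    _ ≤ Q * (D₀ : ℝ≥0∞) ^ (2 - p / 2) * (D₁ : ℝ≥0∞) ^ (p / 2 - 1) * (((T₁.card : ℝ≥0∞) + T₂.card) ^ (p / 2 - 1) *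
          (∑ i ∈ T₁, bb p N K (f i) c + ∑ i ∈ T₂, bb p N K (g i) c)) := by
        gcongr
        refine (prod_rpow_le _ _ hp0.le).trans ?_
        rw [mul_add]
        apply add_le_add
        · refine (sigma_bound T₁ _ hp.le).trans ?_
          gcongr
          · linarith
          · exact le_self_add
        · refine (sigma_bound T₂ _ hp.le).trans ?_
          gcongr
          · linarith
          · exact le_add_self
    _ = _ := by ring
end PExt

end

section
namespace PExt

variable {d : ℕ}

lemma card_sep {E ι : Type*} [NormedAddCommGroup E] [NormedSpace ℝ E] [FiniteDimensional ℝ E]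
    (T : Finset ι) (v : ι → E) {r R : ℝ} (hr : 0 < r) (hR : 0 ≤ R) (y : E)
    (hs : ∀ i ∈ T, ∀ j ∈ T, i ≠ j → r ≤ ‖v i - v j‖) (hb : ∀ i ∈ T, ‖v i - y‖ ≤ R) :
    (T.card : ℝ) ≤ (1 + 2 * R / r) ^ Module.finrank ℝ E := by
  borelize E
  let μ : Measure E := Measure.addHaar
  have ρpos : 0 < R + r / 2 := by positivity
  have r2 : 0 < r / 2 := by positivity
  have D : Set.PairwiseDisjoint (T : Set ι) (fun i => Metric.ball (v i) (r / 2)) := by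
    intro c hc d hd hcd
    apply Metric.ball_disjoint_ball
    rw [dist_eq_norm]
    have := hs c hc d hd hcd
    linarith
  have I : (T.card : ℝ≥0∞) * ENNReal.ofReal ((r / 2) ^ Module.finrank ℝ E) * μ (Metric.ball 0 1) ≤
      ENNReal.ofReal ((R + r / 2) ^ Module.finrank ℝ E) * μ (Metric.ball 0 1) :=
    calc _ = μ (⋃ i ∈ T, Metric.ball (v i) (r / 2)) := by
          rw [measure_biUnion_finset D fun c _ => measurableSet_ball]
          simp only [μ.addHaar_ball_of_pos _ r2]
          simp only [Finset.sum_const, nsmul_eq_mul, mul_assoc]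
      _ ≤ μ (Metric.ball y (R + r / 2)) := by
          apply measure_mono
          refine Set.iUnion₂_subset fun i hi => ?_
          apply Metric.ball_subset_ball'
          rw [dist_eq_norm]
          linarith [hb i hi]
      _ = _ := by simp only [μ.addHaar_ball_of_pos _ ρpos]
  have J : (T.card : ℝ≥0∞) * ENNReal.ofReal ((r / 2) ^ Module.finrank ℝ E) ≤ ENNReal.ofReal ((R + r / 2) ^ Module.finrank ℝ E) :=
    (ENNReal.mul_le_mul_iff_left (Metric.measure_ball_pos _ _ zero_lt_one).ne' measure_ball_lt_top.ne).1 I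
  have K := ENNReal.toReal_le_of_le_ofReal (pow_nonneg ρpos.le _) J
  rw [ENNReal.toReal_mul, ENNReal.toReal_natCast, ENNReal.toReal_ofReal (by positivity), ← le_div_iff₀ (by positivity), ← div_pow] at K
  have e : (R + r / 2) / (r / 2) = 1 + 2 * R / r := by field_simp; ring
  rwa [e] at K

lemma count_net {F ι : Type*} [DecidableEq ι] [NormedAddCommGroup F] [NormedSpace ℝ F] [FiniteDimensional ℝ F]
    (T : Finset ι) (u : ι → F) {r R D : ℝ} (hr : 0 < r) (hR : 0 ≤ R) (hD : 0 ≤ D) (y : F)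
    (hc : ∀ i ∈ T, ((T.filter (fun j => ‖u i - u j‖ ≤ r)).card : ℝ) ≤ D) (hb : ∀ i ∈ T, ‖u i - y‖ ≤ R) :
    (T.card : ℝ) ≤ D * (1 + 2 * R / r) ^ Module.finrank ℝ F := by
  classical
  let sepd : Finset ι → Prop := fun S => ∀ i ∈ S, ∀ j ∈ S, i ≠ j → r ≤ ‖u i - u j‖
  obtain ⟨S, hS, hmax⟩ := Finset.exists_max_image (T.powerset.filter sepd) Finset.card
    ⟨∅, by simp [sepd]⟩
  rw [Finset.mem_filter, Finset.mem_powerset] at hS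
  have cov : T ⊆ S.biUnion (fun i => T.filter (fun j => ‖u i - u j‖ ≤ r)) := by
    intro j hj
    rw [Finset.mem_biUnion]
    by_contra hcon
    push Not at hcon
    have far : ∀ i ∈ S, r < ‖u i - u j‖ := by
      intro i hi
      have := hcon i hi
      rw [Finset.mem_filter] at this
      push Not at this
      exact this hj
    have hjS : j ∉ S := fun h => by
      have := far j h
      simp at this
      linarith
    have h1 := hmax (insert j S) (by
      rw [Finset.mem_filter, Finset.mem_powerset]
      refine ⟨Finset.insert_subset hj hS.1, ?_⟩
      intro a ha b hb hab
      rw [Finset.mem_insert] at ha hb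
      rcases ha with rfl | ha <;> rcases hb with rfl | hb
      · exact absurd rfl hab
      · rw [norm_sub_rev]; exact (far b hb).le
      · exact (far a ha).le
      · exact hS.2 a ha b hb hab)
    rw [Finset.card_insert_of_notMem hjS] at h1
    omega
  have h1 := card_sep S u hr hR y hS.2 (fun i hi => hb i (hS.1 hi))
  have h2 : (T.card : ℝ) ≤ ∑ i ∈ S, ((T.filter (fun j => ‖u i - u j‖ ≤ r)).card : ℝ) := by
    exact_mod_cast (Finset.card_le_card cov).trans Finset.card_biUnion_le
  calc (T.card : ℝ) ≤ _ := h2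
    _ ≤ ∑ i ∈ S, D := Finset.sum_le_sum fun i hi => hc i (hS.1 hi)
    _ = D * S.card := by rw [Finset.sum_const, nsmul_eq_mul]; ring
    _ ≤ _ := by gcongr

lemma trans_one (ξ : Fin 1 → VV d) : Trans 1 ξ := by
  intro z
  unfold LL
  rw [Fin.sum_univ_one]
  have h1 : ‖z‖ ≤ |z 0| := by
    rw [pi_norm_le_iff_of_nonneg (abs_nonneg _)]
    intro i
    rw [Subsingleton.elim i 0]; exact le_rfl
  calc 1 * ‖z‖ ≤ |z 0| := by linarith
    _ = ‖(z 0 • vv (ξ 0)).2‖ := by simp [vv]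
    _ ≤ _ := norm_snd_le _

lemma trans_step {j : ℕ} {c B ε : ℝ} (hc : 0 < c) (hB : 0 ≤ B) (hε : 0 < ε) : ∃ c' > 0, ∀ (ξ : Fin (j + 1) → VV d) (η : VV d),
    Trans c ξ → (∀ i, ‖ξ i‖ ≤ B) → ‖η‖ ≤ B →
    (∀ u ∈ Submodule.span ℝ (Set.range fun i : Fin j => ξ i.succ - ξ 0), ε ≤ ‖η - ξ 0 - u‖) →
    Trans c' (Fin.snoc (α := fun _ => VV d) ξ η) := by
  set A := (1 / 2 + B) / ε with hA
  have hA0 : 0 < A := by positivity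
  refine ⟨(A + (1 + (2 * B + 1) * A) / c)⁻¹, by positivity, ?_⟩
  intro ξ η hT hξ hη hu z
  set W := LL (fun i => vv ((Fin.snoc (α := fun _ => VV d) ξ η : Fin (j+2) → VV d) i)) z with hW
  have hW1 : W = LL (fun i => vv (ξ i)) (fun i => z i.castSucc) + z (Fin.last _) • vv η := by
    rw [hW]; unfold LL
    rw [Fin.sum_univ_castSucc]
    simp
  set zk := z (Fin.last _) with hzk
  have key : |zk| * ε ≤ (1 / 2 + B) * ‖W‖ := by
    have e1 : W.1 = -(2:ℝ) • (∑ i, z i.castSucc • ξ i + zk • η) := by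
      rw [hW1]; unfold LL vv
      simp [Prod.fst_sum, smul_add, Finset.smul_sum, smul_smul, mul_comm]
    have e2 : W.2 = ∑ i : Fin (j+1), z i.castSucc + zk := by
      rw [hW1]; unfold LL vv
      simp [Prod.snd_sum]
    have e3 : ∑ i, z i.castSucc • ξ i + zk • η - W.2 • ξ 0 = (∑ i : Fin j, z i.succ.castSucc • (ξ i.succ - ξ 0)) + zk • (η - ξ 0) := by
      rw [e2, Fin.sum_univ_succ (f := fun i => z i.castSucc • ξ i), Fin.sum_univ_succ (f := fun i : Fin (j+1) => z i.castSucc)]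
      simp only [add_smul, Finset.sum_smul, smul_sub, Finset.sum_sub_distrib]
      abel
    have e4 : ‖∑ i, z i.castSucc • ξ i + zk • η - W.2 • ξ 0‖ ≤ (1 / 2 + B) * ‖W‖ := by
      have h1 : ‖∑ i, z i.castSucc • ξ i + zk • η‖ ≤ 1 / 2 * ‖W‖ := by
        have := norm_fst_le W
        rw [e1, norm_smul] at this
        simp at this ⊢
        linarith
      have h2 : ‖W.2 • ξ 0‖ ≤ ‖W‖ * B := by
        rw [norm_smul]
        exact mul_le_mul (norm_snd_le W) (hξ 0) (norm_nonneg _) (norm_nonneg _)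
      calc _ ≤ _ := norm_sub_le _ _
        _ ≤ 1 / 2 * ‖W‖ + ‖W‖ * B := add_le_add h1 h2
        _ = _ := by ring
    refine le_trans ?_ e4
    rw [e3]
    by_cases h0 : zk = 0
    · simp [h0]
    set q := ∑ i : Fin j, z i.succ.castSucc • (ξ i.succ - ξ 0) with hq
    have hqm : q ∈ Submodule.span ℝ (Set.range fun i : Fin j => ξ i.succ - ξ 0) :=
      Submodule.sum_mem _ fun i _ => Submodule.smul_mem _ _ (Submodule.subset_span ⟨i, rfl⟩)
    have h2 := hu (-(zk⁻¹) • q) (Submodule.smul_mem _ _ hqm)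
    have h3 : q + zk • (η - ξ 0) = zk • (η - ξ 0 - -(zk⁻¹) • q) := by
      rw [smul_sub zk (η - ξ 0), smul_smul]
      rw [mul_neg, mul_inv_cancel₀ h0]
      simp [add_comm]
    rw [h3, norm_smul, Real.norm_eq_abs]
    gcongr
  have hzk' : |zk| ≤ A * ‖W‖ := by
    rw [hA, div_mul_eq_mul_div, le_div_iff₀ hε]; exact key
  have h5 : c * ‖(fun i : Fin (j+1) => z i.castSucc)‖ ≤ (1 + (2 * B + 1) * A) * ‖W‖ := by
    refine (hT _).trans ?_
    have : LL (fun i => vv (ξ i)) (fun i => z i.castSucc) = W - zk • vv η := by rw [hW1]; abel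
    rw [this]
    refine (norm_sub_le _ _).trans ?_
    rw [norm_smul, Real.norm_eq_abs]
    have h6 := vv_norm_le hB hη
    have : |zk| * ‖vv η‖ ≤ A * ‖W‖ * (2 * B + 1) := mul_le_mul hzk' h6 (norm_nonneg _) (by positivity)
    nlinarith
  have h6 : ‖(fun i : Fin (j+1) => z i.castSucc)‖ ≤ (1 + (2 * B + 1) * A) / c * ‖W‖ := by
    rw [div_mul_eq_mul_div, le_div_iff₀ hc]; linarith
  rw [inv_mul_le_iff₀ (by positivity)]
  rw [pi_norm_le_iff_of_nonneg (by positivity)]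
  intro i
  refine Fin.lastCases ?_ (fun i => ?_) i
  · rw [Real.norm_eq_abs]
    refine hzk'.trans ?_
    rw [add_mul]
    have : 0 ≤ (1 + (2 * B + 1) * A) / c * ‖W‖ := by positivity
    linarith
  · refine (norm_le_pi_norm (fun i : Fin (j+1) => z i.castSucc) i).trans (h6.trans ?_)
    rw [add_mul]
    have : 0 ≤ A * ‖W‖ := by positivity
    linarith

lemma trans_alt {B ε : ℝ} (hB : 0 ≤ B) (hε : 0 < ε) (j : ℕ) : ∃ c > 0, ∀ P : Set (VV d), P.Nonempty → (∀ x ∈ P, ‖x‖ ≤ B) →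
    (∃ ξ : Fin (j + 1) → VV d, (∀ i, ξ i ∈ P) ∧ Trans c ξ) ∨
    (∃ (y : VV d) (D : Submodule ℝ (VV d)), Module.finrank ℝ D < j ∧ ∀ x ∈ P, ∃ u ∈ D, ‖x - y - u‖ ≤ ε) := by
  induction j with
  | zero =>
    refine ⟨1, one_pos, ?_⟩
    rintro P ⟨x, hx⟩ _
    exact Or.inl ⟨fun _ => x, fun _ => hx, trans_one _⟩
  | succ j ih =>
    obtain ⟨c, hc, h⟩ := ih
    obtain ⟨c', hc', h'⟩ := trans_step (d := d) (j := j) hc hB hε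
    refine ⟨c', hc', ?_⟩
    intro P hP hPB
    rcases h P hP hPB with ⟨ξ, hξ, hT⟩ | ⟨y, D, hD, hy⟩
    · by_cases hall : ∀ x ∈ P, ∃ u ∈ Submodule.span ℝ (Set.range fun i : Fin j => ξ i.succ - ξ 0), ‖x - ξ 0 - u‖ ≤ ε
      · right
        refine ⟨ξ 0, _, ?_, hall⟩
        have := finrank_range_le_card (R := ℝ) (fun i : Fin j => ξ i.succ - ξ 0)
        simp [Set.finrank] at this
        omega
      · push Not at hall
        obtain ⟨η, hη, hu⟩ := hall
        left
        refine ⟨Fin.snoc (α := fun _ => VV d) ξ η, ?_, h' ξ η hT (fun i => hPB _ (hξ i)) (hPB _ hη) (fun u hu' => (hu u hu').le)⟩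
        intro i
        refine Fin.lastCases ?_ (fun i => ?_) i
        · simpa using hη
        · simpa using hξ i
    · exact Or.inr ⟨y, D, by omega, hy⟩
end PExt

end

section
namespace PExt

variable {d : ℕ}

lemma proj_near (D : Submodule ℝ (VV d)) (x u : VV d) (hu : u ∈ D) : ‖x - D.starProjection x‖ ≤ ‖x - u‖ := by
  rw [Submodule.starProjection_minimal]
  exact ciInf_le (f := fun x_1 : D => ‖x - (x_1 : VV d)‖) ⟨0, by rintro _ ⟨y, rfl⟩; exact norm_nonneg _⟩ ⟨u, hu⟩

lemma proj_pair (D : Submodule ℝ (VV d)) {x x' y : VV d} {l : ℝ} (h : ∃ u ∈ D, ‖x - y - u‖ ≤ l) (h' : ∃ u ∈ D, ‖x' - y - u‖ ≤ l) :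
    ‖(x - x') - D.starProjection (x - x')‖ ≤ 2 * l := by
  obtain ⟨u, hu, h1⟩ := h
  obtain ⟨u', hu', h1'⟩ := h'
  refine (proj_near D (x - x') (u - u') (D.sub_mem hu hu')).trans ?_
  calc _ = ‖(x - y - u) - (x' - y - u')‖ := by congr 1; abel
    _ ≤ _ := (norm_sub_le _ _).trans (by linarith)

/-- number of separated points near a point -/
lemma count_ball {ι : Type*} (T : Finset ι) (ξ : ι → VV d) {K R : ℝ} (hK : 1 ≤ K) (hR : 0 ≤ R)
    (hs : ∀ i ∈ T, ∀ j ∈ T, i ≠ j → 1 / K ≤ ‖ξ i - ξ j‖) (y : VV d) (h : ∀ i ∈ T, ‖ξ i - y‖ ≤ R / K) :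
    (T.card : ℝ) ≤ (1 + 2 * R) ^ d := by
  have := card_sep T ξ (r := 1 / K) (R := R / K) (by positivity) (by positivity) y hs h
  rw [finrank_VV] at this
  convert this using 3
  have : K ≠ 0 := by positivity
  field_simp

lemma count_slab {ι : Type*} [DecidableEq ι] (T : Finset ι) (ξ : ι → VV d) {K L B : ℝ} (hK : 1 ≤ K) (hL : 0 ≤ L) (hB : 0 ≤ B)
    (hs : ∀ i ∈ T, ∀ j ∈ T, i ≠ j → 1 / K ≤ ‖ξ i - ξ j‖) (hξ : ∀ i ∈ T, ‖ξ i‖ ≤ B) (D : Submodule ℝ (VV d)) (y : VV d)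
    {m : ℕ} (hm : Module.finrank ℝ D ≤ m)
    (h : ∀ i ∈ T, ∃ u ∈ D, ‖ξ i - y - u‖ ≤ L / K) :
    (T.card : ℝ) ≤ (1 + 2 * (1 + 2 * L)) ^ d * (1 + 2 * B) ^ m * K ^ m := by
  have hK0 : 0 < K := by linarith
  have h1 := count_net T (fun i => (⟨D.starProjection (ξ i), D.starProjection_apply_mem _⟩ : D)) (r := 1 / K) (R := B)
    (D := (1 + 2 * (1 + 2 * L)) ^ d) (by positivity) hB (by positivity) 0 ?_ ?_
  · refine h1.trans ?_
    rw [mul_assoc, ← mul_pow]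
    gcongr
    calc (1 + 2 * B / (1 / K)) ^ Module.finrank ℝ D ≤ ((1 + 2 * B) * K) ^ Module.finrank ℝ D := by
          gcongr
          rw [div_div_eq_mul_div, div_one]; nlinarith
      _ ≤ _ := pow_le_pow_right₀ (by nlinarith) hm
  · intro i hi
    apply count_ball _ ξ hK (by positivity) (fun a ha b hb => hs a (Finset.mem_of_mem_filter _ ha) b (Finset.mem_of_mem_filter _ hb)) (ξ i)
    intro j hj
    rw [Finset.mem_filter] at hj
    have h2 : ‖D.starProjection (ξ j - ξ i)‖ ≤ 1 / K := by
      rw [map_sub, norm_sub_rev]; exact hj.2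
    have h3 := proj_pair D (h j hj.1) (h i hi)
    calc _ = ‖((ξ j - ξ i) - D.starProjection (ξ j - ξ i)) + D.starProjection (ξ j - ξ i)‖ := by congr 1; abel
      _ ≤ _ := norm_add_le _ _
      _ ≤ 2 * (L / K) + 1 / K := add_le_add h3 h2
      _ = _ := by ring
  · intro i hi
    rw [sub_zero]
    exact (D.norm_starProjection_apply_le _).trans (hξ i hi)

set_option maxHeartbeats 1000000 in
lemma count_pair (d m : ℕ) {ρ B L R : ℝ} (hρ : 0 < ρ) (hB : 0 ≤ B) (hL : 0 ≤ L) (hR : 0 ≤ R) : ∃ C > 0,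
    ∀ (ι : Type) [DecidableEq ι] (T₁ T₂ : Finset ι) (ξ : ι → VV d) (K : ℝ) (D : Submodule ℝ (VV d)) (y₀ : VV d),
      1 ≤ K → L ≤ 8 * ρ * K → (∀ i j, i ≠ j → 1 / K ≤ ‖ξ i - ξ j‖) → (∀ i, ‖ξ i‖ ≤ B) →
      (∀ i ∈ T₁, ∀ j ∈ T₁, ‖ξ i - ξ j‖ ≤ 4 * ρ) → (∀ i ∈ T₁, ∀ j ∈ T₂, 32 * ρ ≤ ‖ξ i - ξ j‖) →
      Module.finrank ℝ D ≤ m + 1 → (∀ i ∈ T₁, ∃ u ∈ D, ‖ξ i - y₀ - u‖ ≤ L / K) → (∀ i ∈ T₂, ∃ u ∈ D, ‖ξ i - y₀ - u‖ ≤ L / K) →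
      ∀ i ∈ T₁ ×ˢ T₂, (((T₁ ×ˢ T₂).filter (fun j => ‖(zt (ξ i.1) + zt (ξ i.2)) - (zt (ξ j.1) + zt (ξ j.2))‖ ≤ R / K)).card : ℝ) ≤ C * K ^ m := by
  set C₁ : ℝ := R * (1 + 4 * B) + 4 * B * L with hC₁
  set C₂ : ℝ := 2 * (1 + C₁ / (16 * ρ) + 2 * L) with hC₂
  have hC₁0 : 0 ≤ C₁ := by positivity
  have hC₂0 : 0 ≤ C₂ := by positivity
  refine ⟨(1 + 2 * (C₂ + 2 * R)) ^ (d + d) * (1 + 4 * B) ^ m, by positivity, ?_⟩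
  intro ι _ T₁ T₂ ξ K D y₀ hK hKL hsep hξ hd1 hd2 hm hD1 hD2 i hi
  have hK0 : 0 < K := by linarith
  rw [Finset.mem_product] at hi
  set a := ξ i.1 with ha
  set b := ξ i.2 with hb
  set e := D.starProjection (a - b) with he
  have hLK : L / K ≤ 8 * ρ := by rw [div_le_iff₀ hK0]; exact hKL
  have he1 : ‖(a - b) - e‖ ≤ 2 * (L / K) := proj_pair D (hD1 _ hi.1) (hD2 _ hi.2)
  have he2 : 16 * ρ ≤ ‖e‖ := by
    have h1 := hd2 _ hi.1 _ hi.2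
    have h2 : ‖a - b‖ ≤ ‖(a - b) - e‖ + ‖e‖ := by
      calc ‖a - b‖ = ‖((a - b) - e) + e‖ := by congr 1; abel
        _ ≤ _ := norm_add_le _ _
    linarith
  have hepos : 0 < ‖e‖ := by linarith
  have heD : e ∈ D := D.starProjection_apply_mem _
  set D' : Submodule ℝ (VV d) := D ⊓ (Submodule.span ℝ {e})ᗮ with hD'
  have hfin : Module.finrank ℝ D' ≤ m := by
    have : D' < D := by
      refine lt_of_le_of_ne inf_le_left ?_
      intro h
      have h1 : e ∈ D' := by rw [h]; exact heD
      have h2 := (Submodule.mem_orthogonal_singleton_iff_inner_right).1 h1.2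
      rw [real_inner_self_eq_norm_sq] at h2
      nlinarith
    have := Submodule.finrank_lt_finrank_of_lt this
    omega
  let u0 : VV d → VV d := fun x => D.starProjection x - (⟪e, D.starProjection x⟫ / ‖e‖ ^ 2) • e
  have hu0 : ∀ x, u0 x ∈ D' := by
    intro x
    refine ⟨D.sub_mem (D.starProjection_apply_mem _) (D.smul_mem _ heD), ?_⟩
    rw [SetLike.mem_coe, Submodule.mem_orthogonal_singleton_iff_inner_right, inner_sub_right, inner_smul_right, real_inner_self_eq_norm_sq]
    field_simp
    ring
  have hu0s : ∀ x x', u0 x - u0 x' = u0 (x - x') := by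
    intro x x'
    simp only [u0, map_sub, inner_sub_right, sub_div, sub_smul]
    abel
  have hu0b : ∀ x, ‖x‖ ≤ B → ‖u0 x‖ ≤ 2 * B := by
    intro x hx
    have h1 : ‖D.starProjection x‖ ≤ B := (D.norm_starProjection_apply_le _).trans hx
    have h2 : ‖(⟪e, D.starProjection x⟫ / ‖e‖ ^ 2) • e‖ ≤ B := by
      rw [norm_smul, norm_div, norm_pow, norm_norm, div_mul_eq_mul_div, div_le_iff₀ (by positivity), Real.norm_eq_abs]
      have := abs_real_inner_le_norm e (D.starProjection x)
      calc _ ≤ ‖e‖ * ‖D.starProjection x‖ * ‖e‖ := by gcongr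
        _ ≤ ‖e‖ * B * ‖e‖ := by gcongr
        _ = _ := by ring
    exact (norm_sub_le _ _).trans (by linarith)
  set S := (T₁ ×ˢ T₂).filter (fun j => ‖(zt a + zt b) - (zt (ξ j.1) + zt (ξ j.2))‖ ≤ R / K) with hS
  -- first facts
  have F1 : ∀ j ∈ S, ‖a + b - ξ j.1 - ξ j.2‖ ≤ R / K ∧ |⟪ξ j.1 - a, ξ j.1 - b⟫| ≤ R * (1 + 4 * B) / K / 2 := by
    intro j hj
    rw [hS, Finset.mem_filter] at hj
    have h1 := hj.2
    unfold zt at h1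
    have h2 : ‖a + b - ξ j.1 - ξ j.2‖ ≤ R / K := by
      refine le_trans (le_of_eq ?_) ((norm_fst_le _).trans h1)
      simp only [Prod.fst_sub, Prod.fst_add]; congr 1; abel
    have h3 : |‖a‖ ^ 2 + ‖b‖ ^ 2 - (‖ξ j.1‖ ^ 2 + ‖ξ j.2‖ ^ 2)| ≤ R / K := by
      refine le_trans (le_of_eq ?_) ((norm_snd_le _).trans h1)
      rfl
    refine ⟨h2, ?_⟩
    set y := ξ j.1
    set w := ξ j.2
    have hw : ‖w‖ ≤ B := hξ _
    have hww : ‖a + b - y‖ ≤ 3 * B := by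
      have := hξ i.1; have := hξ i.2; have := hξ j.1
      calc _ ≤ ‖a‖ + ‖b‖ + ‖y‖ := (norm_sub_le _ _).trans (by gcongr; exact norm_add_le _ _)
        _ ≤ _ := by linarith
    have h4 : |‖a + b - y‖ ^ 2 - ‖w‖ ^ 2| ≤ R / K * (4 * B) := by
      have h5 : |‖a + b - y‖ - ‖w‖| ≤ R / K := (abs_norm_sub_norm_le _ _).trans h2
      rw [show ‖a + b - y‖ ^ 2 - ‖w‖ ^ 2 = (‖a + b - y‖ - ‖w‖) * (‖a + b - y‖ + ‖w‖) by ring, abs_mul]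
      refine mul_le_mul h5 ?_ (abs_nonneg _) (by positivity)
      rw [abs_of_nonneg (by positivity)]; linarith
    have h6 : 2 * ⟪y - a, y - b⟫ = -(‖a‖ ^ 2 + ‖b‖ ^ 2 - (‖y‖ ^ 2 + ‖w‖ ^ 2)) + (‖a + b - y‖ ^ 2 - ‖w‖ ^ 2) := by
      simp only [← real_inner_self_eq_norm_sq, inner_sub_left, inner_sub_right, inner_add_left, inner_add_right]
      rw [real_inner_comm a y, real_inner_comm b y, real_inner_comm a b]
      ring
    have h7 : |2 * ⟪y - a, y - b⟫| ≤ R / K + R / K * (4 * B) := by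
      rw [h6]
      refine (abs_add_le _ _).trans ?_
      rw [abs_neg]
      exact add_le_add h3 h4
    rw [abs_mul, abs_of_pos two_pos] at h7
    have : R * (1 + 4 * B) / K = R / K + R / K * (4 * B) := by ring
    linarith
  -- close projections imply close points
  have F2 : ∀ j ∈ S, ∀ j' ∈ S, ‖u0 (ξ j.1) - u0 (ξ j'.1)‖ ≤ 1 / K → ‖ξ j'.1 - ξ j.1‖ ≤ C₂ / K := by
    intro j hj j' hj' hu
    obtain ⟨g1, g2⟩ := F1 j hj
    obtain ⟨g1', g2'⟩ := F1 j' hj'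
    rw [hS, Finset.mem_filter, Finset.mem_product] at hj hj'
    set y := ξ j.1
    set y' := ξ j'.1
    rw [norm_sub_rev]
    rw [hu0s] at hu
    set v := y - y' with hv
    have k1 : ‖v - D.starProjection v‖ ≤ 2 * (L / K) := proj_pair D (hD1 _ hj.1.1) (hD1 _ hj'.1.1)
    have k2 : ⟪v, a - b⟫ = ⟪y - a, y - b⟫ - ⟪y' - a, y' - b⟫ - ⟪v, (y - a) + (y' - a)⟫ := by
      simp only [hv, inner_sub_left, inner_sub_right, inner_add_left, inner_add_right]
      rw [real_inner_comm a y, real_inner_comm a y', real_inner_comm y y']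
      ring
    have k3 : |⟪v, (y - a) + (y' - a)⟫| ≤ ‖v‖ * (8 * ρ) := by
      refine (abs_real_inner_le_norm _ _).trans ?_
      gcongr
      have := hd1 _ hj.1.1 _ hi.1
      have := hd1 _ hj'.1.1 _ hi.1
      exact (norm_add_le _ _).trans (by linarith)
    have k4 : |⟪v, a - b⟫| ≤ R * (1 + 4 * B) / K + ‖v‖ * (8 * ρ) := by
      rw [k2]
      refine (abs_sub _ _).trans ?_
      have := (abs_sub ⟪y - a, y - b⟫ ⟪y' - a, y' - b⟫)
      linarith
    have k5 : |⟪v, e⟫| ≤ C₁ / K + ‖v‖ * (8 * ρ) := by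
      have q1 : ⟪v, e⟫ = ⟪v, a - b⟫ - ⟪v, (a - b) - e⟫ := by rw [inner_sub_right v (a - b) e]; ring
      have q2 : |⟪v, (a - b) - e⟫| ≤ (2 * B) * (2 * (L / K)) := by
        refine (abs_real_inner_le_norm _ _).trans ?_
        have : ‖v‖ ≤ 2 * B := (norm_sub_le _ _).trans (by linarith [hξ j.1, hξ j'.1])
        exact mul_le_mul this he1 (norm_nonneg _) (by positivity)
      rw [q1]
      refine (abs_sub _ _).trans ?_
      have : C₁ / K = R * (1 + 4 * B) / K + (2 * B) * (2 * (L / K)) := by rw [hC₁]; ring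
      linarith
    have k6 : ⟪e, D.starProjection v⟫ = ⟪v, e⟫ := by
      rw [real_inner_comm]
      have := D.starProjection_inner_eq_zero v e heD
      rw [inner_sub_left] at this
      linarith
    have k7 : ‖(⟪e, D.starProjection v⟫ / ‖e‖ ^ 2) • e‖ ≤ C₁ / (16 * ρ) / K + 1 / 2 * ‖v‖ := by
      rw [norm_smul, norm_div, norm_pow, norm_norm, k6, Real.norm_eq_abs]
      have : |⟪v, e⟫| / ‖e‖ ^ 2 * ‖e‖ = |⟪v, e⟫| / ‖e‖ := by field_simp
      rw [this]
      calc |⟪v, e⟫| / ‖e‖ ≤ (C₁ / K + ‖v‖ * (8 * ρ)) / (16 * ρ) := by gcongr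
        _ = _ := by field_simp; ring
    have k8 : ‖v‖ ≤ ‖v - D.starProjection v‖ + ‖u0 v‖ + ‖(⟪e, D.starProjection v⟫ / ‖e‖ ^ 2) • e‖ := by
      calc ‖v‖ = ‖(v - D.starProjection v) + u0 v + (⟪e, D.starProjection v⟫ / ‖e‖ ^ 2) • e‖ := by
            congr 1; simp only [u0]; abel
        _ ≤ _ := (norm_add_le _ _).trans (by gcongr; exact norm_add_le _ _)
    have k9 : C₂ / K = 2 * (1 / K + C₁ / (16 * ρ) / K + 2 * (L / K)) := by rw [hC₂]; ring
    linarith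
  have h1 := count_net S (fun j => (⟨u0 (ξ j.1), hu0 _⟩ : D')) (r := 1 / K) (R := 2 * B)
    (D := (1 + 2 * (C₂ + 2 * R)) ^ (d + d)) (by positivity) (by positivity) (by positivity) 0 ?_ ?_
  · refine h1.trans ?_
    rw [mul_assoc, ← mul_pow]
    gcongr
    calc (1 + 2 * (2 * B) / (1 / K)) ^ Module.finrank ℝ D' ≤ ((1 + 4 * B) * K) ^ Module.finrank ℝ D' := by
          gcongr
          rw [div_div_eq_mul_div, div_one]; nlinarith
      _ ≤ _ := pow_le_pow_right₀ (by nlinarith) hfin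
  · intro j hj
    have h2 := card_sep (E := VV d × VV d) (S.filter (fun j' => ‖(⟨u0 (ξ j.1), hu0 _⟩ : D') - ⟨u0 (ξ j'.1), hu0 _⟩‖ ≤ 1 / K))
      (fun j => (ξ j.1, ξ j.2)) (r := 1 / K) (R := (C₂ + 2 * R) / K) (by positivity) (by positivity) (ξ j.1, ξ j.2) ?_ ?_
    · rw [Module.finrank_prod, finrank_VV] at h2
      convert h2 using 3
      have : K ≠ 0 := by positivity
      field_simp
    · intro p hp q hq hpq
      by_cases h : p.1 = q.1
      · have : p.2 ≠ q.2 := fun h' => hpq (Prod.ext h h')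
        exact (hsep _ _ this).trans (norm_snd_le ((ξ p.1, ξ p.2) - (ξ q.1, ξ q.2)))
      · exact (hsep _ _ h).trans (norm_fst_le ((ξ p.1, ξ p.2) - (ξ q.1, ξ q.2)))
    · intro j' hj'
      rw [Finset.mem_filter] at hj'
      have g := F2 j hj j' hj'.1 hj'.2
      have g1 := (F1 j hj).1
      have g2 := (F1 j' hj'.1).1
      have hR' : 0 ≤ R / K := by positivity
      have e1 : (C₂ + 2 * R) / K = C₂ / K + 2 * (R / K) := by ring
      rw [e1]
      apply max_le
      · change ‖ξ j'.1 - ξ j.1‖ ≤ _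
        linarith
      · change ‖ξ j'.2 - ξ j.2‖ ≤ _
        calc _ = ‖(a + b - ξ j.1 - ξ j.2) - (a + b - ξ j'.1 - ξ j'.2) - (ξ j'.1 - ξ j.1)‖ := by congr 1; abel
          _ ≤ ‖a + b - ξ j.1 - ξ j.2‖ + ‖a + b - ξ j'.1 - ξ j'.2‖ + ‖ξ j'.1 - ξ j.1‖ := (norm_sub_le _ _).trans (add_le_add_left (norm_sub_le _ _) _)
          _ ≤ _ := by linarith
  · intro j hj
    rw [sub_zero]
    exact hu0b _ (hξ _)
end PExt

end

section
namespace PExt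

variable {d : ℕ}

noncomputable def kap (m : ℕ) (p : ℝ) : ℝ := max 0 ((m - 1 / 2) * (p - 2))

set_option maxHeartbeats 1000000 in
lemma narrow_bd (d m : ℕ) {p a B L ρ : ℝ} (hp : 2 < p) (hmp : m = 0 ∨ p ≤ 4) (ha : 0 ≤ a) (hB : 0 ≤ B) (hL : 0 ≤ L) (hρ : 0 < ρ) :
    ∃ C : ℝ, 0 < C ∧ ∀ (ι : Type) [DecidableEq ι] (K : ℝ) (c : VV d × ℝ) (T₁ T₂ : Finset ι) (f g : ι → VV d → ℂ) (ξ : ι → VV d)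
      (D : Submodule ℝ (VV d)) (y₀ : VV d), 1 ≤ K → L ≤ 8 * ρ * K → (∀ i j, i ≠ j → 1 / K ≤ ‖ξ i - ξ j‖) →
      (∀ i, Nice (f i) (ξ i) (a / K)) → (∀ i, Nice (g i) (ξ i) (a / K)) → (∀ i, ‖ξ i‖ ≤ B) →
      (∀ i ∈ T₁, ∀ j ∈ T₁, ‖ξ i - ξ j‖ ≤ 4 * ρ) → (∀ i ∈ T₁, ∀ j ∈ T₂, 32 * ρ ≤ ‖ξ i - ξ j‖) →
      Module.finrank ℝ D ≤ m → (∀ i ∈ T₁, ∃ u ∈ D, ‖ξ i - y₀ - u‖ ≤ L / K) → (∀ i ∈ T₂, ∃ u ∈ D, ‖ξ i - y₀ - u‖ ≤ L / K) →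
      ∫⁻ X in Metric.closedBall c K, (‖∑ i ∈ T₁, Ex (f i) X.1 X.2‖ₑ * ‖∑ i ∈ T₂, Ex (g i) X.1 X.2‖ₑ) ^ (p / 2) ≤
        ENNReal.ofReal (C * K ^ (d + 1) * K ^ kap m p) *
          (∑ i ∈ T₁, bb p (2 * (d + 1)) K (f i) c + ∑ i ∈ T₂, bb p (2 * (d + 1)) K (g i) c) := by
  have hp0 : 0 < p / 2 := by linarith
  rcases m with _ | m
  · refine ⟨1, one_pos, ?_⟩
    intro ι _ K c T₁ T₂ f g ξ D y₀ hK hKL hsep hf hg hξ hd1 hd2 hm hD1 hD2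
    have hK0 : 0 < K := by linarith
    have : T₁ = ∅ ∨ T₂ = ∅ := by
      by_contra hcon
      push Not at hcon
      obtain ⟨i, hi⟩ := hcon.1
      obtain ⟨j, hj⟩ := hcon.2
      have h1 := hd2 i hi j hj
      have h2 := proj_pair D (hD1 i hi) (hD2 j hj)
      have h3 : D = ⊥ := Submodule.finrank_eq_zero.1 (by omega)
      have h4 : D.starProjection (ξ i - ξ j) = 0 := by
        have := D.starProjection_apply_mem (ξ i - ξ j)
        rw [h3] at this
        rw [h3]
        exact (Submodule.mem_bot ℝ).1 this
      rw [h4, sub_zero] at h2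
      have : L / K ≤ 8 * ρ := by rw [div_le_iff₀ hK0]; exact hKL
      linarith
    have h0 : ∀ X : VV d × ℝ, (‖∑ i ∈ T₁, Ex (f i) X.1 X.2‖ₑ * ‖∑ i ∈ T₂, Ex (g i) X.1 X.2‖ₑ) ^ (p / 2) = 0 := by
      intro X
      rcases this with h | h <;> simp [h, hp0]
    simp only [h0, lintegral_zero]
    exact zero_le
  · have hp4 : p ≤ 4 := by
      rcases hmp with h | h
      · omega
      · exact h
    obtain ⟨C, R', hC, hR', hcore⟩ := narrow_core (d := d) hp hp4 ha hB
    obtain ⟨C₁, hC₁, hpair⟩ := count_pair d m hρ hB hL hR'.le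
    set q := p / 2 - 1 with hq
    have hq0 : 0 < q := by rw [hq]; linarith
    set E₀ : ℝ := (1 + 2 * R') ^ d with hE₀
    set E₁ : ℝ := (1 + 2 * (1 + 2 * L)) ^ d * (1 + 2 * B) ^ (m + 1) with hE₁
    have hE₀p : 0 < E₀ := by positivity
    have hE₁p : 0 < E₁ := by positivity
    refine ⟨C * (E₀ ^ (2 - p / 2) * C₁ ^ q * (2 * E₁) ^ q), by positivity, ?_⟩
    intro ι _ K c T₁ T₂ f g ξ D y₀ hK hKL hsep hf hg hξ hd1 hd2 hm hD1 hD2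
    have hK0 : 0 < K := by linarith
    have hzt : ∀ T : Finset ι, ∀ i ∈ T, (T.filter (fun j => ‖zt (ξ i) - zt (ξ j)‖ ≤ R' / K)).card ≤ ⌊E₀⌋₊ := by
      intro T i hi
      apply Nat.le_floor
      apply count_ball _ ξ hK hR'.le (fun a _ b _ => hsep a b) (ξ i)
      intro j hj
      rw [Finset.mem_filter] at hj
      rw [norm_sub_rev]
      exact (norm_fst_le (zt (ξ i) - zt (ξ j))).trans hj.2
    have h1 := hcore ι K c T₁ T₂ f g ξ ⌊E₀⌋₊ ⌊C₁ * K ^ m⌋₊ hK hf hg hξ (hzt T₁) (hzt T₂)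
      (fun i hi => Nat.le_floor (hpair ι T₁ T₂ ξ K D y₀ hK hKL hsep hξ hd1 hd2 hm hD1 hD2 i hi))
    refine h1.trans ?_
    apply mul_le_mul_left
    have c1 : ((⌊E₀⌋₊ : ℕ) : ℝ≥0∞) ≤ ENNReal.ofReal E₀ := by
      rw [← ENNReal.ofReal_natCast]; exact ENNReal.ofReal_le_ofReal (Nat.floor_le hE₀p.le)
    have c2 : ((⌊C₁ * K ^ m⌋₊ : ℕ) : ℝ≥0∞) ≤ ENNReal.ofReal (C₁ * K ^ m) := by
      rw [← ENNReal.ofReal_natCast]; exact ENNReal.ofReal_le_ofReal (Nat.floor_le (by positivity))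
    have c3 : (T₁.card : ℝ≥0∞) + T₂.card ≤ ENNReal.ofReal (2 * E₁ * K ^ (m + 1)) := by
      have g1 := count_slab T₁ ξ hK hL hB (fun i _ j _ => hsep i j) (fun i _ => hξ i) D y₀ hm hD1
      have g2 := count_slab T₂ ξ hK hL hB (fun i _ j _ => hsep i j) (fun i _ => hξ i) D y₀ hm hD2
      rw [← Nat.cast_add, ← ENNReal.ofReal_natCast]
      apply ENNReal.ofReal_le_ofReal
      push_cast
      linarith
    calc _ ≤ ENNReal.ofReal (C * K ^ (d + 1)) * ENNReal.ofReal E₀ ^ (2 - p / 2) * ENNReal.ofReal (C₁ * K ^ m) ^ q * ENNReal.ofReal (2 * E₁ * K ^ (m + 1)) ^ q := by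
          gcongr
          linarith
      _ = ENNReal.ofReal (C * K ^ (d + 1) * E₀ ^ (2 - p / 2) * (C₁ * K ^ m) ^ q * (2 * E₁ * K ^ (m + 1)) ^ q) := by
          rw [ENNReal.ofReal_rpow_of_pos hE₀p, ENNReal.ofReal_rpow_of_pos (by positivity), ENNReal.ofReal_rpow_of_pos (by positivity),
            ← ENNReal.ofReal_mul (by positivity), ← ENNReal.ofReal_mul (by positivity), ← ENNReal.ofReal_mul (by positivity)]
      _ ≤ _ := by
          apply ENNReal.ofReal_le_ofReal
          rw [Real.mul_rpow hC₁.le (by positivity), Real.mul_rpow (by positivity) (by positivity)]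
          have e : (K ^ m) ^ q * (K ^ (m + 1)) ^ q = K ^ ((m + 1 - 1 / 2) * (p - 2)) := by
            rw [← Real.rpow_natCast, ← Real.rpow_natCast, ← Real.rpow_mul hK0.le, ← Real.rpow_mul hK0.le, ← Real.rpow_add hK0]
            congr 1
            push_cast
            rw [hq]; ring
          have e2 : K ^ ((m + 1 - 1 / 2) * (p - 2)) ≤ K ^ kap (m + 1) p := by
            apply Real.rpow_le_rpow_of_exponent_le hK
            unfold kap
            push_cast
            exact le_max_right _ _
          calc _ = C * (E₀ ^ (2 - p / 2) * C₁ ^ q * (2 * E₁) ^ q) * K ^ (d + 1) * ((K ^ m) ^ q * (K ^ (m + 1)) ^ q) := by ring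
            _ ≤ _ := by rw [e]; gcongr
end PExt

end

section
namespace PExt

variable {d : ℕ}

lemma En_pt (d : ℕ) {B : ℝ} (hB : 0 ≤ B) : ∃ C > 0, ∀ (f : VV d → ℂ) (ξ₀ x : VV d) (t r δ : ℝ), Nice f ξ₀ δ → δ ≤ 1 → ‖ξ₀‖ ≤ B → 1 ≤ r →
    ‖Ex f x t‖ₑ ^ 2 ≤ ENNReal.ofReal C * En f x t r := by
  obtain ⟨χ, hχ, hχc, hχ1⟩ := exists_bump d
  obtain ⟨κ, hκc, hκi, hκd, hκm, -⟩ := exists_kernel (fun ξ => ((χ ξ : ℝ) : ℂ)) (Complex.ofRealCLM.contDiff.comp hχ)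
    (hχc.comp_left (g := fun x : ℝ => (x : ℂ)) (by simp))
  obtain ⟨C0, hC0, hκ0⟩ := hκd (d + 1)
  set I0 := ∫⁻ z, ‖κ z‖ₑ with hI0
  have hI0t : I0 < ∞ := hκi.2
  set R := B + 1 with hR
  have hR0 : 0 < R := by rw [hR]; linarith
  have hR1 : 1 ≤ R := by rw [hR]; linarith
  refine ⟨I0.toReal * C0 * R ^ d + 1, by positivity, ?_⟩
  intro f ξ₀ x t r δ hf hδ hξ hr
  have hr0 : 0 < r := by linarith
  have h1 : (fun ξ => ((χ (R⁻¹ • ξ) : ℝ) : ℂ) * f ξ) = f := by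
    ext ξ
    by_cases h : δ < ‖ξ - ξ₀‖
    · rw [hf.supp ξ h, mul_zero]
    · rw [hχ1, Complex.ofReal_one, one_mul]
      rw [norm_smul, norm_inv, Real.norm_eq_abs, abs_of_pos hR0, inv_mul_le_iff₀ hR0, mul_one]
      push Not at h
      calc ‖ξ‖ = ‖(ξ - ξ₀) + ξ₀‖ := by congr 1; abel
        _ ≤ _ := (norm_add_le _ _).trans (by rw [hR]; linarith)
  have h2 := Ex_multiplier hκi hκm hf.integrable R⁻¹ x t
  simp only [h1] at h2
  have hu : Measurable fun z => Ex f (x - R⁻¹ • z) t :=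
    ((Ex_continuous_x hf.integrable t).comp (by fun_prop : Continuous fun z : VV d => x - R⁻¹ • z)).measurable
  rw [h2]
  refine (conv_sq_le hκc.measurable.aemeasurable hu.aemeasurable).trans ?_
  calc I0 * ∫⁻ z, ‖κ z‖ₑ * ‖Ex f (x - R⁻¹ • z) t‖ₑ ^ 2
      ≤ I0 * ∫⁻ z, ENNReal.ofReal C0 * (‖Ex f (x - R⁻¹ • z) t‖ₑ ^ 2 * ENNReal.ofReal (jw (d + 1) r ((x - R⁻¹ • z) - x))) := by
        refine mul_le_mul_right (lintegral_mono fun z => ?_) _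
        dsimp only
        rw [mul_left_comm, ← ENNReal.ofReal_mul hC0.le, mul_comm]
        refine mul_le_mul_right ?_ _
        rw [← ofReal_norm]
        apply ENNReal.ofReal_le_ofReal
        unfold jw
        rw [← div_eq_mul_inv, le_div_iff₀ (by positivity)]
        refine le_trans ?_ (hκ0 z)
        gcongr
        rw [show x - R⁻¹ • z - x = -(R⁻¹ • z) by abel, norm_neg, norm_smul, norm_inv, Real.norm_eq_abs, abs_of_pos hR0]
        rw [div_le_iff₀ (by positivity)]
        have q1 : R⁻¹ * ‖z‖ ≤ 1 * ‖z‖ := by gcongr; exact inv_le_one_of_one_le₀ hR1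
        have q2 : 0 ≤ R⁻¹ * ‖z‖ := by positivity
        have q3 : (R⁻¹ * ‖z‖) ^ 2 ≤ ‖z‖ ^ 2 := by nlinarith
        have : 1 ≤ r ^ 2 := by nlinarith
        nlinarith [sq_nonneg ‖z‖]
    _ = I0 * (ENNReal.ofReal C0 * (ENNReal.ofReal (R ^ d) * En f x t r)) := by
        rw [lintegral_const_mul' _ _ ENNReal.ofReal_ne_top]
        rw [lintegral_smul_comp volume (fun y => ‖Ex f (x - y) t‖ₑ ^ 2 * ENNReal.ofReal (jw (d + 1) r ((x - y) - x))) hR0]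
        rw [finrank_VV]
        have := lintegral_sub_left_eq_self (μ := (volume : Measure (VV d))) (fun y => ‖Ex f y t‖ₑ ^ 2 * ENNReal.ofReal (jw (d + 1) r (y - x))) x
        unfold En
        rw [← this]
    _ = ENNReal.ofReal (I0.toReal * C0 * R ^ d) * En f x t r := by
        rw [ENNReal.ofReal_mul (by positivity), ENNReal.ofReal_mul (by positivity), ENNReal.ofReal_toReal hI0t.ne]; ring
    _ ≤ _ := by gcongr; linarith

/-- the basic class of functions -/
structure InF (f : VV d → ℂ) : Prop where
  meas : Measurable f
  bdd : ∀ ξ, ‖f ξ‖ ≤ 1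
  supp : ∀ ξ, f ξ ≠ 0 → ∀ i, |ξ i| ≤ 1

lemma norm_le_of_coord {x : VV d} {a : ℝ} (h : ∀ i, |x i| ≤ a) : ‖x‖ ≤ d * a := by
  calc ‖x‖ ≤ ∑ i, |x i| := by
        rw [EuclideanSpace.norm_eq, Real.sqrt_le_left (Finset.sum_nonneg fun i _ => abs_nonneg _)]
        simp only [Real.norm_eq_abs]
        exact Finset.sum_sq_le_sq_sum_of_nonneg fun i _ => abs_nonneg _
    _ ≤ ∑ i : Fin d, a := Finset.sum_le_sum fun i _ => h i
    _ = _ := by simp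

lemma coord_le_norm (x : VV d) (i : Fin d) : |x i| ≤ ‖x‖ := PiLp.norm_apply_le x i

lemma InF.nice {f : VV d → ℂ} (h : InF f) : Nice f 0 d := by
  refine ⟨h.meas, ⟨1, h.bdd⟩, ?_⟩
  intro ξ hξ
  by_contra hc
  have := norm_le_of_coord (h.supp ξ hc)
  simp at hξ
  linarith

lemma InF.integrable {f : VV d → ℂ} (h : InF f) : Integrable f := h.nice.integrable

/-- piece of a function -/
noncomputable def pc {κ : Type} [DecidableEq κ] (q : VV d → κ) (a : κ) (f : VV d → ℂ) : VV d → ℂ :=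
  fun ξ => if q ξ = a then f ξ else 0

lemma pc_ne {κ : Type} [DecidableEq κ] {q : VV d → κ} {a : κ} {f : VV d → ℂ} {ξ : VV d} (h : pc q a f ξ ≠ 0) :
    q ξ = a ∧ f ξ ≠ 0 := by
  unfold pc at h
  split_ifs at h with h1
  · exact ⟨h1, h⟩
  · exact absurd rfl h

lemma InF.pc {κ : Type} [DecidableEq κ] {q : VV d → κ} (hq : ∀ a, MeasurableSet {ξ | q ξ = a}) {a : κ} {f : VV d → ℂ} (h : InF f) : InF (pc q a f) := by
  refine ⟨Measurable.ite (hq a) h.meas measurable_const, ?_, ?_⟩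
  · intro ξ
    unfold PExt.pc
    split_ifs
    · exact h.bdd ξ
    · simp
  · intro ξ hξ
    exact h.supp ξ (pc_ne hξ).2

lemma Ex_sum_pc {κ : Type} [Fintype κ] [DecidableEq κ] {q : VV d → κ} (hq : ∀ a, MeasurableSet {ξ | q ξ = a}) {f : VV d → ℂ} (h : InF f) (x : VV d) (t : ℝ) :
    Ex f x t = ∑ a, Ex (pc q a f) x t := by
  unfold Ex
  rw [← integral_finsetSum]
  · congr 1; ext ξ
    rw [← Finset.sum_mul]
    congr 1
    unfold pc
    simp
  · intro a _
    exact integrable_mul_ee (h.pc hq).integrable (Continuous.measurable (by fun_prop))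

/-- grid -/
noncomputable def gq (K : ℕ) (ξ : VV d) : Fin d → Fin (2 * K + 1) :=
  fun i => ⟨min ⌊(K : ℝ) * (ξ i + 1)⌋₊ (2 * K), by omega⟩

noncomputable def cen (K : ℕ) (a : Fin d → Fin (2 * K + 1)) : VV d := WithLp.toLp 2 (fun i => (a i : ℝ) / K - 1)

lemma cen_apply (K : ℕ) (a : Fin d → Fin (2 * K + 1)) (i : Fin d) : cen K a i = (a i : ℝ) / K - 1 := rfl

lemma gq_meas (K : ℕ) (a : Fin d → Fin (2 * K + 1)) : MeasurableSet {ξ : VV d | gq K ξ = a} := by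
  have : {ξ : VV d | gq K ξ = a} = ⋂ i, {ξ | min ⌊(K : ℝ) * (ξ i + 1)⌋₊ (2 * K) = a i} := by
    ext ξ
    simp only [Set.mem_setOf_eq, Set.mem_iInter, gq, funext_iff, Fin.ext_iff]
  rw [this]
  refine MeasurableSet.iInter fun i => ?_
  have hm : Measurable fun ξ : VV d => min ⌊(K : ℝ) * (ξ i + 1)⌋₊ (2 * K) := by
    refine Measurable.min ?_ measurable_const
    apply Nat.measurable_floor.comp
    exact Continuous.measurable (by fun_prop)
  exact hm (measurableSet_singleton _)

lemma cen_norm (K : ℕ) (a : Fin d → Fin (2 * K + 1)) : ‖cen K a‖ ≤ d := by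
  have := norm_le_of_coord (x := cen K a) (a := 1) ?_
  · simpa using this
  intro i
  rw [cen_apply, abs_le]
  have h1 : ((a i : ℕ) : ℝ) ≤ 2 * K := by
    have := (a i).2
    exact_mod_cast (by omega : (a i : ℕ) ≤ 2 * K)
  have h0 : (0:ℝ) ≤ (a i : ℕ) / (K : ℝ) := by positivity
  have h2 : ((a i : ℕ) : ℝ) / K ≤ 2 := div_le_of_le_mul₀ (by positivity) (by norm_num) h1
  constructor <;> linarith

lemma cen_sep {K : ℕ} (hK : 1 ≤ K) {a b : Fin d → Fin (2 * K + 1)} (h : a ≠ b) : 1 / (K : ℝ) ≤ ‖cen K a - cen K b‖ := by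
  obtain ⟨i, hi⟩ := Function.ne_iff.1 h
  refine le_trans ?_ (coord_le_norm _ i)
  have hK0 : (0:ℝ) < K := by exact_mod_cast hK
  have : (cen K a - cen K b) i = ((((a i : ℕ) : ℤ) - ((b i : ℕ) : ℤ) : ℤ) : ℝ) / K := by
    rw [PiLp.sub_apply, cen_apply, cen_apply]; push_cast; ring
  rw [this, abs_div, abs_of_pos hK0]
  gcongr
  rw [← Int.cast_abs]
  have : 1 ≤ |((a i : ℕ) : ℤ) - ((b i : ℕ) : ℤ)| := by
    apply Int.one_le_abs
    intro h0
    apply hi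
    apply Fin.ext
    omega
  exact_mod_cast this

lemma gq_near {K : ℕ} (hK : 1 ≤ K) {ξ : VV d} (h : ∀ i, |ξ i| ≤ 1) (i : Fin d) :
    0 ≤ (ξ - cen K (gq K ξ)) i ∧ (ξ - cen K (gq K ξ)) i ≤ 1 / K := by
  have hK0 : (0:ℝ) < K := by exact_mod_cast hK
  have hi := abs_le.1 (h i)
  have h0 : 0 ≤ (K:ℝ) * (ξ i + 1) := mul_nonneg hK0.le (by linarith)
  have h1 : ⌊(K : ℝ) * (ξ i + 1)⌋₊ ≤ 2 * K := by
    apply Nat.floor_le_of_le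
    push_cast
    nlinarith
  have h2 : ((gq K ξ i : ℕ) : ℝ) = ⌊(K : ℝ) * (ξ i + 1)⌋₊ := by
    unfold gq
    simp only [min_eq_left h1]
  rw [PiLp.sub_apply, cen_apply, h2]
  have h3 := Nat.floor_le h0
  have h4 := Nat.lt_floor_add_one ((K:ℝ) * (ξ i + 1))
  have e : ξ i - ((⌊(K : ℝ) * (ξ i + 1)⌋₊ : ℝ) / K - 1) = ((K:ℝ) * (ξ i + 1) - ⌊(K : ℝ) * (ξ i + 1)⌋₊) / K := by
    field_simp; ring
  rw [e]
  constructor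
  · apply div_nonneg _ hK0.le; linarith
  · gcongr; linarith

lemma InF.nice_box {f : VV d → ℂ} (h : InF f) {K : ℕ} (hK : 1 ≤ K) {a : Fin d → Fin (2 * K + 1)} (ha : ∀ ξ, f ξ ≠ 0 → gq K ξ = a) :
    Nice f (cen K a) (d / K) := by
  refine ⟨h.meas, ⟨1, h.bdd⟩, ?_⟩
  intro ξ hξ
  by_contra hc
  have := norm_le_of_coord (x := ξ - cen K a) (a := 1 / K) (fun i => by
    have := gq_near hK (h.supp ξ hc) i
    rw [ha ξ hc] at this
    rw [abs_of_nonneg this.1]; exact this.2)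
  rw [mul_one_div] at this
  linarith

/-- the inductive quantity -/
def BdS (d : ℕ) (p S : ℝ) (A : ℝ≥0∞) : Prop := ∀ f : VV d → ℂ, InF f →
  ∫⁻ X : VV d × ℝ, ‖Ex f X.1 X.2‖ₑ ^ p * ENNReal.ofReal (jw (d + 1) S X) ≤ A

lemma Ex_scale (f : VV d → ℂ) {r : ℝ} (hr : 0 < r) (x : VV d) (t : ℝ) :
    Ex f x t = ((r ^ d)⁻¹ : ℝ) * Ex (fun ω => f (r⁻¹ • ω)) (r⁻¹ • x) (t / r ^ 2) := by
  unfold Ex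
  have := Measure.integral_comp_inv_smul_of_nonneg (μ := (volume : Measure (VV d))) (fun ξ => f ξ * ee (⟪x, ξ⟫ + t * ‖ξ‖ ^ 2)) hr.le
  rw [finrank_VV] at this
  have h2 : ∀ ω : VV d, f (r⁻¹ • ω) * ee (⟪r⁻¹ • x, ω⟫ + t / r ^ 2 * ‖ω‖ ^ 2) = f (r⁻¹ • ω) * ee (⟪x, r⁻¹ • ω⟫ + t * ‖r⁻¹ • ω‖ ^ 2) := by
    intro ω
    congr 2
    rw [real_inner_smul_left, real_inner_smul_right, norm_smul, norm_inv, Real.norm_eq_abs, abs_of_pos hr]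
    field_simp
  simp only [h2]
  rw [this, Complex.real_smul, ← mul_assoc, ← Complex.ofReal_mul, inv_mul_cancel₀ (by positivity), Complex.ofReal_one, one_mul]

lemma rescale {p S : ℝ} (hp : 0 < p) (hS : 0 < S) {A : ℝ≥0∞} (hA : BdS d p S A) {K : ℕ} (hK : 1 + 2 * d ≤ K) {f : VV d → ℂ} (hf : InF f)
    {a : Fin d → Fin (2 * K + 1)} (ha : ∀ ξ, f ξ ≠ 0 → gq K ξ = a) :
    ∫⁻ X : VV d × ℝ, ‖Ex f X.1 X.2‖ₑ ^ p * ENNReal.ofReal (jw (d + 1) S X) ≤ ENNReal.ofReal ((K:ℝ) ^ (-(d * p - d - 2))) * A := by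
  have hK1 : 1 ≤ K := by omega
  have hK0 : (0:ℝ) < K := by exact_mod_cast hK1
  set c := cen K a with hc
  set h : VV d → ℂ := fun ω => f (c + (K:ℝ)⁻¹ • ω) with hh
  have hF : InF h := by
    refine ⟨hf.meas.comp (Continuous.measurable (by fun_prop)), fun ω => hf.bdd _, ?_⟩
    intro ω hω i
    have h1 := gq_near hK1 (hf.supp _ hω) i
    rw [ha _ hω, ← hc] at h1
    rw [add_sub_cancel_left, PiLp.smul_apply, smul_eq_mul] at h1
    have h2 : (K:ℝ)⁻¹ * ω i * K = ω i := by field_simp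
    rw [abs_le]
    have h3 := mul_le_mul_of_nonneg_right h1.1 hK0.le
    have h4 := mul_le_mul_of_nonneg_right h1.2 hK0.le
    rw [h2] at h3 h4
    rw [one_div, inv_mul_cancel₀ hK0.ne'] at h4
    constructor <;> linarith
  set G : VV d → ℝ → ℝ≥0∞ := fun u v => ‖Ex h u v‖ₑ ^ p * ENNReal.ofReal (jw (d + 1) S (u, v)) with hG
  have hGm : Measurable (fun X : VV d × ℝ => G X.1 X.2) :=
    ((measurable_ExX hF.integrable).enorm.pow_const _).mul (jw_continuous _ _).measurable.ennreal_ofReal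
  have key : ∀ X : VV d × ℝ, ‖Ex f X.1 X.2‖ₑ ^ p * ENNReal.ofReal (jw (d + 1) S X) ≤
      ENNReal.ofReal (((K:ℝ) ^ d)⁻¹ ^ p) * G ((K:ℝ)⁻¹ • (X.1 + (2 * X.2) • c)) (X.2 / (K:ℝ) ^ 2) := by
    intro X
    have e1 : ‖Ex f X.1 X.2‖ₑ ^ p = ENNReal.ofReal (((K:ℝ) ^ d)⁻¹ ^ p) * ‖Ex h ((K:ℝ)⁻¹ • (X.1 + (2 * X.2) • c)) (X.2 / (K:ℝ) ^ 2)‖ₑ ^ p := by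
      rw [Ex_galilean f c, Ex_scale _ hK0, enorm_mul, enorm_mul, enorm_ee, one_mul, ENNReal.mul_rpow_of_nonneg _ _ hp.le]
      congr 1
      rw [← ENNReal.ofReal_rpow_of_pos (by positivity)]
      congr 1
      rw [← ofReal_norm, Complex.norm_real, Real.norm_eq_abs, abs_of_pos (by positivity)]
    rw [e1, mul_assoc, hG]
    refine mul_le_mul_right (mul_le_mul_right (ENNReal.ofReal_le_ofReal ?_) _) _
    unfold jw
    gcongr
    have hX1 := norm_fst_le X
    have hX2 := norm_snd_le X
    rw [Real.norm_eq_abs] at hX2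
    have hKK : (1:ℝ) + 2 * d ≤ K := by exact_mod_cast hK
    have hX0 := norm_nonneg X
    apply max_le
    · change ‖(K:ℝ)⁻¹ • (X.1 + (2 * X.2) • c)‖ ≤ _
      rw [norm_smul, norm_inv, Real.norm_eq_abs, abs_of_pos hK0, inv_mul_le_iff₀ hK0]
      calc _ ≤ ‖X.1‖ + ‖(2 * X.2) • c‖ := norm_add_le _ _
        _ ≤ ‖X‖ + (2 * ‖X‖) * d := by
            rw [norm_smul, norm_mul, Real.norm_eq_abs, Real.norm_eq_abs, abs_two]
            gcongr
            exact cen_norm _ _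
        _ = (1 + 2 * d) * ‖X‖ := by ring
        _ ≤ _ := by gcongr
    · change |X.2 / (K:ℝ) ^ 2| ≤ _
      rw [abs_div, abs_of_pos (show (0:ℝ) < (K:ℝ) ^ 2 by positivity), div_le_iff₀ (by positivity)]
      have : (1:ℝ) ≤ (K:ℝ) ^ 2 := one_le_pow₀ (by exact_mod_cast hK1)
      nlinarith
  have sub : ∫⁻ X : VV d × ℝ, G ((K:ℝ)⁻¹ • (X.1 + (2 * X.2) • c)) (X.2 / (K:ℝ) ^ 2) = ENNReal.ofReal ((K:ℝ) ^ (d + 2)) * ∫⁻ X : VV d × ℝ, G X.1 X.2 := by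
    have hm2 : Measurable (fun X : VV d × ℝ => G ((K:ℝ)⁻¹ • (X.1 + (2 * X.2) • c)) (X.2 / (K:ℝ) ^ 2)) :=
      hGm.comp (Continuous.measurable (by fun_prop) : Measurable fun X : VV d × ℝ => ((K:ℝ)⁻¹ • (X.1 + (2 * X.2) • c), X.2 / (K:ℝ) ^ 2))
    rw [Measure.volume_eq_prod, lintegral_prod_symm _ hm2.aemeasurable, lintegral_prod_symm _ hGm.aemeasurable]
    dsimp only
    have s1 : ∀ t : ℝ, ∫⁻ x : VV d, G ((K:ℝ)⁻¹ • (x + (2 * t) • c)) (t / (K:ℝ) ^ 2) = ENNReal.ofReal ((K:ℝ) ^ d) * ∫⁻ x : VV d, G x (t / (K:ℝ) ^ 2) := by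
      intro t
      rw [lintegral_add_right_eq_self (fun x : VV d => G ((K:ℝ)⁻¹ • x) (t / (K:ℝ) ^ 2)),
        lintegral_smul_comp volume (fun x => G x (t / (K:ℝ) ^ 2)) hK0, finrank_VV]
    simp only [s1]
    rw [lintegral_const_mul' _ _ ENNReal.ofReal_ne_top, pow_add, ENNReal.ofReal_mul (by positivity), mul_assoc]
    congr 1
    have s2 := lintegral_smul_comp (volume : Measure ℝ) (fun t => ∫⁻ x : VV d, G x t) (by positivity : 0 < (K:ℝ) ^ 2)
    rw [Module.finrank_self, pow_one] at s2
    rw [← s2]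
    congr 1; ext t
    rw [smul_eq_mul, div_eq_inv_mul]
  calc _ ≤ ∫⁻ X : VV d × ℝ, ENNReal.ofReal (((K:ℝ) ^ d)⁻¹ ^ p) * G ((K:ℝ)⁻¹ • (X.1 + (2 * X.2) • c)) (X.2 / (K:ℝ) ^ 2) := lintegral_mono key
    _ = ENNReal.ofReal (((K:ℝ) ^ d)⁻¹ ^ p) * (ENNReal.ofReal ((K:ℝ) ^ (d + 2)) * ∫⁻ X : VV d × ℝ, G X.1 X.2) := by
        rw [lintegral_const_mul' _ _ ENNReal.ofReal_ne_top, sub]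
    _ ≤ ENNReal.ofReal (((K:ℝ) ^ d)⁻¹ ^ p) * (ENNReal.ofReal ((K:ℝ) ^ (d + 2)) * A) := by
        gcongr; exact hA h hF
    _ = _ := by
        rw [← mul_assoc, ← ENNReal.ofReal_mul (by positivity)]
        congr 2
        rw [← Real.rpow_natCast, ← Real.rpow_natCast, ← Real.rpow_neg hK0.le, ← Real.rpow_mul hK0.le, ← Real.rpow_add hK0]
        congr 1
        push_cast; ring
end PExt

end

section
namespace PExt

variable {d : ℕ}

/-- sup over a ball -/
noncomputable def sK (f : VV d → ℂ) (K : ℝ) (c : VV d × ℝ) : ℝ≥0∞ := ⨆ X ∈ Metric.closedBall c K, ‖Ex f X.1 X.2‖ₑ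

lemma le_sK (f : VV d → ℂ) {K : ℝ} {c X : VV d × ℝ} (h : X ∈ Metric.closedBall c K) : ‖Ex f X.1 X.2‖ₑ ≤ sK f K c :=
  le_iSup₂ (f := fun (X : VV d × ℝ) (_ : X ∈ Metric.closedBall c K) => ‖Ex f X.1 X.2‖ₑ) X h

lemma sK_pow_le {f : VV d → ℂ} {K : ℝ} {c : VV d × ℝ} {q : ℝ} (hq : 0 < q) {A : ℝ≥0∞} (h : ∀ X ∈ Metric.closedBall c K, ‖Ex f X.1 X.2‖ₑ ^ q ≤ A) :
    sK f K c ^ q ≤ A := by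
  have : sK f K c ≤ A ^ (q⁻¹) := iSup₂_le fun X hX => by
    rw [ENNReal.le_rpow_inv_iff hq]; exact h X hX
  rwa [ENNReal.le_rpow_inv_iff hq] at this

lemma sK_eq_zero {f : VV d → ℂ} (hf : ∀ ξ, f ξ = 0) (K : ℝ) (c : VV d × ℝ) : sK f K c = 0 := by
  unfold sK
  have : ∀ X : VV d × ℝ, ‖Ex f X.1 X.2‖ₑ = 0 := by
    intro X
    have := norm_Ex_le f X.1 X.2
    simp only [hf, norm_zero, integral_zero] at this
    simpa using this
  simp [this]

lemma broad_one (d : ℕ) {k : ℕ} (hk : 2 ≤ k) {p K B : ℝ} (hp : 0 < p) (hK : 0 ≤ K) (hB : 0 ≤ B) :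
    ∃ C > 0, ∀ (f : Fin k → VV d → ℂ) (ξ : Fin k → VV d) (δ : ℝ) (c : VV d × ℝ), (∀ j, Nice (f j) (ξ j) δ) → 0 < δ → δ ≤ 1 → (∀ j, ‖ξ j‖ ≤ B) →
      ∏ j, sK (f j) K c ^ (p / k) ≤ ENNReal.ofReal C * aa f δ⁻¹ c ^ (p * (k - 1) / (2 * k)) := by
  obtain ⟨C, hC, h1⟩ := En_pt d hB
  obtain ⟨D, hD, h2⟩ := En_near d hK hB
  have hk0 : (0:ℝ) < k := by positivity
  have hk1 : (0:ℝ) < (k:ℝ) - 1 := by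
    have : (2:ℝ) ≤ k := by exact_mod_cast hk
    linarith
  refine ⟨((C * D) ^ (p / (2 * k))) ^ k, by positivity, ?_⟩
  intro f ξ δ c hf hδ hδ1 hξ
  have hr : 1 ≤ δ⁻¹ := (one_le_inv₀ hδ).2 hδ1
  have key : ∀ j, sK (f j) K c ^ (p / k) ≤ ENNReal.ofReal ((C * D) ^ (p / (2 * k))) * En (f j) c.1 c.2 δ⁻¹ ^ (p / (2 * k)) := by
    intro j
    have h3 : sK (f j) K c ^ (2:ℝ) ≤ ENNReal.ofReal (C * D) * En (f j) c.1 c.2 δ⁻¹ := by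
      apply sK_pow_le (by norm_num)
      intro X hX
      have h4 := h1 (f j) (ξ j) X.1 X.2 δ⁻¹ δ (hf j) hδ1 (hξ j) hr
      have h5 := h2 (f j) (ξ j) δ⁻¹ δ X (c - X) (hf j) hδ hδ1 (hξ j) (by rw [inv_mul_cancel₀ hδ.ne']) (by
        rw [mem_closedBall_iff_norm'] at hX
        nlinarith)
      rw [add_sub_cancel] at h5
      rw [ENNReal.rpow_two]
      refine h4.trans ?_
      rw [ENNReal.ofReal_mul hC.le, mul_assoc]
      exact mul_le_mul_right h5 _
    have h6 : p / k = 2 * (p / (2 * k)) := by field_simp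
    rw [h6, ENNReal.rpow_mul]
    refine (ENNReal.rpow_le_rpow h3 (by positivity)).trans ?_
    rw [ENNReal.mul_rpow_of_nonneg _ _ (by positivity), ENNReal.ofReal_rpow_of_pos (by positivity)]
  refine (Finset.prod_le_prod' fun j _ => key j).trans ?_
  rw [Finset.prod_mul_distrib, Finset.prod_const, Finset.card_univ, Fintype.card_fin, ← ENNReal.ofReal_pow (by positivity)]
  refine mul_le_mul_right (le_of_eq ?_) _
  unfold aa
  rw [← ENNReal.prod_rpow_of_nonneg (by positivity)]
  refine Finset.prod_congr rfl fun j _ => ?_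
  rw [← ENNReal.rpow_mul]
  congr 1
  field_simp

lemma narrow_pt {p : ℝ} (hp : 2 < p) {F1 F2 S1 S2 : ℂ} {s η N : ℝ≥0∞} (hη : N * η = 1) (hN : N ≠ ∞)
    (h1 : ‖F1 - S1‖ₑ ≤ η ^ 3 * s) (h2 : ‖F2 - S2‖ₑ ≤ η ^ 3 * s) (h3 : ‖F2‖ₑ ≤ N * s) (h4 : ‖S1‖ₑ ≤ N * s) :
    (‖F1‖ₑ * ‖F2‖ₑ) ^ (p / 2) ≤ 2 ^ (p / 2) * (‖S1‖ₑ * ‖S2‖ₑ) ^ (p / 2) + 2 ^ p * (η ^ p * s ^ p) := by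
  have e : N * s * (η ^ 3 * s) = (η * s) ^ 2 := by
    calc _ = (N * η) * (η * s) ^ 2 := by ring
      _ = _ := by rw [hη, one_mul]
  have b : ‖F1‖ₑ * ‖F2‖ₑ ≤ ‖S1‖ₑ * ‖S2‖ₑ + 2 * (η * s) ^ 2 := by
    calc ‖F1‖ₑ * ‖F2‖ₑ = ‖S1 * S2 + (S1 * (F2 - S2) + (F1 - S1) * F2)‖ₑ := by rw [← enorm_mul]; congr 1; ring
      _ ≤ ‖S1‖ₑ * ‖S2‖ₑ + (‖S1‖ₑ * ‖F2 - S2‖ₑ + ‖F1 - S1‖ₑ * ‖F2‖ₑ) := by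
          refine (enorm_add_le _ _).trans (add_le_add (enorm_mul _ _).le ((enorm_add_le _ _).trans (add_le_add (enorm_mul _ _).le (enorm_mul _ _).le)))
      _ ≤ ‖S1‖ₑ * ‖S2‖ₑ + (N * s * (η ^ 3 * s) + (η ^ 3 * s) * (N * s)) :=
          add_le_add le_rfl (add_le_add (mul_le_mul' h4 h2) (mul_le_mul' h1 h3))
      _ = _ := by rw [mul_comm (η ^ 3 * s) (N * s), e, two_mul]
  have hp2 : 0 < p / 2 := by linarith
  have mx : ∀ x y : ℝ≥0∞, (x + y) ^ (p / 2) ≤ 2 ^ (p / 2) * x ^ (p / 2) + 2 ^ (p / 2) * y ^ (p / 2) := by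
    intro x y
    rcases le_total x y with h | h
    · calc (x + y) ^ (p / 2) ≤ (2 * y) ^ (p / 2) := ENNReal.rpow_le_rpow (by rw [two_mul]; exact add_le_add h le_rfl) hp2.le
        _ = 2 ^ (p / 2) * y ^ (p / 2) := ENNReal.mul_rpow_of_nonneg _ _ hp2.le
        _ ≤ _ := le_add_self
    · calc (x + y) ^ (p / 2) ≤ (2 * x) ^ (p / 2) := ENNReal.rpow_le_rpow (by rw [two_mul]; exact add_le_add le_rfl h) hp2.le
        _ = 2 ^ (p / 2) * x ^ (p / 2) := ENNReal.mul_rpow_of_nonneg _ _ hp2.le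
        _ ≤ _ := le_self_add
  refine (ENNReal.rpow_le_rpow b hp2.le).trans ((mx _ _).trans (le_of_eq ?_))
  congr 1
  rw [ENNReal.mul_rpow_of_nonneg _ _ hp2.le, ← mul_assoc, ← ENNReal.rpow_add _ _ (by norm_num) (by norm_num), add_halves,
    ← ENNReal.rpow_two, ← ENNReal.rpow_mul, ← ENNReal.mul_rpow_of_nonneg _ _ (by linarith)]
  congr 2; ring

lemma avg (d : ℕ) : ∃ C > 0, ∀ (K S : ℝ) (h : VV d × ℝ → ℝ≥0∞), 1 ≤ K → K ≤ S → Measurable h →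
    ∫⁻ X : VV d × ℝ, h X * ENNReal.ofReal (jw (d + 1) S X) ≤ ENNReal.ofReal (C * (K ^ (d + 1))⁻¹) *
      ∫⁻ c : VV d × ℝ, ENNReal.ofReal (jw (d + 1) S c) * ∫⁻ X in Metric.closedBall c K, h X := by
  set v := volume (Metric.closedBall (0 : VV d × ℝ) 1) with hv
  have hv0 : 0 < v := Metric.measure_closedBall_pos _ _ one_pos
  have hvt : v ≠ ∞ := measure_closedBall_lt_top.ne
  have hv1 : 0 < v.toReal := ENNReal.toReal_pos hv0.ne' hvt
  set C0 : ℝ := (2 * (1 + 1 ^ 2)) ^ (d + 1) with hC0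
  have hC0p : 0 < C0 := by rw [hC0]; positivity
  refine ⟨C0 * v.toReal⁻¹, by positivity, ?_⟩
  intro K S h hK hKS hh
  have hK0 : 0 < K := by linarith
  have hS0 : 0 < S := by linarith
  have hvol : ∀ X : VV d × ℝ, volume (Metric.closedBall X K) = ENNReal.ofReal (K ^ (d + 1)) * v := by
    intro X
    rw [hv, Measure.addHaar_closedBall' volume X hK0.le, finrank_X]
  have hset : MeasurableSet {q : (VV d × ℝ) × (VV d × ℝ) | q.2 ∈ Metric.closedBall q.1 K} := by
    apply IsClosed.measurableSet
    have : {q : (VV d × ℝ) × (VV d × ℝ) | q.2 ∈ Metric.closedBall q.1 K} = {q | dist q.2 q.1 ≤ K} := rfl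
    rw [this]
    exact isClosed_le (by fun_prop) continuous_const
  set g : (VV d × ℝ) × (VV d × ℝ) → ℝ≥0∞ := {q : (VV d × ℝ) × (VV d × ℝ) | q.2 ∈ Metric.closedBall q.1 K}.indicator
    (fun q => ENNReal.ofReal (jw (d + 1) S q.1) * h q.2) with hg
  have hgm : Measurable g := Measurable.indicator (((jw_continuous _ _).measurable.comp measurable_fst).ennreal_ofReal.mul (hh.comp measurable_snd)) hset
  have r1 : ∀ c : VV d × ℝ, ENNReal.ofReal (jw (d + 1) S c) * ∫⁻ X in Metric.closedBall c K, h X = ∫⁻ X, g (c, X) := by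
    intro c
    rw [← lintegral_const_mul' _ _ ENNReal.ofReal_ne_top, ← lintegral_indicator Metric.isClosed_closedBall.measurableSet]
    congr 1
  simp only [r1]
  rw [lintegral_lintegral_swap (f := fun c X => g (c, X)) hgm.aemeasurable, ← lintegral_const_mul' _ _ ENNReal.ofReal_ne_top]
  refine lintegral_mono fun X => ?_
  have r2 : ENNReal.ofReal (C0⁻¹ * jw (d + 1) S X) * h X * volume (Metric.closedBall X K) ≤ ∫⁻ c, g (c, X) := by
    rw [← setLIntegral_const, ← lintegral_indicator Metric.isClosed_closedBall.measurableSet]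
    refine lintegral_mono fun c => ?_
    rw [hg]
    by_cases hc : c ∈ Metric.closedBall X K
    · have hc' : X ∈ Metric.closedBall c K := by rw [Metric.mem_closedBall_comm]; exact hc
      rw [Set.indicator_of_mem hc, Set.indicator_of_mem (by exact hc')]
      refine mul_le_mul_left (ENNReal.ofReal_le_ofReal ?_) _
      rw [inv_mul_le_iff₀ hC0p]
      have := jw_shift (d + 1) (x := X) (y := c) (z := 0) hS0 zero_le_one (by rw [mem_closedBall_iff_norm'] at hc; linarith)
      rw [zero_sub, zero_sub, jw_neg, jw_neg] at this
      exact this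
    · rw [Set.indicator_of_notMem hc]; exact zero_le
  refine le_trans (le_of_eq ?_) (mul_le_mul_right r2 _)
  have e1 : ENNReal.ofReal (C0⁻¹ * jw (d + 1) S X) * h X * volume (Metric.closedBall X K) =
      h X * ENNReal.ofReal (C0⁻¹ * jw (d + 1) S X * (K ^ (d + 1) * v.toReal)) := by
    have hj := (jw_pos (d + 1) S X).le
    rw [hvol, ENNReal.ofReal_mul (p := C0⁻¹ * jw (d + 1) S X) (by positivity), ENNReal.ofReal_mul (p := K ^ (d + 1)) (by positivity), ENNReal.ofReal_toReal hvt]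
    ring
  rw [e1, mul_left_comm, ← ENNReal.ofReal_mul (by positivity)]
  congr 2
  field_simp
end PExt

end

section
namespace PExt

variable {d : ℕ}

/-- index set of pieces -/
abbrev Th (d K M : ℕ) : Type := Bool × (Fin d → Fin (2 * K + 1)) × (Fin d → Fin (2 * M + 1))

/-- doubly localized pieces -/
noncomputable def ff (K M : ℕ) (gg : Bool → VV d → ℂ) (θ : Th d K M) : VV d → ℂ := pc (gq M) θ.2.2 (pc (gq K) θ.2.1 (gg θ.1))

lemma ff_ne {K M : ℕ} {gg : Bool → VV d → ℂ} {θ : Th d K M} {ξ : VV d} (h : ff K M gg θ ξ ≠ 0) :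
    gq M ξ = θ.2.2 ∧ gq K ξ = θ.2.1 ∧ gg θ.1 ξ ≠ 0 :=
  ⟨(pc_ne h).1, pc_ne (pc_ne h).2⟩

lemma ff_InF {K M : ℕ} {gg : Bool → VV d → ℂ} (hg : ∀ i, InF (gg i)) (θ : Th d K M) : InF (ff K M gg θ) :=
  ((hg θ.1).pc (gq_meas K)).pc (gq_meas M)

/-- maximal piece -/
noncomputable def smax (K M : ℕ) (gg : Bool → VV d → ℂ) (c : VV d × ℝ) : ℝ≥0∞ :=
  Finset.univ.sup fun θ : Th d K M => sK (ff K M gg θ) K c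

lemma sK_le_smax (K M : ℕ) (gg : Bool → VV d → ℂ) (c : VV d × ℝ) (θ : Th d K M) : sK (ff K M gg θ) K c ≤ smax K M gg c :=
  Finset.le_sup (f := fun θ : Th d K M => sK (ff K M gg θ) K c) (Finset.mem_univ θ)

/-- number of pieces -/
noncomputable def NN (d K M : ℕ) : ℝ≥0∞ := (Fintype.card (Th d K M) : ℝ≥0∞)

lemma NN_ne_top (d K M : ℕ) : NN d K M ≠ ∞ := ENNReal.natCast_ne_top _

lemma NN_one_le (d K M : ℕ) : 1 ≤ NN d K M := by
  unfold NN
  exact_mod_cast Fintype.card_pos (α := Th d K M)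

lemma NN_mul_inv (d K M : ℕ) : NN d K M * (NN d K M)⁻¹ = 1 :=
  ENNReal.mul_inv_cancel (one_pos.trans_le (NN_one_le d K M)).ne' (NN_ne_top d K M)

/-- significant pieces -/
def Sig (K M : ℕ) (gg : Bool → VV d → ℂ) (c : VV d × ℝ) (θ : Th d K M) : Prop :=
  smax K M gg c ≤ NN d K M ^ 4 * sK (ff K M gg θ) K c ∧ sK (ff K M gg θ) K c ≠ 0

lemma not_sig {K M : ℕ} {gg : Bool → VV d → ℂ} {c : VV d × ℝ} {θ : Th d K M} (h : ¬ Sig K M gg c θ) :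
    sK (ff K M gg θ) K c ≤ (NN d K M)⁻¹ ^ 4 * smax K M gg c := by
  by_cases h0 : sK (ff K M gg θ) K c = 0
  · rw [h0]; exact zero_le
  · have h1 : NN d K M ^ 4 * sK (ff K M gg θ) K c ≤ smax K M gg c := by
      by_contra hc
      push Not at hc
      exact h ⟨hc.le, h0⟩
    calc _ = (NN d K M * (NN d K M)⁻¹) ^ 4 * sK (ff K M gg θ) K c := by rw [NN_mul_inv]; simp
      _ = (NN d K M)⁻¹ ^ 4 * (NN d K M ^ 4 * sK (ff K M gg θ) K c) := by ring
      _ ≤ _ := mul_le_mul_right h1 _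

lemma sig_ne {K M : ℕ} {gg : Bool → VV d → ℂ} {c : VV d × ℝ} {θ : Th d K M} (h : Sig K M gg c θ) : ∃ ξ, ff K M gg θ ξ ≠ 0 := by
  by_contra hc
  push Not at hc
  exact h.2 (sK_eq_zero hc _ _)

lemma part_le {K M : ℕ} {gg : Bool → VV d → ℂ} (hg : ∀ i, InF (gg i)) {c X : VV d × ℝ} (hX : X ∈ Metric.closedBall c (K:ℝ)) (i : Bool)
    (T : Finset (Fin d → Fin (2 * K + 1))) {t : ℝ≥0∞} (ht : ∀ a ∈ T, ∀ b, sK (ff K M gg (i, a, b)) K c ≤ t) :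
    ‖∑ a ∈ T, Ex (pc (gq K) a (gg i)) X.1 X.2‖ₑ ≤ NN d K M * t := by
  calc ‖∑ a ∈ T, Ex (pc (gq K) a (gg i)) X.1 X.2‖ₑ ≤ ∑ a ∈ T, ‖Ex (pc (gq K) a (gg i)) X.1 X.2‖ₑ := enorm_sum_le _ _
    _ ≤ ∑ a ∈ T, ∑ b : Fin d → Fin (2 * M + 1), t := by
        refine Finset.sum_le_sum fun a ha => ?_
        rw [Ex_sum_pc (gq_meas M) ((hg i).pc (gq_meas K))]
        refine (enorm_sum_le _ _).trans (Finset.sum_le_sum fun b _ => ?_)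
        exact (le_sK (ff K M gg (i, a, b)) hX).trans (ht a ha b)
    _ ≤ ∑ a : Fin d → Fin (2 * K + 1), ∑ b : Fin d → Fin (2 * M + 1), t := Finset.sum_le_sum_of_subset (Finset.subset_univ _)
    _ ≤ ∑ i : Bool, ∑ a : Fin d → Fin (2 * K + 1), ∑ b : Fin d → Fin (2 * M + 1), t := 
        Finset.single_le_sum (f := fun _ : Bool => ∑ a : Fin d → Fin (2 * K + 1), ∑ b : Fin d → Fin (2 * M + 1), t) (fun _ _ => zero_le) (Finset.mem_univ i)
    _ = _ := by
        unfold NN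
        simp only [Finset.sum_const, Finset.card_univ, Fintype.card_prod, nsmul_eq_mul]
        push_cast
        ring

lemma vol_ball (d : ℕ) : ∃ v > 0, ∀ (K : ℝ) (c : VV d × ℝ), 0 ≤ K → volume (Metric.closedBall c K) = ENNReal.ofReal (v * K ^ (d + 1)) := by
  refine ⟨(volume (Metric.closedBall (0 : VV d × ℝ) 1)).toReal, ENNReal.toReal_pos (Metric.measure_closedBall_pos _ _ one_pos).ne' measure_closedBall_lt_top.ne, ?_⟩
  intro K c hK
  rw [Measure.addHaar_closedBall' volume c hK, finrank_X, mul_comm, ENNReal.ofReal_mul (by positivity), ENNReal.ofReal_toReal measure_closedBall_lt_top.ne]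

lemma smax_pow (d : ℕ) {p : ℝ} (hp : 1 < p) : ∃ C > 0, ∀ (K M : ℕ) (gg : Bool → VV d → ℂ) (c : VV d × ℝ), 1 ≤ K → (∀ i, InF (gg i)) →
    smax K M gg c ^ p ≤ ENNReal.ofReal C * ∑ θ : Th d K M, bb p (2 * (d + 1)) K (ff K M gg θ) c := by
  obtain ⟨C, hC, h⟩ := bb_pointwise d (2 * (d + 1)) (by omega) hp (Nat.cast_nonneg d) (Nat.cast_nonneg d)
  refine ⟨C * (1 + 1) ^ (2 * (d + 1)), by positivity, ?_⟩
  intro K M gg c hK hg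
  have hK1 : (1:ℝ) ≤ K := by exact_mod_cast hK
  have h1 : ∀ θ : Th d K M, sK (ff K M gg θ) K c ^ p ≤ ENNReal.ofReal (C * (1 + 1) ^ (2 * (d + 1))) * bb p (2 * (d + 1)) K (ff K M gg θ) c := by
    intro θ
    apply sK_pow_le (by linarith)
    intro X hX
    refine (h _ (cen K θ.2.1) K X c ((ff_InF hg θ).nice_box hK fun ξ hξ => (ff_ne hξ).2.1) (cen_norm _ _) hK1).trans ?_
    refine mul_le_mul_left (ENNReal.ofReal_le_ofReal ?_) _
    rw [mem_closedBall_iff_norm] at hX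
    gcongr
    rw [div_le_one (by positivity)]
    gcongr
  rw [Finset.mul_sum]
  obtain ⟨θ, -, hθ⟩ := Finset.exists_mem_eq_sup (Finset.univ : Finset (Th d K M)) Finset.univ_nonempty fun θ => sK (ff K M gg θ) K c
  unfold smax
  rw [hθ]
  refine (h1 θ).trans ?_
  exact Finset.single_le_sum (f := fun θ => ENNReal.ofReal (C * (1 + 1) ^ (2 * (d + 1))) * bb p (2 * (d + 1)) K (ff K M gg θ) c) (fun _ _ => zero_le) (Finset.mem_univ θ)

set_option maxHeartbeats 1000000 in
lemma narrow_c (d m : ℕ) {p ρ : ℝ} (hp : 2 < p) (hmp : m = 0 ∨ p ≤ 4) (hρ : 0 < ρ) : ∃ C > 0, ∀ (K M : ℕ) (gg : Bool → VV d → ℂ) (e : Bool → VV d)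
    (c : VV d × ℝ) (D : Submodule ℝ (VV d)) (y : VV d), 1 ≤ K → K ≤ M → (d:ℝ) / K ≤ ρ → (1:ℝ) + 2 * d ≤ 8 * ρ * K → (∀ i, InF (gg i)) →
    (∀ i ξ, gg i ξ ≠ 0 → ‖ξ - e i‖ ≤ ρ) → 36 * ρ ≤ ‖e false - e true‖ → Module.finrank ℝ D ≤ m →
    (∀ θ, Sig K M gg c θ → ∃ u ∈ D, ‖cen M θ.2.2 - y - u‖ ≤ 1 / (K:ℝ)) →
    ∫⁻ X in Metric.closedBall c (K:ℝ), (‖Ex (gg false) X.1 X.2‖ₑ * ‖Ex (gg true) X.1 X.2‖ₑ) ^ (p / 2) ≤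
      ENNReal.ofReal (C * (K:ℝ) ^ (d + 1) * (K:ℝ) ^ kap m p) * (∑ i : Bool, ∑ a, bb p (2 * (d + 1)) K (pc (gq K) a (gg i)) c) +
      ENNReal.ofReal (C * (K:ℝ) ^ (d + 1)) * ((NN d K M)⁻¹ * ∑ θ : Th d K M, bb p (2 * (d + 1)) K (ff K M gg θ) c) := by
  obtain ⟨C1, hC1, hnb⟩ := narrow_bd d m (L := 1 + 2 * d) hp hmp (Nat.cast_nonneg d) (Nat.cast_nonneg d) (by positivity) hρ
  obtain ⟨C2, hC2, hsm⟩ := smax_pow d (p := p) (by linarith)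
  obtain ⟨v, hv, hvol⟩ := vol_ball d
  refine ⟨2 ^ (p / 2) * C1 + 2 ^ p * C2 * v, by positivity, ?_⟩
  intro K M gg e c D y hK hKM hdK hLK hg hsupp hsep hD hsig
  classical
  have hK1 : (1:ℝ) ≤ K := by exact_mod_cast hK
  have hK0 : (0:ℝ) < K := by linarith
  let T : Bool → Finset (Fin d → Fin (2 * K + 1)) := fun i => Finset.univ.filter fun a => ∃ b, Sig K M gg c (i, a, b)
  have hT : ∀ i a, a ∈ T i → ∃ b, Sig K M gg c (i, a, b) := fun i a ha => (Finset.mem_filter.1 ha).2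
  have hT' : ∀ i a, a ∉ T i → ∀ b, ¬ Sig K M gg c (i, a, b) := fun i a ha b hb => ha (Finset.mem_filter.2 ⟨Finset.mem_univ _, b, hb⟩)
  set s := smax K M gg c with hs
  set N := NN d K M with hN
  have hNt : N ≠ ∞ := NN_ne_top _ _ _
  have hη : N * N⁻¹ = 1 := NN_mul_inv _ _ _
  -- geometry
  have geo : ∀ i a, a ∈ T i → ‖cen K a - e i‖ ≤ 2 * ρ ∧ ∃ u ∈ D, ‖cen K a - y - u‖ ≤ (1 + 2 * d) / K := by
    intro i a ha
    obtain ⟨b, hb⟩ := hT i a ha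
    obtain ⟨ξ, hξ⟩ := sig_ne hb
    have hI := ff_InF hg (i, a, b)
    have n1 : ‖ξ - cen K a‖ ≤ d / K := by
      by_contra hc; push Not at hc
      exact hξ ((hI.nice_box hK fun ξ hξ => (ff_ne hξ).2.1).supp ξ hc)
    have n2 : ‖ξ - cen M b‖ ≤ d / M := by
      by_contra hc; push Not at hc
      exact hξ ((hI.nice_box (hK.trans hKM) fun ξ hξ => (ff_ne hξ).1).supp ξ hc)
    have n3 : ‖ξ - e i‖ ≤ ρ := hsupp i ξ (ff_ne hξ).2.2
    constructor
    · calc ‖cen K a - e i‖ = ‖(ξ - e i) - (ξ - cen K a)‖ := by congr 1; abel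
        _ ≤ ‖ξ - e i‖ + ‖ξ - cen K a‖ := norm_sub_le _ _
        _ ≤ _ := by linarith
    · obtain ⟨u, hu, h1⟩ := hsig _ hb
      refine ⟨u, hu, ?_⟩
      have n4 : (d:ℝ) / M ≤ d / K := by
        have : (K:ℝ) ≤ M := by exact_mod_cast hKM
        gcongr
      calc ‖cen K a - y - u‖ = ‖(cen M b - y - u) + ((ξ - cen M b) - (ξ - cen K a))‖ := by congr 1; abel
        _ ≤ ‖cen M b - y - u‖ + (‖ξ - cen M b‖ + ‖ξ - cen K a‖) := (norm_add_le _ _).trans (add_le_add le_rfl (norm_sub_le _ _))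
        _ ≤ 1 / K + (d / K + d / K) := by
            refine add_le_add h1 (add_le_add (n2.trans n4) n1)
        _ = _ := by ring
  -- pointwise
  have hF : ∀ i (X : VV d × ℝ), Ex (gg i) X.1 X.2 = ∑ a, Ex (pc (gq K) a (gg i)) X.1 X.2 := fun i X => Ex_sum_pc (gq_meas K) (hg i) _ _
  have pt : ∀ X ∈ Metric.closedBall c (K:ℝ), (‖Ex (gg false) X.1 X.2‖ₑ * ‖Ex (gg true) X.1 X.2‖ₑ) ^ (p / 2) ≤
      2 ^ (p / 2) * (‖∑ a ∈ T false, Ex (pc (gq K) a (gg false)) X.1 X.2‖ₑ * ‖∑ a ∈ T true, Ex (pc (gq K) a (gg true)) X.1 X.2‖ₑ) ^ (p / 2)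
        + 2 ^ p * (N⁻¹ ^ p * s ^ p) := by
    intro X hX
    have hr : ∀ i, ‖Ex (gg i) X.1 X.2 - ∑ a ∈ T i, Ex (pc (gq K) a (gg i)) X.1 X.2‖ₑ ≤ N⁻¹ ^ 3 * s := by
      intro i
      rw [hF, ← Finset.sum_add_sum_compl (T i) (fun a => Ex (pc (gq K) a (gg i)) X.1 X.2), add_sub_cancel_left]
      refine (part_le (M := M) hg hX i _ (t := N⁻¹ ^ 4 * s) fun a ha b => not_sig (hT' i a (Finset.mem_compl.1 ha) b)).trans (le_of_eq ?_)
      calc N * (N⁻¹ ^ 4 * s) = (N * N⁻¹) * (N⁻¹ ^ 3 * s) := by ring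
        _ = _ := by rw [hη, one_mul]
    refine narrow_pt hp hη hNt (hr false) (hr true) ?_ ?_
    · rw [hF]
      exact part_le hg hX true _ fun a _ b => sK_le_smax _ _ _ _ _
    · exact part_le hg hX false _ fun a _ b => sK_le_smax _ _ _ _ _
  have nb := hnb (Fin d → Fin (2 * K + 1)) K c (T false) (T true) (fun a => pc (gq K) a (gg false)) (fun a => pc (gq K) a (gg true)) (cen K) D y hK1 hLK
    (fun i j hij => cen_sep hK hij) (fun a => ((hg _).pc (gq_meas K)).nice_box hK fun ξ hξ => (pc_ne hξ).1)
    (fun a => ((hg _).pc (gq_meas K)).nice_box hK fun ξ hξ => (pc_ne hξ).1) (cen_norm K)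
    (fun i hi j hj => by
      calc ‖cen K i - cen K j‖ = ‖(cen K i - e false) - (cen K j - e false)‖ := by congr 1; abel
        _ ≤ _ := norm_sub_le _ _
        _ ≤ 2 * ρ + 2 * ρ := add_le_add (geo _ _ hi).1 (geo _ _ hj).1
        _ = _ := by ring)
    (fun i hi j hj => by
      have h1 : ‖e false - e true‖ ≤ ‖cen K i - cen K j‖ + (2 * ρ + 2 * ρ) := by
        calc ‖e false - e true‖ = ‖(cen K i - cen K j) + ((cen K j - e true) - (cen K i - e false))‖ := by congr 1; abel
          _ ≤ ‖cen K i - cen K j‖ + (‖cen K j - e true‖ + ‖cen K i - e false‖) := (norm_add_le _ _).trans (add_le_add le_rfl (norm_sub_le _ _))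
          _ ≤ _ := by
            have := (geo _ _ hi).1
            have := (geo _ _ hj).1
            linarith
      linarith)
    hD (fun i hi => (geo _ _ hi).2) (fun i hi => (geo _ _ hi).2)
  have b1 : ∑ a ∈ T false, bb p (2 * (d + 1)) K (pc (gq K) a (gg false)) c + ∑ a ∈ T true, bb p (2 * (d + 1)) K (pc (gq K) a (gg true)) c ≤
      ∑ i : Bool, ∑ a, bb p (2 * (d + 1)) K (pc (gq K) a (gg i)) c := by
    rw [Fintype.sum_bool, add_comm]
    exact add_le_add (Finset.sum_le_sum_of_subset (Finset.subset_univ _)) (Finset.sum_le_sum_of_subset (Finset.subset_univ _))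
  have hNp : N⁻¹ ^ p ≤ N⁻¹ := by
    calc N⁻¹ ^ p ≤ N⁻¹ ^ (1:ℝ) := ENNReal.rpow_le_rpow_of_exponent_ge (ENNReal.inv_le_one.2 (NN_one_le _ _ _)) (by linarith)
      _ = _ := ENNReal.rpow_one _
  have h2t : ∀ q : ℝ, (2:ℝ≥0∞) ^ q = ENNReal.ofReal (2 ^ q) := by
    intro q
    rw [← ENNReal.ofReal_rpow_of_pos (by norm_num)]; simp
  have h2q : (2:ℝ≥0∞) ^ (p / 2) ≠ ∞ := by rw [h2t]; exact ENNReal.ofReal_ne_top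
  refine (setLIntegral_mono' Metric.isClosed_closedBall.measurableSet pt).trans ?_
  rw [lintegral_add_right _ measurable_const, lintegral_const_mul' _ _ h2q, setLIntegral_const, hvol K c hK0.le]
  refine add_le_add ?_ ?_
  · calc _ ≤ 2 ^ (p / 2) * (ENNReal.ofReal (C1 * K ^ (d + 1) * K ^ kap m p) * ∑ i : Bool, ∑ a, bb p (2 * (d + 1)) K (pc (gq K) a (gg i)) c) :=
          mul_le_mul_right (nb.trans (mul_le_mul_right b1 _)) _
      _ ≤ _ := by
          rw [h2t, ← mul_assoc, ← ENNReal.ofReal_mul (by positivity)]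
          refine mul_le_mul_left (ENNReal.ofReal_le_ofReal ?_) _
          have : 0 ≤ 2 ^ p * C2 * v * (K:ℝ) ^ (d + 1) * (K:ℝ) ^ kap m p := by positivity
          linarith
  · calc 2 ^ p * (N⁻¹ ^ p * s ^ p) * ENNReal.ofReal (v * K ^ (d + 1)) ≤ 2 ^ p * (N⁻¹ * (ENNReal.ofReal C2 * ∑ θ : Th d K M, bb p (2 * (d + 1)) K (ff K M gg θ) c)) * ENNReal.ofReal (v * K ^ (d + 1)) :=
          mul_le_mul_left (mul_le_mul_right (mul_le_mul' hNp (hsm K M gg c hK hg)) _) _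
      _ = ENNReal.ofReal (2 ^ p * C2 * v * K ^ (d + 1)) * (N⁻¹ * ∑ θ : Th d K M, bb p (2 * (d + 1)) K (ff K M gg θ) c) := by
          rw [h2t, mul_assoc (2 ^ p * C2), ENNReal.ofReal_mul (p := 2 ^ p * C2) (by positivity), ENNReal.ofReal_mul (p := 2 ^ p) (by positivity)]
          ring
      _ ≤ _ := by
          refine mul_le_mul_left (ENNReal.ofReal_le_ofReal ?_) _
          have : 0 ≤ 2 ^ (p / 2) * C1 * (K:ℝ) ^ (d + 1) := by positivity
          linarith
end PExt

end

section
namespace PExt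

variable {d : ℕ}

lemma broad_c (d : ℕ) {k : ℕ} (hk : 2 ≤ k) {p : ℝ} (hp : 0 < p) {K : ℕ} (hK : 1 ≤ K) {M : ℕ} (hM : 1 ≤ M) : ∃ C > 0, ∀ (gg : Bool → VV d → ℂ)
    (c : VV d × ℝ) (τ : Fin k → Th d K M) (δ : ℝ), (∀ i, InF (gg i)) → 0 < δ → δ ≤ 1 → (d:ℝ) / M ≤ δ → (∀ j, Sig K M gg c (τ j)) →
    ∫⁻ X in Metric.closedBall c (K:ℝ), (‖Ex (gg false) X.1 X.2‖ₑ * ‖Ex (gg true) X.1 X.2‖ₑ) ^ (p / 2) ≤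
      ENNReal.ofReal C * aa (fun j => ff K M gg (τ j)) δ⁻¹ c ^ (p * (k - 1) / (2 * k)) := by
  obtain ⟨C1, hC1, hb⟩ := broad_one d hk hp (Nat.cast_nonneg K) (Nat.cast_nonneg d)
  obtain ⟨v, hv, hvol⟩ := vol_ball d
  have hK0 : (0:ℝ) < K := by exact_mod_cast hK
  have hNr : 0 < (NN d K M).toReal := ENNReal.toReal_pos (one_pos.trans_le (NN_one_le d K M)).ne' (NN_ne_top d K M)
  refine ⟨(NN d K M).toReal ^ p * (((NN d K M).toReal ^ 4) ^ (p / k)) ^ k * C1 * (v * K ^ (d + 1)), by positivity, ?_⟩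
  intro gg c τ δ hg hδ hδ1 hM2 hsig
  have hk0 : (0:ℝ) < k := by positivity
  have hNo : NN d K M = ENNReal.ofReal (NN d K M).toReal := (ENNReal.ofReal_toReal (NN_ne_top d K M)).symm
  set N := NN d K M with hN
  set s := smax K M gg c with hs
  have h1 : s ^ p ≤ ENNReal.ofReal ((((N.toReal) ^ 4) ^ (p / k)) ^ k) * ∏ j, sK (ff K M gg (τ j)) K c ^ (p / k) := by
    calc s ^ p = ∏ j : Fin k, s ^ (p / k) := by
          rw [Finset.prod_const, Finset.card_univ, Fintype.card_fin, ← ENNReal.rpow_natCast, ← ENNReal.rpow_mul]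
          congr 1; field_simp
      _ ≤ ∏ j : Fin k, (ENNReal.ofReal ((N.toReal ^ 4) ^ (p / k)) * sK (ff K M gg (τ j)) K c ^ (p / k)) := by
          refine Finset.prod_le_prod' fun j _ => ?_
          refine (ENNReal.rpow_le_rpow (hsig j).1 (by positivity)).trans (le_of_eq ?_)
          rw [ENNReal.mul_rpow_of_nonneg _ _ (by positivity)]
          congr 1
          rw [← ENNReal.ofReal_rpow_of_pos (by positivity), ENNReal.ofReal_pow hNr.le, ← hNo]
      _ = _ := by
          rw [Finset.prod_mul_distrib, Finset.prod_const, Finset.card_univ, Fintype.card_fin, ENNReal.ofReal_pow (by positivity)]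
  have hb' := hb (fun j => ff K M gg (τ j)) (fun j => cen M (τ j).2.2) δ c (fun j => ((ff_InF hg (τ j)).nice_box hM fun ξ hξ => (ff_ne hξ).1).mono hM2) hδ hδ1 (fun j => cen_norm _ _)
  have pt : ∀ X ∈ Metric.closedBall c (K:ℝ), (‖Ex (gg false) X.1 X.2‖ₑ * ‖Ex (gg true) X.1 X.2‖ₑ) ^ (p / 2) ≤ N ^ p * s ^ p := by
    intro X hX
    have hF : ∀ i, ‖Ex (gg i) X.1 X.2‖ₑ ≤ N * s := by
      intro i
      rw [Ex_sum_pc (gq_meas K) (hg i)]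
      exact part_le hg hX i _ fun a _ b => sK_le_smax _ _ _ _ _
    refine (ENNReal.rpow_le_rpow (mul_le_mul' (hF false) (hF true)) (by positivity)).trans (le_of_eq ?_)
    rw [← ENNReal.mul_rpow_of_nonneg _ _ hp.le, ← sq, ← ENNReal.rpow_two, ← ENNReal.rpow_mul]
    congr 1; ring
  refine (setLIntegral_mono' Metric.isClosed_closedBall.measurableSet pt).trans ?_
  rw [setLIntegral_const, hvol K c hK0.le]
  calc N ^ p * s ^ p * ENNReal.ofReal (v * K ^ (d + 1)) ≤ N ^ p * (ENNReal.ofReal ((((N.toReal) ^ 4) ^ (p / k)) ^ k) * (ENNReal.ofReal C1 * aa (fun j => ff K M gg (τ j)) δ⁻¹ c ^ (p * (k - 1) / (2 * k)))) * ENNReal.ofReal (v * K ^ (d + 1)) := 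
        mul_le_mul_left (mul_le_mul_right (h1.trans (mul_le_mul_right hb' _)) _) _
    _ = _ := by
        rw [ENNReal.ofReal_mul (q := v * K ^ (d + 1)) (by positivity), ENNReal.ofReal_mul (q := C1) (by positivity), ENNReal.ofReal_mul (q := (((N.toReal) ^ 4) ^ (p / k)) ^ k) (by positivity),
          ← ENNReal.ofReal_rpow_of_pos hNr, ← hNo]
        ring

lemma bb_W (d : ℕ) {p : ℝ} (hp : 0 < p) : ∃ C > 0, ∀ (K : ℕ) (S : ℝ) (A : ℝ≥0∞) (f : VV d → ℂ) (a : Fin d → Fin (2 * K + 1)), 1 + 2 * d ≤ K → (K:ℝ) ≤ S → BdS d p S A →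
    InF f → (∀ ξ, f ξ ≠ 0 → gq K ξ = a) →
    ∫⁻ c : VV d × ℝ, ENNReal.ofReal (jw (d + 1) S c) * bb p (2 * (d + 1)) K f c ≤ ENNReal.ofReal (C * (K:ℝ) ^ (-(d * p - d - 2))) * A := by
  obtain ⟨C, hC, h⟩ := bb_int d p
  refine ⟨C, hC, ?_⟩
  intro K S A f a hK hKS hA hf ha
  have hK1 : (1:ℝ) ≤ K := by exact_mod_cast (by omega : 1 ≤ K)
  refine (h f K S hf.integrable hK1 hKS).trans ?_
  rw [ENNReal.ofReal_mul hC.le, mul_assoc]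
  exact mul_le_mul_right (rescale hp (by linarith) hA hK hf ha) _

set_option maxHeartbeats 1000000 in
lemma bilinear (d m : ℕ) (hd : 1 ≤ d) {p ρ : ℝ} (hp : 2 < p) (hmp : m = 0 ∨ p ≤ 4) (hs : 1 < p * (((m + 1 + 1 : ℕ) : ℝ) - 1) / (2 * ((m + 1 + 1 : ℕ) : ℝ))) (hρ : 0 < ρ) :
    ∃ C > 0, ∀ K : ℕ, 1 + 2 * d ≤ K → (d:ℝ) / K ≤ ρ → (1:ℝ) + 2 * d ≤ 8 * ρ * K → ∃ C2 > 0, ∀ (S : ℝ) (A : ℝ≥0∞) (gg : Bool → VV d → ℂ) (e : Bool → VV d),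
      (K:ℝ) ≤ S → BdS d p S A → (∀ i, InF (gg i)) → (∀ i ξ, gg i ξ ≠ 0 → ‖ξ - e i‖ ≤ ρ) → 36 * ρ ≤ ‖e false - e true‖ →
      ∫⁻ X : VV d × ℝ, (‖Ex (gg false) X.1 X.2‖ₑ * ‖Ex (gg true) X.1 X.2‖ₑ) ^ (p / 2) * ENNReal.ofReal (jw (d + 1) S X) ≤
        ENNReal.ofReal (C * (K:ℝ) ^ (kap m p - (d * (p - 2) - 2))) * A + ENNReal.ofReal C2 := by
  obtain ⟨C1, hC1, hnar⟩ := narrow_c d m hp hmp hρ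
  obtain ⟨Ca, hCa, havg⟩ := avg d
  obtain ⟨Cb, hCb, hbb⟩ := bb_W d (p := p) (by linarith)
  refine ⟨Ca * C1 * Cb * (2 * 3 ^ d + 1), by positivity, ?_⟩
  intro K hK hdK hLK
  have hKn : 1 ≤ K := by omega
  have hK1 : (1:ℝ) ≤ K := by exact_mod_cast hKn
  have hK0 : (0:ℝ) < K := by linarith
  obtain ⟨c0, hc0, htr⟩ := trans_alt (d := d) (B := d) (ε := 1 / K) (Nat.cast_nonneg d) (by positivity) (m + 1)
  obtain ⟨δ, Cg, hδ, hδ1, hglob⟩ := broad_global (k := m + 1 + 1) hd (by omega) hc0 (Nat.cast_nonneg d : (0:ℝ) ≤ d) hs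
  obtain ⟨M, hKM, hMδ⟩ : ∃ M : ℕ, K ≤ M ∧ (d:ℝ) / M ≤ δ := by
    refine ⟨max K ⌈d / δ⌉₊, le_max_left _ _, ?_⟩
    have h1 : (d:ℝ) / δ ≤ (max K ⌈d / δ⌉₊ : ℕ) := (Nat.le_ceil _).trans (by exact_mod_cast le_max_right _ _)
    have h2 : (0:ℝ) < (max K ⌈d / δ⌉₊ : ℕ) := by exact_mod_cast lt_of_lt_of_le hKn (le_max_left _ _)
    rw [div_le_iff₀ hδ] at h1
    rw [div_le_iff₀ h2]; linarith
  obtain ⟨C3, hC3, hbro⟩ := broad_c d (k := m + 1 + 1) (by omega) (by linarith : 0 < p) hKn (hKn.trans hKM)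
  classical
  let U : Finset (Fin (m + 1 + 1) → Th d K M) := Finset.univ.filter fun τ => Trans c0 fun j => cen M (τ j).2.2
  refine ⟨Ca * (K ^ (d + 1) : ℝ)⁻¹ * (C3 * (U.card * |Cg|)) + 1, by positivity, ?_⟩
  intro S A gg e hKS hA hg hsupp hsep
  set s := p * (((m + 1 + 1 : ℕ) : ℝ) - 1) / (2 * ((m + 1 + 1 : ℕ) : ℝ)) with hsdef
  have hU : ∀ τ, τ ∈ U ↔ Trans c0 fun j => cen M (τ j).2.2 := fun τ => by simp [U]
  have perc : ∀ c : VV d × ℝ, ∫⁻ X in Metric.closedBall c (K:ℝ), (‖Ex (gg false) X.1 X.2‖ₑ * ‖Ex (gg true) X.1 X.2‖ₑ) ^ (p / 2) ≤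
      ENNReal.ofReal (C1 * (K:ℝ) ^ (d + 1) * (K:ℝ) ^ kap m p) * (∑ i : Bool, ∑ a, bb p (2 * (d + 1)) K (pc (gq K) a (gg i)) c) +
      ENNReal.ofReal (C1 * (K:ℝ) ^ (d + 1)) * ((NN d K M)⁻¹ * ∑ θ : Th d K M, bb p (2 * (d + 1)) K (ff K M gg θ) c) +
      ENNReal.ofReal C3 * ∑ τ ∈ U, aa (fun j => ff K M gg (τ j)) δ⁻¹ c ^ s := by
    intro c
    have nar := fun (D : Submodule ℝ (VV d)) (y : VV d) h1 h2 => (hnar K M gg e c D y hKn hKM hdK hLK hg hsupp hsep h1 h2).trans (le_self_add (b := ENNReal.ofReal C3 * ∑ τ ∈ U, aa (fun j => ff K M gg (τ j)) δ⁻¹ c ^ s))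
    by_cases hne : ∃ θ, Sig K M gg c θ
    · obtain ⟨θ0, hθ0⟩ := hne
      rcases htr {x | ∃ θ, Sig K M gg c θ ∧ cen M θ.2.2 = x} ⟨_, θ0, hθ0, rfl⟩ (by rintro x ⟨θ, -, rfl⟩; exact cen_norm _ _) with ⟨ξ, hξ, ht⟩ | ⟨y, D, hD, hx⟩
      · choose τ hτ hτ2 using hξ
        have hτU : τ ∈ U := by
          rw [hU]
          have : (fun j => cen M (τ j).2.2) = ξ := funext hτ2
          rw [this]; exact ht
        refine (hbro gg c τ δ hg hδ hδ1.le hMδ hτ).trans (le_trans ?_ le_add_self)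
        exact mul_le_mul_right (Finset.single_le_sum (f := fun τ : Fin (m + 1 + 1) → Th d K M => aa (fun j => ff K M gg (τ j)) δ⁻¹ c ^ s) (fun _ _ => zero_le) hτU) _
      · exact nar D y (by omega) fun θ hθ => hx _ ⟨θ, hθ, rfl⟩
    · push Not at hne
      exact nar ⊥ 0 (by simp) fun θ hθ => absurd hθ (hne θ)
  have mF : ∀ i, Measurable fun X : VV d × ℝ => ‖Ex (gg i) X.1 X.2‖ₑ := fun i => (measurable_ExX (hg i).integrable).enorm
  refine (havg K S _ hK1 hKS (((mF false).mul (mF true)).pow_const _)).trans ?_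
  set W : VV d × ℝ → ℝ≥0∞ := fun c => ENNReal.ofReal (jw (d + 1) S c) with hW
  have mW : Measurable W := (jw_continuous _ _).measurable.ennreal_ofReal
  have mb : ∀ f : VV d → ℂ, InF f → Measurable fun c => W c * bb p (2 * (d + 1)) K f c := fun f hf => mW.mul (bb_measurable hf.integrable _ _ _)
  have ma : ∀ τ : Fin (m + 1 + 1) → Th d K M, Measurable fun c => W c * aa (fun j => ff K M gg (τ j)) δ⁻¹ c ^ s := fun τ =>
    mW.mul ((aa_measurable (fun j => (ff_InF hg (τ j)).integrable) _).pow_const _)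
  set Q : ℝ≥0∞ := ENNReal.ofReal (Cb * (K:ℝ) ^ (-(d * p - d - 2))) * A with hQ
  have i1 : ∫⁻ c, ∑ i : Bool, ∑ a, W c * bb p (2 * (d + 1)) K (pc (gq K) a (gg i)) c ≤ ENNReal.ofReal (2 * 3 ^ d * (K:ℝ) ^ d) * Q := by
    rw [lintegral_finsetSum _ fun i _ => Finset.measurable_sum _ fun a _ => mb _ ((hg i).pc (gq_meas K))]
    calc _ ≤ ∑ i : Bool, ∑ a : Fin d → Fin (2 * K + 1), Q := by
          refine Finset.sum_le_sum fun i _ => ?_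
          rw [lintegral_finsetSum _ fun a _ => mb _ ((hg i).pc (gq_meas K))]
          exact Finset.sum_le_sum fun a _ => hbb K S A _ a hK hKS hA ((hg i).pc (gq_meas K)) fun ξ hξ => (pc_ne hξ).1
      _ = ENNReal.ofReal (2 * (2 * K + 1) ^ d) * Q := by
          simp only [Finset.sum_const, Finset.card_univ, nsmul_eq_mul, Fintype.card_bool, Fintype.card_fun, Fintype.card_fin]
          rw [← mul_assoc]
          congr 1
          rw [ENNReal.ofReal_mul (by norm_num), ENNReal.ofReal_pow (by positivity)]
          congr 1
          · simp
          · push_cast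
            congr 1
            rw [ENNReal.ofReal_add (by positivity) (by norm_num), ENNReal.ofReal_mul (by norm_num)]
            simp
      _ ≤ _ := by
          refine mul_le_mul_left (ENNReal.ofReal_le_ofReal ?_) _
          rw [mul_assoc, ← mul_pow]
          gcongr
          linarith
  have i2 : ∫⁻ c, ∑ θ : Th d K M, W c * bb p (2 * (d + 1)) K (ff K M gg θ) c ≤ NN d K M * Q := by
    rw [lintegral_finsetSum _ fun θ _ => mb _ (ff_InF hg θ)]
    calc _ ≤ ∑ θ : Th d K M, Q := Finset.sum_le_sum fun θ _ => hbb K S A _ θ.2.1 hK hKS hA (ff_InF hg θ) fun ξ hξ => (ff_ne hξ).2.1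
      _ = _ := by rw [Finset.sum_const, Finset.card_univ, nsmul_eq_mul]; rfl
  have i3 : ∫⁻ c, ∑ τ ∈ U, W c * aa (fun j => ff K M gg (τ j)) δ⁻¹ c ^ s ≤ ENNReal.ofReal (U.card * |Cg|) := by
    rw [lintegral_finsetSum _ fun τ _ => ma τ]
    calc _ ≤ ∑ τ ∈ U, ENNReal.ofReal |Cg| := by
          refine Finset.sum_le_sum fun τ hτ => ?_
          refine le_trans (lintegral_mono fun c => ?_) ((hglob (fun j => ff K M gg (τ j)) (fun j => cen M (τ j).2.2)
            (fun j => ((ff_InF hg (τ j)).nice_box (hKn.trans hKM) fun ξ hξ => (ff_ne hξ).1).mono hMδ) (fun j => (ff_InF hg (τ j)).bdd)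
            (fun j => cen_norm _ _) ((hU τ).1 hτ)).trans (ENNReal.ofReal_le_ofReal (le_abs_self _)))
          calc _ ≤ 1 * aa (fun j => ff K M gg (τ j)) δ⁻¹ c ^ s := mul_le_mul_left (ENNReal.ofReal_le_one.2 (jw_le_one _ _ _)) _
            _ = _ := one_mul _
      _ = _ := by rw [Finset.sum_const, nsmul_eq_mul, ENNReal.ofReal_mul (by positivity)]; simp
  have tot : ∫⁻ c, W c * ∫⁻ X in Metric.closedBall c (K:ℝ), (‖Ex (gg false) X.1 X.2‖ₑ * ‖Ex (gg true) X.1 X.2‖ₑ) ^ (p / 2) ≤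
      ENNReal.ofReal (C1 * (K:ℝ) ^ (d + 1) * (K:ℝ) ^ kap m p) * (ENNReal.ofReal (2 * 3 ^ d * (K:ℝ) ^ d) * Q) +
      ENNReal.ofReal (C1 * (K:ℝ) ^ (d + 1)) * Q + ENNReal.ofReal C3 * ENNReal.ofReal (U.card * |Cg|) := by
    have hNi : (NN d K M)⁻¹ ≠ ∞ := ENNReal.inv_ne_top.2 (one_pos.trans_le (NN_one_le d K M)).ne'
    calc _ ≤ ∫⁻ c, (ENNReal.ofReal (C1 * (K:ℝ) ^ (d + 1) * (K:ℝ) ^ kap m p) * (∑ i : Bool, ∑ a, W c * bb p (2 * (d + 1)) K (pc (gq K) a (gg i)) c) +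
      ENNReal.ofReal (C1 * (K:ℝ) ^ (d + 1)) * ((NN d K M)⁻¹ * ∑ θ : Th d K M, W c * bb p (2 * (d + 1)) K (ff K M gg θ) c) +
      ENNReal.ofReal C3 * ∑ τ ∈ U, W c * aa (fun j => ff K M gg (τ j)) δ⁻¹ c ^ s) := by
          refine lintegral_mono fun c => ?_
          refine (mul_le_mul_right (perc c) _).trans (le_of_eq ?_)
          simp only [← Finset.mul_sum]
          ring
      _ = ENNReal.ofReal (C1 * (K:ℝ) ^ (d + 1) * (K:ℝ) ^ kap m p) * (∫⁻ c, ∑ i : Bool, ∑ a, W c * bb p (2 * (d + 1)) K (pc (gq K) a (gg i)) c) +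
      ENNReal.ofReal (C1 * (K:ℝ) ^ (d + 1)) * ((NN d K M)⁻¹ * ∫⁻ c, ∑ θ : Th d K M, W c * bb p (2 * (d + 1)) K (ff K M gg θ) c) +
      ENNReal.ofReal C3 * ∫⁻ c, ∑ τ ∈ U, W c * aa (fun j => ff K M gg (τ j)) δ⁻¹ c ^ s := by
          rw [lintegral_add_right _ ((Finset.measurable_sum _ fun τ _ => ma τ).const_mul _),
            lintegral_add_right _ (((Finset.measurable_sum _ fun θ _ => mb _ (ff_InF hg θ)).const_mul _).const_mul _),
            lintegral_const_mul' _ _ ENNReal.ofReal_ne_top, lintegral_const_mul' _ _ ENNReal.ofReal_ne_top, lintegral_const_mul' _ _ ENNReal.ofReal_ne_top, lintegral_const_mul' _ _ hNi]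
      _ ≤ _ := by
          refine add_le_add (add_le_add (mul_le_mul_right i1 _) (mul_le_mul_right ?_ _)) (mul_le_mul_right i3 _)
          calc _ ≤ (NN d K M)⁻¹ * (NN d K M * Q) := mul_le_mul_right i2 _
            _ = Q := by rw [← mul_assoc, mul_comm (NN d K M)⁻¹, NN_mul_inv, one_mul]
  refine (mul_le_mul_right tot _).trans ?_
  have hkap : 0 ≤ kap m p := le_max_left _ _
  rw [mul_add]
  refine add_le_add ?_ ?_
  · rw [hQ, ← mul_assoc, ← mul_assoc, ← mul_assoc, ← add_mul, ← mul_assoc]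
    refine mul_le_mul_left ?_ _
    rw [← ENNReal.ofReal_mul (by positivity), ← ENNReal.ofReal_mul (by positivity), ← ENNReal.ofReal_mul (by positivity), ← ENNReal.ofReal_add (by positivity) (by positivity),
      ← ENNReal.ofReal_mul (by positivity)]
    apply ENNReal.ofReal_le_ofReal
    have q1 : (K:ℝ) ^ kap m p * ((K:ℝ) ^ d * (K:ℝ) ^ (-(d * p - d - 2))) = (K:ℝ) ^ (kap m p - (d * (p - 2) - 2)) := by
      rw [← Real.rpow_natCast, ← Real.rpow_add hK0, ← Real.rpow_add hK0]
      congr 1; ring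
    have q2 : (K:ℝ) ^ (-(d * p - d - 2)) ≤ (K:ℝ) ^ (kap m p - (d * (p - 2) - 2)) := by
      apply Real.rpow_le_rpow_of_exponent_le hK1
      have : (0:ℝ) ≤ d := Nat.cast_nonneg d
      linarith
    calc _ = Ca * C1 * Cb * (2 * 3 ^ d * ((K:ℝ) ^ kap m p * ((K:ℝ) ^ d * (K:ℝ) ^ (-(d * p - d - 2)))) + (K:ℝ) ^ (-(d * p - d - 2))) := by
          field_simp
      _ ≤ Ca * C1 * Cb * (2 * 3 ^ d * (K:ℝ) ^ (kap m p - (d * (p - 2) - 2)) + (K:ℝ) ^ (kap m p - (d * (p - 2) - 2))) := by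
          rw [q1]; gcongr
      _ = _ := by ring
  · rw [← ENNReal.ofReal_mul hC3.le, ← ENNReal.ofReal_mul (by positivity)]
    apply ENNReal.ofReal_le_ofReal
    linarith
end PExt

end

section
namespace PExt

variable {d : ℕ}

/-- near indices -/
def near (d R : ℕ) (a b : Fin d → Fin (2 * R + 1)) : Prop := ∀ i, |((a i : ℕ) : ℤ) - ((b i : ℕ) : ℤ)| ≤ 36 * d

instance (R : ℕ) (a b : Fin d → Fin (2 * R + 1)) : Decidable (near d R a b) := by unfold near; infer_instance

lemma card_near (R : ℕ) (b : Fin d → Fin (2 * R + 1)) : (Finset.univ.filter fun a => near d R a b).card ≤ (72 * d + 1) ^ d := by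
  have h1 : (Finset.univ.filter fun a => near d R a b) ⊆
      Fintype.piFinset fun i => Finset.univ.filter fun x : Fin (2 * R + 1) => |((x : ℕ) : ℤ) - ((b i : ℕ) : ℤ)| ≤ 36 * d := by
    intro a ha
    rw [Fintype.mem_piFinset]
    intro i
    simp only [Finset.mem_filter, Finset.mem_univ, true_and] at ha ⊢
    exact ha i
  refine (Finset.card_le_card h1).trans ?_
  rw [Fintype.card_piFinset]
  calc _ ≤ ∏ i : Fin d, (72 * d + 1) := by
        refine Finset.prod_le_prod' fun i _ => ?_
        have h2 : (Finset.univ.filter fun x : Fin (2 * R + 1) => |((x : ℕ) : ℤ) - ((b i : ℕ) : ℤ)| ≤ 36 * d).card ≤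
            (Finset.Icc (((b i : ℕ) : ℤ) - 36 * d) (((b i : ℕ) : ℤ) + 36 * d)).card := by
          apply Finset.card_le_card_of_injOn (fun x : Fin (2 * R + 1) => ((x : ℕ) : ℤ))
          · intro x hx
            simp only [Finset.coe_filter, Finset.mem_univ, true_and, Set.mem_setOf_eq, abs_le] at hx
            simp only [Finset.coe_Icc, Set.mem_Icc]
            constructor <;> linarith [hx.1, hx.2]
          · intro x _ y _ h
            apply Fin.ext
            have hxy : ((x : ℕ) : ℤ) = ((y : ℕ) : ℤ) := h
            exact_mod_cast hxy
        refine h2.trans ?_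
        rw [Int.card_Icc]
        omega
    _ = _ := by simp

lemma far_sep {R : ℕ} (hR : 1 ≤ R) {a b : Fin d → Fin (2 * R + 1)} (h : ¬ near d R a b) : 36 * ((d:ℝ) / R) ≤ ‖cen R a - cen R b‖ := by
  unfold near at h
  push Not at h
  obtain ⟨i, hi⟩ := h
  refine le_trans ?_ (coord_le_norm _ i)
  have hK0 : (0:ℝ) < R := by exact_mod_cast hR
  have : (cen R a - cen R b) i = ((((a i : ℕ) : ℤ) - ((b i : ℕ) : ℤ) : ℤ) : ℝ) / R := by
    rw [PiLp.sub_apply, cen_apply, cen_apply]; push_cast; ring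
  rw [this, abs_div, abs_of_pos hK0, ← mul_div_assoc]
  gcongr
  rw [← Int.cast_abs]
  exact_mod_cast hi.le

/-- pointwise broad-narrow (bilinear) -/
lemma bil_pt {p : ℝ} (hp : 2 < p) (R : ℕ) (u : (Fin d → Fin (2 * R + 1)) → ℂ) :
    ‖∑ a, u a‖ₑ ^ p ≤ ENNReal.ofReal (2 ^ p * ((72 * d + 1) ^ d) ^ p) * ∑ a, ‖u a‖ₑ ^ p +
      ENNReal.ofReal (2 ^ p * (Fintype.card (Fin d → Fin (2 * R + 1)) : ℝ) ^ p) *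
        ∑ q ∈ Finset.univ.filter (fun q : (Fin d → Fin (2 * R + 1)) × (Fin d → Fin (2 * R + 1)) => ¬ near d R q.1 q.2), (‖u q.1‖ₑ * ‖u q.2‖ₑ) ^ (p / 2) := by
  have hp0 : 0 < p := by linarith
  obtain ⟨b, -, hb⟩ := Finset.exists_max_image Finset.univ (fun a => ‖u a‖ₑ) Finset.univ_nonempty
  set n1 : ℝ≥0∞ := ENNReal.ofReal ((72 * d + 1) ^ d) with hn1
  set N : ℝ≥0∞ := ENNReal.ofReal (Fintype.card (Fin d → Fin (2 * R + 1))) with hN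
  set Z := ∑ q ∈ Finset.univ.filter (fun q : (Fin d → Fin (2 * R + 1)) × (Fin d → Fin (2 * R + 1)) => ¬ near d R q.1 q.2), (‖u q.1‖ₑ * ‖u q.2‖ₑ) ^ (p / 2) with hZ
  have A1 : ∑ a ∈ Finset.univ.filter (fun a => near d R a b), ‖u a‖ₑ ≤ n1 * ‖u b‖ₑ := by
    calc _ ≤ ∑ a ∈ Finset.univ.filter (fun a => near d R a b), ‖u b‖ₑ := Finset.sum_le_sum fun a _ => hb a (Finset.mem_univ a)
      _ = ((Finset.univ.filter (fun a => near d R a b)).card : ℝ≥0∞) * ‖u b‖ₑ := by rw [Finset.sum_const, nsmul_eq_mul]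
      _ ≤ _ := by
          refine mul_le_mul_left ?_ _
          rw [hn1, ← ENNReal.ofReal_natCast]
          apply ENNReal.ofReal_le_ofReal
          exact_mod_cast card_near R b
  have A2 : ∀ a ∈ Finset.univ.filter (fun a => ¬ near d R a b), ‖u a‖ₑ ≤ Z ^ (p⁻¹) := by
    intro a ha
    rw [ENNReal.le_rpow_inv_iff hp0]
    calc ‖u a‖ₑ ^ p = (‖u a‖ₑ * ‖u a‖ₑ) ^ (p / 2) := by
          rw [← sq, ← ENNReal.rpow_two, ← ENNReal.rpow_mul]; congr 1; ring
      _ ≤ (‖u a‖ₑ * ‖u b‖ₑ) ^ (p / 2) := ENNReal.rpow_le_rpow (mul_le_mul_right (hb a (Finset.mem_univ a)) _) (by linarith)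
      _ ≤ Z := Finset.single_le_sum (f := fun q : (Fin d → Fin (2 * R + 1)) × (Fin d → Fin (2 * R + 1)) => (‖u q.1‖ₑ * ‖u q.2‖ₑ) ^ (p / 2)) (fun _ _ => zero_le)
          (Finset.mem_filter.2 ⟨Finset.mem_univ (a, b), (Finset.mem_filter.1 ha).2⟩)
  have A3 : ∑ a ∈ Finset.univ.filter (fun a => ¬ near d R a b), ‖u a‖ₑ ≤ N * Z ^ (p⁻¹) := by
    calc _ ≤ ∑ a ∈ Finset.univ.filter (fun a => ¬ near d R a b), Z ^ (p⁻¹) := Finset.sum_le_sum A2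
      _ = ((Finset.univ.filter (fun a => ¬ near d R a b)).card : ℝ≥0∞) * Z ^ (p⁻¹) := by rw [Finset.sum_const, nsmul_eq_mul]
      _ ≤ _ := by
          refine mul_le_mul_left ?_ _
          rw [hN, ENNReal.ofReal_natCast]
          exact_mod_cast Finset.card_le_univ _
  have A4 : ‖∑ a, u a‖ₑ ≤ n1 * ‖u b‖ₑ + N * Z ^ (p⁻¹) := by
    refine (enorm_sum_le _ _).trans ?_
    rw [← Finset.sum_filter_add_sum_filter_not Finset.univ (fun a => near d R a b)]
    exact add_le_add A1 A3
  have mx : ∀ x y : ℝ≥0∞, (x + y) ^ p ≤ 2 ^ p * x ^ p + 2 ^ p * y ^ p := by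
    intro x y
    rcases le_total x y with h | h
    · calc (x + y) ^ p ≤ (2 * y) ^ p := ENNReal.rpow_le_rpow (by rw [two_mul]; exact add_le_add h le_rfl) hp0.le
        _ = 2 ^ p * y ^ p := ENNReal.mul_rpow_of_nonneg _ _ hp0.le
        _ ≤ _ := le_add_self
    · calc (x + y) ^ p ≤ (2 * x) ^ p := ENNReal.rpow_le_rpow (by rw [two_mul]; exact add_le_add le_rfl h) hp0.le
        _ = 2 ^ p * x ^ p := ENNReal.mul_rpow_of_nonneg _ _ hp0.le
        _ ≤ _ := le_self_add
  have hcard : (0:ℝ) < Fintype.card (Fin d → Fin (2 * R + 1)) := by exact_mod_cast Fintype.card_pos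
  have h2 : (2:ℝ≥0∞) ^ p = ENNReal.ofReal (2 ^ p) := by
    rw [← ENNReal.ofReal_rpow_of_pos (by norm_num)]; simp
  refine (ENNReal.rpow_le_rpow A4 hp0.le).trans ((mx _ _).trans ?_)
  refine add_le_add ?_ (le_of_eq ?_)
  · rw [ENNReal.mul_rpow_of_nonneg _ _ hp0.le, ENNReal.ofReal_mul (by positivity), ← ENNReal.ofReal_rpow_of_pos (p := p) (x := (72 * (d:ℝ) + 1) ^ d) (by positivity), ← hn1, h2, mul_assoc]
    refine mul_le_mul_right (mul_le_mul_right ?_ _) _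
    exact Finset.single_le_sum (f := fun a => ‖u a‖ₑ ^ p) (fun _ _ => zero_le) (Finset.mem_univ b)
  · rw [ENNReal.mul_rpow_of_nonneg _ _ hp0.le, ENNReal.ofReal_mul (by positivity), ← ENNReal.ofReal_rpow_of_pos (p := p) hcard, ← hN, h2, mul_assoc,
      ← ENNReal.rpow_mul, inv_mul_cancel₀ hp0.ne', ENNReal.rpow_one]

lemma exists_nat_rpow (a C ε : ℝ) (ha : 0 < a) (hε : 0 < ε) (n₀ : ℕ) : ∃ K : ℕ, n₀ ≤ K ∧ C * (K:ℝ) ^ (-a) ≤ ε := by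
  have h1 : Filter.Tendsto (fun K : ℕ => C * (K:ℝ) ^ (-a)) Filter.atTop (nhds (C * 0)) :=
    ((tendsto_rpow_neg_atTop ha).comp tendsto_natCast_atTop_atTop).const_mul C
  rw [mul_zero] at h1
  obtain ⟨K, hK1, hK2⟩ := ((h1.eventually (eventually_le_nhds hε)).and (Filter.eventually_ge_atTop n₀)).exists
  exact ⟨K, hK2, hK1⟩

set_option maxHeartbeats 1000000 in
lemma step (d m : ℕ) (hd : 1 ≤ d) {p : ℝ} (hp : 2 < p) (hmp : m = 0 ∨ p ≤ 4) (hs : 1 < p * (((m + 1 + 1 : ℕ) : ℝ) - 1) / (2 * ((m + 1 + 1 : ℕ) : ℝ)))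
    (hγ : 0 < d * (p - 2) - 2) (hκ : kap m p < d * (p - 2) - 2) :
    ∃ K : ℕ, ∃ C > 0, ∀ (S : ℝ) (A : ℝ≥0∞), 1 ≤ S → (K:ℝ) ≤ S → BdS d p S A → BdS d p S (ENNReal.ofReal (1 / 2) * A + ENNReal.ofReal C) := by
  have hp0 : 0 < p := by linarith
  have hd0 : (0:ℝ) < d := by exact_mod_cast hd
  obtain ⟨R, hR, hR2⟩ := exists_nat_rpow (d * (p - 2) - 2) (2 ^ p * ((72 * d + 1) ^ d) ^ p * 3 ^ d) (1 / 4) hγ (by norm_num) (1 + 2 * d)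
  have hRn : 1 ≤ R := by omega
  have hR1 : (1:ℝ) ≤ R := by exact_mod_cast hRn
  have hR0 : (0:ℝ) < R := by linarith
  obtain ⟨C1, hC1, hbil⟩ := bilinear d m hd hp hmp hs (by positivity : 0 < (d:ℝ) / R)
  set N : ℝ := (Fintype.card (Fin d → Fin (2 * R + 1)) : ℝ) with hN
  have hN0 : 0 < N := by rw [hN]; exact_mod_cast Fintype.card_pos
  set U := Finset.univ.filter (fun q : (Fin d → Fin (2 * R + 1)) × (Fin d → Fin (2 * R + 1)) => ¬ near d R q.1 q.2) with hU
  obtain ⟨K, hK, hK2⟩ := exists_nat_rpow (d * (p - 2) - 2 - kap m p) (2 ^ p * N ^ p * (U.card * C1)) (1 / 4) (by linarith) (by norm_num)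
    ((1 + 2 * d) * R)
  have hKR : R ≤ K := by nlinarith
  have hKR' : (R:ℝ) ≤ K := by exact_mod_cast hKR
  have hK0 : (0:ℝ) < K := by linarith
  obtain ⟨C2, hC2, hb⟩ := hbil K (by nlinarith) (by gcongr) (by
    have h1 : ((1 + 2 * d) * R : ℝ) ≤ K := by exact_mod_cast hK
    have h2 : (1:ℝ) ≤ d := by exact_mod_cast hd
    have h3 : (1:ℝ) + 2 * d ≤ K / R := by rw [le_div_iff₀ hR0]; exact h1
    have h4 : 8 * ((d:ℝ) / R) * K = 8 * d * (K / R) := by ring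
    rw [h4]
    nlinarith)
  refine ⟨K, 2 ^ p * N ^ p * (U.card * C2) + 1, by positivity, ?_⟩
  intro S A hS1 hKS hA f hf
  set W : VV d × ℝ → ℝ≥0∞ := fun c => ENNReal.ofReal (jw (d + 1) S c) with hW
  have mW : Measurable W := (jw_continuous _ _).measurable.ennreal_ofReal
  have hI : ∀ a, InF (pc (gq R) a f) := fun a => hf.pc (gq_meas R)
  have mE : ∀ a, Measurable fun X : VV d × ℝ => ‖Ex (pc (gq R) a f) X.1 X.2‖ₑ := fun a => (measurable_ExX (hI a).integrable).enorm
  have pt : ∀ X : VV d × ℝ, ‖Ex f X.1 X.2‖ₑ ^ p * W X ≤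
      ENNReal.ofReal (2 ^ p * ((72 * d + 1) ^ d) ^ p) * ∑ a, ‖Ex (pc (gq R) a f) X.1 X.2‖ₑ ^ p * W X +
      ENNReal.ofReal (2 ^ p * N ^ p) * ∑ q ∈ U, (‖Ex (pc (gq R) q.1 f) X.1 X.2‖ₑ * ‖Ex (pc (gq R) q.2 f) X.1 X.2‖ₑ) ^ (p / 2) * W X := by
    intro X
    rw [Ex_sum_pc (gq_meas R) hf]
    refine (mul_le_mul_left (bil_pt hp R _) _).trans (le_of_eq ?_)
    rw [← Finset.sum_mul, ← Finset.sum_mul]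
    ring
  refine (lintegral_mono pt).trans ?_
  have m1 : ∀ a, Measurable fun X : VV d × ℝ => ‖Ex (pc (gq R) a f) X.1 X.2‖ₑ ^ p * W X := fun a => ((mE a).pow_const _).mul mW
  have m2 : ∀ q : (Fin d → Fin (2 * R + 1)) × (Fin d → Fin (2 * R + 1)), Measurable fun X : VV d × ℝ => (‖Ex (pc (gq R) q.1 f) X.1 X.2‖ₑ * ‖Ex (pc (gq R) q.2 f) X.1 X.2‖ₑ) ^ (p / 2) * W X :=
    fun q => (((mE q.1).mul (mE q.2)).pow_const _).mul mW
  rw [lintegral_add_right _ ((Finset.measurable_sum _ fun q _ => m2 q).const_mul _), lintegral_const_mul' _ _ ENNReal.ofReal_ne_top, lintegral_const_mul' _ _ ENNReal.ofReal_ne_top,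
    lintegral_finsetSum _ fun a _ => m1 a, lintegral_finsetSum _ fun q _ => m2 q]
  have b1 : ∑ a, ∫⁻ X : VV d × ℝ, ‖Ex (pc (gq R) a f) X.1 X.2‖ₑ ^ p * W X ≤ ENNReal.ofReal (N * (R:ℝ) ^ (-(d * p - d - 2))) * A := by
    calc _ ≤ ∑ a : Fin d → Fin (2 * R + 1), ENNReal.ofReal ((R:ℝ) ^ (-(d * p - d - 2))) * A :=
          Finset.sum_le_sum fun a _ => rescale hp0 (by linarith) hA hR (hI a) fun ξ hξ => (pc_ne hξ).1
      _ = _ := by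
          rw [Finset.sum_const, Finset.card_univ, nsmul_eq_mul, ENNReal.ofReal_mul hN0.le, hN, ENNReal.ofReal_natCast, mul_assoc]
  have b2 : ∑ q ∈ U, ∫⁻ X : VV d × ℝ, (‖Ex (pc (gq R) q.1 f) X.1 X.2‖ₑ * ‖Ex (pc (gq R) q.2 f) X.1 X.2‖ₑ) ^ (p / 2) * W X ≤
      ENNReal.ofReal (U.card * C1 * (K:ℝ) ^ (kap m p - (d * (p - 2) - 2))) * A + ENNReal.ofReal (U.card * C2) := by
    calc _ ≤ ∑ q ∈ U, (ENNReal.ofReal (C1 * (K:ℝ) ^ (kap m p - (d * (p - 2) - 2))) * A + ENNReal.ofReal C2) := by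
          refine Finset.sum_le_sum fun q hq => ?_
          have hq' : ¬ near d R q.1 q.2 := (Finset.mem_filter.1 hq).2
          exact hb S A (fun i => pc (gq R) (if i then q.2 else q.1) f) (fun i => cen R (if i then q.2 else q.1)) hKS hA (fun i => hI _)
            (fun i ξ hξ => by
              by_contra hc; push Not at hc
              exact hξ (((hI _).nice_box hRn fun ξ hξ => (pc_ne hξ).1).supp ξ hc)) (far_sep hRn hq')
      _ = _ := by
          rw [Finset.sum_const, nsmul_eq_mul, mul_add, mul_assoc (U.card : ℝ), ENNReal.ofReal_mul (p := (U.card : ℝ)) (by positivity), ENNReal.ofReal_mul (p := (U.card : ℝ)) (by positivity), ENNReal.ofReal_natCast, mul_assoc]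
  refine (add_le_add (mul_le_mul_right b1 _) (mul_le_mul_right b2 _)).trans ?_
  rw [mul_add, ← mul_assoc, ← mul_assoc, ← ENNReal.ofReal_mul (by positivity), ← ENNReal.ofReal_mul (by positivity), ← ENNReal.ofReal_mul (by positivity), ← add_assoc, ← add_mul,
    ← ENNReal.ofReal_add (by positivity) (by positivity)]
  refine add_le_add (mul_le_mul_left (ENNReal.ofReal_le_ofReal ?_) _) (ENNReal.ofReal_le_ofReal (by linarith))
  have c1 : N * (R:ℝ) ^ (-(d * p - d - 2)) ≤ 3 ^ d * (R:ℝ) ^ (-(d * (p - 2) - 2)) := by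
    have e1 : (R:ℝ) ^ (-(d * (p - 2) - 2)) = (R:ℝ) ^ d * (R:ℝ) ^ (-(d * p - d - 2)) := by
      rw [← Real.rpow_natCast, ← Real.rpow_add hR0]; congr 1; ring
    rw [e1, ← mul_assoc, ← mul_pow]
    gcongr
    rw [hN, Fintype.card_fun, Fintype.card_fin, Fintype.card_fin]
    push_cast
    gcongr
    linarith
  have c2 : 2 ^ p * ((72 * d + 1) ^ d : ℝ) ^ p * (N * (R:ℝ) ^ (-(d * p - d - 2))) ≤ 1 / 4 := by
    refine le_trans ?_ hR2
    rw [mul_assoc _ ((3:ℝ) ^ d)]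
    gcongr
  have c3 : 2 ^ p * N ^ p * (U.card * C1 * (K:ℝ) ^ (kap m p - (d * (p - 2) - 2))) ≤ 1 / 4 := by
    refine le_trans (le_of_eq ?_) hK2
    rw [neg_sub]; ring
  linarith

lemma unif_bd (d : ℕ) : ∃ B : ℝ, 0 < B ∧ ∀ f : VV d → ℂ, InF f → ∀ x t, ‖Ex f x t‖ₑ ≤ ENNReal.ofReal B := by
  have hfin : volume (Metric.closedBall (0 : VV d) d) ≠ ∞ := measure_closedBall_lt_top.ne
  refine ⟨(volume (Metric.closedBall (0 : VV d) d)).toReal + 1, by positivity, fun f hf x t => ?_⟩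
  refine (enorm_Ex_le f x t).trans ?_
  calc ∫⁻ ξ, ‖f ξ‖ₑ ≤ ∫⁻ ξ, (Metric.closedBall (0 : VV d) d).indicator (fun _ => 1) ξ := by
        refine lintegral_mono fun ξ => ?_
        by_cases h : ξ ∈ Metric.closedBall (0 : VV d) d
        · rw [Set.indicator_of_mem h, ← ofReal_norm]
          exact ENNReal.ofReal_le_one.2 (hf.bdd ξ)
        · rw [hf.nice.supp ξ (by simpa using h)]; simp
    _ = volume (Metric.closedBall (0 : VV d) d) := by
        rw [lintegral_indicator Metric.isClosed_closedBall.measurableSet]; simp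
    _ = ENNReal.ofReal (volume (Metric.closedBall (0 : VV d) d)).toReal := (ENNReal.ofReal_toReal hfin).symm
    _ ≤ _ := ENNReal.ofReal_le_ofReal (by linarith)

lemma main0 (d m : ℕ) (hd : 1 ≤ d) {p : ℝ} (hp : 2 < p) (hmp : m = 0 ∨ p ≤ 4) (hs : 1 < p * (((m + 1 + 1 : ℕ) : ℝ) - 1) / (2 * ((m + 1 + 1 : ℕ) : ℝ)))
    (hγ : 0 < d * (p - 2) - 2) (hκ : kap m p < d * (p - 2) - 2) :
    ∃ C > 0, ∀ f : VV d → ℂ, InF f → ∫⁻ X : VV d × ℝ, ‖Ex f X.1 X.2‖ₑ ^ p ≤ ENNReal.ofReal C := by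
  obtain ⟨K, C, hC, hst⟩ := step d m hd hp hmp hs hγ hκ
  obtain ⟨B, hB, hBd⟩ := unif_bd d
  have hp0 : 0 < p := by linarith
  refine ⟨2 * C, by positivity, ?_⟩
  have bd : ∀ S : ℝ, 1 ≤ S → (K:ℝ) ≤ S → BdS d p S (ENNReal.ofReal (2 * C)) := by
    intro S hS hKS
    set A0 : ℝ≥0∞ := ⨆ (f : VV d → ℂ) (_ : InF f), ∫⁻ X : VV d × ℝ, ‖Ex f X.1 X.2‖ₑ ^ p * ENNReal.ofReal (jw (d + 1) S X) with hA0
    have h1 : BdS d p S A0 := fun f hf => le_iSup₂ (f := fun (f : VV d → ℂ) (_ : InF f) => ∫⁻ X : VV d × ℝ, ‖Ex f X.1 X.2‖ₑ ^ p * ENNReal.ofReal (jw (d + 1) S X)) f hf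
    have h2 : A0 ≤ ENNReal.ofReal (1 / 2) * A0 + ENNReal.ofReal C := iSup₂_le fun f hf => hst S A0 hS hKS h1 f hf
    have hW : ∫⁻ X : VV d × ℝ, ENNReal.ofReal (jw (d + 1) S X) ≠ ∞ := by
      have e := lintegral_jw (E := VV d × ℝ) volume (d + 1) (by linarith : 0 < S) 0
      simp only [sub_zero] at e
      rw [e]
      exact ENNReal.mul_ne_top ENNReal.ofReal_ne_top (lintegral_jw_lt_top volume (by rw [finrank_X]; omega)).ne
    have h3 : A0 ≠ ∞ := by
      refine ne_top_of_le_ne_top (ENNReal.mul_ne_top (ENNReal.rpow_ne_top_of_nonneg hp0.le ENNReal.ofReal_ne_top) hW) (iSup₂_le fun f hf => ?_ : A0 ≤ ENNReal.ofReal B ^ p * _)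
      rw [← lintegral_const_mul' _ _ (ENNReal.rpow_ne_top_of_nonneg hp0.le ENNReal.ofReal_ne_top)]
      exact lintegral_mono fun X => mul_le_mul_left (ENNReal.rpow_le_rpow (hBd f hf _ _) hp0.le) _
    have h4 : A0 ≤ ENNReal.ofReal (2 * C) := by
      have e : A0 = ENNReal.ofReal A0.toReal := (ENNReal.ofReal_toReal h3).symm
      have nn : 0 ≤ A0.toReal := ENNReal.toReal_nonneg
      rw [e, ← ENNReal.ofReal_mul (by norm_num), ← ENNReal.ofReal_add (by positivity) hC.le, ENNReal.ofReal_le_ofReal_iff (by positivity)] at h2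
      rw [e]
      apply ENNReal.ofReal_le_ofReal
      linarith
    exact fun f hf => (h1 f hf).trans h4
  intro f hf
  have mE : Measurable fun X : VV d × ℝ => ‖Ex f X.1 X.2‖ₑ := (measurable_ExX hf.integrable).enorm
  have lim := lintegral_tendsto_of_tendsto_of_monotone (μ := (volume : Measure (VV d × ℝ))) (f := fun (n : ℕ) (X : VV d × ℝ) => ‖Ex f X.1 X.2‖ₑ ^ p * ENNReal.ofReal (jw (d + 1) ((n:ℝ) + 1) X))
    (F := fun X => ‖Ex f X.1 X.2‖ₑ ^ p) (fun n => ((mE.pow_const _).mul (jw_continuous _ _).measurable.ennreal_ofReal).aemeasurable)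
    (Filter.Eventually.of_forall fun X n n' hn => mul_le_mul_right (ENNReal.ofReal_le_ofReal (jw_mono_r _ (by positivity) (by
      have : (n:ℝ) ≤ n' := by exact_mod_cast hn
      linarith) _)) _)
    (Filter.Eventually.of_forall fun X => by
      have t1 : Filter.Tendsto (fun n : ℕ => jw (d + 1) ((n:ℝ) + 1) X) Filter.atTop (nhds 1) := by
        have t2 : Filter.Tendsto (fun n : ℕ => ((n:ℝ) + 1)) Filter.atTop Filter.atTop := Filter.tendsto_atTop_add_const_right _ _ tendsto_natCast_atTop_atTop
        have t3 : Filter.Tendsto (fun n : ℕ => ‖X‖ ^ 2 / ((n:ℝ) + 1) ^ 2) Filter.atTop (nhds 0) :=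
          Filter.Tendsto.div_atTop tendsto_const_nhds ((Filter.tendsto_pow_atTop (by norm_num)).comp t2)
        have t4 := ((t3.const_add 1).pow (d + 1)).inv₀ (by simp)
        simpa [jw] using t4
      have t5 := ENNReal.Tendsto.const_mul (a := ‖Ex f X.1 X.2‖ₑ ^ p) (ENNReal.tendsto_ofReal t1) (Or.inl (by simp))
      simpa using t5)
  refine le_of_tendsto lim ?_
  filter_upwards [Filter.eventually_ge_atTop K] with n hn
  have : (K:ℝ) ≤ n := by exact_mod_cast hn
  exact bd _ (by have := Nat.cast_nonneg (α := ℝ) n; linarith) (by linarith) f hf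

lemma main1 (d : ℕ) (hd : 1 ≤ d) {p : ℝ} (hp : 2 + 4 / ((d:ℝ) + 1) < p) (hp4 : d = 1 ∨ p ≤ 4) :
    ∃ C > 0, ∀ f : VV d → ℂ, InF f → ∫⁻ X : VV d × ℝ, ‖Ex f X.1 X.2‖ₑ ^ p ≤ ENNReal.ofReal C := by
  have hd1 : (1:ℝ) ≤ d := by exact_mod_cast hd
  have h4 : 0 < 4 / ((d:ℝ) + 1) := by positivity
  have hq : 4 < (p - 2) * ((d:ℝ) + 1) := by
    rw [← div_lt_iff₀ (by positivity)]; linarith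
  have hm1 : ((d / 2 : ℕ) : ℝ) ≤ d / 2 := by
    rw [le_div_iff₀ (by norm_num)]; exact_mod_cast Nat.div_mul_le_self d 2
  have hm2 : ((d:ℝ) - 1) / 2 ≤ ((d / 2 : ℕ) : ℝ) := by
    rw [div_le_iff₀ (by norm_num), sub_le_iff_le_add]; exact_mod_cast (by omega : d ≤ d / 2 * 2 + 1)
  set m := d / 2 with hm
  refine main0 d m hd (by linarith) ?_ ?_ ?_ ?_
  · rcases hp4 with h | h
    · left; omega
    · right; exact h
  · push_cast
    rw [lt_div_iff₀ (by positivity)]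
    nlinarith
  · nlinarith
  · unfold kap
    apply max_lt
    · nlinarith
    · nlinarith

lemma main2 (d : ℕ) (hd : 1 ≤ d) {p : ℝ} (hp : 2 + 4 / ((d:ℝ) + 1) < p) :
    ∃ C > 0, ∀ f : VV d → ℂ, InF f → ∫⁻ X : VV d × ℝ, ‖Ex f X.1 X.2‖ₑ ^ p ≤ ENNReal.ofReal C := by
  by_cases h1 : d = 1
  · exact main1 d hd hp (Or.inl h1)
  have hd2 : (2:ℝ) ≤ d := by exact_mod_cast (by omega : 2 ≤ d)
  have h4 : 2 + 4 / ((d:ℝ) + 1) < 4 := by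
    have : 4 / ((d:ℝ) + 1) < 2 := by rw [div_lt_iff₀ (by positivity)]; linarith
    linarith
  have h5 : 0 < 4 / ((d:ℝ) + 1) := by positivity
  set q := min p 4 with hq
  obtain ⟨C, hC, h⟩ := main1 d hd (p := q) (lt_min hp h4) (Or.inr (min_le_right _ _))
  obtain ⟨B, hB, hBd⟩ := unif_bd d
  have hqp : q ≤ p := min_le_left _ _
  have hq0 : 0 < q := by rw [hq]; exact lt_min (by linarith) (by norm_num)
  refine ⟨B ^ (p - q) * C, by positivity, fun f hf => ?_⟩
  rw [ENNReal.ofReal_mul (by positivity), ← ENNReal.ofReal_rpow_of_pos hB]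
  refine le_trans ?_ (mul_le_mul_right (h f hf) _)
  rw [← lintegral_const_mul' _ _ (ENNReal.rpow_ne_top_of_nonneg (by linarith) ENNReal.ofReal_ne_top)]
  refine lintegral_mono fun X => ?_
  calc ‖Ex f X.1 X.2‖ₑ ^ p = ‖Ex f X.1 X.2‖ₑ ^ (p - q) * ‖Ex f X.1 X.2‖ₑ ^ q := by
        rw [← ENNReal.rpow_add_of_nonneg _ _ (by linarith) hq0.le]; congr 1; ring
    _ ≤ _ := mul_le_mul_left (ENNReal.rpow_le_rpow (hBd f hf _ _) (by linarith)) _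
end PExt

end

/-- **Linear extension estimate for the paraboloid from bilinear restriction.** For every
`n ≥ 2` and every `p > 2(n+2)/n` there is `C = C(n,p)` with
`‖E_{[−1,1]^{n−1}} f‖_{L^p(ℝ^n)} ≤ C ‖f‖_{L^∞([−1,1]^{n−1})}` for all bounded measurable
`f : [−1,1]^{n−1} → ℂ`. -/
theorem linear_extension_paraboloid (n : ℕ) (hn : 2 ≤ n) (p : ℝ)
    (hp : 2 * ((n : ℝ) + 2) / (n : ℝ) < p) :
    ∃ C : ℝ, 0 < C ∧
      ∀ f : EuclideanSpace ℝ (Fin (n - 1)) → ℂ,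
        Measurable f → (∃ M : ℝ, ∀ x, ‖f x‖ ≤ M) →
        (∫⁻ x : EuclideanSpace ℝ (Fin (n - 1)) × ℝ,
            (‖parabExt {ξ | ∀ i, ξ i ∈ Set.Icc (-1 : ℝ) 1} f x‖₊ : ℝ≥0∞) ^ p) ^ (1 / p) ≤
          ENNReal.ofReal C *
            eLpNorm f ⊤ (volume.restrict {ξ | ∀ i, ξ i ∈ Set.Icc (-1 : ℝ) 1}) := by
  have hn0 : (0:ℝ) < n := by exact_mod_cast (by omega : 0 < n)
  have hcast : ((n - 1 : ℕ) : ℝ) + 1 = n := by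
    rw [Nat.cast_sub (by omega)]; simp
  have hp' : 2 + 4 / (((n - 1 : ℕ) : ℝ) + 1) < p := by
    rw [hcast]
    refine lt_of_eq_of_lt ?_ hp
    field_simp; ring
  have hp0 : 0 < p := by
    have : 0 < 2 * ((n : ℝ) + 2) / (n : ℝ) := by positivity
    linarith
  obtain ⟨C, hC, hmain⟩ := PExt.main2 (n - 1) (by omega) hp'
  refine ⟨C ^ (1 / p), by positivity, ?_⟩
  intro f hf hM
  obtain ⟨M, hM⟩ := hM
  set Ω : Set (EuclideanSpace ℝ (Fin (n - 1))) := {ξ | ∀ i, ξ i ∈ Set.Icc (-1 : ℝ) 1} with hΩ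
  have hΩm : MeasurableSet Ω := by
    have : Ω = ⋂ i, {ξ : EuclideanSpace ℝ (Fin (n - 1)) | ξ i ∈ Set.Icc (-1 : ℝ) 1} := by
      ext ξ; simp [hΩ]
    rw [this]
    refine MeasurableSet.iInter fun i => ?_
    exact (Continuous.measurable (by fun_prop : Continuous fun ξ : EuclideanSpace ℝ (Fin (n - 1)) => ξ i)) measurableSet_Icc
  set Λ := eLpNorm f ⊤ (volume.restrict Ω) with hΛ
  have hΛt : Λ ≠ ∞ := by
    rw [hΛ, eLpNorm_exponent_top]
    exact (eLpNormEssSup_lt_top_of_ae_bound (Filter.Eventually.of_forall hM)).ne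
  set t := Λ.toReal with ht
  have ht0 : 0 ≤ t := ENNReal.toReal_nonneg
  have hΛe : Λ = ENNReal.ofReal t := (ENNReal.ofReal_toReal hΛt).symm
  classical
  have hset : MeasurableSet {ξ : EuclideanSpace ℝ (Fin (n - 1)) | ξ ∈ Ω ∧ ‖f ξ‖ ≤ t} :=
    hΩm.inter (measurableSet_le hf.norm measurable_const)
  let g : EuclideanSpace ℝ (Fin (n - 1)) → ℂ := fun ξ => if ξ ∈ Ω ∧ ‖f ξ‖ ≤ t then f ξ / (t : ℂ) else 0
  have hg : PExt.InF g := by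
    refine ⟨Measurable.ite hset (hf.div_const _) measurable_const, ?_, ?_⟩
    · intro ξ
      simp only [g]
      split_ifs with h
      · rw [norm_div, Complex.norm_real, Real.norm_eq_abs, abs_of_nonneg ht0]
        exact div_le_one_of_le₀ h.2 ht0
      · simp
    · intro ξ hξ i
      simp only [g] at hξ
      split_ifs at hξ with h
      · exact abs_le.2 (h.1 i)
      · exact absurd rfl hξ
  have hae : ∀ᵐ ξ ∂(volume.restrict Ω), ‖f ξ‖ ≤ t := by
    filter_upwards [ae_le_eLpNormEssSup (f := f) (μ := volume.restrict Ω)] with ξ hξ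
    rw [← eLpNorm_exponent_top, ← hΛ, hΛe, ← ofReal_norm, ENNReal.ofReal_le_ofReal_iff ht0] at hξ
    exact hξ
  have key : ∀ x : EuclideanSpace ℝ (Fin (n - 1)) × ℝ, parabExt Ω f x = (t : ℂ) * PExt.Ex g x.1 x.2 := by
    intro x
    unfold parabExt PExt.Ex
    rw [← integral_const_mul, ← integral_indicator hΩm]
    apply integral_congr_ae
    rw [ae_restrict_iff' hΩm] at hae
    filter_upwards [hae] with ξ hξ
    by_cases h : ξ ∈ Ω
    · rw [Set.indicator_of_mem h]
      have e1 : (t : ℂ) * g ξ = f ξ := by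
        simp only [g]
        rw [if_pos ⟨h, hξ h⟩]
        by_cases h0 : t = 0
        · have := hξ h
          rw [h0] at this
          have : f ξ = 0 := norm_le_zero_iff.1 this
          simp [this]
        · rw [mul_div_cancel₀]
          exact_mod_cast h0
      rw [← mul_assoc, e1]
      congr 1
      unfold PExt.ee
      rw [EuclideanSpace.norm_sq_eq]
      simp only [Real.norm_eq_abs, sq_abs]
    · rw [Set.indicator_of_notMem h]
      simp only [g]
      rw [if_neg (fun h' => h h'.1)]
      simp
  have e2 : ∀ x : EuclideanSpace ℝ (Fin (n - 1)) × ℝ, (‖parabExt Ω f x‖₊ : ℝ≥0∞) ^ p = Λ ^ p * ‖PExt.Ex g x.1 x.2‖ₑ ^ p := by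
    intro x
    rw [key]
    change ‖(t : ℂ) * PExt.Ex g x.1 x.2‖ₑ ^ p = _
    rw [enorm_mul, ENNReal.mul_rpow_of_nonneg _ _ hp0.le]
    congr 2
    rw [hΛe, ← ofReal_norm, Complex.norm_real, Real.norm_eq_abs, abs_of_nonneg ht0]
  simp only [e2]
  rw [lintegral_const_mul' _ _ (ENNReal.rpow_ne_top_of_nonneg hp0.le hΛt), ENNReal.mul_rpow_of_nonneg _ _ (by positivity), ← ENNReal.rpow_mul, mul_one_div_cancel hp0.ne', ENNReal.rpow_one, mul_comm,
    ← ENNReal.ofReal_rpow_of_pos hC]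
  refine mul_le_mul_left (ENNReal.rpow_le_rpow (hmain g hg) (by positivity)) _
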